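/- Let d, k ≥ 1 and let S₁, S₂ ⊂ I^d be closed cubes. Suppose that (C1) det(Σ_{i=1}^k t_i Hφ_i(ν)) ≠ 0 for every ν ∈ S₁ ∪ S₂ and every t ∈ ℝ^k with |t| = 1, and (C2) det[D(ν₁,ν₂)(Σ_{j=1}^k t_j Hφ_j(ν))^{-1} D(ν₁,ν₂)^t] ≠ 0 for every ν₁ ∈ S₁, ν₂ ∈ S₂, every t ∈ ℝ^k with |t| = 1, and ν ∈ {ν₁, ν₂}. Then for every pair of exponents q, p with q > (d+3k)/(d+k) and 1/p + ((d+3k)/(d+k))·(1/(2q)) < 1, there is a constant C such that ‖E₁f · E₂g‖_{L^q(ℝ^{d+k})} ≤ C ‖f‖_{L^p(ℝ^d)} ‖g‖_{L^p(ℝ^d)} for all f, g. -/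

import Mathlib

open MeasureTheory ENNReal Matrix

noncomputable section

/-- The extension (adjoint restriction) operator associated to the surface
`ξ ↦ (ξ, Φ ξ)`, acting on functions supported in `S ⊆ I^d`, evaluated at
`w = (x, t) ∈ ℝ^d × ℝ^k`. -/
def extOp (d k : ℕ) (S : Set (Fin d → ℝ)) (Φ : (Fin d → ℝ) → Fin k → ℝ)
    (f : (Fin d → ℝ) → ℂ) (w : (Fin d → ℝ) × (Fin k → ℝ)) : ℂ :=
  ∫ ξ in S, Complex.exp (2 * Real.pi * Complex.I *
    (((∑ i, w.1 i * ξ i) + ∑ j, w.2 j * Φ ξ j : ℝ) : ℂ)) * f ξ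

/-- `S` is a closed cube in `ℝ^d` (an axis-parallel cube `∏ [aᵢ - r, aᵢ + r]`). -/
def IsClosedCube (d : ℕ) (S : Set (Fin d → ℝ)) : Prop :=
  ∃ (a : Fin d → ℝ) (r : ℝ), 0 ≤ r ∧ S = {x | ∀ i, |x i - a i| ≤ r}

/-- The gradient `∇φ(ν)` of a scalar function on `ℝ^d`, as a vector. -/
def gradPhi (d : ℕ) (φ : (Fin d → ℝ) → ℝ) (ν : Fin d → ℝ) : Fin d → ℝ :=
  fun i => fderiv ℝ φ ν (Pi.single i 1)

/-- The Hessian matrix `Hφ(ν)` of a scalar function on `ℝ^d`. -/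
def hessPhi (d : ℕ) (φ : (Fin d → ℝ) → ℝ) (ν : Fin d → ℝ) : Matrix (Fin d) (Fin d) ℝ :=
  Matrix.of fun i j => fderiv ℝ (fun x => fderiv ℝ φ x (Pi.single j 1)) ν (Pi.single i 1)

/-- The `k × d` matrix `D(ν₁, ν₂)` whose `j`-th row is `∇φⱼ(ν₂) - ∇φⱼ(ν₁)`. -/
def Dmat (d k : ℕ) (Φ : (Fin d → ℝ) → Fin k → ℝ) (ν₁ ν₂ : Fin d → ℝ) :
    Matrix (Fin k) (Fin d) ℝ :=
  Matrix.of fun j i => gradPhi d (fun x => Φ x j) ν₂ i - gradPhi d (fun x => Φ x j) ν₁ i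

/-- The matrix `∑ᵢ tᵢ Hφᵢ(ν)`. -/
def tHess (d k : ℕ) (Φ : (Fin d → ℝ) → Fin k → ℝ) (t : Fin k → ℝ) (ν : Fin d → ℝ) :
    Matrix (Fin d) (Fin d) ℝ :=
  ∑ i, t i • hessPhi d (fun x => Φ x i) ν

/-- The unitary character `x ↦ exp (2πix)`. -/
def eC (x : ℝ) : ℂ := Complex.exp (2 * Real.pi * Complex.I * (x : ℂ))

lemma norm_eC (x : ℝ) : ‖eC x‖ = 1 := by
  unfold eC
  rw [show (2 * Real.pi * Complex.I * (x : ℂ)) = ((2 * Real.pi * x : ℝ) : ℂ) * Complex.I by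
    push_cast; ring]
  exact Complex.norm_exp_ofReal_mul_I _

lemma eC_add (x y : ℝ) : eC (x + y) = eC x * eC y := by
  unfold eC; rw [← Complex.exp_add]; push_cast; ring_nf

lemma eC_zero : eC 0 = 1 := by simp [eC]

lemma conj_eC (x : ℝ) : (starRingEnd ℂ) (eC x) = eC (-x) := by
  unfold eC
  rw [← Complex.exp_conj]
  simp [Complex.conj_ofNat]

lemma contDiff_eC {n : WithTop ℕ∞} : ContDiff ℝ n eC := by
  unfold eC
  exact (contDiff_const.mul Complex.ofRealCLM.contDiff).cexp

lemma continuous_eC : Continuous eC := (contDiff_eC (n := 0)).continuous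

/-- The phase `x·ξ + t·Φ(ξ)`. -/
def phase {d k : ℕ} (Φ : (Fin d → ℝ) → Fin k → ℝ) (w : (Fin d → ℝ) × (Fin k → ℝ))
    (ξ : Fin d → ℝ) : ℝ := (∑ i, w.1 i * ξ i) + ∑ j, w.2 j * Φ ξ j

/-- The extension operator without frequency truncation. -/
def exOp {d k : ℕ} (Φ : (Fin d → ℝ) → Fin k → ℝ) (f : (Fin d → ℝ) → ℂ)
    (w : (Fin d → ℝ) × (Fin k → ℝ)) : ℂ := ∫ ξ, eC (phase Φ w ξ) * f ξ

lemma extOp_eq_exOp {d k : ℕ} (Φ : (Fin d → ℝ) → Fin k → ℝ) {S : Set (Fin d → ℝ)}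
    (hS : MeasurableSet S) (f : (Fin d → ℝ) → ℂ) (w : (Fin d → ℝ) × (Fin k → ℝ)) :
    extOp d k S Φ f w = exOp Φ (S.indicator f) w := by
  unfold extOp exOp
  rw [← integral_indicator hS]
  congr 1; ext ξ
  by_cases h : ξ ∈ S <;> simp [h, eC, phase]

open FourierTransform in
/-- A nonnegative integrable kernel, bounded below by one on `[-1,1]`, whose Fourier transform
vanishes outside `(-1,1)`. -/
lemma exists_kernel : ∃ ρ : ℝ → ℝ, Continuous ρ ∧ Integrable ρ ∧ (∀ s, 0 ≤ ρ s) ∧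
    (∀ s, |s| ≤ 1 → 1 ≤ ρ s) ∧ (∀ ζ : ℝ, 1 ≤ |ζ| → ∫ s, eC (s * ζ) * (ρ s : ℂ) = 0) := by
  let b : ContDiffBump (0 : ℝ) := ⟨1 / 16, 1 / 8, by norm_num, by norm_num⟩
  let bc : ℝ → ℂ := fun x => (b x : ℂ)
  have hbc : ContDiff ℝ (⊤ : ℕ∞) bc :=
    Complex.ofRealCLM.contDiff.comp (b.contDiff (n := ⊤))
  have hsupp : ∀ x, 1 / 8 ≤ |x| → b x = 0 := by
    intro x hx
    apply b.zero_of_le_dist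
    simpa [Real.dist_eq, b] using hx
  have hcs : HasCompactSupport bc := by
    apply HasCompactSupport.comp_left (g := fun x : ℝ => (x : ℂ)) b.hasCompactSupport; simp
  let f : SchwartzMap ℝ ℂ := hcs.toSchwartzMap hbc
  have hf : ∀ x, f x = (b x : ℂ) := fun x => rfl
  have hFf : ∀ s : ℝ, (𝓕 f) s = ∫ x : ℝ, eC (-(x * s)) * (b x : ℂ) := by
    intro s
    rw [SchwartzMap.fourier_coe, Real.fourier_eq]
    congr 1; ext v
    rw [Circle.smul_def, Real.fourierChar_apply]
    simp [hf, eC, mul_comm]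
    left; ring_nf
  have hbint : Integrable (fun x => b x) := b.continuous.integrable_of_hasCompactSupport
    b.hasCompactSupport
  have hbpos : 0 < ∫ x, b x := b.integral_pos
  have hlow : ∀ s : ℝ, |s| ≤ 1 → (1 / 2) * (∫ x, b x) ≤ ‖(𝓕 f) s‖ := by
    intro s hs
    have hint : Integrable (fun x : ℝ => eC (-(x * s)) * (b x : ℂ)) := by
      refine hbint.ofReal.bdd_mul (c := 1) ?_ ?_
      · exact (continuous_eC.comp (by fun_prop)).aestronglyMeasurable
      · exact Filter.Eventually.of_forall fun x => (norm_eC _).le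
    refine le_trans ?_ (Complex.re_le_norm _)
    rw [hFf, show (∫ x : ℝ, eC (-(x * s)) * (b x : ℂ)).re =
      ∫ x : ℝ, (eC (-(x * s)) * (b x : ℂ)).re from (integral_re hint).symm,
      ← integral_const_mul]
    apply integral_mono (hbint.const_mul _) hint.re
    intro x
    by_cases hx : 1 / 8 ≤ |x|
    · simp [hsupp x hx]
    · push Not at hx
      have h1 : (eC (-(x * s)) * (b x : ℂ)).re = Real.cos (2 * Real.pi * (x * s)) * b x := by
        unfold eC
        rw [show (2 * Real.pi * Complex.I * ((-(x * s) : ℝ) : ℂ)) =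
          ((-(2 * Real.pi * (x * s)) : ℝ) : ℂ) * Complex.I by push_cast; ring,
          Complex.re_mul_ofReal, Complex.exp_ofReal_mul_I_re, Real.cos_neg]
      show (1 / 2) * b x ≤ (eC (-(x * s)) * (b x : ℂ)).re
      rw [h1]
      apply mul_le_mul_of_nonneg_right _ b.nonneg
      rw [← Real.cos_pi_div_three, ← Real.cos_abs (2 * Real.pi * (x * s))]
      have : |2 * Real.pi * (x * s)| ≤ Real.pi / 3 := by
        rw [abs_mul, abs_mul x, abs_of_pos (by positivity : (0:ℝ) < 2 * Real.pi)]
        have : |x| * |s| ≤ 1 / 8 := by nlinarith [abs_nonneg x, abs_nonneg s]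
        nlinarith [Real.pi_pos]
      exact Real.cos_le_cos_of_nonneg_of_le_pi (abs_nonneg _) (by linarith [Real.pi_pos]) this
  set m := (1 / 2) * (∫ x, b x) with hm
  have hmpos : 0 < m := by positivity
  have hF2 : Integrable (fun s : ℝ => ‖(𝓕 f) s‖ ^ 2) := by
    have := ((𝓕 f).memLp (p := 2) (μ := volume)).integrable_norm_pow (by norm_num)
    simpa using this
  refine ⟨fun s => ‖(𝓕 f) s‖ ^ 2 / m ^ 2, ?_, hF2.div_const _, fun s => by positivity, ?_, ?_⟩
  · have := (𝓕 f).continuous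
    fun_prop
  · intro s hs
    rw [le_div_iff₀ (by positivity), one_mul]
    exact pow_le_pow_left₀ hmpos.le (hlow s hs) 2
  · intro ζ hζ
    let fz : SchwartzMap ℝ ℂ := f.compSubConstCLM ℝ (-ζ)
    have hfz : ∀ s, (𝓕 fz) s = eC (s * ζ) * (𝓕 f) s := by
      intro s
      rw [hFf, SchwartzMap.fourier_coe, Real.fourier_eq, ← integral_const_mul,
        ← integral_sub_right_eq_self _ ζ]
      congr 1; ext v
      rw [Circle.smul_def, Real.fourierChar_apply]
      simp only [fz, SchwartzMap.compSubConstCLM_apply, hf, smul_eq_mul]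
      rw [← mul_assoc, ← eC_add]
      unfold eC
      simp
      left; ring_nf
    have key := SchwartzMap.integral_inner_fourier_fourier f fz
    have hz : ∀ x : ℝ, inner ℂ (f x) (fz x) = 0 := by
      intro x
      simp only [fz, SchwartzMap.compSubConstCLM_apply, hf]
      by_cases hx : 1 / 8 ≤ |x|
      · simp [hsupp x hx]
      · have : 1 / 8 ≤ |x - -ζ| := by
          push Not at hx
          have := abs_sub_abs_le_abs_sub ζ (-x)
          rw [abs_neg] at this
          rw [show x - -ζ = ζ - -x by ring]
          linarith
        rw [hsupp _ this]; simp
    simp only [hz, integral_zero] at key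
    have : ∀ s : ℝ, eC (s * ζ) * ((‖(𝓕 f) s‖ ^ 2 / m ^ 2 : ℝ) : ℂ) =
        inner ℂ ((𝓕 f) s) ((𝓕 fz) s) * ((1 / m ^ 2 : ℝ) : ℂ) := by
      intro s
      rw [hfz, RCLike.inner_apply, mul_assoc (eC _), Complex.mul_conj, Complex.normSq_eq_norm_sq]
      push_cast
      ring
    simp_rw [this]
    rw [integral_mul_const, key, zero_mul]

/-- The standard pairing on `ℝ^d × ℝ^k`. -/
def dotW {d k : ℕ} (w ζ : (Fin d → ℝ) × (Fin k → ℝ)) : ℝ :=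
  (∑ i, w.1 i * ζ.1 i) + ∑ j, w.2 j * ζ.2 j

instance isAddHaarMeasure_volume_prod {d k : ℕ} :
    (volume : Measure ((Fin d → ℝ) × (Fin k → ℝ))).IsAddHaarMeasure := by
  rw [Measure.volume_eq_prod]; exact Measure.prod.instIsAddHaarMeasure _ _

section dotW
variable {d k : ℕ}

lemma phase_eq_dotW (Φ : (Fin d → ℝ) → Fin k → ℝ) (w : (Fin d → ℝ) × (Fin k → ℝ))
    (ξ : Fin d → ℝ) : phase Φ w ξ = dotW w (ξ, Φ ξ) := rfl

lemma dotW_add_left (w w' ζ : (Fin d → ℝ) × (Fin k → ℝ)) :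
    dotW (w + w') ζ = dotW w ζ + dotW w' ζ := by
  simp [dotW, add_mul, Finset.sum_add_distrib]; ring

lemma dotW_add_right (w ζ ζ' : (Fin d → ℝ) × (Fin k → ℝ)) :
    dotW w (ζ + ζ') = dotW w ζ + dotW w ζ' := by
  simp [dotW, mul_add, Finset.sum_add_distrib]; ring

lemma dotW_sub_right (w ζ ζ' : (Fin d → ℝ) × (Fin k → ℝ)) :
    dotW w (ζ - ζ') = dotW w ζ - dotW w ζ' := by
  simp [dotW, mul_sub, Finset.sum_sub_distrib]; ring

lemma dotW_smul_left (c : ℝ) (w ζ : (Fin d → ℝ) × (Fin k → ℝ)) :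
    dotW (c • w) ζ = c * dotW w ζ := by
  simp [dotW, mul_add, Finset.mul_sum, mul_assoc]

lemma dotW_smul_right (c : ℝ) (w ζ : (Fin d → ℝ) × (Fin k → ℝ)) :
    dotW w (c • ζ) = c * dotW w ζ := by
  simp [dotW, mul_add, Finset.mul_sum, mul_left_comm]

lemma continuous_dotW :
    Continuous fun p : ((Fin d → ℝ) × (Fin k → ℝ)) × ((Fin d → ℝ) × (Fin k → ℝ)) =>
      dotW p.1 p.2 := by
  unfold dotW; fun_prop

lemma eC_sum {ι : Type*} (s : Finset ι) (f : ι → ℝ) : eC (∑ i ∈ s, f i) = ∏ i ∈ s, eC (f i) := by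
  classical
  induction s using Finset.induction_on with
  | empty => simp [eC_zero]
  | insert a s ha ih => rw [Finset.sum_insert ha, Finset.prod_insert ha, eC_add, ih]

/-- A multivariate version of `exists_kernel`. -/
lemma exists_kernel_prod (d k : ℕ) : ∃ ρ : (Fin d → ℝ) × (Fin k → ℝ) → ℝ,
    Continuous ρ ∧ Integrable ρ ∧ (∀ w, 0 ≤ ρ w) ∧ (∀ w, ‖w‖ ≤ 1 → 1 ≤ ρ w) ∧
    (∀ ζ, 1 ≤ ‖ζ‖ → ∫ w, eC (dotW w ζ) * (ρ w : ℂ) = 0) := by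
  obtain ⟨ρ, hc, hi, h0, h1, hv⟩ := exists_kernel
  refine ⟨fun w => (∏ i, ρ (w.1 i)) * ∏ j, ρ (w.2 j), by fun_prop, ?_, ?_, ?_, ?_⟩
  · exact (Integrable.fintype_prod (f := fun _ : Fin d => ρ) fun _ => hi).mul_prod
      (Integrable.fintype_prod (f := fun _ : Fin k => ρ) fun _ => hi)
  · exact fun w => mul_nonneg (Finset.prod_nonneg fun _ _ => h0 _)
      (Finset.prod_nonneg fun _ _ => h0 _)
  · intro w hw
    rw [Prod.norm_def, max_le_iff, pi_norm_le_iff_of_nonneg zero_le_one,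
      pi_norm_le_iff_of_nonneg zero_le_one] at hw
    have key : ∀ {N : ℕ} (x : Fin N → ℝ), (∀ i, ‖x i‖ ≤ 1) → 1 ≤ ∏ i, ρ (x i) := fun x hx =>
      Finset.prod_induction _ (fun y => 1 ≤ y) (fun _ _ => one_le_mul_of_one_le_of_one_le) le_rfl
        fun i _ => h1 _ (hx i)
    exact one_le_mul_of_one_le_of_one_le (key _ hw.1) (key _ hw.2)
  · intro ζ hζ
    have hfac : ∀ w : (Fin d → ℝ) × (Fin k → ℝ),
        eC (dotW w ζ) * (((∏ i, ρ (w.1 i)) * ∏ j, ρ (w.2 j) : ℝ) : ℂ) =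
        (∏ i, (eC (w.1 i * ζ.1 i) * (ρ (w.1 i) : ℂ))) *
          ∏ j, (eC (w.2 j * ζ.2 j) * (ρ (w.2 j) : ℂ)) := by
      intro w
      rw [dotW, eC_add, eC_sum, eC_sum, Finset.prod_mul_distrib, Finset.prod_mul_distrib]
      push_cast; ring
    simp_rw [hfac]
    rw [Measure.volume_eq_prod, integral_prod_mul
      (f := fun x : Fin d → ℝ => ∏ i, (eC (x i * ζ.1 i) * (ρ (x i) : ℂ)))
      (g := fun x : Fin k → ℝ => ∏ i, (eC (x i * ζ.2 i) * (ρ (x i) : ℂ))),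
      integral_fintype_prod_volume_eq_prod
        (f := fun i (s : ℝ) => eC (s * ζ.1 i) * (ρ s : ℂ)),
      integral_fintype_prod_volume_eq_prod
        (f := fun i (s : ℝ) => eC (s * ζ.2 i) * (ρ s : ℂ))]
    rw [Prod.norm_def, le_max_iff] at hζ
    rcases hζ with hζ | hζ
    · have : ∃ i, 1 ≤ |ζ.1 i| := by
        by_contra! hcon
        exact absurd hζ (not_le.2 ((pi_norm_lt_iff zero_lt_one).2 hcon))
      obtain ⟨i, hi⟩ := this
      rw [Finset.prod_eq_zero (Finset.mem_univ i) (hv _ hi), zero_mul]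
    · have : ∃ i, 1 ≤ |ζ.2 i| := by
        by_contra! hcon
        exact absurd hζ (not_le.2 ((pi_norm_lt_iff zero_lt_one).2 hcon))
      obtain ⟨i, hi⟩ := this
      rw [Finset.prod_eq_zero (Finset.mem_univ i) (hv _ hi), mul_zero]

/-- A rescaled and translated version of `exists_kernel_prod`. -/
lemma exists_kernel_scaled (d k : ℕ) : ∃ C : ℝ, 0 < C ∧
    ∀ (L : ℝ) (w₀ : (Fin d → ℝ) × (Fin k → ℝ)), 0 < L →
    ∃ ρ : (Fin d → ℝ) × (Fin k → ℝ) → ℝ, Continuous ρ ∧ Integrable ρ ∧ (∀ w, 0 ≤ ρ w) ∧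
    (∀ w ∈ Metric.closedBall w₀ L, 1 ≤ ρ w) ∧ (∫ w, ρ w ≤ C * L ^ (d + k)) ∧
    (∀ ζ, 1 / L ≤ ‖ζ‖ → ∫ w, eC (dotW w ζ) * (ρ w : ℂ) = 0) := by
  obtain ⟨ρ, hc, hi, h0, h1, hv⟩ := exists_kernel_prod d k
  refine ⟨(∫ w, ρ w) + 1,
      by have := integral_nonneg (μ := volume)  (f := ρ) (fun w => h0 w); linarith,
    fun L w₀ hL => ⟨fun w => ρ (L⁻¹ • (w - w₀)), by fun_prop, ?_, fun w => h0 _, ?_, ?_, ?_⟩⟩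
  · exact (hi.comp_smul (inv_ne_zero hL.ne')).comp_sub_right w₀
  · intro w hw
    apply h1
    rw [norm_smul, norm_inv, Real.norm_of_nonneg hL.le]
    rw [mem_closedBall_iff_norm] at hw
    rw [inv_mul_le_iff₀ hL]; simpa using hw
  · rw [integral_sub_right_eq_self (fun w => ρ (L⁻¹ • w)) w₀, Measure.integral_comp_smul]
    simp only [Module.finrank_prod, Module.finrank_fintype_fun_eq_card, Fintype.card_fin]
    rw [inv_pow, inv_inv, abs_of_pos (by positivity), smul_eq_mul, mul_comm]
    gcongr; linarith
  · intro ζ hζ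
    have h2 : ∀ w, eC (dotW w ζ) * ((ρ (L⁻¹ • (w - w₀)) : ℝ) : ℂ) =
        (fun u => eC (dotW w₀ ζ) * (eC (dotW u (L • ζ)) * (ρ u : ℂ))) (L⁻¹ • (w - w₀)) := by
      intro w
      simp only
      rw [← mul_assoc, ← eC_add, dotW_smul_right, dotW_smul_left, ← mul_assoc,
        mul_inv_cancel₀ hL.ne', one_mul, ← dotW_add_left]
      congr 3; abel
    simp_rw [h2]
    rw [integral_sub_right_eq_self (fun w => (fun u => eC (dotW w₀ ζ) *
        (eC (dotW u (L • ζ)) * (ρ u : ℂ))) (L⁻¹ • w)) w₀,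
      Measure.integral_comp_smul volume (fun u => eC (dotW w₀ ζ) *
        (eC (dotW u (L • ζ)) * (ρ u : ℂ))), integral_const_mul, hv, mul_zero, smul_zero]
    rw [norm_smul, Real.norm_of_nonneg hL.le]
    rwa [div_le_iff₀' hL] at hζ

end dotW

section oscillatory
variable {d k : ℕ} {Y : Type*} [MeasurableSpace Y] {μ : Measure Y}

/-- The oscillatory integral with frequency map `P` and amplitude `h`. -/
def osc (μ : Measure Y) (P : Y → (Fin d → ℝ) × (Fin k → ℝ)) (h : Y → ℂ)
    (w : (Fin d → ℝ) × (Fin k → ℝ)) : ℂ := ∫ y, eC (dotW w (P y)) * h y ∂μ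

lemma norm_osc_le (P : Y → (Fin d → ℝ) × (Fin k → ℝ)) (h : Y → ℂ)
    (w : (Fin d → ℝ) × (Fin k → ℝ)) : ‖osc μ P h w‖ ≤ ∫ y, ‖h y‖ ∂μ := by
  refine (norm_integral_le_integral_norm _).trans (le_of_eq ?_)
  simp [norm_eC]

lemma measurable_eC_dotW {P : Y → (Fin d → ℝ) × (Fin k → ℝ)} (hP : Measurable P) :
    Measurable fun p : ((Fin d → ℝ) × (Fin k → ℝ)) × Y => eC (dotW p.1 (P p.2)) :=
  continuous_eC.measurable.comp (continuous_dotW.measurable.comp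
    (measurable_fst.prodMk (hP.comp measurable_snd)))

lemma aestronglyMeasurable_eC_dotW {P : Y → (Fin d → ℝ) × (Fin k → ℝ)} (hP : Measurable P)
    (w : (Fin d → ℝ) × (Fin k → ℝ)) : AEStronglyMeasurable (fun y => eC (dotW w (P y))) μ :=
  ((measurable_eC_dotW hP).comp measurable_prodMk_left).aestronglyMeasurable

lemma integrable_eC_mul {P : Y → (Fin d → ℝ) × (Fin k → ℝ)} (hP : Measurable P) {h : Y → ℂ}
    (hh : Integrable h μ) (w : (Fin d → ℝ) × (Fin k → ℝ)) :
    Integrable (fun y => eC (dotW w (P y)) * h y) μ :=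
  hh.bdd_mul (c := 1) (aestronglyMeasurable_eC_dotW hP w)
    (Filter.Eventually.of_forall fun _ => (norm_eC _).le)

lemma continuous_osc {P : Y → (Fin d → ℝ) × (Fin k → ℝ)} (hP : Measurable P) {h : Y → ℂ}
    (hh : Integrable h μ) : Continuous (osc μ P h) := by
  refine continuous_of_dominated (bound := fun y => ‖h y‖)
    (fun w => (integrable_eC_mul hP hh w).1) (fun w => ?_) hh.norm ?_
  · exact Filter.Eventually.of_forall fun y => by simp [norm_eC]
  · refine Filter.Eventually.of_forall fun y => ?_
    have hc : Continuous fun w : (Fin d → ℝ) × (Fin k → ℝ) => dotW w (P y) := by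
      unfold dotW; fun_prop
    exact (continuous_eC.comp hc).mul continuous_const

lemma integral_kernel_osc_mul_conj [SFinite μ] {P : Y → (Fin d → ℝ) × (Fin k → ℝ)}
    (hP : Measurable P) {h h' : Y → ℂ} (hh : Integrable h μ) (hh' : Integrable h' μ)
    {ρ : (Fin d → ℝ) × (Fin k → ℝ) → ℝ} (hρ : Integrable ρ) :
    ∫ w, (ρ w : ℂ) * (osc μ P h w * (starRingEnd ℂ) (osc μ P h' w)) =
      ∫ z : Y × Y, (h z.1 * (starRingEnd ℂ) (h' z.2)) *
        (∫ w, eC (dotW w (P z.1 - P z.2)) * (ρ w : ℂ)) ∂(μ.prod μ) := by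
  have hconj : Integrable (fun y => (starRingEnd ℂ) (h' y)) μ :=
    (LinearIsometryEquiv.integrable_comp_iff (φ := h') Complex.conjLIE).2 hh'
  have hz : Integrable (fun z : Y × Y => h z.1 * (starRingEnd ℂ) (h' z.2)) (μ.prod μ) :=
    hh.mul_prod hconj
  have hPz : Measurable fun z : Y × Y => P z.1 - P z.2 :=
    (hP.comp measurable_fst).sub (hP.comp measurable_snd)
  have h1 : ∀ w, osc μ P h w * (starRingEnd ℂ) (osc μ P h' w) =
      ∫ z : Y × Y, eC (dotW w (P z.1 - P z.2)) * (h z.1 * (starRingEnd ℂ) (h' z.2))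
        ∂(μ.prod μ) := by
    intro w
    rw [osc, osc, ← integral_conj, ← integral_prod_mul]
    congr 1; ext z
    rw [dotW_sub_right, sub_eq_add_neg, eC_add, ← conj_eC, map_mul]; ring
  simp_rw [h1, ← integral_const_mul]
  rw [integral_integral_swap]
  · congr 1; ext z
    congr 1; ext w; ring
  · have := (hρ.ofReal (𝕜 := ℂ)).mul_prod hz
    refine (this.bdd_mul (c := 1) (measurable_eC_dotW hPz).aestronglyMeasurable
      (Filter.Eventually.of_forall fun _ => (norm_eC _).le)).congr
      (Filter.Eventually.of_forall fun p => ?_)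
    simp only [Function.uncurry]
    rw [mul_comm (ρ p.1 : ℂ) (_ * _), mul_assoc]
    congr 1; exact mul_comm _ _

/-- Local almost orthogonality for finite sums of oscillatory integrals. -/
theorem exists_lintegral_sum_osc_le (d k : ℕ) : ∃ C : ℝ, 0 < C ∧
    ∀ {Y : Type} [MeasurableSpace Y] (μ : Measure Y) [SFinite μ] {ι : Type} (J : Finset ι)
      (P : Y → (Fin d → ℝ) × (Fin k → ℝ)) (_ : Measurable P) (h : ι → Y → ℂ)
      (_ : ∀ j ∈ J, Integrable (h j) μ) (A : ι → ℝ) (_ : ∀ j ∈ J, ∫ y, ‖h j y‖ ∂μ ≤ A j)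
      (L : ℝ) (_ : 0 < L) (w₀ : (Fin d → ℝ) × (Fin k → ℝ))
      (Res : ι → ι → Prop) [DecidableRel Res]
      (_ : ∀ i j, ¬ Res i j → ∀ y y', h i y ≠ 0 → h j y' ≠ 0 → 1 / L ≤ ‖P y - P y'‖),
      ∫⁻ w in Metric.closedBall w₀ L, ‖∑ j ∈ J, osc μ P (h j) w‖ₑ ^ 2 ≤
        ENNReal.ofReal (C * L ^ (d + k) * ∑ i ∈ J, ∑ j ∈ J, if Res i j then A i * A j else 0) := by
  obtain ⟨C, hC, hker⟩ := exists_kernel_scaled d k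
  refine ⟨C, hC, ?_⟩
  intro Y _ μ _ ι J P hP h hh A hA L hL w₀ Res _ hres
  obtain ⟨ρ, hρc, hρi, hρ0, hρ1, hρI, hρv⟩ := hker L w₀ hL
  have hA0 : ∀ j ∈ J, 0 ≤ A j := fun j hj =>
      (integral_nonneg fun _ => norm_nonneg _).trans (hA j hj)
  have hcont : ∀ j ∈ J, Continuous (osc μ P (h j)) := fun j hj => continuous_osc hP (hh j hj)
  have hint : ∀ i ∈ J, ∀ j ∈ J, Integrable fun w =>
      (ρ w : ℂ) * (osc μ P (h i) w * (starRingEnd ℂ) (osc μ P (h j) w)) := by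
    intro i hi j hj
    refine (hρi.ofReal (𝕜 := ℂ)).mul_bdd (c := A i * A j) ?_ ?_
    · exact ((hcont i hi).mul (Complex.continuous_conj.comp (hcont j hj))).aestronglyMeasurable
    · refine Filter.Eventually.of_forall fun w => ?_
      rw [norm_mul, RCLike.norm_conj]
      exact mul_le_mul ((norm_osc_le _ _ _).trans (hA i hi)) ((norm_osc_le _ _ _).trans (hA j hj))
        (norm_nonneg _) (hA0 i hi)
  have hsq : ∀ w, ((ρ w * ‖∑ j ∈ J, osc μ P (h j) w‖ ^ 2 : ℝ) : ℂ) =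
      ∑ i ∈ J, ∑ j ∈ J, (ρ w : ℂ) * (osc μ P (h i) w * (starRingEnd ℂ) (osc μ P (h j) w)) := by
    intro w
    push_cast
    rw [← Complex.mul_conj', map_sum, Finset.sum_mul_sum, Finset.mul_sum]
    simp_rw [Finset.mul_sum]
  have hintsq : Integrable fun w => ρ w * ‖∑ j ∈ J, osc μ P (h j) w‖ ^ 2 := by
    have : Integrable fun w => ((ρ w * ‖∑ j ∈ J, osc μ P (h j) w‖ ^ 2 : ℝ) : ℂ) := by
      simp_rw [hsq]
      exact integrable_finsetSum _ fun i hi => integrable_finsetSum _ fun j hj => hint i hi j hj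
    exact this.re.congr (Filter.Eventually.of_forall fun w => Complex.ofReal_re _)
  have hterm : ∀ i ∈ J, ∀ j ∈ J,
      ‖∫ w, (ρ w : ℂ) * (osc μ P (h i) w * (starRingEnd ℂ) (osc μ P (h j) w))‖ ≤
        C * L ^ (d + k) * if Res i j then A i * A j else 0 := by
    intro i hi j hj
    split_ifs with hR
    · calc _ ≤ ∫ w, ρ w * (A i * A j) := by
            refine norm_integral_le_of_norm_le (hρi.mul_const _)
              (Filter.Eventually.of_forall fun w => ?_)
            rw [norm_mul, norm_mul, RCLike.norm_conj, Complex.norm_real,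
              Real.norm_of_nonneg (hρ0 w)]
            exact mul_le_mul_of_nonneg_left (mul_le_mul ((norm_osc_le _ _ _).trans (hA i hi))
              ((norm_osc_le _ _ _).trans (hA j hj)) (norm_nonneg _) (hA0 i hi)) (hρ0 w)
        _ ≤ _ := by
            rw [integral_mul_const]
            exact mul_le_mul_of_nonneg_right hρI (mul_nonneg (hA0 i hi) (hA0 j hj))
    · rw [integral_kernel_osc_mul_conj hP (hh i hi) (hh j hj) hρi, mul_zero]
      refine le_of_eq (norm_eq_zero.2 (integral_eq_zero_of_ae (Filter.Eventually.of_forall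
        fun z => ?_)))
      simp only [Pi.zero_apply]
      by_cases h1 : h i z.1 = 0
      · simp [h1]
      by_cases h2 : h j z.2 = 0
      · simp [h2]
      rw [hρv _ (hres i j hR _ _ h1 h2), mul_zero]
  calc ∫⁻ w in Metric.closedBall w₀ L, ‖∑ j ∈ J, osc μ P (h j) w‖ₑ ^ 2
      ≤ ∫⁻ w, ENNReal.ofReal (ρ w * ‖∑ j ∈ J, osc μ P (h j) w‖ ^ 2) := by
        refine (setLIntegral_mono' measurableSet_closedBall fun w hw => ?_).trans
          (setLIntegral_le_lintegral _ _)
        rw [← ofReal_norm, ← ENNReal.ofReal_pow (norm_nonneg _)]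
        exact ENNReal.ofReal_le_ofReal (le_mul_of_one_le_left (by positivity) (hρ1 w hw))
    _ = ENNReal.ofReal (∫ w, ρ w * ‖∑ j ∈ J, osc μ P (h j) w‖ ^ 2) := by
        rw [ofReal_integral_eq_lintegral_ofReal hintsq]
        exact Filter.Eventually.of_forall fun w => mul_nonneg (hρ0 w) (by positivity)
    _ ≤ _ := by
        apply ENNReal.ofReal_le_ofReal
        have : ((∫ w, ρ w * ‖∑ j ∈ J, osc μ P (h j) w‖ ^ 2 : ℝ) : ℂ) = ∑ i ∈ J, ∑ j ∈ J,
            ∫ w, (ρ w : ℂ) * (osc μ P (h i) w * (starRingEnd ℂ) (osc μ P (h j) w)) := by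
          rw [← integral_complex_ofReal]
          simp_rw [hsq]
          rw [integral_finsetSum _ fun i hi => integrable_finsetSum _ fun j hj => hint i hi j hj]
          exact Finset.sum_congr rfl fun i hi => integral_finsetSum _ fun j hj => hint i hi j hj
        refine (le_abs_self _).trans ?_
        rw [← Real.norm_eq_abs, ← Complex.norm_real, this, Finset.mul_sum]
        refine (norm_sum_le _ _).trans (Finset.sum_le_sum fun i hi => ?_)
        rw [Finset.mul_sum]
        exact (norm_sum_le _ _).trans (Finset.sum_le_sum fun j hj => hterm i hi j hj)

/-- Local square function estimate under an injectivity hypothesis on the frequency map. -/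
theorem exists_lintegral_osc_le (d k : ℕ) : ∃ C : ℝ, 0 < C ∧
    ∀ {Y : Type} [MeasurableSpace Y] (μ : Measure Y) [SFinite μ]
      (P : Y → (Fin d → ℝ) × (Fin k → ℝ)) (_ : Measurable P) (h : Y → ℂ)
      (_ : Integrable h μ) (E : Set Y) (_ : MeasurableSet E) (_ : ∀ y ∉ E, h y = 0)
      (L : ℝ) (_ : 0 < L) (w₀ : (Fin d → ℝ) × (Fin k → ℝ)) (V : ℝ≥0∞)
      (_ : ∀ y ∈ E, μ {y' | y' ∈ E ∧ ‖P y - P y'‖ < 1 / L} ≤ V),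
      ∫⁻ w in Metric.closedBall w₀ L, ‖osc μ P h w‖ₑ ^ 2 ≤
        ENNReal.ofReal (C * L ^ (d + k)) * (2 * (V * ∫⁻ y, ‖h y‖ₑ ^ 2 ∂μ)) := by
  obtain ⟨C, hC, hker⟩ := exists_kernel_scaled d k
  refine ⟨C, hC, ?_⟩
  intro Y _ μ _ P hP h hh E hE hhE L hL w₀ V hV
  obtain ⟨ρ, hρc, hρi, hρ0, hρ1, hρI, hρv⟩ := hker L w₀ hL
  have hcont : Continuous (osc μ P h) := continuous_osc hP hh
  have hint : Integrable fun w => ρ w * ‖osc μ P h w‖ ^ 2 := by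
    refine hρi.mul_bdd (c := (∫ y, ‖h y‖ ∂μ) ^ 2) (hcont.norm.pow 2).aestronglyMeasurable
      (Filter.Eventually.of_forall fun w => ?_)
    rw [Real.norm_of_nonneg (by positivity)]
    exact pow_le_pow_left₀ (norm_nonneg _) (norm_osc_le _ _ _) 2
  set G : Set (Y × Y) := {z | z.1 ∈ E ∧ z.2 ∈ E ∧ ‖P z.1 - P z.2‖ < 1 / L} with hGdef
  have hG : MeasurableSet G := by
    refine (measurable_fst hE).inter ((measurable_snd hE).inter ?_)
    exact measurableSet_lt
      ((hP.comp measurable_fst).sub (hP.comp measurable_snd)).norm measurable_const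
  have hker_le : ∀ z : Y × Y, ‖(h z.1 * (starRingEnd ℂ) (h z.2)) *
      (∫ w, eC (dotW w (P z.1 - P z.2)) * (ρ w : ℂ))‖ₑ ≤ ENNReal.ofReal (C * L ^ (d + k)) *
        (G.indicator (fun z => ‖h z.1‖ₑ ^ 2) z + G.indicator (fun z => ‖h z.2‖ₑ ^ 2) z) := by
    intro z
    by_cases hz : z ∈ G
    · rw [Set.indicator_of_mem hz, Set.indicator_of_mem hz, enorm_mul, mul_comm]
      refine mul_le_mul' ?_ ?_
      · rw [← ofReal_norm]
        refine ENNReal.ofReal_le_ofReal (le_trans ?_ hρI)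
        refine norm_integral_le_of_norm_le hρi (Filter.Eventually.of_forall fun w => ?_)
        rw [norm_mul, norm_eC, one_mul, Complex.norm_real, Real.norm_of_nonneg (hρ0 w)]
      · rw [enorm_mul, ← ofReal_norm, ← ofReal_norm, ← ENNReal.ofReal_mul (norm_nonneg _),
          ← ENNReal.ofReal_pow (norm_nonneg _), ← ofReal_norm,
          ← ENNReal.ofReal_pow (norm_nonneg _), ← ENNReal.ofReal_add (by positivity)
          (by positivity), RCLike.norm_conj]
        apply ENNReal.ofReal_le_ofReal
        nlinarith [sq_nonneg (‖h z.1‖ - ‖h z.2‖), sq_nonneg ‖h z.1‖, sq_nonneg ‖h z.2‖]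
    · have : (h z.1 * (starRingEnd ℂ) (h z.2)) *
          (∫ w, eC (dotW w (P z.1 - P z.2)) * (ρ w : ℂ)) = 0 := by
        by_cases h1 : z.1 ∈ E
        · by_cases h2 : z.2 ∈ E
          · rw [hρv _ (not_lt.1 fun h3 => hz ⟨h1, h2, h3⟩), mul_zero]
          · simp [hhE _ h2]
        · simp [hhE _ h1]
      rw [this]; simp
  have hm1 : AEMeasurable (G.indicator fun z : Y × Y => ‖h z.1‖ₑ ^ 2) (μ.prod μ) :=
    ((hh.1.comp_fst (ν := μ)).enorm.pow_const 2).indicator hG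
  have hm2 : AEMeasurable (G.indicator fun z : Y × Y => ‖h z.2‖ₑ ^ 2) (μ.prod μ) :=
    ((hh.1.comp_snd (μ := μ)).enorm.pow_const 2).indicator hG
  have hslice : ∀ y, ∫⁻ y', G.indicator (fun z : Y × Y => ‖h z.1‖ₑ ^ 2) (y, y') ∂μ ≤
      V * ‖h y‖ₑ ^ 2 := by
    intro y
    by_cases hy : y ∈ E
    · have : ∀ y', G.indicator (fun z : Y × Y => ‖h z.1‖ₑ ^ 2) (y, y') =
          {y' | y' ∈ E ∧ ‖P y - P y'‖ < 1 / L}.indicator (fun _ => ‖h y‖ₑ ^ 2) y' := by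
        intro y'
        have : (y, y') ∈ G ↔ y' ∈ {y' | y' ∈ E ∧ ‖P y - P y'‖ < 1 / L} := by simp [hGdef, hy]
        classical
        simp only [Set.indicator_apply, this]
      simp_rw [this]
      refine (lintegral_indicator_const_le _ _).trans ?_
      rw [mul_comm]; gcongr; exact hV y hy
    · simp [Set.indicator, hGdef, hy]
  have hslice' : ∀ y', ∫⁻ y, G.indicator (fun z : Y × Y => ‖h z.2‖ₑ ^ 2) (y, y') ∂μ ≤
      V * ‖h y'‖ₑ ^ 2 := by
    intro y'
    refine le_trans (le_of_eq ?_) (hslice y')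
    congr 1; ext y
    have : (y, y') ∈ G ↔ (y', y) ∈ G := by
      simp [hGdef, norm_sub_rev (P y), and_left_comm]
    classical
    simp only [Set.indicator_apply, this]
  calc ∫⁻ w in Metric.closedBall w₀ L, ‖osc μ P h w‖ₑ ^ 2
      ≤ ∫⁻ w, ENNReal.ofReal (ρ w * ‖osc μ P h w‖ ^ 2) := by
        refine (setLIntegral_mono' measurableSet_closedBall fun w hw => ?_).trans
          (setLIntegral_le_lintegral _ _)
        rw [← ofReal_norm, ← ENNReal.ofReal_pow (norm_nonneg _)]
        exact ENNReal.ofReal_le_ofReal (le_mul_of_one_le_left (by positivity) (hρ1 w hw))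
    _ = ENNReal.ofReal (∫ w, ρ w * ‖osc μ P h w‖ ^ 2) := by
        rw [ofReal_integral_eq_lintegral_ofReal hint]
        exact Filter.Eventually.of_forall fun w => mul_nonneg (hρ0 w) (by positivity)
    _ ≤ ‖∫ w, (ρ w : ℂ) * (osc μ P h w * (starRingEnd ℂ) (osc μ P h w))‖ₑ := by
        rw [← ofReal_norm]
        apply ENNReal.ofReal_le_ofReal
        refine (le_abs_self _).trans (le_of_eq ?_)
        rw [← Real.norm_eq_abs, ← Complex.norm_real, ← integral_complex_ofReal]
        congr 2; ext w
        rw [Complex.mul_conj']; push_cast; rfl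
    _ ≤ ∫⁻ z : Y × Y, ENNReal.ofReal (C * L ^ (d + k)) *
        (G.indicator (fun z => ‖h z.1‖ₑ ^ 2) z + G.indicator (fun z => ‖h z.2‖ₑ ^ 2) z)
          ∂(μ.prod μ) := by
        rw [integral_kernel_osc_mul_conj hP hh hh hρi]
        exact (enorm_integral_le_lintegral_enorm _).trans (lintegral_mono hker_le)
    _ ≤ _ := by
        rw [lintegral_const_mul' _ _ ENNReal.ofReal_ne_top, lintegral_add_left' hm1,
          lintegral_prod _ hm1, lintegral_prod_symm _ hm2, two_mul]
        have hfin : ∀ F : Y → ℝ≥0∞, (∀ y, F y ≤ V * ‖h y‖ₑ ^ 2) →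
            ∫⁻ y, F y ∂μ ≤ V * ∫⁻ y, ‖h y‖ₑ ^ 2 ∂μ := fun F hF =>
          (lintegral_mono hF).trans
            (lintegral_const_mul'' _ (hh.1.enorm.pow_const 2)).le
        exact mul_le_mul_right (add_le_add (hfin _ hslice) (hfin _ hslice')) _

end oscillatory

section Parseval

/-- The normalised Haar measure on the circle, as used for Fourier series on `UnitAddTorus`. -/
local instance measureSpaceUnitAddCircle : MeasureSpace UnitAddCircle := ⟨AddCircle.haarAddCircle⟩

local instance isAddHaarMeasureUnitAddCircle :
    Measure.IsAddHaarMeasure (volume : Measure UnitAddCircle) :=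
  inferInstanceAs (Measure.IsAddHaarMeasure AddCircle.haarAddCircle)

local instance isProbabilityMeasureUnitAddCircle :
    IsProbabilityMeasure (volume : Measure UnitAddCircle) :=
  inferInstanceAs (IsProbabilityMeasure AddCircle.haarAddCircle)

variable {d : ℕ}

/-- The half open unit cube with corner `a`. -/
def unitCube (a : Fin d → ℝ) : Set (Fin d → ℝ) := {x | ∀ i, x i ∈ Set.Ioc (a i) (a i + 1)}

lemma measurableSet_unitCube (a : Fin d → ℝ) : MeasurableSet (unitCube a) := 
  MeasurableSet.univ_pi' (fun _ => measurableSet_Ioc)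

/-- Fourier coefficients over the unit cube with corner `a`. -/
def cubeCoeff (a : Fin d → ℝ) (F : (Fin d → ℝ) → ℂ) (ℓ : Fin d → ℤ) : ℂ :=
  ∫ x in unitCube a, eC (-∑ i, ℓ i * x i) * F x

/-- Transfer of a function on a unit cube to the torus. -/
def torusLift (a : Fin d → ℝ) (F : (Fin d → ℝ) → ℂ) (z : UnitAddTorus (Fin d)) : ℂ :=
  F (UnitAddTorus.measurableEquivPiIoc a z).1

lemma torusLift_coe {a x : Fin d → ℝ} (hx : x ∈ unitCube a) (F : (Fin d → ℝ) → ℂ) :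
    torusLift a F (fun i => (x i : UnitAddCircle)) = F x := by
  unfold torusLift
  have := (UnitAddTorus.measurableEquivPiIoc a).apply_symm_apply ⟨x, hx⟩
  rw [UnitAddTorus.coe_symm_measurableEquivPiIoc_apply] at this
  rw [this]

lemma mFourier_coe (ℓ : Fin d → ℤ) (x : Fin d → ℝ) :
    UnitAddTorus.mFourier ℓ (fun i => (x i : UnitAddCircle)) = eC (∑ i, ℓ i * x i) := by
  rw [eC_sum]
  simp only [UnitAddTorus.mFourier, ContinuousMap.coe_mk]
  refine Finset.prod_congr rfl fun i _ => ?_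
  rw [fourier_coe_apply, eC]
  congr 1; push_cast; ring

lemma mFourierCoeff_torusLift (a : Fin d → ℝ) (F : (Fin d → ℝ) → ℂ) (ℓ : Fin d → ℤ) :
    UnitAddTorus.mFourierCoeff (torusLift a F) ℓ = cubeCoeff a F ℓ := by
  rw [UnitAddTorus.mFourierCoeff_eq_integral _ _ a, cubeCoeff]
  refine setIntegral_congr_fun (measurableSet_unitCube a) fun x hx => ?_
  simp only [smul_eq_mul]
  rw [torusLift_coe hx, mFourier_coe]
  simp

lemma memLp_torusLift {a : Fin d → ℝ} {F : (Fin d → ℝ) → ℂ}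
    (hF : MemLp F 2 (volume.restrict (unitCube a))) : MemLp (torusLift a F) 2 := by
  have h1 : MemLp (fun x : {x : Fin d → ℝ // ∀ i, x i ∈ Set.Ioc (a i) (a i + 1)} => F x.1) 2
      (Measure.comap Subtype.val volume) := by
    have hm := measurableSet_unitCube a
    refine MemLp.comp_of_map (f := Subtype.val) ?_ measurable_subtype_coe.aemeasurable
    have : Measure.map Subtype.val (Measure.comap Subtype.val volume) =
        volume.restrict (unitCube a) := map_comap_subtype_coe hm volume
    exact this.symm ▸ hF
  exact h1.comp_measurePreserving (UnitAddTorus.measurePreserving_equivPiIoc a)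

/-- Parseval's identity on a unit cube. -/
theorem hasSum_conj_cubeCoeff_mul {a : Fin d → ℝ} {F G : (Fin d → ℝ) → ℂ}
    (hF : MemLp F 2 (volume.restrict (unitCube a)))
    (hG : MemLp G 2 (volume.restrict (unitCube a))) :
    HasSum (fun ℓ => (starRingEnd ℂ) (cubeCoeff a F ℓ) * cubeCoeff a G ℓ)
      (∫ x in unitCube a, (starRingEnd ℂ) (F x) * G x) := by
  have h := UnitAddTorus.hasSum_prod_mFourierCoeff (memLp_torusLift hF).toLp
    (memLp_torusLift hG).toLp
  have hc : ∀ {F : (Fin d → ℝ) → ℂ} (hF : MemLp F 2 (volume.restrict (unitCube a))) ℓ,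
      UnitAddTorus.mFourierCoeff ((memLp_torusLift hF).toLp) ℓ = cubeCoeff a F ℓ := by
    intro F hF ℓ
    rw [← mFourierCoeff_torusLift]
    refine integral_congr_ae ?_
    filter_upwards [(memLp_torusLift hF).coeFn_toLp] with z hz
    rw [hz]
  have h' : HasSum (fun ℓ => (starRingEnd ℂ) (cubeCoeff a F ℓ) * cubeCoeff a G ℓ)
      (∫ z, (starRingEnd ℂ) ((memLp_torusLift hF).toLp _ z) * (memLp_torusLift hG).toLp _ z) :=
    HasSum.congr_fun h fun ℓ => congrArg₂ (fun x y : ℂ => (starRingEnd ℂ) x * y)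
      (hc hF ℓ).symm (hc hG ℓ).symm
  convert h' using 1
  have h2 : ∫ z, (starRingEnd ℂ) ((memLp_torusLift hF).toLp _ z) * (memLp_torusLift hG).toLp _ z =
      ∫ z, (starRingEnd ℂ) (torusLift a F z) * torusLift a G z := by
    refine integral_congr_ae ?_
    filter_upwards [(memLp_torusLift hF).coeFn_toLp, (memLp_torusLift hG).coeFn_toLp]
      with z hz hz'
    rw [hz, hz']
  rw [h2, UnitAddTorus.integral_preimage _ a]
  refine setIntegral_congr_fun (measurableSet_unitCube a) fun x hx => ?_
  simp only [torusLift_coe hx]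

theorem hasSum_norm_sq_cubeCoeff {a : Fin d → ℝ} {F : (Fin d → ℝ) → ℂ}
    (hF : MemLp F 2 (volume.restrict (unitCube a))) :
    HasSum (fun ℓ => ‖cubeCoeff a F ℓ‖ ^ 2) (∫ x in unitCube a, ‖F x‖ ^ 2) := by
  have h := hasSum_conj_cubeCoeff_mul hF hF
  have h2 := Complex.hasSum_re h
  simp only [Complex.conj_mul', ← Complex.ofReal_pow, Complex.ofReal_re] at h2
  convert h2 using 1
  rw [integral_complex_ofReal]; rfl

end Parseval

section Bump

/-- A smooth function supported in `(-1/2, 1/2)` whose half-integer translates have squares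
summing to one. -/
def chiOne (s : ℝ) : ℝ :=
  Real.sin (Real.pi / 2 * Real.smoothTransition (2 * s + 1)) *
    Real.cos (Real.pi / 2 * Real.smoothTransition (2 * s))

lemma contDiff_chiOne : ContDiff ℝ (⊤ : ℕ∞) chiOne := by
  unfold chiOne
  have h1 : ContDiff ℝ (⊤ : ℕ∞) fun s : ℝ => Real.smoothTransition (2 * s + 1) :=
    Real.smoothTransition.contDiff.comp (by fun_prop)
  have h2 : ContDiff ℝ (⊤ : ℕ∞) fun s : ℝ => Real.smoothTransition (2 * s) :=
    Real.smoothTransition.contDiff.comp (by fun_prop)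
  exact (Real.contDiff_sin.comp (contDiff_const.mul h1)).mul
    (Real.contDiff_cos.comp (contDiff_const.mul h2))

lemma chiOne_eq_zero {s : ℝ} (hs : 1 / 2 ≤ |s|) : chiOne s = 0 := by
  unfold chiOne
  rcases le_abs.1 hs with h | h
  · rw [Real.smoothTransition.one_of_one_le (x := 2 * s) (by linarith)]
    simp
  · rw [Real.smoothTransition.zero_of_nonpos (x := 2 * s + 1) (by linarith)]
    simp

lemma abs_chiOne_le (s : ℝ) : |chiOne s| ≤ 1 := by
  unfold chiOne
  rw [abs_mul]
  exact mul_le_one₀ (Real.abs_sin_le_one _) (abs_nonneg _) (Real.abs_cos_le_one _)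

lemma chiOne_sq_add_chiOne_sq {s : ℝ} (h0 : 0 ≤ s) (h1 : s ≤ 1 / 2) :
    chiOne s ^ 2 + chiOne (s - 1 / 2) ^ 2 = 1 := by
  unfold chiOne
  rw [Real.smoothTransition.one_of_one_le (x := 2 * s + 1) (by linarith),
    Real.smoothTransition.zero_of_nonpos (x := 2 * (s - 1 / 2)) (by linarith)]
  have : 2 * (s - 1 / 2) + 1 = 2 * s := by ring
  rw [this]
  simp

variable {d : ℕ}

/-- The tensor power of `chiOne`. -/
def chi (u : Fin d → ℝ) : ℝ := ∏ i, chiOne (u i)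

lemma contDiff_chi : ContDiff ℝ (⊤ : ℕ∞) (chi (d := d)) := by
  unfold chi
  exact contDiff_prod fun i _ => contDiff_chiOne.comp (contDiff_apply ℝ ℝ i)

lemma continuous_chi : Continuous (chi (d := d)) := contDiff_chi.continuous

lemma abs_chi_le (u : Fin d → ℝ) : |chi u| ≤ 1 := by
  unfold chi
  rw [Finset.abs_prod]
  exact Finset.prod_le_one (fun _ _ => abs_nonneg _) fun i _ => abs_chiOne_le _

lemma abs_lt_of_chi_ne_zero {u : Fin d → ℝ} (h : chi u ≠ 0) (i : Fin d) : |u i| < 1 / 2 := by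
  by_contra! hi
  exact h (Finset.prod_eq_zero (Finset.mem_univ i) (chiOne_eq_zero hi))

/-- The half-integer lattice point `m / 2`. -/
def halfPt (m : Fin d → ℤ) : Fin d → ℝ := fun i => (m i : ℝ) / 2

lemma sum_chi_sq_eq_one (x : Fin d → ℝ) (s : Finset (Fin d → ℤ))
    (hs : ∀ m, chi (x - halfPt m) ≠ 0 → m ∈ s) : ∑ m ∈ s, chi (x - halfPt m) ^ 2 = 1 := by
  classical
  set B : Finset (Fin d → ℤ) := Fintype.piFinset fun i => {⌊2 * x i⌋, ⌊2 * x i⌋ + 1} with hB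
  have hmem : ∀ m, chi (x - halfPt m) ≠ 0 → m ∈ B := by
    intro m hm
    rw [hB, Fintype.mem_piFinset]
    intro i
    have h := abs_lt.1 (abs_lt_of_chi_ne_zero hm i)
    simp only [Pi.sub_apply, halfPt] at h
    have h1 : m i ≤ ⌊2 * x i⌋ + 1 := by
      have : (m i : ℝ) < ⌊2 * x i⌋ + 1 + 1 := by linarith [Int.lt_floor_add_one (2 * x i)]
      have : m i < ⌊2 * x i⌋ + 1 + 1 := by exact_mod_cast this
      omega
    have h2 : ⌊2 * x i⌋ ≤ m i := by
      have : (⌊2 * x i⌋ : ℝ) < m i + 1 := by linarith [Int.floor_le (2 * x i)]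
      have : ⌊2 * x i⌋ < m i + 1 := by exact_mod_cast this
      omega
    rw [Finset.mem_insert, Finset.mem_singleton]
    omega
  have hsupp : ∀ t : Finset (Fin d → ℤ), (∀ m, chi (x - halfPt m) ≠ 0 → m ∈ t) →
      ∑ m ∈ t, chi (x - halfPt m) ^ 2 = ∑ᶠ m, chi (x - halfPt m) ^ 2 := by
    intro t ht
    refine (finsum_eq_sum_of_support_subset _ fun m hm => ?_).symm
    exact ht m fun h => hm (by simp [h])
  rw [hsupp s hs, ← hsupp B hmem]
  have : ∀ m, chi (x - halfPt m) ^ 2 = ∏ i, chiOne (x i - (m i : ℝ) / 2) ^ 2 := by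
    intro m; rw [chi, Finset.prod_pow]; rfl
  simp_rw [this]
  rw [hB, ← Finset.prod_univ_sum (fun i => ({⌊2 * x i⌋, ⌊2 * x i⌋ + 1} : Finset ℤ))
    (fun i (n : ℤ) => chiOne (x i - (n : ℝ) / 2) ^ 2)]
  refine Finset.prod_eq_one fun i _ => ?_
  rw [Finset.sum_pair (by omega)]
  push_cast
  have := chiOne_sq_add_chiOne_sq (s := x i - (⌊2 * x i⌋ : ℝ) / 2)
    (by linarith [Int.floor_le (2 * x i)]) (by linarith [Int.lt_floor_add_one (2 * x i)])
  rwa [show x i - ((⌊2 * x i⌋ : ℝ) + 1) / 2 = x i - (⌊2 * x i⌋ : ℝ) / 2 - 1 / 2 by ring]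

end Bump

section Frame
variable {d k : ℕ}

/-- The wave packet with frequency cap centred at `m / (2 * L)` and position index `ℓ`. -/
def psi (L : ℝ) (T : (Fin d → ℤ) × (Fin d → ℤ)) (ξ : Fin d → ℝ) : ℂ :=
  (chi (L • ξ - halfPt T.1) : ℂ) * eC (∑ i, (T.2 i : ℝ) * (L * ξ i))

/-- The wave packet coefficients of `f`. -/
def coef (L : ℝ) (f : (Fin d → ℝ) → ℂ) (T : (Fin d → ℤ) × (Fin d → ℤ)) : ℂ :=
  (L : ℂ) ^ d * ∫ ξ, (starRingEnd ℂ) (psi L T ξ) * f ξ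

lemma continuous_psi (L : ℝ) (T : (Fin d → ℤ) × (Fin d → ℤ)) : Continuous (psi L T) := by
  unfold psi
  refine Continuous.mul ?_ (continuous_eC.comp (by fun_prop))
  exact Complex.continuous_ofReal.comp (continuous_chi.comp (by fun_prop))

lemma norm_psi (L : ℝ) (T : (Fin d → ℤ) × (Fin d → ℤ)) (ξ : Fin d → ℝ) :
    ‖psi L T ξ‖ = |chi (L • ξ - halfPt T.1)| := by
  rw [psi, norm_mul, norm_eC, mul_one, Complex.norm_real, Real.norm_eq_abs]

lemma norm_psi_le (L : ℝ) (T : (Fin d → ℤ) × (Fin d → ℤ)) (ξ : Fin d → ℝ) :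
    ‖psi L T ξ‖ ≤ 1 := (norm_psi L T ξ).trans_le (abs_chi_le _)

/-- The centre of the frequency cap with index `m`. -/
def capPt (L : ℝ) (m : Fin d → ℤ) : Fin d → ℝ := L⁻¹ • halfPt m

lemma norm_sub_capPt_le {L : ℝ} (hL : 0 < L) {m : Fin d → ℤ} {ξ : Fin d → ℝ}
    (h : chi (L • ξ - halfPt m) ≠ 0) : ‖ξ - capPt L m‖ ≤ 1 / (2 * L) := by
  have : ξ - capPt L m = L⁻¹ • (L • ξ - halfPt m) := by
    rw [smul_sub, inv_smul_smul₀ hL.ne', capPt]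
  rw [this, norm_smul, norm_inv, Real.norm_of_nonneg hL.le, inv_mul_le_iff₀ hL,
    pi_norm_le_iff_of_nonneg (by positivity)]
  intro i
  have := (abs_lt_of_chi_ne_zero h i).le
  rw [Real.norm_eq_abs]
  refine this.trans (le_of_eq ?_)
  field_simp

lemma norm_sub_capPt_le_of_psi {L : ℝ} (hL : 0 < L) {T : (Fin d → ℤ) × (Fin d → ℤ)}
    {ξ : Fin d → ℝ} (h : psi L T ξ ≠ 0) : ‖ξ - capPt L T.1‖ ≤ 1 / (2 * L) :=
  norm_sub_capPt_le hL fun h0 => h (by simp [psi, h0])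

lemma hasCompactSupport_psi {L : ℝ} (hL : 0 < L) (T : (Fin d → ℤ) × (Fin d → ℤ)) :
    HasCompactSupport (psi L T) := by
  refine HasCompactSupport.of_support_subset_isCompact
    (isCompact_closedBall (capPt L T.1) (1 / (2 * L))) fun ξ hξ => ?_
  rw [mem_closedBall_iff_norm]
  exact norm_sub_capPt_le_of_psi hL hξ

lemma integrable_psi {L : ℝ} (hL : 0 < L) (T : (Fin d → ℤ) × (Fin d → ℤ)) :
    Integrable (psi L T) :=
  (continuous_psi L T).integrable_of_hasCompactSupport (hasCompactSupport_psi hL T)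

lemma memLp_psi {L : ℝ} (hL : 0 < L) (T : (Fin d → ℤ) × (Fin d → ℤ)) (p : ℝ≥0∞) :
    MemLp (psi L T) p :=
  (continuous_psi L T).memLp_of_hasCompactSupport (hasCompactSupport_psi hL T)

lemma integral_norm_psi_le {L : ℝ} (hL : 0 < L) (T : (Fin d → ℤ) × (Fin d → ℤ)) :
    ∫ ξ, ‖psi L T ξ‖ ≤ L⁻¹ ^ d := by
  calc ∫ ξ, ‖psi L T ξ‖ ≤ ∫ ξ, (Metric.closedBall (capPt L T.1) (1 / (2 * L))).indicator 1 ξ := by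
        refine integral_mono (integrable_psi hL T).norm ?_ fun ξ => ?_
        · exact (integrable_indicator_iff measurableSet_closedBall).2
            (integrableOn_const (measure_closedBall_lt_top.ne))
        · by_cases h : psi L T ξ = 0
          · simp only [h, norm_zero]
            exact Set.indicator_nonneg (fun _ _ => zero_le_one) _
          · rw [Set.indicator_of_mem (mem_closedBall_iff_norm.2 (norm_sub_capPt_le_of_psi hL h))]
            exact norm_psi_le _ _ _
    _ = L⁻¹ ^ d := by
        rw [integral_indicator_one measurableSet_closedBall, Measure.real,
          Real.volume_pi_closedBall _ (by positivity), ENNReal.toReal_ofReal (by positivity)]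
        simp only [Fintype.card_fin]
        congr 1; field_simp

lemma integral_scaled_cube {L : ℝ} (hL : 0 < L) (m : Fin d → ℤ) (H : (Fin d → ℝ) → ℂ)
    (hH : ∀ u, chi (u - halfPt m) = 0 → H u = 0) :
    ∫ u in unitCube (fun i => (m i : ℝ) / 2 - 1 / 2), H u = (L : ℂ) ^ d * ∫ ξ, H (L • ξ) := by
  rw [setIntegral_eq_integral_of_forall_compl_eq_zero, Measure.integral_comp_smul volume H L]
  · simp only [Module.finrank_fintype_fun_eq_card, Fintype.card_fin]
    rw [abs_of_pos (by positivity), Complex.real_smul, ← mul_assoc]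
    push_cast
    rw [mul_inv_cancel₀ (by exact_mod_cast (pow_pos hL d).ne'), one_mul]
  · intro u hu
    apply hH
    by_contra hne
    refine hu fun i => ?_
    have := abs_lt.1 (abs_lt_of_chi_ne_zero hne i)
    simp only [Pi.sub_apply, halfPt] at this
    constructor <;> linarith

lemma cubeCoeff_eq_coef {L : ℝ} (hL : 0 < L) (f : (Fin d → ℝ) → ℂ)
    (T : (Fin d → ℤ) × (Fin d → ℤ)) :
    cubeCoeff (fun i => (T.1 i : ℝ) / 2 - 1 / 2)
      (fun u => (chi (u - halfPt T.1) : ℂ) * f (L⁻¹ • u)) T.2 = coef L f T := by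
  rw [cubeCoeff, integral_scaled_cube hL, coef]
  · congr 2; ext ξ
    rw [psi, inv_smul_smul₀ hL.ne', map_mul, Complex.conj_ofReal, conj_eC]
    simp only [Pi.smul_apply, smul_eq_mul]; ring
  · intro u hu; simp [hu]

lemma memLp_cube {L : ℝ} (hL : 0 < L) (a : Fin d → ℝ) (m : Fin d → ℤ) {f : (Fin d → ℝ) → ℂ}
    (hf : MemLp f 2) :
    MemLp (fun u => (chi (u - halfPt m) : ℂ) * f (L⁻¹ • u)) 2 (volume.restrict (unitCube a)) := by
  have h1 : MemLp (fun u => f (L⁻¹ • u)) 2 := by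
    have hm : Measurable fun u : Fin d → ℝ => L⁻¹ • u := by fun_prop
    refine MemLp.comp_of_map (f := fun u : Fin d → ℝ => L⁻¹ • u) ?_ hm.aemeasurable
    rw [Measure.map_addHaar_smul _ (inv_ne_zero hL.ne')]
    exact hf.smul_measure ENNReal.ofReal_ne_top
  have h2 : Continuous fun u : Fin d → ℝ => (chi (u - halfPt m) : ℂ) :=
    Complex.continuous_ofReal.comp (continuous_chi.comp (by fun_prop))
  refine MemLp.of_le (h1.restrict _) (h2.aestronglyMeasurable.mul h1.1.restrict)
    (Filter.Eventually.of_forall fun u => ?_)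
  rw [norm_mul, Complex.norm_real, Real.norm_eq_abs]
  exact mul_le_of_le_one_left (norm_nonneg _) (abs_chi_le _)

lemma hasSum_norm_sq_coef {L : ℝ} (hL : 0 < L) {f : (Fin d → ℝ) → ℂ} (hf : MemLp f 2)
    (m : Fin d → ℤ) : HasSum (fun ℓ => ‖coef L f (m, ℓ)‖ ^ 2)
      (L ^ d * ∫ ξ, chi (L • ξ - halfPt m) ^ 2 * ‖f ξ‖ ^ 2) := by
  have h := hasSum_norm_sq_cubeCoeff (memLp_cube hL (fun i => (m i : ℝ) / 2 - 1 / 2) m hf)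
  have h2 : ∀ ℓ, _ = coef L f (m, ℓ) := fun ℓ => cubeCoeff_eq_coef hL f (m, ℓ)
  simp only at h2
  simp_rw [h2] at h
  convert h using 1
  have := integral_scaled_cube hL m
    (fun u => ((‖(chi (u - halfPt m) : ℂ) * f (L⁻¹ • u)‖ ^ 2 : ℝ) : ℂ)) (by intro u hu; simp [hu])
  rw [integral_complex_ofReal, integral_complex_ofReal] at this
  have h3 : ∫ u in unitCube (fun i => (m i : ℝ) / 2 - 1 / 2),
      ‖(chi (u - halfPt m) : ℂ) * f (L⁻¹ • u)‖ ^ 2 =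
      L ^ d * ∫ ξ, ‖(chi (L • ξ - halfPt m) : ℂ) * f (L⁻¹ • L • ξ)‖ ^ 2 := by exact_mod_cast this
  rw [h3]
  congr 2; ext ξ
  rw [inv_smul_smul₀ hL.ne', norm_mul, mul_pow, Complex.norm_real, Real.norm_eq_abs, sq_abs]

/-- Reconstruction of the extension operator from wave packets with frequency index `m`. -/
lemma hasSum_coef_mul_exOp {L : ℝ} (hL : 0 < L) {f : (Fin d → ℝ) → ℂ} (hf : MemLp f 2)
    {Φ : (Fin d → ℝ) → Fin k → ℝ} (hΦ : Continuous Φ) (w : (Fin d → ℝ) × (Fin k → ℝ))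
    (m : Fin d → ℤ) : HasSum (fun ℓ => coef L f (m, ℓ) * exOp Φ (psi L (m, ℓ)) w)
      (∫ ξ, (chi (L • ξ - halfPt m) : ℂ) ^ 2 * (eC (phase Φ w ξ) * f ξ)) := by
  set a : Fin d → ℝ := fun i => (m i : ℝ) / 2 - 1 / 2 with ha
  set g : (Fin d → ℝ) → ℂ := fun u => (chi (u - halfPt m) : ℂ) * eC (-phase Φ w (L⁻¹ • u)) with hg
  have hphase : Continuous (phase Φ w) := by unfold phase; fun_prop
  have hchi : Continuous fun u : Fin d → ℝ => (chi (u - halfPt m) : ℂ) :=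
    Complex.continuous_ofReal.comp (continuous_chi.comp (by fun_prop))
  have hgc : Continuous g := hchi.mul (continuous_eC.comp (hphase.comp (by fun_prop)).neg)
  have hfin : IsFiniteMeasure (volume.restrict (unitCube a)) := by
    refine ⟨?_⟩
    rw [Measure.restrict_apply_univ]
    refine (measure_mono (t := Set.Icc a (a + 1)) fun x hx => ?_).trans_lt
      isCompact_Icc.measure_lt_top
    exact ⟨fun i => (hx i).1.le, fun i => (hx i).2⟩
  have hgm : MemLp g 2 (volume.restrict (unitCube a)) := by
    refine MemLp.of_bound hgc.aestronglyMeasurable 1 (Filter.Eventually.of_forall fun u => ?_)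
    rw [hg, norm_mul, norm_eC, mul_one, Complex.norm_real]
    exact abs_chi_le _
  have h := hasSum_conj_cubeCoeff_mul hgm (memLp_cube hL a m hf)
  have h2 : ∀ ℓ, _ = coef L f (m, ℓ) := fun ℓ => cubeCoeff_eq_coef hL f (m, ℓ)
  simp only at h2
  simp_rw [← ha] at h2
  have h3 : ∀ ℓ, (starRingEnd ℂ) (cubeCoeff a g ℓ) = (L : ℂ) ^ d * exOp Φ (psi L (m, ℓ)) w := by
    intro ℓ
    rw [cubeCoeff, integral_scaled_cube hL m _ (by intro u hu; simp [hg, hu]), map_mul,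
      ← integral_conj, map_pow, Complex.conj_ofReal, exOp]
    congr 2; ext ξ
    simp only [hg, map_mul, conj_eC, neg_neg, Complex.conj_ofReal, inv_smul_smul₀ hL.ne', psi,
      Pi.smul_apply, smul_eq_mul]
    ring
  simp_rw [h2, h3] at h
  have hLd : (L : ℂ) ^ d ≠ 0 := by exact_mod_cast (pow_pos hL d).ne'
  have h4 := h.mul_left ((L : ℂ) ^ d)⁻¹
  rw [integral_scaled_cube hL m _ (by intro u hu; simp [hg, hu])] at h4
  have e1 : ∀ ℓ, ((L : ℂ) ^ d)⁻¹ * ((L : ℂ) ^ d * exOp Φ (psi L (m, ℓ)) w * coef L f (m, ℓ)) =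
      coef L f (m, ℓ) * exOp Φ (psi L (m, ℓ)) w := fun ℓ => by field_simp
  simp_rw [e1] at h4
  rw [inv_mul_cancel_left₀ hLd] at h4
  have e2 : ∀ ξ, (starRingEnd ℂ) (g (L • ξ)) *
      ((chi (L • ξ - halfPt m) : ℂ) * f (L⁻¹ • L • ξ)) =
      (chi (L • ξ - halfPt m) : ℂ) ^ 2 * (eC (phase Φ w ξ) * f ξ) := fun ξ => by
    simp only [hg, map_mul, conj_eC, neg_neg, Complex.conj_ofReal, inv_smul_smul₀ hL.ne']
    ring
  simp_rw [e2] at h4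
  exact h4

end Frame

section FrameBounds
variable {d k : ℕ}

lemma sum_chi_sq_le_one (x : Fin d → ℝ) (s : Finset (Fin d → ℤ)) :
    ∑ m ∈ s, chi (x - halfPt m) ^ 2 ≤ 1 := by
  classical
  set s' : Finset (Fin d → ℤ) := s ∪
    Fintype.piFinset fun i => Finset.Icc ⌈2 * x i - 1⌉ ⌊2 * x i + 1⌋ with hs'
  rw [← sum_chi_sq_eq_one x s']
  · exact Finset.sum_le_sum_of_subset_of_nonneg Finset.subset_union_left
      fun _ _ _ => sq_nonneg _
  · intro m hm
    refine Finset.mem_union_right _ (Fintype.mem_piFinset.2 fun i => ?_)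
    have := abs_lt.1 (abs_lt_of_chi_ne_zero hm i)
    simp only [Pi.sub_apply, halfPt] at this
    rw [Finset.mem_Icc, Int.ceil_le, Int.le_floor]
    constructor <;> linarith

lemma sum_norm_sq_coef_le {L : ℝ} (hL : 0 < L) {f : (Fin d → ℝ) → ℂ} (hf : MemLp f 2)
    (S : Finset ((Fin d → ℤ) × (Fin d → ℤ))) :
    ∑ T ∈ S, ‖coef L f T‖ ^ 2 ≤ L ^ d * ∫ ξ, ‖f ξ‖ ^ 2 := by
  classical
  have hfi : Integrable fun ξ => ‖f ξ‖ ^ 2 := (memLp_two_iff_integrable_sq_norm hf.1).1 hf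
  have hi : ∀ m : Fin d → ℤ, Integrable fun ξ => chi (L • ξ - halfPt m) ^ 2 * ‖f ξ‖ ^ 2 := by
    intro m
    refine hfi.bdd_mul (c := 1) (Continuous.aestronglyMeasurable ?_) (Filter.Eventually.of_forall
      fun ξ => ?_)
    · exact (continuous_chi.comp (by fun_prop)).pow 2
    · rw [Real.norm_eq_abs, abs_pow]
      exact pow_le_one₀ (abs_nonneg _) (abs_chi_le _)
  calc ∑ T ∈ S, ‖coef L f T‖ ^ 2
      ≤ ∑ T ∈ S.image Prod.fst ×ˢ S.image Prod.snd, ‖coef L f T‖ ^ 2 :=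
        Finset.sum_le_sum_of_subset_of_nonneg Finset.subset_product fun _ _ _ => sq_nonneg _
    _ = ∑ m ∈ S.image Prod.fst, ∑ ℓ ∈ S.image Prod.snd, ‖coef L f (m, ℓ)‖ ^ 2 :=
        Finset.sum_product _ _ _
    _ ≤ ∑ m ∈ S.image Prod.fst, L ^ d * ∫ ξ, chi (L • ξ - halfPt m) ^ 2 * ‖f ξ‖ ^ 2 :=
        Finset.sum_le_sum fun m _ => sum_le_hasSum _ (fun _ _ => sq_nonneg _)
          (hasSum_norm_sq_coef hL hf m)
    _ = L ^ d * ∫ ξ, (∑ m ∈ S.image Prod.fst, chi (L • ξ - halfPt m) ^ 2) * ‖f ξ‖ ^ 2 := by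
        rw [← Finset.mul_sum, ← integral_finsetSum _ fun m _ => hi m]
        simp_rw [Finset.sum_mul]
    _ ≤ L ^ d * ∫ ξ, ‖f ξ‖ ^ 2 := by
        refine mul_le_mul_of_nonneg_left (integral_mono ?_ hfi fun ξ => ?_) (by positivity)
        · simp_rw [Finset.sum_mul]
          exact integrable_finsetSum _ fun m _ => hi m
        · exact mul_le_of_le_one_left (sq_nonneg _) (sum_chi_sq_le_one _ _)

/-- The superposition of finitely many wave packets. -/
def synth (L : ℝ) (S : Finset ((Fin d → ℤ) × (Fin d → ℤ)))
    (c : (Fin d → ℤ) × (Fin d → ℤ) → ℂ) (ξ : Fin d → ℝ) : ℂ := ∑ T ∈ S, c T * psi L T ξ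

lemma memLp_synth {L : ℝ} (hL : 0 < L) (S : Finset ((Fin d → ℤ) × (Fin d → ℤ)))
    (c : (Fin d → ℤ) × (Fin d → ℤ) → ℂ) (p : ℝ≥0∞) : MemLp (synth L S c) p := by
  unfold synth
  exact memLp_finsetSum _ fun T _ => (memLp_psi hL T p).const_mul _

lemma integral_norm_sq_synth_le {L : ℝ} (hL : 0 < L)
    (S : Finset ((Fin d → ℤ) × (Fin d → ℤ))) (c : (Fin d → ℤ) × (Fin d → ℤ) → ℂ) :
    L ^ d * ∫ ξ, ‖synth L S c ξ‖ ^ 2 ≤ ∑ T ∈ S, ‖c T‖ ^ 2 := by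
  set u := synth L S c with hu
  have hum : MemLp u 2 := memLp_synth hL S c 2
  have hI : ∀ T, Integrable fun ξ => (starRingEnd ℂ) (psi L T ξ) * u ξ := fun T =>
    MemLp.integrable_mul (p := 2) (q := 2) (memLp_psi hL T 2).star hum
  have h1 : ((L ^ d * ∫ ξ, ‖u ξ‖ ^ 2 : ℝ) : ℂ) =
      ∑ T ∈ S, (starRingEnd ℂ) (c T) * coef L u T := by
    have e : ∀ ξ, ((‖u ξ‖ ^ 2 : ℝ) : ℂ) =
        ∑ T ∈ S, (starRingEnd ℂ) (c T) * ((starRingEnd ℂ) (psi L T ξ) * u ξ) := by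
      intro ξ
      push_cast
      rw [← Complex.conj_mul']
      nth_rw 1 [hu]
      rw [synth, map_sum, Finset.sum_mul]
      refine Finset.sum_congr rfl fun T _ => ?_
      rw [map_mul, mul_assoc]
    push_cast
    rw [← integral_complex_ofReal]
    simp_rw [e]
    rw [integral_finsetSum _ fun T _ => (hI T).const_mul _, Finset.mul_sum]
    refine Finset.sum_congr rfl fun T _ => ?_
    rw [integral_const_mul, coef]; ring
  have hnn : 0 ≤ L ^ d * ∫ ξ, ‖u ξ‖ ^ 2 :=
    mul_nonneg (by positivity) (integral_nonneg fun _ => sq_nonneg _)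
  set E := L ^ d * ∫ ξ, ‖u ξ‖ ^ 2 with hE
  have h2 : E ≤ ∑ T ∈ S, ‖c T‖ * ‖coef L u T‖ := by
    have : ‖(E : ℂ)‖ = E := by rw [Complex.norm_real, Real.norm_of_nonneg hnn]
    rw [← this, h1]
    refine (norm_sum_le _ _).trans (le_of_eq (Finset.sum_congr rfl fun T _ => ?_))
    rw [norm_mul, RCLike.norm_conj]
  have h3 := Finset.sum_mul_sq_le_sq_mul_sq S (fun T => ‖c T‖) (fun T => ‖coef L u T‖)
  have h4 : ∑ T ∈ S, ‖coef L u T‖ ^ 2 ≤ E := sum_norm_sq_coef_le hL hum S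
  have h5 : 0 ≤ ∑ T ∈ S, ‖c T‖ ^ 2 := Finset.sum_nonneg fun _ _ => sq_nonneg _
  rcases hnn.eq_or_lt with h0 | h0
  · rw [← h0]; exact h5
  · have : E ^ 2 ≤ (∑ T ∈ S, ‖c T‖ ^ 2) * E :=
      (pow_le_pow_left₀ hnn h2 2).trans (h3.trans (mul_le_mul_of_nonneg_left h4 h5))
    rw [sq] at this
    exact le_of_mul_le_mul_right this h0

/-- The indices of the frequency caps meeting the closed ball `B(ν, ρ)`. -/
def freqSet (L : ℝ) (ν : Fin d → ℝ) (ρ : ℝ) : Finset (Fin d → ℤ) :=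
  Fintype.piFinset fun i => Finset.Icc ⌈2 * L * (ν i - ρ) - 1⌉ ⌊2 * L * (ν i + ρ) + 1⌋

lemma mem_freqSet {L : ℝ} (hL : 0 < L) {ν : Fin d → ℝ} {ρ : ℝ} {m : Fin d → ℤ}
    (hρ : 0 ≤ ρ) : m ∈ freqSet L ν ρ ↔ ‖capPt L m - ν‖ ≤ ρ + 1 / (2 * L) := by
  rw [freqSet, Fintype.mem_piFinset, pi_norm_le_iff_of_nonneg (by positivity)]
  refine forall_congr' fun i => ?_
  simp only [capPt, halfPt, Pi.sub_apply, Pi.smul_apply, smul_eq_mul, Real.norm_eq_abs]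
  rw [Finset.mem_Icc, Int.ceil_le, Int.le_floor, abs_le]
  have e : L⁻¹ * ((m i : ℝ) / 2) = (m i : ℝ) / (2 * L) := by field_simp
  have h2 : 0 < 2 * L := by positivity
  rw [e]
  constructor
  · rintro ⟨h3, h4⟩
    constructor
    · have : (2 * L * (ν i - ρ) - 1) / (2 * L) ≤ m i / (2 * L) := by gcongr
      have e2 : (2 * L * (ν i - ρ) - 1) / (2 * L) = ν i - ρ - 1 / (2 * L) := by field_simp
      linarith
    · have : m i / (2 * L) ≤ (2 * L * (ν i + ρ) + 1) / (2 * L) := by gcongr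
      have e2 : (2 * L * (ν i + ρ) + 1) / (2 * L) = ν i + ρ + 1 / (2 * L) := by field_simp
      linarith
  · rintro ⟨h3, h4⟩
    have e3 : (m i : ℝ) = 2 * L * (m i / (2 * L)) := by field_simp
    have e4 : 2 * L * (1 / (2 * L)) = 1 := by field_simp
    constructor
    · have := mul_le_mul_of_nonneg_left h3 h2.le
      nlinarith
    · have := mul_le_mul_of_nonneg_left h4 h2.le
      nlinarith

lemma card_freqSet_le {L : ℝ} (hL : 1 ≤ L) (ν : Fin d → ℝ) {ρ : ℝ}
    (hρ1 : ρ ≤ 1) : ((freqSet L ν ρ).card : ℝ) ≤ (7 * L) ^ d := by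
  rw [freqSet, Fintype.card_piFinset]
  push_cast
  calc ∏ i, ((Finset.Icc ⌈2 * L * (ν i - ρ) - 1⌉ ⌊2 * L * (ν i + ρ) + 1⌋).card : ℝ)
      ≤ ∏ _i : Fin d, (7 * L) := by
        refine Finset.prod_le_prod (fun _ _ => by positivity) fun i _ => ?_
        rw [Int.card_Icc]
        have h1 := Int.le_ceil (2 * L * (ν i - ρ) - 1)
        have h2 := Int.floor_le (2 * L * (ν i + ρ) + 1)
        have h3 : (((⌊2 * L * (ν i + ρ) + 1⌋ + 1 - ⌈2 * L * (ν i - ρ) - 1⌉).toNat : ℤ) : ℝ) =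
            max ((⌊2 * L * (ν i + ρ) + 1⌋ : ℝ) + 1 - ⌈2 * L * (ν i - ρ) - 1⌉) 0 := by
          rw [Int.toNat_eq_max]; push_cast; rfl
        rw [Int.cast_natCast] at h3
        rw [h3]
        refine max_le ?_ (by positivity)
        nlinarith
    _ = (7 * L) ^ d := by simp

lemma sum_freqSet_chi_sq {L : ℝ} (hL : 0 < L) {ν : Fin d → ℝ} {ρ : ℝ} (hρ : 0 ≤ ρ)
    {ξ : Fin d → ℝ} (hξ : ‖ξ - ν‖ ≤ ρ) :
    ∑ m ∈ freqSet L ν ρ, chi (L • ξ - halfPt m) ^ 2 = 1 := by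
  refine sum_chi_sq_eq_one _ _ fun m hm => (mem_freqSet hL hρ).2 ?_
  have := norm_sub_capPt_le hL hm
  rw [norm_sub_rev] at this
  calc ‖capPt L m - ν‖ = ‖(capPt L m - ξ) + (ξ - ν)‖ := by congr 1; abel
    _ ≤ _ := (norm_add_le _ _).trans (by linarith)

lemma indicator_closedBall_eq {f : (Fin d → ℝ) → ℂ} {ν : Fin d → ℝ} {ρ : ℝ}
    (hfs : ∀ ξ, f ξ ≠ 0 → ‖ξ - ν‖ ≤ ρ) : (Metric.closedBall ν ρ).indicator f = f :=
  Set.indicator_eq_self.2 fun ξ hξ => mem_closedBall_iff_norm.2 (hfs ξ hξ)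

lemma integrable_of_ball_support {f : (Fin d → ℝ) → ℂ} (hf : MemLp f 2) {ν : Fin d → ℝ} {ρ : ℝ}
    (hfs : ∀ ξ, f ξ ≠ 0 → ‖ξ - ν‖ ≤ ρ) : Integrable f := by
  have : IsFiniteMeasure (volume.restrict (Metric.closedBall ν ρ)) :=
    ⟨by rw [Measure.restrict_apply_univ]; exact measure_closedBall_lt_top⟩
  rw [← indicator_closedBall_eq hfs, integrable_indicator_iff measurableSet_closedBall]
  exact (hf.restrict (Metric.closedBall ν ρ)).integrable one_le_two

lemma integral_norm_sq_le_of_ball_support {f : (Fin d → ℝ) → ℂ} (hf : MemLp f 2)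
    {ν : Fin d → ℝ} {ρ : ℝ} (hρ : 0 ≤ ρ) (hfs : ∀ ξ, f ξ ≠ 0 → ‖ξ - ν‖ ≤ ρ) :
    (∫ ξ, ‖f ξ‖) ^ 2 ≤ (2 * ρ) ^ d * ∫ ξ, ‖f ξ‖ ^ 2 := by
  set B := Metric.closedBall ν ρ
  have : IsFiniteMeasure (volume.restrict B) :=
    ⟨by rw [Measure.restrict_apply_univ]; exact measure_closedBall_lt_top⟩
  have e1 : ∫ ξ, ‖f ξ‖ = ∫ ξ in B, 1 * ‖f ξ‖ := by
    rw [← integral_indicator measurableSet_closedBall]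
    congr 1; ext ξ
    by_cases h : ξ ∈ B
    · rw [Set.indicator_of_mem h, one_mul]
    · rw [Set.indicator_of_notMem h, norm_eq_zero]
      by_contra h1
      exact h (mem_closedBall_iff_norm.2 (hfs ξ h1))
  have h2 := integral_mul_le_Lp_mul_Lq_of_nonneg (μ := volume.restrict B) (p := 2) (q := 2)
    (f := fun _ => (1 : ℝ)) (g := fun ξ => ‖f ξ‖) Real.HolderConjugate.two_two
    (Filter.Eventually.of_forall fun _ => zero_le_one)
    (Filter.Eventually.of_forall fun _ => norm_nonneg _)
    (memLp_const 1) (by simpa using (hf.restrict B).norm)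
  have hfi : Integrable fun ξ => ‖f ξ‖ ^ 2 := (memLp_two_iff_integrable_sq_norm hf.1).1 hf
  have e3 : ∫ _ξ in B, ((1 : ℝ) ^ (2 : ℝ)) = (2 * ρ) ^ d := by
    simp only [Real.one_rpow, integral_const, smul_eq_mul, mul_one, Measure.real,
      Measure.restrict_apply_univ]
    rw [Real.volume_pi_closedBall _ hρ, ENNReal.toReal_ofReal (by positivity)]
    simp
  rw [e1]
  have h4 : ∫ ξ in B, ‖f ξ‖ ^ (2 : ℝ) ≤ ∫ ξ, ‖f ξ‖ ^ 2 := by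
    simp_rw [Real.rpow_two]
    exact setIntegral_le_integral hfi (Filter.Eventually.of_forall fun _ => sq_nonneg _)
  have h5 : 0 ≤ ∫ ξ in B, ‖f ξ‖ ^ (2 : ℝ) := integral_nonneg fun _ => by positivity
  have h6 : 0 ≤ ∫ ξ in B, 1 * ‖f ξ‖ := integral_nonneg fun _ => by positivity
  rw [e3] at h2
  calc _ ≤ _ := pow_le_pow_left₀ h6 h2 2
    _ = (2 * ρ) ^ d * ∫ ξ in B, ‖f ξ‖ ^ (2 : ℝ) := by
        rw [mul_pow, ← Real.sqrt_eq_rpow, ← Real.sqrt_eq_rpow, Real.sq_sqrt (by positivity),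
          Real.sq_sqrt h5]
    _ ≤ _ := mul_le_mul_of_nonneg_left h4 (by positivity)

lemma hasSum_exOp {L : ℝ} (hL : 0 < L) {f : (Fin d → ℝ) → ℂ} (hf : MemLp f 2)
    {ν : Fin d → ℝ} {ρ : ℝ} (hρ : 0 ≤ ρ) (hfs : ∀ ξ, f ξ ≠ 0 → ‖ξ - ν‖ ≤ ρ)
    {Φ : (Fin d → ℝ) → Fin k → ℝ} (hΦ : Continuous Φ) (w : (Fin d → ℝ) × (Fin k → ℝ)) :
    HasSum (fun ℓ => ∑ m ∈ freqSet L ν ρ, coef L f (m, ℓ) * exOp Φ (psi L (m, ℓ)) w)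
      (exOp Φ f w) := by
  have h := hasSum_sum (s := freqSet L ν ρ) fun m _ => hasSum_coef_mul_exOp hL hf hΦ w m
  have hphase : Continuous (phase Φ w) := by unfold phase; fun_prop
  have hfi : Integrable f := integrable_of_ball_support hf hfs
  have hi : ∀ m : Fin d → ℤ, Integrable fun ξ =>
      (chi (L • ξ - halfPt m) : ℂ) ^ 2 * (eC (phase Φ w ξ) * f ξ) := by
    intro m
    have h1 : Integrable fun ξ => eC (phase Φ w ξ) * f ξ := by
      refine hfi.bdd_mul (c := 1) (continuous_eC.comp hphase).aestronglyMeasurable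
        (Filter.Eventually.of_forall fun ξ => (norm_eC _).le)
    refine h1.bdd_mul (c := 1) (Continuous.aestronglyMeasurable ?_) (Filter.Eventually.of_forall
      fun ξ => ?_)
    · exact (Complex.continuous_ofReal.comp (continuous_chi.comp (by fun_prop))).pow 2
    · rw [norm_pow, Complex.norm_real]
      exact pow_le_one₀ (norm_nonneg _) (abs_chi_le _)
  rw [← integral_finsetSum _ fun m _ => hi m] at h
  have e : ∀ ξ, ∑ m ∈ freqSet L ν ρ, (chi (L • ξ - halfPt m) : ℂ) ^ 2 * (eC (phase Φ w ξ) * f ξ)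
      = eC (phase Φ w ξ) * f ξ := by
    intro ξ
    by_cases h0 : f ξ = 0
    · simp [h0]
    · rw [← Finset.sum_mul]
      have := sum_freqSet_chi_sq hL hρ (hfs ξ h0)
      have h2 : (∑ m ∈ freqSet L ν ρ, (chi (L • ξ - halfPt m) : ℂ) ^ 2) = 1 := by
        exact_mod_cast this
      rw [h2, one_mul]
  simp_rw [e] at h
  exact h

end FrameBounds

lemma hasDerivAt_eC (x : ℝ) : HasDerivAt eC (2 * Real.pi * Complex.I * eC x) x := by
  unfold eC
  have h1 : HasDerivAt (fun x : ℝ => 2 * Real.pi * Complex.I * (x : ℂ))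
      (2 * Real.pi * Complex.I * 1) x := Complex.ofRealCLM.hasDerivAt.const_mul _
  convert h1.cexp using 1
  ring

lemma norm_iteratedFDeriv_eC (n : ℕ) (x : ℝ) :
    ‖iteratedFDeriv ℝ n eC x‖ = (2 * Real.pi) ^ n := by
  have h : ∀ n, iteratedDeriv n eC = fun x => (2 * Real.pi * Complex.I) ^ n * eC x := by
    intro n
    induction n with
    | zero => ext x; simp
    | succ n ih =>
      rw [iteratedDeriv_succ, ih]
      ext x
      rw [((hasDerivAt_eC x).const_mul _).deriv, pow_succ]; ring
  rw [norm_iteratedFDeriv_eq_norm_iteratedDeriv, h]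
  simp [norm_eC, abs_of_pos Real.pi_pos]

section Tail
variable {d k : ℕ}

/-- Derivatives of the amplitude `χ(v) e(Θ(v))` are controlled by those of `Θ`. -/
lemma exists_iteratedFDeriv_amplitude_le (d N : ℕ) (M : ℝ) : ∃ C : ℝ, 0 < C ∧
    ∀ Θ : (Fin d → ℝ) → ℝ, ContDiff ℝ (⊤ : ℕ∞) Θ → ∀ v ∈ Metric.closedBall (0 : Fin d → ℝ) 1,
    (∀ j, 1 ≤ j → j ≤ N → ‖iteratedFDeriv ℝ j Θ v‖ ≤ M) →
    ‖iteratedFDeriv ℝ N (fun u => (chi u : ℂ) * eC (Θ u)) v‖ ≤ C := by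
  have hchi : ContDiff ℝ (⊤ : ℕ∞) (fun u : Fin d → ℝ => (chi u : ℂ)) :=
    Complex.ofRealCLM.contDiff.comp contDiff_chi
  have h1 : ∀ i, ∃ B, ∀ v ∈ Metric.closedBall (0 : Fin d → ℝ) 1,
      ‖iteratedFDeriv ℝ i (fun u : Fin d → ℝ => (chi u : ℂ)) v‖ ≤ B := fun i =>
    (isCompact_closedBall _ _).exists_bound_of_continuousOn
      (hchi.continuous_iteratedFDeriv (m := i) (by exact_mod_cast le_top)).continuousOn
  choose B hB using h1
  set M' := max M 1
  have hpi : 0 < Real.pi := Real.pi_pos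
  set A : ℕ → ℝ := fun j => (Nat.factorial j) * (2 * Real.pi + 1) ^ j * M' ^ j with hA
  have hA0 : ∀ j, 0 ≤ A j := fun j => by positivity
  refine ⟨∑ i ∈ Finset.range (N + 1), (N.choose i : ℝ) * |B i| * A (N - i) + 1,
    by positivity, fun Θ hΘ v hv hM => ?_⟩
  have heC : ContDiff ℝ (⊤ : ℕ∞) (fun u => eC (Θ u)) := contDiff_eC.comp hΘ
  refine (norm_iteratedFDeriv_mul_le hchi heC v (by exact_mod_cast le_top)).trans ?_
  refine le_trans (Finset.sum_le_sum fun i hi => ?_) (le_add_of_nonneg_right zero_le_one)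
  have h2 : ‖iteratedFDeriv ℝ (N - i) (fun u => eC (Θ u)) v‖ ≤ A (N - i) := by
    refine norm_iteratedFDeriv_comp_le (contDiff_eC (n := (⊤ : ℕ∞))) hΘ
      (WithTop.coe_le_coe.2 le_top) v (fun j hj => ?_) (fun j hj hj2 => ?_)
    · rw [norm_iteratedFDeriv_eC]
      calc (2 * Real.pi) ^ j ≤ (2 * Real.pi + 1) ^ j := by gcongr; linarith
        _ ≤ _ := pow_le_pow_right₀ (by linarith) hj
    · refine (hM j hj (hj2.trans (Nat.sub_le _ _))).trans ((le_max_left M 1).trans ?_)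
      exact le_self_pow₀ (le_max_right M 1) (by omega)
  gcongr
  exact (hB i v hv).trans (le_abs_self _)

/-- The second order Taylor remainder of `φ` at `ξ`, at scale `h`. -/
def taylorRem (φ : (Fin d → ℝ) → ℝ) (ξ : Fin d → ℝ) (h : ℝ) (v : Fin d → ℝ) : ℝ :=
  φ (ξ + h • v) - φ ξ - h * fderiv ℝ φ ξ v

lemma contDiff_taylorRem {φ : (Fin d → ℝ) → ℝ} (hφ : ContDiff ℝ (⊤ : ℕ∞) φ) (ξ : Fin d → ℝ)
    (h : ℝ) : ContDiff ℝ (⊤ : ℕ∞) (taylorRem φ ξ h) := by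
  unfold taylorRem
  refine ContDiff.sub (ContDiff.sub (hφ.comp ?_) contDiff_const) ?_
  · fun_prop
  · exact contDiff_const.mul (fderiv ℝ φ ξ).contDiff

lemma fderiv_taylorRem {φ : (Fin d → ℝ) → ℝ} (hφ : ContDiff ℝ (⊤ : ℕ∞) φ) (ξ : Fin d → ℝ)
    (h : ℝ) : fderiv ℝ (taylorRem φ ξ h) =
      fun v => h • fderiv ℝ φ (ξ + h • v) - h • fderiv ℝ φ ξ := by
  ext1 v
  have h1 : HasFDerivAt φ (fderiv ℝ φ (ξ + h • v)) (ξ + h • v) :=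
    (hφ.differentiable (by simp) _).hasFDerivAt
  have h2 : HasFDerivAt (fun v : Fin d → ℝ => ξ + h • v) (h • ContinuousLinearMap.id ℝ _) v :=
    ((hasFDerivAt_id v).const_smul h).const_add ξ
  have h3 := ((h1.comp v h2).sub_const (φ ξ)).sub
      (((fderiv ℝ φ ξ).hasFDerivAt (x := v)).const_mul h)
  have h4 : taylorRem φ ξ h = fun v => (φ ∘ fun v => ξ + h • v) v - φ ξ - h * fderiv ℝ φ ξ v := rfl
  rw [h4]; refine h3.fderiv.trans ?_
  ext u
  simp

lemma norm_iteratedFDeriv_taylorRem_le {φ : (Fin d → ℝ) → ℝ} (hφ : ContDiff ℝ (⊤ : ℕ∞) φ)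
    {R M h : ℝ} {N : ℕ} {ξ : Fin d → ℝ} (hξ : ‖ξ‖ ≤ R) (h0 : 0 ≤ h) (h1 : h ≤ 1) (hN : 2 ≤ N)
    (hM : ∀ j ≤ N, ∀ x ∈ Metric.closedBall (0 : Fin d → ℝ) (R + 1), ‖iteratedFDeriv ℝ j φ x‖ ≤ M)
    {j : ℕ} (hj : 1 ≤ j) (hjN : j ≤ N) {v : Fin d → ℝ}
    (hv : v ∈ Metric.closedBall (0 : Fin d → ℝ) 1) :
    ‖iteratedFDeriv ℝ j (taylorRem φ ξ h) v‖ ≤ h ^ 2 * M := by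
  rw [mem_closedBall_zero_iff] at hv
  have hmem : ξ + h • v ∈ Metric.closedBall (0 : Fin d → ℝ) (R + 1) := by
    rw [mem_closedBall_zero_iff]
    refine (norm_add_le _ _).trans (add_le_add hξ ?_)
    rw [norm_smul, Real.norm_of_nonneg h0]
    nlinarith [norm_nonneg v]
  have hM0 : 0 ≤ M := (norm_nonneg _).trans (hM 0 (by omega) _ hmem)
  obtain ⟨j, rfl⟩ := Nat.exists_eq_add_of_le' hj
  rw [← norm_iteratedFDeriv_fderiv, fderiv_taylorRem hφ]
  have hdφ : ContDiff ℝ (⊤ : ℕ∞) (fderiv ℝ φ) := hφ.fderiv_right (by simp)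
  rcases Nat.eq_zero_or_pos j with rfl | hj0
  · have e0 : h • fderiv ℝ φ (ξ + h • v) - h • fderiv ℝ φ ξ =
        h • (fderiv ℝ φ (ξ + h • v) - fderiv ℝ φ ξ) := by ext; simp; ring
    rw [norm_iteratedFDeriv_zero, e0, norm_smul, Real.norm_of_nonneg h0]
    have hξm : ξ ∈ Metric.closedBall (0 : Fin d → ℝ) (R + 1) := by
      rw [mem_closedBall_zero_iff]; linarith
    have := (convex_closedBall (0 : Fin d → ℝ) (R + 1)).norm_image_sub_le_of_norm_fderiv_le
      (f := fderiv ℝ φ) (𝕜 := ℝ) (C := M)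
      (fun x _ => hdφ.differentiable (by simp) x) (fun x hx => ?_) hξm hmem
    · have e : ‖ξ + h • v - ξ‖ ≤ h := by
        rw [add_sub_cancel_left, norm_smul, Real.norm_of_nonneg h0]
        nlinarith [norm_nonneg v]
      calc _ ≤ h * (M * h) := by gcongr; exact this.trans (by gcongr)
        _ = h ^ 2 * M := by ring
    · have := hM 2 hN x hx
      rw [← norm_iteratedFDeriv_fderiv, ← norm_iteratedFDeriv_fderiv,
        norm_iteratedFDeriv_zero] at this
      exact this
  · obtain ⟨i, rfl⟩ := Nat.exists_eq_add_of_le' hj0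
    rw [← norm_iteratedFDeriv_fderiv, show (fderiv ℝ fun v => h • fderiv ℝ φ (ξ + h • v) -
      h • fderiv ℝ φ ξ) = fderiv ℝ fun v => h • fderiv ℝ φ (ξ + h • v) from
      funext fun _ => fderiv_sub_const _, norm_iteratedFDeriv_fderiv]
    have hc : ContDiff ℝ (⊤ : ℕ∞) fun v => fderiv ℝ φ (ξ + v) :=
      hdφ.comp (contDiff_const.add contDiff_id)
    have e1 : (fun v => h • fderiv ℝ φ (ξ + h • v)) =
        h • ((fun v => fderiv ℝ φ (ξ + v)) ∘ (h • ContinuousLinearMap.id ℝ (Fin d → ℝ))) := by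
      ext1 v; rfl
    rw [e1, iteratedFDeriv_const_smul_apply, ContinuousLinearMap.iteratedFDeriv_comp_right _ hc _
      (by exact_mod_cast le_top), norm_smul, Real.norm_of_nonneg h0]
    · have h5 := ContinuousMultilinearMap.norm_compContinuousLinearMap_le
        (iteratedFDeriv ℝ (i + 1) (fun v => fderiv ℝ φ (ξ + v))
          ((h • ContinuousLinearMap.id ℝ (Fin d → ℝ)) v))
        (fun _ => h • ContinuousLinearMap.id ℝ (Fin d → ℝ))
      have h6 : ‖iteratedFDeriv ℝ (i + 1) (fun v => fderiv ℝ φ (ξ + v))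
          ((h • ContinuousLinearMap.id ℝ (Fin d → ℝ)) v)‖ ≤ M := by
        rw [iteratedFDeriv_comp_add_left, norm_iteratedFDeriv_fderiv]
        exact hM _ (by omega) _ hmem
      have h7 : ‖h • ContinuousLinearMap.id ℝ (Fin d → ℝ)‖ ≤ h := by
        rw [norm_smul, Real.norm_of_nonneg h0]
        exact mul_le_of_le_one_right h0 ContinuousLinearMap.norm_id_le
      rw [Finset.prod_const, Finset.card_univ, Fintype.card_fin] at h5
      have h8 : ‖h • ContinuousLinearMap.id ℝ (Fin d → ℝ)‖ ^ (i + 1) ≤ h := by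
        calc _ ≤ h ^ (i + 1) := pow_le_pow_left₀ (norm_nonneg _) h7 _
          _ ≤ h := pow_le_of_le_one h0 h1 (by omega)
      calc _ ≤ h * (M * h) := by gcongr; exact h5.trans (by gcongr)
        _ = h ^ 2 * M := by ring
    · exact (hc.comp (ContinuousLinearMap.contDiff _)).contDiffAt.of_le (by exact_mod_cast le_top)

end Tail

section Decay
variable {d k : ℕ}

/-- The (inverse) Fourier transform in the conventions of this file. -/
def fourInt (H : (Fin d → ℝ) → ℂ) (y : Fin d → ℝ) : ℂ := ∫ v, eC (∑ i, y i * v i) * H v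

/-- The `n`-th derivative in the `i`-th coordinate direction. -/
def dirDeriv (i : Fin d) (n : ℕ) (H : (Fin d → ℝ) → ℂ) (v : Fin d → ℝ) : ℂ :=
  iteratedFDeriv ℝ n H v fun _ => Pi.single i 1

lemma norm_dirDeriv_le (i : Fin d) (n : ℕ) (H : (Fin d → ℝ) → ℂ) (v : Fin d → ℝ) :
    ‖dirDeriv i n H v‖ ≤ ‖iteratedFDeriv ℝ n H v‖ := by
  refine (ContinuousMultilinearMap.le_opNorm _ _).trans (le_of_eq ?_)
  simp [Pi.norm_single]

lemma contDiff_dirDeriv {H : (Fin d → ℝ) → ℂ} (hH : ContDiff ℝ (⊤ : ℕ∞) H) (i : Fin d) (n : ℕ) :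
    ContDiff ℝ (⊤ : ℕ∞) (dirDeriv i n H) := by
  have h1 : ContDiff ℝ (⊤ : ℕ∞) (iteratedFDeriv ℝ n H) :=
    hH.iteratedFDeriv_right (by exact_mod_cast le_top)
  exact (ContinuousMultilinearMap.apply ℝ (fun _ : Fin n => Fin d → ℝ) ℂ
    (fun _ => Pi.single i 1)).contDiff.comp h1

lemma fderiv_dirDeriv {H : (Fin d → ℝ) → ℂ} (hH : ContDiff ℝ (⊤ : ℕ∞) H) (i : Fin d) (n : ℕ)
    (v : Fin d → ℝ) : fderiv ℝ (dirDeriv i n H) v (Pi.single i 1) = dirDeriv i (n + 1) H v := by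
  have h1 : ContDiff ℝ (⊤ : ℕ∞) (iteratedFDeriv ℝ n H) :=
    hH.iteratedFDeriv_right (by exact_mod_cast le_top)
  have h2 := (h1.differentiable (by simp) v).hasFDerivAt
  have h3 := (ContinuousMultilinearMap.apply ℝ (fun _ : Fin n => Fin d → ℝ) ℂ
    (fun _ => Pi.single i 1)).hasFDerivAt.comp v h2
  have h4 : fderiv ℝ (dirDeriv i n H) v = _ := h3.fderiv
  rw [h4, dirDeriv, iteratedFDeriv_succ_apply_left]
  rfl

lemma hasCompactSupport_dirDeriv {H : (Fin d → ℝ) → ℂ} (hH : HasCompactSupport H) (i : Fin d)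
    (n : ℕ) : HasCompactSupport (dirDeriv i n H) :=
  (hH.iteratedFDeriv (𝕜 := ℝ) n).mono' fun v hv => subset_closure fun h0 => hv (by
    simp [dirDeriv, h0])

lemma differentiable_eC_sum (y : Fin d → ℝ) :
    Differentiable ℝ fun v : Fin d → ℝ => eC (∑ i, y i * v i) :=
  (contDiff_eC.differentiable (n := 1) (by simp)).comp (by fun_prop)

lemma fderiv_eC_sum (y v : Fin d → ℝ) (i : Fin d) :
    fderiv ℝ (fun v : Fin d → ℝ => eC (∑ i, y i * v i)) v (Pi.single i 1) =
      2 * Real.pi * Complex.I * y i * eC (∑ i, y i * v i) := by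
  have h1 : HasFDerivAt (fun v : Fin d → ℝ => ∑ i, y i * v i)
      (∑ i, y i • ContinuousLinearMap.proj (R := ℝ) (φ := fun _ : Fin d => ℝ) i) v := by
    refine HasFDerivAt.fun_sum fun i _ => ?_
    exact (ContinuousLinearMap.proj (R := ℝ) (φ := fun _ : Fin d => ℝ) i).hasFDerivAt.const_mul _
  have h2 := (hasDerivAt_eC (∑ i, y i * v i)).hasFDerivAt.comp v h1
  have h3 : fderiv ℝ (fun v : Fin d → ℝ => eC (∑ i, y i * v i)) v = _ := h2.fderiv
  rw [h3]
  have e : (∑ j, y j * (Pi.single i (1 : ℝ) : Fin d → ℝ) j) = y i := by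
    simp [Pi.single_apply]
  simp only [ContinuousLinearMap.comp_apply, _root_.sum_apply,
    _root_.smul_apply, ContinuousLinearMap.proj_apply, smul_eq_mul, e,
    ContinuousLinearMap.toSpanSingleton_apply, Complex.real_smul]
  ring

lemma fourInt_dirDeriv_succ {H : (Fin d → ℝ) → ℂ} (hH : ContDiff ℝ (⊤ : ℕ∞) H)
    (hc : HasCompactSupport H) (i : Fin d) (n : ℕ) (y : Fin d → ℝ) :
    fourInt (dirDeriv i (n + 1) H) y =
      -(2 * Real.pi * Complex.I * y i) * fourInt (dirDeriv i n H) y := by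
  have hcont : Continuous fun v : Fin d → ℝ => eC (∑ i, y i * v i) :=
    (differentiable_eC_sum y).continuous
  have hI : ∀ n, Integrable fun v => eC (∑ i, y i * v i) * dirDeriv i n H v := fun n =>
    (hcont.mul (contDiff_dirDeriv hH i n).continuous).integrable_of_hasCompactSupport
      (hasCompactSupport_dirDeriv hc i n).mul_left
  have h := integral_mul_fderiv_eq_neg_fderiv_mul_of_integrable (μ := volume)
    (f := fun v : Fin d → ℝ => eC (∑ i, y i * v i)) (g := dirDeriv i n H) (v := Pi.single i 1)
    ?_ ?_ (hI n) (fun x _ => differentiable_eC_sum y x)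
    (fun x _ => (contDiff_dirDeriv hH i n).differentiable (by simp) x)
  · simp_rw [fderiv_dirDeriv hH, fderiv_eC_sum] at h
    rw [fourInt, h, fourInt, ← integral_const_mul, ← integral_neg]
    congr 1; ext v; ring
  · simp_rw [fderiv_eC_sum]
    simpa only [mul_assoc] using (hI n).const_mul (2 * Real.pi * Complex.I * y i)
  · simp_rw [fderiv_dirDeriv hH]; exact hI (n + 1)

lemma pow_mul_norm_fourInt_le {H : (Fin d → ℝ) → ℂ} (hH : ContDiff ℝ (⊤ : ℕ∞) H)
    (hc : HasCompactSupport H) (i : Fin d) (n : ℕ) (y : Fin d → ℝ) :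
    |y i| ^ n * ‖fourInt H y‖ ≤ ‖fourInt (dirDeriv i n H) y‖ := by
  induction n with
  | zero =>
    have : dirDeriv i 0 H = H := by ext v; simp [dirDeriv]
    rw [this]; simp
  | succ n ih =>
    rw [fourInt_dirDeriv_succ hH hc, norm_mul, pow_succ']
    have e : ‖-(2 * Real.pi * Complex.I * (y i : ℂ))‖ = 2 * Real.pi * |y i| := by
      simp [abs_of_pos Real.pi_pos]
    rw [e, mul_assoc]
    have h1 : |y i| ≤ 2 * Real.pi * |y i| := by
      have := Real.pi_gt_three
      nlinarith [abs_nonneg (y i)]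
    exact mul_le_mul h1 ih (by positivity) (by positivity)

lemma sum_norm_sq_fourInt_le {H : (Fin d → ℝ) → ℂ} (hH : Continuous H) {C : ℝ}
    (hs : ∀ v, 1 / 2 < ‖v‖ → H v = 0) (hC : ∀ v, ‖H v‖ ≤ C) (z : Fin d → ℝ)
    (S : Finset (Fin d → ℤ)) :
    ∑ ℓ ∈ S, ‖fourInt H (fun i => z i + ℓ i)‖ ^ 2 ≤ C ^ 2 := by
  set a : Fin d → ℝ := fun _ => -1 / 2 with ha
  have hvol : volume (unitCube a) = 1 := by
    have : unitCube a = Set.univ.pi fun i => Set.Ioc (a i) (a i + 1) := by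
      ext x; simp only [unitCube, Set.mem_univ_pi]; rfl
    rw [this, Real.volume_pi_Ioc]
    simp
  have hsub : ∀ v, v ∉ unitCube a → H v = 0 := by
    have ho : IsOpen {v | H v ≠ 0} := isOpen_ne_fun hH continuous_const
    have h1 : {v | H v ≠ 0} ⊆ Metric.closedBall 0 (1 / 2) := fun v hv => by
      rw [mem_closedBall_zero_iff]
      by_contra h2
      exact hv (hs v (not_le.1 h2))
    have h2 := interior_maximal h1 ho
    rw [interior_closedBall _ (by norm_num)] at h2
    intro v hv
    by_contra h3
    have h4 := mem_ball_zero_iff.1 (h2 h3)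
    refine hv fun i => ?_
    have h5 := abs_lt.1 ((norm_le_pi_norm v i).trans_lt h4)
    constructor <;> simp only [ha] <;> linarith
  set F : (Fin d → ℝ) → ℂ := fun v => (starRingEnd ℂ) (eC (∑ i, z i * v i) * H v) with hF
  have hFc : Continuous F :=
    Complex.continuous_conj.comp ((differentiable_eC_sum z).continuous.mul hH)
  have hFn : ∀ v, ‖F v‖ = ‖H v‖ := fun v => by
    rw [hF, RCLike.norm_conj, norm_mul, norm_eC, one_mul]
  have : IsFiniteMeasure (volume.restrict (unitCube a)) :=
    ⟨by rw [Measure.restrict_apply_univ, hvol]; exact one_lt_top⟩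
  have hFm : MemLp F 2 (volume.restrict (unitCube a)) :=
    MemLp.of_bound hFc.aestronglyMeasurable C (Filter.Eventually.of_forall fun v =>
      (hFn v).trans_le (hC v))
  have key : ∀ ℓ : Fin d → ℤ, ‖cubeCoeff a F ℓ‖ = ‖fourInt H (fun i => z i + ℓ i)‖ := by
    intro ℓ
    have e : cubeCoeff a F ℓ = (starRingEnd ℂ) (fourInt H (fun i => z i + ℓ i)) := by
      rw [cubeCoeff, fourInt, ← integral_conj,
        setIntegral_eq_integral_of_forall_compl_eq_zero fun v hv => by simp [hF, hsub v hv]]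
      congr 1; ext v
      simp only [hF, map_mul, conj_eC]
      rw [← mul_assoc, ← eC_add]
      congr 2
      rw [← neg_add, ← Finset.sum_add_distrib]
      congr 1
      exact Finset.sum_congr rfl fun i _ => by ring
    rw [e, RCLike.norm_conj]
  simp_rw [← key]
  refine (sum_le_hasSum S (fun _ _ => sq_nonneg _) (hasSum_norm_sq_cubeCoeff hFm)).trans ?_
  have hb : ∀ v ∈ unitCube a, ‖F v‖ ^ 2 ≤ C ^ 2 := fun v _ =>
    pow_le_pow_left₀ (norm_nonneg _) ((hFn v).trans_le (hC v)) 2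
  have h := norm_setIntegral_le_of_norm_le_const (μ := volume) (s := unitCube a)
    (f := fun v => ‖F v‖ ^ 2) (C := C ^ 2) (by rw [hvol]; exact one_lt_top)
    (fun v hv => by rw [Real.norm_of_nonneg (sq_nonneg _)]; exact hb v hv)
  rw [Measure.real, hvol, ENNReal.toReal_one, mul_one] at h
  exact (le_abs_self _).trans h

lemma sum_pow_mul_norm_sq_fourInt_le {H : (Fin d → ℝ) → ℂ} (hH : ContDiff ℝ (⊤ : ℕ∞) H)
    (hs : ∀ v, 1 / 2 < ‖v‖ → H v = 0) {n : ℕ} {C : ℝ}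
    (hC : ∀ v ∈ Metric.closedBall (0 : Fin d → ℝ) 1, ‖iteratedFDeriv ℝ n H v‖ ≤ C)
    (z : Fin d → ℝ) {Λ : ℝ} (hΛ : 0 < Λ) (S : Finset (Fin d → ℤ))
    (hS : ∀ ℓ ∈ S, ∃ i, Λ ≤ |z i + ℓ i|) :
    Λ ^ (2 * n) * ∑ ℓ ∈ S, ‖fourInt H (fun i => z i + ℓ i)‖ ^ 2 ≤ d * C ^ 2 := by
  have hcs : HasCompactSupport H := by
    refine HasCompactSupport.of_support_subset_isCompact
      (isCompact_closedBall (0 : Fin d → ℝ) (1 / 2)) fun v hv => ?_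
    rw [mem_closedBall_zero_iff]
    by_contra h
    exact hv (hs v (not_le.1 h))
  have hts : tsupport H ⊆ Metric.closedBall 0 (1 / 2) := by
    refine closure_minimal (fun v hv => ?_) Metric.isClosed_closedBall
    rw [mem_closedBall_zero_iff]
    by_contra h
    exact hv (hs v (not_le.1 h))
  have h0 : ∀ v, 1 / 2 < ‖v‖ → iteratedFDeriv ℝ n H v = 0 := by
    intro v hv
    by_contra h
    have := hts (support_iteratedFDeriv_subset (𝕜 := ℝ) n h)
    rw [mem_closedBall_zero_iff] at this
    linarith
  have hC0 : 0 ≤ C := (norm_nonneg _).trans (hC 0 (by simp))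
  have hC' : ∀ v, ‖iteratedFDeriv ℝ n H v‖ ≤ C := by
    intro v
    by_cases hv : v ∈ Metric.closedBall (0 : Fin d → ℝ) 1
    · exact hC v hv
    · rw [mem_closedBall_zero_iff, not_le] at hv
      rw [h0 v (by linarith), norm_zero]; exact hC0
  calc Λ ^ (2 * n) * ∑ ℓ ∈ S, ‖fourInt H (fun i => z i + ℓ i)‖ ^ 2
      ≤ ∑ ℓ ∈ S, ∑ i, ‖fourInt (dirDeriv i n H) (fun i => z i + ℓ i)‖ ^ 2 := by
        rw [Finset.mul_sum]
        refine Finset.sum_le_sum fun ℓ hℓ => ?_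
        obtain ⟨i, hi⟩ := hS ℓ hℓ
        refine le_trans ?_ (Finset.single_le_sum (f := fun i =>
          ‖fourInt (dirDeriv i n H) (fun i => z i + ℓ i)‖ ^ 2) (fun _ _ => sq_nonneg _)
          (Finset.mem_univ i))
        rw [mul_comm 2 n, pow_mul, ← mul_pow]
        refine pow_le_pow_left₀ (by positivity) ?_ 2
        refine le_trans ?_ (pow_mul_norm_fourInt_le hH hcs i n _)
        gcongr
    _ = ∑ i, ∑ ℓ ∈ S, ‖fourInt (dirDeriv i n H) (fun i => z i + ℓ i)‖ ^ 2 := Finset.sum_comm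
    _ ≤ ∑ _i : Fin d, C ^ 2 := by
        refine Finset.sum_le_sum fun i _ => ?_
        refine sum_norm_sq_fourInt_le (contDiff_dirDeriv hH i n).continuous (fun v hv => ?_)
          (fun v => (norm_dirDeriv_le i n H v).trans (hC' v)) z S
        rw [dirDeriv, h0 v hv]; rfl
    _ = d * C ^ 2 := by simp

end Decay

section PacketDecay
variable {d k : ℕ}

/-- The scalar phase function `t · Φ`. -/
def phiT (Φ : (Fin d → ℝ) → Fin k → ℝ) (t : Fin k → ℝ) (ξ : Fin d → ℝ) : ℝ := ∑ j, t j * Φ ξ j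

/-- The gradient of `t · Φ`. -/
def grT (Φ : (Fin d → ℝ) → Fin k → ℝ) (t : Fin k → ℝ) (ξ : Fin d → ℝ) (i : Fin d) : ℝ :=
  ∑ j, t j * gradPhi d (fun x => Φ x j) ξ i

/-- The rescaled position of `w` relative to the tube with index `T`. -/
def posVec (Φ : (Fin d → ℝ) → Fin k → ℝ) (L : ℝ) (T : (Fin d → ℤ) × (Fin d → ℤ))
    (w : (Fin d → ℝ) × (Fin k → ℝ)) (i : Fin d) : ℝ :=
  (w.1 i + grT Φ w.2 (capPt L T.1) i) / L + T.2 i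

lemma contDiff_phiT {Φ : (Fin d → ℝ) → Fin k → ℝ} (hΦ : ContDiff ℝ (⊤ : ℕ∞) Φ) (t : Fin k → ℝ) :
    ContDiff ℝ (⊤ : ℕ∞) (phiT Φ t) := by
  unfold phiT
  exact ContDiff.sum fun j _ => contDiff_const.mul (contDiff_pi.1 hΦ j)

lemma fderiv_phiT {Φ : (Fin d → ℝ) → Fin k → ℝ} (hΦ : ContDiff ℝ (⊤ : ℕ∞) Φ) (t : Fin k → ℝ)
    (ξ v : Fin d → ℝ) : fderiv ℝ (phiT Φ t) ξ v = ∑ i, grT Φ t ξ i * v i := by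
  have h1 : ∀ j, HasFDerivAt (fun x => Φ x j) (fderiv ℝ (fun x => Φ x j) ξ) ξ := fun j =>
    ((contDiff_pi.1 hΦ j).differentiable (by simp) ξ).hasFDerivAt
  have h2 : HasFDerivAt (phiT Φ t) (∑ j, t j • fderiv ℝ (fun x => Φ x j) ξ) ξ :=
    HasFDerivAt.fun_sum fun j _ => (h1 j).const_mul (t j)
  rw [h2.fderiv]
  simp only [_root_.sum_apply, _root_.smul_apply, smul_eq_mul, grT, gradPhi, Finset.sum_mul]
  rw [Finset.sum_comm]
  refine Finset.sum_congr rfl fun j _ => ?_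
  have hv : v = ∑ i, v i • (Pi.single i (1 : ℝ) : Fin d → ℝ) := by
    ext i; simp [Finset.sum_apply, Pi.single_apply]
  conv_lhs => rw [hv]
  rw [map_sum, Finset.mul_sum]
  refine Finset.sum_congr rfl fun i _ => ?_
  rw [map_smul, smul_eq_mul]; ring

lemma norm_exOp_psi {Φ : (Fin d → ℝ) → Fin k → ℝ} (hΦ : ContDiff ℝ (⊤ : ℕ∞) Φ) {L : ℝ}
    (hL : 0 < L) (T : (Fin d → ℤ) × (Fin d → ℤ)) (w : (Fin d → ℝ) × (Fin k → ℝ)) :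
    ‖exOp Φ (psi L T) w‖ = L⁻¹ ^ d * ‖fourInt (fun v => (chi v : ℂ) *
      eC (taylorRem (phiT Φ w.2) (capPt L T.1) L⁻¹ v)) (posVec Φ L T w)‖ := by
  set c := capPt L T.1 with hc
  set F : (Fin d → ℝ) → ℂ := fun ξ => eC (phase Φ w ξ) * psi L T ξ with hF
  have h1 : ∫ v, F (c + L⁻¹ • v) = (L : ℂ) ^ d * ∫ ξ, F ξ := by
    rw [Measure.integral_comp_smul volume (fun v => F (c + v)) L⁻¹, integral_add_left_eq_self F c]
    simp only [Module.finrank_fintype_fun_eq_card, Fintype.card_fin]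
    rw [abs_of_pos (by positivity), Complex.real_smul]
    push_cast
    rw [inv_pow, inv_inv]
  set a : ℝ := phase Φ w c + ∑ i, (T.2 i : ℝ) * (L * c i)
  have h2 : ∀ v, F (c + L⁻¹ • v) = eC a * (eC (∑ i, posVec Φ L T w i * v i) *
      ((chi v : ℂ) * eC (taylorRem (phiT Φ w.2) c L⁻¹ v))) := by
    intro v
    have e1 : L • (c + L⁻¹ • v) - halfPt T.1 = v := by
      rw [smul_add, smul_inv_smul₀ hL.ne', hc, capPt, smul_inv_smul₀ hL.ne', add_sub_cancel_left]
    have e2 : phase Φ w (c + L⁻¹ • v) + ∑ i, (T.2 i : ℝ) * (L * (c + L⁻¹ • v) i) =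
        a + ∑ i, posVec Φ L T w i * v i + taylorRem (phiT Φ w.2) c L⁻¹ v := by
      simp only [taylorRem, fderiv_phiT hΦ, posVec, ← hc]
      simp only [phase, phiT, a, Pi.add_apply, Pi.smul_apply, smul_eq_mul]
      rw [Finset.mul_sum]
      have e3 : ∑ i, (w.1 i * (c i + L⁻¹ * v i)) + ∑ i, (T.2 i : ℝ) * (L * (c i + L⁻¹ * v i)) =
          ∑ i, w.1 i * c i + ∑ i, (T.2 i : ℝ) * (L * c i) +
          (∑ i, ((w.1 i + grT Φ w.2 c i) / L + T.2 i) * v i -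
            ∑ i, L⁻¹ * (grT Φ w.2 c i * v i)) := by
        rw [← Finset.sum_sub_distrib, ← Finset.sum_add_distrib, ← Finset.sum_add_distrib,
          ← Finset.sum_add_distrib]
        refine Finset.sum_congr rfl fun i _ => ?_
        field_simp; ring
      linarith
    simp only [hF, psi, e1]
    calc _ = (chi v : ℂ) * eC (phase Φ w (c + L⁻¹ • v) +
          ∑ i, (T.2 i : ℝ) * (L * (c + L⁻¹ • v) i)) := by rw [eC_add]; ring
      _ = _ := by rw [e2, eC_add, eC_add]; ring
  simp_rw [h2] at h1
  rw [integral_const_mul] at h1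
  have h3 := congrArg norm h1
  rw [norm_mul, norm_mul, norm_eC, one_mul, norm_pow, Complex.norm_real,
    Real.norm_of_nonneg hL.le] at h3
  have h4 : ‖exOp Φ (psi L T) w‖ = ‖∫ ξ, F ξ‖ := rfl
  rw [h4, fourInt, h3, ← mul_assoc, ← mul_pow, inv_mul_cancel₀ hL.ne', one_pow, one_mul]

/-- Uniform derivative bounds for `t · Φ` on a ball. -/
lemma exists_iteratedFDeriv_phiT_le {Φ : (Fin d → ℝ) → Fin k → ℝ} (hΦ : ContDiff ℝ (⊤ : ℕ∞) Φ)
    (R : ℝ) (N : ℕ) : ∃ M : ℝ, 0 < M ∧ ∀ t, ∀ j ≤ N, ∀ x ∈ Metric.closedBall (0 : Fin d → ℝ) R,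
      ‖iteratedFDeriv ℝ j (phiT Φ t) x‖ ≤ M * ‖t‖ := by
  have h1 : ∀ j, ∃ B, ∀ v ∈ Metric.closedBall (0 : Fin d → ℝ) R,
      ‖iteratedFDeriv ℝ j Φ v‖ ≤ B := fun j =>
    (isCompact_closedBall _ _).exists_bound_of_continuousOn
      (hΦ.continuous_iteratedFDeriv (m := j) (by exact_mod_cast le_top)).continuousOn
  choose B hB using h1
  refine ⟨k * (∑ j ∈ Finset.range (N + 1), |B j|) + 1, by positivity, fun t j hj x hx => ?_⟩
  set ℓ : (Fin k → ℝ) →L[ℝ] ℝ := ∑ j, t j • ContinuousLinearMap.proj j with hℓ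
  have e : phiT Φ t = ℓ ∘ Φ := by
    ext ξ; simp [phiT, hℓ, _root_.sum_apply]
  have hn : ‖ℓ‖ ≤ k * ‖t‖ := by
    refine ContinuousLinearMap.opNorm_le_bound _ (by positivity) fun u => ?_
    have : ℓ u = ∑ j, t j * u j := by simp [hℓ, _root_.sum_apply]
    rw [this]
    calc ‖∑ j, t j * u j‖ ≤ ∑ _j : Fin k, ‖t‖ * ‖u‖ := by
          refine (norm_sum_le _ _).trans (Finset.sum_le_sum fun j _ => ?_)
          rw [norm_mul]
          gcongr
          · exact norm_le_pi_norm t j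
          · exact norm_le_pi_norm u j
      _ = k * ‖t‖ * ‖u‖ := by simp; ring
  rw [e, ContinuousLinearMap.iteratedFDeriv_comp_left ℓ hΦ.contDiffAt
    (by exact_mod_cast le_top : (j : WithTop ℕ∞) ≤ ((⊤ : ℕ∞) : WithTop ℕ∞))]
  refine (ContinuousLinearMap.norm_compContinuousMultilinearMap_le _ _).trans ?_
  have h2 : ‖iteratedFDeriv ℝ j Φ x‖ ≤ ∑ j ∈ Finset.range (N + 1), |B j| :=
    ((hB j x hx).trans (le_abs_self _)).trans (Finset.single_le_sum (f := fun j => |B j|)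
      (fun _ _ => abs_nonneg _) (Finset.mem_range.2 (by omega)))
  calc _ ≤ (k * ‖t‖) * ∑ j ∈ Finset.range (N + 1), |B j| := by gcongr
    _ ≤ _ := by nlinarith [norm_nonneg t]

/-- Wave packets decay rapidly away from their tubes, in the mean square sense. -/
theorem exists_sum_norm_sq_exOp_psi_le {Φ : (Fin d → ℝ) → Fin k → ℝ}
    (hΦ : ContDiff ℝ (⊤ : ℕ∞) Φ) (R K : ℝ) (N : ℕ) : ∃ C : ℝ, 0 < C ∧
    ∀ L : ℝ, 1 ≤ L → ∀ m : Fin d → ℤ, ‖capPt L m‖ ≤ R → ∀ w : (Fin d → ℝ) × (Fin k → ℝ),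
    ‖w.2‖ ≤ K * L ^ 2 → ∀ Λ : ℝ, 0 < Λ → ∀ S : Finset (Fin d → ℤ),
    (∀ ℓ ∈ S, ∃ i, Λ ≤ |posVec Φ L (m, ℓ) w i|) →
    Λ ^ (2 * N) * ∑ ℓ ∈ S, ‖exOp Φ (psi L (m, ℓ)) w‖ ^ 2 ≤ C := by
  obtain ⟨M, hM, hMb⟩ := exists_iteratedFDeriv_phiT_le hΦ (R + 1) (N + 2)
  obtain ⟨C, hC, hCb⟩ := exists_iteratedFDeriv_amplitude_le d N (M * K)
  refine ⟨d * C ^ 2 + 1, by positivity, fun L hL m hm w hw Λ hΛ S hS => ?_⟩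
  have hL0 : 0 < L := one_pos.trans_le hL
  set Θ := taylorRem (phiT Φ w.2) (capPt L m) L⁻¹ with hΘ
  have hΘs : ContDiff ℝ (⊤ : ℕ∞) Θ := contDiff_taylorRem (contDiff_phiT hΦ _) _ _
  set H : (Fin d → ℝ) → ℂ := fun v => (chi v : ℂ) * eC (Θ v) with hH
  have hHs : ContDiff ℝ (⊤ : ℕ∞) H :=
    (Complex.ofRealCLM.contDiff.comp contDiff_chi).mul (contDiff_eC.comp hΘs)
  have hsupp : ∀ v, 1 / 2 < ‖v‖ → H v = 0 := by
    intro v hv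
    by_contra h
    have h1 : chi v ≠ 0 := fun h0 => h (by simp [hH, h0])
    refine absurd hv (not_lt.2 ((pi_norm_le_iff_of_nonneg (by norm_num)).2 fun i => ?_))
    exact (abs_lt_of_chi_ne_zero h1 i).le
  have hHb : ∀ v ∈ Metric.closedBall (0 : Fin d → ℝ) 1, ‖iteratedFDeriv ℝ N H v‖ ≤ C := by
    intro v hv
    refine hCb Θ hΘs v hv fun j hj hjN => ?_
    refine (norm_iteratedFDeriv_taylorRem_le (contDiff_phiT hΦ _) (N := N + 2) hm (by positivity)
      (inv_le_one_of_one_le₀ hL) (by omega) (hMb w.2) hj (by omega) hv).trans ?_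
    calc L⁻¹ ^ 2 * (M * ‖w.2‖) ≤ L⁻¹ ^ 2 * (M * (K * L ^ 2)) := by gcongr
      _ = M * K := by field_simp
  set z : Fin d → ℝ := fun i => (w.1 i + grT Φ w.2 (capPt L m) i) / L
  have key := sum_pow_mul_norm_sq_fourInt_le hHs hsupp hHb z hΛ S hS
  refine le_trans (mul_le_mul_of_nonneg_left (Finset.sum_le_sum fun ℓ _ => ?_) (by positivity))
    (key.trans (by linarith))
  refine pow_le_pow_left₀ (norm_nonneg _) ?_ 2
  rw [norm_exOp_psi hΦ hL0]
  exact mul_le_of_le_one_left (norm_nonneg _)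
    (pow_le_one₀ (by positivity) (inv_le_one_of_one_le₀ hL))

end PacketDecay

section Transversality
variable {d k : ℕ}

/-- The curvature and transversality conditions at the pair `(ν₁, ν₂)`, with Hessians at `ν₁`. -/
def LocalCond (Φ : (Fin d → ℝ) → Fin k → ℝ) (ν₁ ν₂ : Fin d → ℝ) : Prop :=
  ∀ t : Fin k → ℝ, (∑ i, t i ^ 2) = 1 → (tHess d k Φ t ν₁).det ≠ 0 ∧
    (Dmat d k Φ ν₁ ν₂ * (tHess d k Φ t ν₁)⁻¹ * (Dmat d k Φ ν₁ ν₂)ᵀ).det ≠ 0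

lemma eq_zero_of_transversal {H : Matrix (Fin d) (Fin d) ℝ} {D : Matrix (Fin k) (Fin d) ℝ}
    (hH : H.det ≠ 0) (hD : (D * H⁻¹ * Dᵀ).det ≠ 0) {u : Fin d → ℝ} {σ : Fin k → ℝ}
    (h1 : u ᵥ* H + σ ᵥ* D = 0) (h2 : D *ᵥ u = 0) : u = 0 ∧ σ = 0 := by
  have hu : u = -(σ ᵥ* (D * H⁻¹)) := by
    have h3 : u ᵥ* H = -(σ ᵥ* D) := eq_neg_of_add_eq_zero_left h1
    calc u = (u ᵥ* H) ᵥ* H⁻¹ := by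
          rw [vecMul_vecMul, Matrix.mul_nonsing_inv _ (isUnit_iff_ne_zero.2 hH), vecMul_one]
      _ = _ := by rw [h3, neg_vecMul, vecMul_vecMul]
  have hσ : σ = 0 := by
    have h4 : σ ᵥ* (D * H⁻¹ * Dᵀ) = 0 := by
      rw [← vecMul_vecMul, vecMul_transpose, ← neg_neg (σ ᵥ* (D * H⁻¹)), ← hu, mulVec_neg, h2,
        neg_zero]
    exact eq_zero_of_vecMul_eq_zero hD h4
  refine ⟨?_, hσ⟩
  rw [hu, hσ]; simp

lemma tHess_smul (Φ : (Fin d → ℝ) → Fin k → ℝ) (c : ℝ) (t : Fin k → ℝ) (ν : Fin d → ℝ) :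
    tHess d k Φ (c • t) ν = c • tHess d k Φ t ν := by
  simp [tHess, Finset.smul_sum, smul_smul]

lemma exists_transversal_lower_bound {Φ : (Fin d → ℝ) → Fin k → ℝ} {ν₁ ν₂ : Fin d → ℝ}
    (hc : LocalCond Φ ν₁ ν₂) : ∃ c : ℝ, 0 < c ∧ ∀ (s σ : Fin k → ℝ) (u : Fin d → ℝ),
    c * (‖s‖ * ‖u‖ + ‖σ‖) ≤ ‖u ᵥ* tHess d k Φ s ν₁ + σ ᵥ* Dmat d k Φ ν₁ ν₂‖ +
      ‖s‖ * ‖Dmat d k Φ ν₁ ν₂ *ᵥ u‖ := by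
  set D := Dmat d k Φ ν₁ ν₂
  set f : (Fin k → ℝ) × ((Fin d → ℝ) × (Fin k → ℝ)) → ℝ := fun p =>
    ‖p.2.1 ᵥ* tHess d k Φ p.1 ν₁ + p.2.2 ᵥ* D‖ + ‖D *ᵥ p.2.1‖ with hf
  have hcont : Continuous f := by
    have h1 : Continuous fun p : (Fin k → ℝ) × ((Fin d → ℝ) × (Fin k → ℝ)) =>
        tHess d k Φ p.1 ν₁ := by
      unfold tHess; fun_prop
    have h2 : Continuous fun p : (Fin k → ℝ) × ((Fin d → ℝ) × (Fin k → ℝ)) =>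
        p.2.1 ᵥ* tHess d k Φ p.1 ν₁ :=
      Continuous.matrix_vecMul (by fun_prop) h1
    have h3 : Continuous fun p : (Fin k → ℝ) × ((Fin d → ℝ) × (Fin k → ℝ)) => p.2.2 ᵥ* D :=
      Continuous.matrix_vecMul (by fun_prop) continuous_const
    have h4 : Continuous fun p : (Fin k → ℝ) × ((Fin d → ℝ) × (Fin k → ℝ)) => D *ᵥ p.2.1 :=
      Continuous.matrix_mulVec continuous_const (by fun_prop)
    exact (h2.add h3).norm.add h4.norm
  have hK1 : IsCompact {t : Fin k → ℝ | ∑ i, t i ^ 2 = 1} := by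
    refine Metric.isCompact_of_isClosed_isBounded (isClosed_eq (by fun_prop) continuous_const) ?_
    refine (Metric.isBounded_closedBall (x := (0 : Fin k → ℝ)) (r := 1)).subset fun t ht => ?_
    rw [mem_closedBall_zero_iff, pi_norm_le_iff_of_nonneg zero_le_one]
    intro i
    have h1 : t i ^ 2 ≤ 1 := by
      rw [← (show ∑ i, t i ^ 2 = 1 from ht)]
      exact Finset.single_le_sum (f := fun i => t i ^ 2) (fun _ _ => sq_nonneg _)
        (Finset.mem_univ i)
    rw [Real.norm_eq_abs]
    exact (sq_le_one_iff_abs_le_one _).1 h1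
  have hK := hK1.prod (isCompact_sphere (0 : (Fin d → ℝ) × (Fin k → ℝ)) 1)
  obtain ⟨c, hc0, hcb⟩ := hK.exists_forall_le' hcont.continuousOn (a := 0) (by
    rintro ⟨t, u, σ⟩ ⟨ht, hp⟩
    rw [mem_sphere_zero_iff_norm] at hp
    refine lt_of_le_of_ne (by positivity) fun h0 => ?_
    have h1 : ‖u ᵥ* tHess d k Φ t ν₁ + σ ᵥ* D‖ = 0 := by
      refine le_antisymm ?_ (norm_nonneg _)
      have := norm_nonneg (D *ᵥ u)
      simp only [hf] at h0
      linarith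
    have h2 : ‖D *ᵥ u‖ = 0 := by
      simp only [hf] at h0; linarith
    obtain ⟨rfl, rfl⟩ := eq_zero_of_transversal (hc t ht).1 (hc t ht).2 (norm_eq_zero.1 h1)
      (norm_eq_zero.1 h2)
    rw [Prod.mk_zero_zero, norm_zero] at hp
    exact zero_ne_one hp)
  have hhom : ∀ t : Fin k → ℝ, ∑ i, t i ^ 2 = 1 → ∀ (u : Fin d → ℝ) (σ : Fin k → ℝ),
      c * ‖(u, σ)‖ ≤ f (t, u, σ) := by
    intro t ht u σ
    rcases eq_or_ne (u, σ) 0 with h0 | h0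
    · rw [h0, norm_zero, mul_zero]; positivity
    · have hn : 0 < ‖(u, σ)‖ := norm_pos_iff.2 h0
      have h1 := hcb (t, ‖(u, σ)‖⁻¹ • (u, σ)) ⟨ht, by
        rw [mem_sphere_zero_iff_norm, norm_smul, norm_inv, norm_norm, inv_mul_cancel₀ hn.ne']⟩
      have h2 : f (t, ‖(u, σ)‖⁻¹ • (u, σ)) = ‖(u, σ)‖⁻¹ * f (t, u, σ) := by
        simp only [hf, Prod.smul_mk, smul_vecMul, mulVec_smul, ← smul_add, norm_smul, norm_inv,
          norm_norm, mul_add]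
      rw [h2, le_inv_mul_iff₀ hn] at h1
      linarith
  refine ⟨c / (2 * (k + 1)), by positivity, fun s σ u => ?_⟩
  rcases eq_or_ne s 0 with rfl | hs
  · have ht : ∃ t : Fin k → ℝ, ∑ i, t i ^ 2 = 1 ∨ σ = 0 := by
      rcases Nat.eq_zero_or_pos k with rfl | hk
      · exact ⟨0, Or.inr (Subsingleton.elim _ _)⟩
      · exact ⟨Pi.single ⟨0, hk⟩ 1, Or.inl (by simp [Pi.single_apply])⟩
    have hz : tHess d k Φ 0 ν₁ = 0 := by simp [tHess]
    simp only [hz, vecMul_zero, zero_add, norm_zero, zero_mul, add_zero]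
    obtain ⟨t, ht | rfl⟩ := ht
    · have h1 := hhom t ht 0 σ
      simp only [hf, zero_vecMul, zero_add, mulVec_zero, norm_zero, add_zero] at h1
      refine le_trans ?_ h1
      have h2 : ‖σ‖ ≤ ‖((0 : Fin d → ℝ), σ)‖ := le_max_right _ _
      gcongr
      exact div_le_self hc0.le (by linarith [(Nat.cast_nonneg k : (0 : ℝ) ≤ k)])
    · simp
  · have hs2 : 0 < ∑ i, s i ^ 2 := by
      refine lt_of_le_of_ne (Finset.sum_nonneg fun _ _ => sq_nonneg _) fun h => hs ?_
      ext i
      have := (Finset.sum_eq_zero_iff_of_nonneg (fun _ _ => sq_nonneg _)).1 h.symm i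
        (Finset.mem_univ i)
      simpa using this
    set S := Real.sqrt (∑ i, s i ^ 2) with hS
    have hS0 : 0 < S := Real.sqrt_pos.2 hs2
    have hSs : ‖s‖ ≤ S := by
      rw [pi_norm_le_iff_of_nonneg hS0.le]
      intro i
      refine Real.abs_le_sqrt ?_
      exact Finset.single_le_sum (f := fun i => s i ^ 2) (fun _ _ => sq_nonneg _)
        (Finset.mem_univ i)
    have hsS : S ≤ (k + 1) * ‖s‖ := by
      refine Real.sqrt_le_iff.2 ⟨by positivity, ?_⟩
      calc ∑ i, s i ^ 2 ≤ ∑ _i : Fin k, ‖s‖ ^ 2 := Finset.sum_le_sum fun i _ =>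
            sq_le_sq' (by linarith [neg_le_of_abs_le (norm_le_pi_norm s i)])
              (le_of_abs_le (norm_le_pi_norm s i))
        _ = k * ‖s‖ ^ 2 := by simp
        _ ≤ _ := by nlinarith [sq_nonneg ‖s‖, (Nat.cast_nonneg k : (0 : ℝ) ≤ k)]
    have ht : ∑ i, (S⁻¹ • s) i ^ 2 = 1 := by
      simp only [Pi.smul_apply, smul_eq_mul, mul_pow, ← Finset.mul_sum]
      rw [inv_pow, hS, Real.sq_sqrt hs2.le, inv_mul_cancel₀ hs2.ne']
    have h1 := hhom (S⁻¹ • s) ht (S • u) σ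
    simp only [hf, tHess_smul, smul_vecMul, vecMul_smul, mulVec_smul, smul_smul,
      inv_mul_cancel₀ hS0.ne', one_smul, norm_smul,
      Real.norm_of_nonneg hS0.le] at h1
    have h2 : S * ‖u‖ ≤ ‖(S • u, σ)‖ := by
      have h7 : ‖S • u‖ = S * ‖u‖ := by rw [norm_smul, Real.norm_of_nonneg hS0.le]
      rw [← h7]; exact le_max_left _ _
    have h3 : ‖σ‖ ≤ ‖(S • u, σ)‖ := le_max_right _ _
    have hk1 : (0 : ℝ) < k + 1 := by positivity
    set P := ‖u ᵥ* tHess d k Φ s ν₁ + σ ᵥ* D‖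
    set Q := ‖D *ᵥ u‖
    have hP : 0 ≤ P := norm_nonneg _
    have hQ : 0 ≤ Q := norm_nonneg _
    rw [div_mul_eq_mul_div, div_le_iff₀ (by positivity)]
    have h4 : ‖s‖ * ‖u‖ ≤ S * ‖u‖ := by gcongr
    have h5 : S * Q ≤ (k + 1) * ‖s‖ * Q := by gcongr
    have h6 : P ≤ (k + 1) * P := by nlinarith [(Nat.cast_nonneg k : (0 : ℝ) ≤ k)]
    nlinarith

end Transversality

section Perturbation
variable {d k : ℕ}

/-- The transposed Jacobian of `Φ`, as a matrix-valued function. -/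
def jac (Φ : (Fin d → ℝ) → Fin k → ℝ) (ξ : Fin d → ℝ) : Fin k → Fin d → ℝ :=
  fun j i => gradPhi d (fun x => Φ x j) ξ i

lemma contDiff_jac {Φ : (Fin d → ℝ) → Fin k → ℝ} (hΦ : ContDiff ℝ (⊤ : ℕ∞) Φ) :
    ContDiff ℝ (⊤ : ℕ∞) (jac Φ) := by
  refine contDiff_pi.2 fun j => contDiff_pi.2 fun i => ?_
  exact ((contDiff_pi.1 hΦ j).fderiv_right (m := (⊤ : ℕ∞)) (by simp)).clm_apply contDiff_const

lemma grT_eq_sum_jac (Φ : (Fin d → ℝ) → Fin k → ℝ) (s : Fin k → ℝ) (ξ : Fin d → ℝ) (i : Fin d) :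
    grT Φ s ξ i = ∑ j, s j * jac Φ ξ j i := rfl

lemma clm_apply_eq_sum {E : Type*} [NormedAddCommGroup E] [NormedSpace ℝ E]
    (A : (Fin d → ℝ) →L[ℝ] E) (v : Fin d → ℝ) : A v = ∑ a, v a • A (Pi.single a 1) := by
  conv_lhs => rw [pi_eq_sum_univ' v]
  simp [map_sum]

lemma norm_sum_mul_le (s : Fin k → ℝ) (M : Fin k → Fin d → ℝ) :
    ‖fun i => ∑ j, s j * M j i‖ ≤ k * ‖s‖ * ‖M‖ := by
  rw [pi_norm_le_iff_of_nonneg (by positivity)]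
  intro i
  calc ‖∑ j, s j * M j i‖ ≤ ∑ j : Fin k, ‖s‖ * ‖M‖ := by
        refine norm_sum_le_of_le _ fun j _ => ?_
        rw [norm_mul]
        exact mul_le_mul (norm_le_pi_norm s j)
          ((norm_le_pi_norm (M j) i).trans (norm_le_pi_norm M j)) (norm_nonneg _) (norm_nonneg _)
    _ = _ := by simp [mul_assoc]

lemma fderiv_jac_apply {Φ : (Fin d → ℝ) → Fin k → ℝ} (hΦ : ContDiff ℝ (⊤ : ℕ∞) Φ)
    (ν u : Fin d → ℝ) (s : Fin k → ℝ) :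
    (fun i => ∑ j, s j * fderiv ℝ (jac Φ) ν u j i) = u ᵥ* tHess d k Φ s ν := by
  have h0 : HasFDerivAt (jac Φ) (fderiv ℝ (jac Φ) ν) ν :=
    ((contDiff_jac hΦ).differentiable (by simp) ν).hasFDerivAt
  ext i
  have h1 : ∀ j a, fderiv ℝ (jac Φ) ν (Pi.single a 1) j i =
      hessPhi d (fun x => Φ x j) ν a i := by
    intro j a
    have h2 := hasFDerivAt_pi'.1 (hasFDerivAt_pi'.1 h0 j) i
    simp only [hessPhi, Matrix.of_apply]
    rw [show (fun x => fderiv ℝ (fun x => Φ x j) x (Pi.single i 1)) = fun x => jac Φ x j i from rfl,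
      h2.fderiv]
    rfl
  rw [clm_apply_eq_sum]
  simp only [Finset.sum_apply, Pi.smul_apply, smul_eq_mul, h1, vecMul, dotProduct, tHess,
    Matrix.sum_apply, Matrix.smul_apply, Finset.mul_sum]
  rw [Finset.sum_comm]
  refine Finset.sum_congr rfl fun a _ => Finset.sum_congr rfl fun j _ => by ring

lemma fderiv_sub_fderiv_apply {Φ : (Fin d → ℝ) → Fin k → ℝ} (hΦ : ContDiff ℝ (⊤ : ℕ∞) Φ)
    (ν₁ ν₂ u : Fin d → ℝ) :
    fderiv ℝ Φ ν₂ u - fderiv ℝ Φ ν₁ u = Dmat d k Φ ν₁ ν₂ *ᵥ u := by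
  have h1 : ∀ ν j a, fderiv ℝ Φ ν (Pi.single a 1) j = gradPhi d (fun x => Φ x j) ν a := by
    intro ν j a
    have h0 := hasFDerivAt_pi'.1 (hΦ.differentiable (by simp) ν).hasFDerivAt j
    rw [gradPhi, h0.fderiv]; rfl
  ext j
  rw [clm_apply_eq_sum, clm_apply_eq_sum (fderiv ℝ Φ ν₁)]
  simp only [Pi.sub_apply, Finset.sum_apply, Pi.smul_apply, smul_eq_mul, h1, mulVec, dotProduct,
    Dmat, Matrix.of_apply, ← Finset.sum_sub_distrib]
  refine Finset.sum_congr rfl fun a _ => by ring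

lemma exists_strict_bound {E F : Type*} [NormedAddCommGroup E] [NormedSpace ℝ E]
    [NormedAddCommGroup F] [NormedSpace ℝ F] {g : E → F} (hg : ContDiff ℝ (⊤ : ℕ∞) g) (ν : E)
    {ε : ℝ} (hε : 0 < ε) : ∃ r : ℝ, 0 < r ∧ ∀ x y, ‖x - ν‖ ≤ r → ‖y - ν‖ ≤ r →
    ‖g x - g y - fderiv ℝ g ν (x - y)‖ ≤ ε * ‖x - y‖ := by
  have h1 : HasStrictFDerivAt g (fderiv ℝ g ν) ν := hg.contDiffAt.hasStrictFDerivAt (by simp)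
  have h2 := h1.isLittleO.def hε
  obtain ⟨r, hr, h3⟩ := Metric.eventually_nhds_iff.1 h2
  refine ⟨r / 2, by positivity, fun x y hx hy => h3 (y := (x, y)) ?_⟩
  rw [Prod.dist_eq, max_lt_iff, dist_eq_norm, dist_eq_norm]
  exact ⟨by simp only; linarith, by simp only; linarith⟩

/-- Quantitative transversality on small neighbourhoods of `ν₁` and `ν₂`. -/
lemma exists_perturbed_lower_bound {Φ : (Fin d → ℝ) → Fin k → ℝ} (hΦ : ContDiff ℝ (⊤ : ℕ∞) Φ)
    {ν₁ ν₂ : Fin d → ℝ} (hc : LocalCond Φ ν₁ ν₂) : ∃ r c : ℝ, 0 < r ∧ 0 < c ∧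
    ∀ ξ ξ' ζ ζ' ξ₂ : Fin d → ℝ, ‖ξ - ν₁‖ ≤ r → ‖ξ' - ν₁‖ ≤ r → ‖ζ - ν₂‖ ≤ r → ‖ζ' - ν₂‖ ≤ r →
    ‖ξ₂ - ν₂‖ ≤ r → ζ - ζ' = ξ - ξ' → ∀ s σ : Fin k → ℝ, c * (‖s‖ * ‖ξ - ξ'‖ + ‖σ‖) ≤
      ‖grT Φ s ξ - grT Φ s ξ' + grT Φ σ ξ' - grT Φ σ ξ₂‖ +
        ‖s‖ * ‖(Φ ξ - Φ ζ) - (Φ ξ' - Φ ζ')‖ := by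
  obtain ⟨c, hc0, hK⟩ := exists_transversal_lower_bound hc
  set ε := c / (4 * (k + 1)) with hε
  have hε0 : 0 < ε := by positivity
  obtain ⟨r1, hr1, h1⟩ := exists_strict_bound (contDiff_jac hΦ) ν₁ hε0
  obtain ⟨r2, hr2, h2⟩ := exists_strict_bound hΦ ν₁ hε0
  obtain ⟨r3, hr3, h3⟩ := exists_strict_bound hΦ ν₂ hε0
  have hj := (contDiff_jac hΦ).continuous
  obtain ⟨r4, hr4, h4⟩ := Metric.continuous_iff.1 hj ν₁ ε hε0
  obtain ⟨r5, hr5, h5⟩ := Metric.continuous_iff.1 hj ν₂ ε hε0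
  refine ⟨min r1 (min r2 (min r3 (min (r4 / 2) (r5 / 2)))), c / 2, by positivity, by positivity, ?_⟩
  intro ξ ξ' ζ ζ' ξ₂ hξ hξ' hζ hζ' hξ₂ hd s σ
  simp only [le_min_iff] at hξ hξ' hζ hζ' hξ₂
  set u := ξ - ξ' with hu
  have e1 := h1 ξ ξ' hξ.1 hξ'.1
  have e2 := h2 ξ ξ' hξ.2.1 hξ'.2.1
  have e3 := h3 ζ ζ' hζ.2.2.1 hζ'.2.2.1
  rw [hd] at e3
  have e4 : ‖jac Φ ξ' - jac Φ ν₁‖ ≤ ε := by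
    rw [← dist_eq_norm]
    exact (h4 ξ' (by rw [dist_eq_norm]; linarith [hξ'.2.2.2.1])).le
  have e5 : ‖jac Φ ξ₂ - jac Φ ν₂‖ ≤ ε := by
    rw [← dist_eq_norm]
    exact (h5 ξ₂ (by rw [dist_eq_norm]; linarith [hξ₂.2.2.2.2])).le
  set N := grT Φ s ξ - grT Φ s ξ' + grT Φ σ ξ' - grT Φ σ ξ₂ with hN
  set M := (Φ ξ - Φ ζ) - (Φ ξ' - Φ ζ') with hM
  set M1 := jac Φ ξ - jac Φ ξ' - fderiv ℝ (jac Φ) ν₁ u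
  set M2 := (jac Φ ξ' - jac Φ ν₁) - (jac Φ ξ₂ - jac Φ ν₂)
  have hM2 : ‖M2‖ ≤ 2 * ε := (norm_sub_le _ _).trans (by linarith)
  have f1 : u ᵥ* tHess d k Φ s ν₁ + (-σ) ᵥ* Dmat d k Φ ν₁ ν₂ =
      N - (fun i => ∑ j, s j * M1 j i) - (fun i => ∑ j, σ j * M2 j i) := by
    rw [← fderiv_jac_apply hΦ]
    ext i
    simp only [hN, Pi.add_apply, Pi.sub_apply, grT_eq_sum_jac, vecMul, dotProduct, Dmat,
      Matrix.of_apply, M1, M2, Pi.neg_apply]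
    simp only [← Finset.sum_sub_distrib, ← Finset.sum_add_distrib]
    refine Finset.sum_congr rfl fun j _ => ?_
    simp only [jac]; ring
  have f2 : Dmat d k Φ ν₁ ν₂ *ᵥ u = -M + (Φ ξ - Φ ξ' - fderiv ℝ Φ ν₁ u) -
      (Φ ζ - Φ ζ' - fderiv ℝ Φ ν₂ u) := by
    rw [← fderiv_sub_fderiv_apply hΦ, hM]; abel
  have g0 := hK s (-σ) u
  rw [f1, f2, norm_neg] at g0
  have g1 := norm_sum_mul_le s M1
  have g2 := norm_sum_mul_le σ M2
  have g3 : ‖N - (fun i => ∑ j, s j * M1 j i) - (fun i => ∑ j, σ j * M2 j i)‖ ≤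
      ‖N‖ + k * ‖s‖ * (ε * ‖u‖) + k * ‖σ‖ * (2 * ε) := by
    refine (norm_sub_le _ _).trans (add_le_add ((norm_sub_le _ _).trans
      (add_le_add le_rfl (g1.trans ?_))) (g2.trans ?_)) <;> gcongr
  have g4 : ‖-M + (Φ ξ - Φ ξ' - fderiv ℝ Φ ν₁ u) - (Φ ζ - Φ ζ' - fderiv ℝ Φ ν₂ u)‖ ≤
      ‖M‖ + ε * ‖u‖ + ε * ‖u‖ := by
    refine (norm_sub_le _ _).trans (add_le_add ((norm_add_le _ _).trans ?_) e3)
    rw [norm_neg]; gcongr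
  have g5 : ‖s‖ * ‖-M + (Φ ξ - Φ ξ' - fderiv ℝ Φ ν₁ u) - (Φ ζ - Φ ζ' - fderiv ℝ Φ ν₂ u)‖ ≤
      ‖s‖ * (‖M‖ + ε * ‖u‖ + ε * ‖u‖) := by gcongr
  have g6 : 4 * (k + 1) * ε = c := by rw [hε]; field_simp
  have g7 : 0 ≤ ‖s‖ * ‖u‖ := by positivity
  have g8 : 0 ≤ ‖σ‖ := norm_nonneg _
  have g9 : (0 : ℝ) ≤ k * ε := by positivity
  nlinarith [mul_nonneg g9 g7, mul_nonneg g9 g8, mul_nonneg hε0.le g7, mul_nonneg hε0.le g8]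

end Perturbation

section Counting
variable {d k n : ℕ}

/-- An integer vector regarded as a real vector. -/
def rv (m : Fin n → ℤ) : Fin n → ℝ := fun i => (m i : ℝ)

/-- The integer vectors at distance at most `R` from `x`. -/
def intWindow (x : Fin n → ℝ) (R : ℝ) : Finset (Fin n → ℤ) :=
  Fintype.piFinset fun i => Finset.Icc ⌈x i - R⌉ ⌊x i + R⌋

lemma mem_intWindow {x : Fin n → ℝ} {R : ℝ} (hR : 0 ≤ R) {m : Fin n → ℤ} :
    m ∈ intWindow x R ↔ ‖rv m - x‖ ≤ R := by
  rw [intWindow, Fintype.mem_piFinset, pi_norm_le_iff_of_nonneg hR]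
  refine forall_congr' fun i => ?_
  rw [Finset.mem_Icc, Int.ceil_le, Int.le_floor, Real.norm_eq_abs, abs_le, Pi.sub_apply, rv]
  constructor <;> rintro ⟨h1, h2⟩ <;> constructor <;> linarith

lemma card_intWindow_le (x : Fin n → ℝ) {R : ℝ} (hR : 1 ≤ R) :
    ((intWindow x R).card : ℝ) ≤ (3 * R) ^ n := by
  rw [intWindow, Fintype.card_piFinset]
  push_cast
  refine (Finset.prod_le_prod (fun _ _ => by positivity) (g := fun _ => 3 * R) fun i _ => ?_).trans
    (by simp)
  rw [Int.card_Icc]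
  have h1 : (⌊x i + R⌋ : ℝ) ≤ x i + R := Int.floor_le _
  have h2 : x i - R ≤ (⌈x i - R⌉ : ℝ) := Int.le_ceil _
  have h3 : ((⌊x i + R⌋ + 1 - ⌈x i - R⌉ : ℤ) : ℝ) ≤ 3 * R := by push_cast; linarith
  rcases le_total 0 (⌊x i + R⌋ + 1 - ⌈x i - R⌉) with h | h
  · have h4 : (((⌊x i + R⌋ + 1 - ⌈x i - R⌉).toNat : ℤ) : ℝ) ≤ 3 * R := by
      rw [Int.toNat_of_nonneg h]; exact h3
    exact_mod_cast h4
  · rw [Int.toNat_of_nonpos h]; simp; linarith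

/-- The tube with index `T` passes near the cube with index `q`. -/
def Inc (Φ : (Fin d → ℝ) → Fin k → ℝ) (L Λ : ℝ) (q : (Fin d → ℤ) × (Fin k → ℤ))
    (T : (Fin d → ℤ) × (Fin d → ℤ)) : Prop :=
  ‖rv q.1 + rv T.2 + grT Φ (rv q.2) (capPt L T.1)‖ ≤ Λ

/-- The tubes with frequency index in `M` passing near the cube with index `q`. -/
def nearSet (Φ : (Fin d → ℝ) → Fin k → ℝ) (L Λ : ℝ) (M : Finset (Fin d → ℤ))
    (q : (Fin d → ℤ) × (Fin k → ℤ)) : Finset ((Fin d → ℤ) × (Fin d → ℤ)) :=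
  M.biUnion fun m => (intWindow (-(rv q.1 + grT Φ (rv q.2) (capPt L m))) Λ).image (Prod.mk m)

lemma mem_nearSet {Φ : (Fin d → ℝ) → Fin k → ℝ} {L Λ : ℝ} (hΛ : 0 ≤ Λ) {M : Finset (Fin d → ℤ)}
    {q : (Fin d → ℤ) × (Fin k → ℤ)} {T : (Fin d → ℤ) × (Fin d → ℤ)} :
    T ∈ nearSet Φ L Λ M q ↔ T.1 ∈ M ∧ Inc Φ L Λ q T := by
  obtain ⟨m, l⟩ := T
  simp only [nearSet, Finset.mem_biUnion, Finset.mem_image, mem_intWindow hΛ, Prod.mk.injEq, Inc]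
  constructor
  · rintro ⟨m', hm', l', hl', rfl, rfl⟩
    refine ⟨hm', ?_⟩
    convert hl' using 2; abel
  · rintro ⟨hm, hl⟩
    refine ⟨m, hm, l, ?_, rfl, rfl⟩
    convert hl using 2; abel

lemma card_nearSet_le (Φ : (Fin d → ℝ) → Fin k → ℝ) (L : ℝ) {Λ : ℝ} (hΛ : 1 ≤ Λ)
    (M : Finset (Fin d → ℤ)) (q : (Fin d → ℤ) × (Fin k → ℤ)) :
    ((nearSet Φ L Λ M q).card : ℝ) ≤ M.card * (3 * Λ) ^ d := by
  calc ((nearSet Φ L Λ M q).card : ℝ)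
      ≤ ((∑ m ∈ M, (intWindow (-(rv q.1 + grT Φ (rv q.2) (capPt L m))) Λ).card : ℕ) : ℝ) := by
        refine Nat.cast_le.2 (Finset.card_biUnion_le.trans (Finset.sum_le_sum fun m _ => ?_))
        exact Finset.card_image_le
    _ ≤ ∑ _m ∈ M, (3 * Λ) ^ d := by
        push_cast
        exact Finset.sum_le_sum fun m _ => card_intWindow_le _ hΛ
    _ = _ := by simp

/-- The products of caps `(m₁, m₂)` and `(m₁', m₂')` interact at scale `1 / L`. -/
def Res (Φ : (Fin d → ℝ) → Fin k → ℝ) (L : ℝ) (m₁ m₂ m₁' m₂' : Fin d → ℤ) : Prop :=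
  ∃ ξ η ξ' η' : Fin d → ℝ, ‖ξ - capPt L m₁‖ ≤ 1 / (2 * L) ∧ ‖η - capPt L m₂‖ ≤ 1 / (2 * L) ∧
    ‖ξ' - capPt L m₁'‖ ≤ 1 / (2 * L) ∧ ‖η' - capPt L m₂'‖ ≤ 1 / (2 * L) ∧
    ‖(ξ + η) - (ξ' + η')‖ ≤ 1 / L ∧ ‖(Φ ξ + Φ η) - (Φ ξ' + Φ η')‖ ≤ 1 / L

lemma Res.symm {Φ : (Fin d → ℝ) → Fin k → ℝ} {L : ℝ} {m₁ m₂ m₁' m₂' : Fin d → ℤ}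
    (h : Res Φ L m₁ m₂ m₁' m₂') : Res Φ L m₁' m₂' m₁ m₂ := by
  obtain ⟨ξ, η, ξ', η', h1, h2, h3, h4, h5, h6⟩ := h
  exact ⟨ξ', η', ξ, η, h3, h4, h1, h2, by rwa [norm_sub_rev], by rwa [norm_sub_rev]⟩

lemma grT_sub (Φ : (Fin d → ℝ) → Fin k → ℝ) (s t : Fin k → ℝ) (ξ : Fin d → ℝ) :
    grT Φ (s - t) ξ = grT Φ s ξ - grT Φ t ξ := by
  ext i; simp [grT, sub_mul, Finset.sum_sub_distrib]

lemma norm_rv_sub_rv {L : ℝ} (hL : 0 < L) (m m' : Fin n → ℤ) :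
    ‖rv m - rv m'‖ = 2 * L * ‖capPt L m - capPt L m'‖ := by
  have h1 : rv m - rv m' = (2 * L) • (capPt L m - capPt L m') := by
    ext i
    simp only [rv, capPt, halfPt, Pi.sub_apply, Pi.smul_apply, smul_eq_mul]
    field_simp
  rw [h1, norm_smul, Real.norm_of_nonneg (by positivity)]

lemma norm_sub_eq_rv (q q' : (Fin d → ℤ) × (Fin k → ℤ)) :
    ‖q - q'‖ = max ‖rv q.1 - rv q'.1‖ ‖rv q.2 - rv q'.2‖ := by
  have h : ∀ {n : ℕ} (m m' : Fin n → ℤ), ‖m - m'‖ = ‖rv m - rv m'‖ := by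
    intro n m m'
    simp only [Pi.norm_def, rv, Pi.sub_apply]
    congr 2
    ext i
    simp [← Int.cast_sub, Int.norm_eq_abs]
  rw [Prod.norm_def, Prod.fst_sub, Prod.snd_sub, h, h]

lemma exists_ball_bounds {Φ : (Fin d → ℝ) → Fin k → ℝ} (hΦ : ContDiff ℝ (⊤ : ℕ∞) Φ)
    (ν : Fin d → ℝ) : ∃ r B : ℝ, 0 < r ∧ 1 ≤ B ∧ ∀ x, ‖x - ν‖ ≤ r →
      (∀ s, ‖grT Φ s x‖ ≤ B * ‖s‖) ∧ ∀ y, ‖y - ν‖ ≤ r → ‖Φ x - Φ y‖ ≤ B * ‖x - y‖ := by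
  obtain ⟨r1, hr1, h1⟩ := exists_strict_bound hΦ ν one_pos
  obtain ⟨r2, hr2, h2⟩ := Metric.continuous_iff.1 (contDiff_jac hΦ).continuous ν 1 one_pos
  refine ⟨min r1 (r2 / 2), 1 + ‖fderiv ℝ Φ ν‖ + k * (1 + ‖jac Φ ν‖), by positivity, ?_, ?_⟩
  · have : 0 ≤ ‖fderiv ℝ Φ ν‖ + k * (1 + ‖jac Φ ν‖) := by positivity
    linarith
  intro x hx
  refine ⟨fun s => ?_, fun y hy => ?_⟩
  · have h3 : ‖jac Φ x‖ ≤ 1 + ‖jac Φ ν‖ := by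
      have h4 := h2 x (by rw [dist_eq_norm]; linarith [hx.trans (min_le_right _ _)])
      rw [dist_eq_norm] at h4
      linarith [norm_le_norm_add_norm_sub' (jac Φ x) (jac Φ ν)]
    calc ‖grT Φ s x‖ ≤ k * ‖s‖ * ‖jac Φ x‖ := norm_sum_mul_le s (jac Φ x)
      _ ≤ k * ‖s‖ * (1 + ‖jac Φ ν‖) := by gcongr
      _ ≤ _ := by nlinarith [mul_nonneg (norm_nonneg (fderiv ℝ Φ ν)) (norm_nonneg s), norm_nonneg s]
  · have h3 := h1 x y (hx.trans (min_le_left _ _)) (hy.trans (min_le_left _ _))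
    have h4 := (fderiv ℝ Φ ν).le_opNorm (x - y)
    have h5 := norm_le_norm_add_norm_sub' (Φ x - Φ y) (fderiv ℝ Φ ν (x - y))
    have h6 : 0 ≤ k * (1 + ‖jac Φ ν‖) * ‖x - y‖ := by positivity
    nlinarith

end Counting

section Kakeya
variable {d k : ℕ}

lemma Res.completion {Φ : (Fin d → ℝ) → Fin k → ℝ} {L : ℝ} {m₁ m₂ m₁' m₂' : Fin d → ℤ}
    (h : Res Φ L m₁ m₂ m₁' m₂') :
    ‖capPt L m₁' + capPt L m₂' - capPt L m₁ - capPt L m₂‖ ≤ 3 / L := by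
  obtain ⟨ξ, η, ξ', η', h1, h2, h3, h4, h5, -⟩ := h
  have e : capPt L m₁' + capPt L m₂' - capPt L m₁ - capPt L m₂ =
      (ξ - capPt L m₁) + (η - capPt L m₂) - (ξ' - capPt L m₁') - (η' - capPt L m₂') -
        ((ξ + η) - (ξ' + η')) := by abel
  rw [e]
  have e1 : 3 / L = 1 / (2 * L) + 1 / (2 * L) + 1 / (2 * L) + 1 / (2 * L) + 1 / L := by
    rw [← div_div]; ring
  rw [e1]
  exact (norm_sub_le _ _).trans (add_le_add ((norm_sub_le _ _).trans (add_le_add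
    ((norm_sub_le _ _).trans (add_le_add ((norm_add_le _ _).trans (add_le_add h1 h2)) h3)) h4)) h5)

lemma Res.norm_defect_le {Φ : (Fin d → ℝ) → Fin k → ℝ} {ν₁ ν₂ : Fin d → ℝ} {r B : ℝ} (hB1 : 1 ≤ B)
    (hB₁ : ∀ x, ‖x - ν₁‖ ≤ r → ∀ y, ‖y - ν₁‖ ≤ r → ‖Φ x - Φ y‖ ≤ B * ‖x - y‖)
    (hB₂ : ∀ x, ‖x - ν₂‖ ≤ r → ∀ y, ‖y - ν₂‖ ≤ r → ‖Φ x - Φ y‖ ≤ B * ‖x - y‖)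
    {L : ℝ} (hL : 0 < L) (hrL : 6 ≤ r * L)
    {m₁ m₂ m₁' m₂' : Fin d → ℤ} (hm₁ : ‖capPt L m₁ - ν₁‖ ≤ r / 2) (hm₂ : ‖capPt L m₂ - ν₂‖ ≤ r / 2)
    (hm₁' : ‖capPt L m₁' - ν₁‖ ≤ r / 2) (hm₂' : ‖capPt L m₂' - ν₂‖ ≤ r / 2)
    (h : Res Φ L m₁ m₂ m₁' m₂') :
    ‖capPt L m₁' + capPt L m₂' - capPt L m₁ - ν₂‖ ≤ r ∧
    ‖Φ (capPt L m₁) + Φ (capPt L m₁' + capPt L m₂' - capPt L m₁) - Φ (capPt L m₁') -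
      Φ (capPt L m₂')‖ ≤ 6 * B / L := by
  have h0 := h.completion
  obtain ⟨ξ, η, ξ', η', h1, h2, h3, h4, -, h6⟩ := h
  set z := capPt L m₁' + capPt L m₂' - capPt L m₁
  have hL3 : 3 / L ≤ r / 2 := by rw [div_le_div_iff₀ hL two_pos]; linarith
  have hL1 : 1 / (2 * L) ≤ r / 2 := by
    refine le_trans ?_ hL3
    rw [div_le_div_iff₀ (by positivity) hL]; linarith
  have near : ∀ {x c ν : Fin d → ℝ}, ‖x - c‖ ≤ r / 2 → ‖c - ν‖ ≤ r / 2 → ‖x - ν‖ ≤ r := by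
    intro x c ν hx hc
    have := norm_sub_le_norm_sub_add_norm_sub x c ν
    linarith
  have hr : 0 ≤ r := by have := (norm_nonneg _).trans hm₁; linarith
  have hz : ‖z - ν₂‖ ≤ r := near (h0.trans hL3) hm₂
  have far : ∀ {c ν : Fin d → ℝ}, ‖c - ν‖ ≤ r / 2 → ‖c - ν‖ ≤ r := fun h => h.trans (by linarith)
  refine ⟨hz, ?_⟩
  have g1 := hB₁ _ (near (h1.trans hL1) hm₁) _ (far hm₁)
  have g2 := hB₂ _ (near (h2.trans hL1) hm₂) _ hz
  have g3 := hB₁ _ (near (h3.trans hL1) hm₁') _ (far hm₁')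
  have g4 := hB₂ _ (near (h4.trans hL1) hm₂') _ (far hm₂')
  have g5 : ‖η - z‖ ≤ 1 / (2 * L) + 3 / L := by
    have := norm_sub_le_norm_sub_add_norm_sub η (capPt L m₂) z
    rw [norm_sub_rev (capPt L m₂)] at this
    linarith
  have e : Φ (capPt L m₁) + Φ z - Φ (capPt L m₁') - Φ (capPt L m₂') =
      ((Φ ξ + Φ η) - (Φ ξ' + Φ η')) - (Φ ξ - Φ (capPt L m₁)) - (Φ η - Φ z) +
        (Φ ξ' - Φ (capPt L m₁')) + (Φ η' - Φ (capPt L m₂')) := by abel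
  rw [e]
  refine ((norm_add_le _ _).trans (add_le_add ((norm_add_le _ _).trans (add_le_add
    ((norm_sub_le _ _).trans (add_le_add ((norm_sub_le _ _).trans (add_le_add h6 g1)) g2)) g3))
      g4)).trans ?_
  have e2 : 1 / (2 * L) = 1 / L / 2 := by rw [div_div, mul_comm]
  have e3 : 3 / L = 3 * (1 / L) := by ring
  have e4 : 6 * B / L = 6 * B * (1 / L) := by ring
  rw [e2] at h1 h2 h3 h4 g5
  rw [e3] at g5
  rw [e4]
  have hx : 0 < 1 / L := by positivity
  set x := 1 / L
  have k1 := mul_le_mul_of_nonneg_left h1 (zero_le_one.trans hB1)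
  have k2 := mul_le_mul_of_nonneg_left g5 (zero_le_one.trans hB1)
  have k3 := mul_le_mul_of_nonneg_left h3 (zero_le_one.trans hB1)
  have k4 := mul_le_mul_of_nonneg_left h4 (zero_le_one.trans hB1)
  nlinarith

set_option maxHeartbeats 1000000 in
/-- The Kakeya-type incidence bound for tubes meeting a fixed tube away from a fixed cube. -/
lemma exists_card_incidence_le {Φ : (Fin d → ℝ) → Fin k → ℝ} (hΦ : ContDiff ℝ (⊤ : ℕ∞) Φ)
    {ν₁ ν₂ : Fin d → ℝ} (hc : LocalCond Φ ν₁ ν₂) : ∃ r C : ℝ, 0 < r ∧ 1 ≤ C ∧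
    ∀ L Λ : ℝ, 1 ≤ Λ → C * Λ ^ 3 ≤ L →
    ∀ (𝒮 : Finset (((Fin d → ℤ) × (Fin k → ℤ)) × ((Fin d → ℤ) × (Fin d → ℤ))))
      (q₀ : (Fin d → ℤ) × (Fin k → ℤ)) (m₁ m₂' : Fin d → ℤ) (T₂ : (Fin d → ℤ) × (Fin d → ℤ)),
    ‖capPt L m₁ - ν₁‖ ≤ r → ‖capPt L m₂' - ν₂‖ ≤ r → ‖capPt L T₂.1 - ν₂‖ ≤ r →
    (∀ x ∈ 𝒮, Inc Φ L Λ x.1 T₂ ∧ Inc Φ L Λ x.1 x.2 ∧ Inc Φ L Λ q₀ x.2 ∧ L / Λ ^ 2 ≤ ‖x.1 - q₀‖ ∧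
      ‖x.1 - q₀‖ ≤ 4 * L ∧ ‖capPt L x.2.1 - ν₁‖ ≤ r ∧
      ∃ m₂, ‖capPt L m₂ - ν₂‖ ≤ r ∧ Res Φ L m₁ m₂ x.2.1 m₂') →
    (𝒮.card : ℝ) ≤ C * Λ ^ (5 * d + k) := by
  obtain ⟨r0, c, hr0, hc0, hK⟩ := exists_perturbed_lower_bound hΦ hc
  obtain ⟨r1, B1, hr1, hB1, h1⟩ := exists_ball_bounds hΦ ν₁
  obtain ⟨r2, B2, hr2, hB2, h2⟩ := exists_ball_bounds hΦ ν₂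
  set R := min r0 (min r1 r2) with hR
  have hR0 : 0 < R := by positivity
  have hRr : R ≤ r0 ∧ R ≤ r1 ∧ R ≤ r2 := by
    refine ⟨min_le_left _ _, (min_le_right _ _).trans (min_le_left _ _),
      (min_le_right _ _).trans (min_le_right _ _)⟩
  set B := max B1 B2
  have hB : 1 ≤ B := hB1.trans (le_max_left _ _)
  have hg1 : ∀ x, ‖x - ν₁‖ ≤ R → ∀ s, ‖grT Φ s x‖ ≤ B * ‖s‖ := fun x hx s =>
    ((h1 x (hx.trans hRr.2.1)).1 s).trans (by gcongr; exact le_max_left _ _)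
  have hg2 : ∀ x, ‖x - ν₂‖ ≤ R → ∀ s, ‖grT Φ s x‖ ≤ B * ‖s‖ := fun x hx s =>
    ((h2 x (hx.trans hRr.2.2)).1 s).trans (by gcongr; exact le_max_right _ _)
  have hl1 : ∀ x, ‖x - ν₁‖ ≤ R → ∀ y, ‖y - ν₁‖ ≤ R → ‖Φ x - Φ y‖ ≤ B * ‖x - y‖ :=
    fun x hx y hy => ((h1 x (hx.trans hRr.2.1)).2 y (hy.trans hRr.2.1)).trans
      (by gcongr; exact le_max_left _ _)
  have hl2 : ∀ x, ‖x - ν₂‖ ≤ R → ∀ y, ‖y - ν₂‖ ≤ R → ‖Φ x - Φ y‖ ≤ B * ‖x - y‖ :=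
    fun x hx y hy => ((h2 x (hx.trans hRr.2.2)).2 y (hy.trans hRr.2.2)).trans
      (by gcongr; exact le_max_right _ _)
  set C2 := 6 + 48 * B with hC2
  set C3 := 4 * B * (C2 / c) + 2 with hC3
  have hC20 : 0 < C2 / c := by positivity
  have hC31 : 1 ≤ C3 := by
    have : 0 < 4 * B * (C2 / c) := by positivity
    linarith
  refine ⟨R / 2, max (6 / R + 4) ((3 * C3) ^ d * (3 * C3) ^ k * ((3 * C3) ^ d * 3 ^ d)),
    by positivity, le_max_of_le_left (by have : 0 < 6 / R := by positivity
                                         linarith), ?_⟩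
  intro L Λ hΛ hL 𝒮 q₀ m₁ m₂' T₂ hm₁ hm₂' hT₂ h𝒮
  have hΛ0 : 0 < Λ := by linarith
  have hΛ3 : 1 ≤ Λ ^ 3 := one_le_pow₀ hΛ
  have hL6 : (6 / R + 4) * Λ ^ 3 ≤ L := le_trans (by gcongr; exact le_max_left _ _) hL
  have hL4 : 4 * Λ ^ 3 ≤ L := le_trans (by gcongr; linarith [(by positivity : 0 < 6 / R)]) hL6
  have hL0 : 0 < L := by linarith
  have hRL : 6 ≤ R * L := by
    have : 6 / R ≤ L := by
      have : 0 < 6 / R := by positivity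
      nlinarith
    rwa [div_le_iff₀' hR0] at this
  have near : ∀ {x ν : Fin d → ℝ}, ‖x - ν‖ ≤ R / 2 → ‖x - ν‖ ≤ R := fun h => h.trans (by linarith)
  rcases 𝒮.eq_empty_or_nonempty with rfl | ⟨y, hy⟩
  · simp only [Finset.card_empty, Nat.cast_zero]; positivity
  have key : 𝒮 ⊆ (intWindow (rv y.1.1) (C3 * Λ) ×ˢ intWindow (rv y.1.2) (C3 * Λ)) ×ˢ
      nearSet Φ L Λ (intWindow (rv y.2.1) (C3 * Λ ^ 3)) q₀ := by
    intro x hx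
    obtain ⟨y1, y2, y3, y4, y5, y6, my, y7, y8⟩ := h𝒮 y hy
    obtain ⟨x1, x2, x3, x4, x5, x6, mx, x7, x8⟩ := h𝒮 x hx
    obtain ⟨zx, dx⟩ := x8.norm_defect_le hB hl1 hl2 hL0 hRL hm₁ x7 x6 hm₂'
    obtain ⟨zy, dy⟩ := y8.norm_defect_le hB hl1 hl2 hL0 hRL hm₁ y7 y6 hm₂'
    set ξ := capPt L x.2.1 with hξ
    set ξ' := capPt L y.2.1 with hξ'
    set ζ := ξ + capPt L m₂' - capPt L m₁ with hζ
    set ζ' := ξ' + capPt L m₂' - capPt L m₁ with hζ'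
    set s := rv x.1.2 - rv q₀.2 with hs
    set σ := rv x.1.2 - rv y.1.2 with hσ
    have e1 : ‖rv x.1.1 - rv q₀.1 + grT Φ s ξ‖ ≤ 2 * Λ := by
      have e : rv x.1.1 - rv q₀.1 + grT Φ s ξ = (rv x.1.1 + rv x.2.2 + grT Φ (rv x.1.2) ξ) -
          (rv q₀.1 + rv x.2.2 + grT Φ (rv q₀.2) ξ) := by rw [hs, grT_sub]; abel
      rw [e]
      exact (norm_sub_le _ _).trans ((add_le_add x2 x3).trans_eq (two_mul _).symm)
    have e2 : ‖rv x.1.1 - rv y.1.1 + grT Φ σ (capPt L T₂.1)‖ ≤ 2 * Λ := by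
      have e : rv x.1.1 - rv y.1.1 + grT Φ σ (capPt L T₂.1) =
          (rv x.1.1 + rv T₂.2 + grT Φ (rv x.1.2) (capPt L T₂.1)) -
          (rv y.1.1 + rv T₂.2 + grT Φ (rv y.1.2) (capPt L T₂.1)) := by rw [hσ, grT_sub]; abel
      rw [e]
      exact (norm_sub_le _ _).trans ((add_le_add x1 y1).trans_eq (two_mul _).symm)
    have e3 : ‖grT Φ s ξ - grT Φ s ξ' + grT Φ σ ξ' - grT Φ σ (capPt L T₂.1)‖ ≤ 6 * Λ := by
      have e : grT Φ s ξ - grT Φ s ξ' + grT Φ σ ξ' - grT Φ σ (capPt L T₂.1) =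
          ((rv x.1.1 + rv x.2.2 + grT Φ (rv x.1.2) ξ) - (rv q₀.1 + rv x.2.2 + grT Φ (rv q₀.2) ξ)) -
          ((rv y.1.1 + rv y.2.2 + grT Φ (rv y.1.2) ξ') -
            (rv q₀.1 + rv y.2.2 + grT Φ (rv q₀.2) ξ')) -
          ((rv x.1.1 + rv T₂.2 + grT Φ (rv x.1.2) (capPt L T₂.1)) -
          (rv y.1.1 + rv T₂.2 + grT Φ (rv y.1.2) (capPt L T₂.1))) := by
        rw [hs, hσ, grT_sub, grT_sub, grT_sub, grT_sub]; abel
      rw [e]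
      refine (norm_sub_le _ _).trans ((add_le_add ((norm_sub_le _ _).trans (add_le_add
        ((norm_sub_le _ _).trans (add_le_add x2 x3)) ((norm_sub_le _ _).trans (add_le_add y2 y3))))
        ((norm_sub_le _ _).trans (add_le_add x1 y1))).trans_eq ?_)
      ring
    have e4 : ‖(Φ ξ - Φ ζ) - (Φ ξ' - Φ ζ')‖ ≤ 12 * B / L := by
      have e : (Φ ξ - Φ ζ) - (Φ ξ' - Φ ζ') = (Φ (capPt L m₁) + Φ ζ' - Φ ξ' - Φ (capPt L m₂')) -
          (Φ (capPt L m₁) + Φ ζ - Φ ξ - Φ (capPt L m₂')) := by abel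
      rw [e]
      refine (norm_sub_le _ _).trans ((add_le_add dy dx).trans_eq ?_)
      ring
    have hs4 : ‖s‖ ≤ 4 * L := by
      rw [norm_sub_eq_rv] at x5
      exact (le_max_right _ _).trans x5
    have e5 := hK ξ ξ' ζ ζ' (capPt L T₂.1) ((near x6).trans hRr.1) ((near y6).trans hRr.1)
      (zx.trans hRr.1) (zy.trans hRr.1) ((near hT₂).trans hRr.1) (by rw [hζ, hζ']; abel) s σ
    have e6 : c * (‖s‖ * ‖ξ - ξ'‖ + ‖σ‖) ≤ C2 * Λ := by
      have : ‖s‖ * ‖(Φ ξ - Φ ζ) - (Φ ξ' - Φ ζ')‖ ≤ 4 * L * (12 * B / L) := by gcongr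
      have e : 4 * L * (12 * B / L) = 48 * B := by field_simp; ring
      rw [e] at this
      have h48 : 48 * B ≤ 48 * B * Λ := le_mul_of_one_le_right (by positivity) hΛ
      rw [hC2]; linarith
    have e7 : ‖s‖ * ‖ξ - ξ'‖ + ‖σ‖ ≤ C2 / c * Λ := by
      rw [div_mul_eq_mul_div, le_div_iff₀ hc0]; linarith
    have e8 : ‖σ‖ ≤ C2 / c * Λ := by
      have : 0 ≤ ‖s‖ * ‖ξ - ξ'‖ := by positivity
      linarith
    have e9 : ‖s‖ * ‖ξ - ξ'‖ ≤ C2 / c * Λ := by linarith [norm_nonneg σ]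
    have hBC : C2 / c ≤ B * (C2 / c) := le_mul_of_one_le_left hC20.le hB
    have e10 : L / Λ ^ 2 ≤ 2 * B * ‖s‖ := by
      have f1 : ‖rv x.1.1 - rv q₀.1‖ ≤ 2 * Λ + B * ‖s‖ := by
        have g := hg1 ξ (near x6) s
        have g' := norm_sub_le (rv x.1.1 - rv q₀.1 + grT Φ s ξ) (grT Φ s ξ)
        rw [add_sub_cancel_right] at g'
        linarith
      have f2 : ‖s‖ ≤ 2 * Λ + B * ‖s‖ := by nlinarith [norm_nonneg s]
      have f3 : L / Λ ^ 2 ≤ 2 * Λ + B * ‖s‖ := by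
        rw [norm_sub_eq_rv] at x4
        exact x4.trans (max_le f1 f2)
      have f4 : 4 * Λ ≤ L / Λ ^ 2 := by
        rw [le_div_iff₀ (by positivity)]
        calc 4 * Λ * Λ ^ 2 = 4 * Λ ^ 3 := by ring
          _ ≤ L := hL4
      linarith
    rw [Finset.mem_product, Finset.mem_product, mem_intWindow (by positivity),
      mem_intWindow (by positivity), mem_nearSet hΛ0.le, mem_intWindow (by positivity)]
    refine ⟨⟨?_, ?_⟩, ?_, x3⟩
    · have g := hg2 _ (near hT₂) σ
      have g' := norm_sub_le (rv x.1.1 - rv y.1.1 + grT Φ σ (capPt L T₂.1))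
        (grT Φ σ (capPt L T₂.1))
      rw [add_sub_cancel_right] at g'
      have g2 : B * ‖σ‖ ≤ B * (C2 / c * Λ) := by gcongr
      have g3 : 0 ≤ B * (C2 / c * Λ) := by positivity
      rw [hC3]; nlinarith
    · have g3 : 0 ≤ B * (C2 / c) * Λ := by positivity
      have g4 : C2 / c * Λ ≤ B * (C2 / c) * Λ := by gcongr
      change ‖σ‖ ≤ _
      rw [hC3]; nlinarith
    · rw [norm_rv_sub_rv hL0, ← hξ, ← hξ']
      have f1 : L * ‖ξ - ξ'‖ ≤ 2 * B * (C2 / c) * Λ ^ 3 := by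
        rw [div_le_iff₀ (by positivity)] at e10
        calc L * ‖ξ - ξ'‖ ≤ 2 * B * ‖s‖ * Λ ^ 2 * ‖ξ - ξ'‖ := by gcongr
          _ = 2 * B * Λ ^ 2 * (‖s‖ * ‖ξ - ξ'‖) := by ring
          _ ≤ 2 * B * Λ ^ 2 * (C2 / c * Λ) := by gcongr
          _ = _ := by ring
      rw [hC3]; nlinarith
  have hcard : (𝒮.card : ℝ) ≤ (3 * (C3 * Λ)) ^ d * (3 * (C3 * Λ)) ^ k *
      ((3 * (C3 * Λ ^ 3)) ^ d * (3 * Λ) ^ d) := by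
    have hw1 : 1 ≤ C3 * Λ := by nlinarith
    have hw3 : 1 ≤ C3 * Λ ^ 3 := by nlinarith
    calc (𝒮.card : ℝ) ≤ _ := Nat.cast_le.2 (Finset.card_le_card key)
      _ = ((intWindow (rv y.1.1) (C3 * Λ)).card : ℝ) * (intWindow (rv y.1.2) (C3 * Λ)).card *
          (nearSet Φ L Λ (intWindow (rv y.2.1) (C3 * Λ ^ 3)) q₀).card := by
        rw [Finset.card_product, Finset.card_product]; push_cast; ring
      _ ≤ _ := by
        gcongr
        · exact card_intWindow_le _ hw1
        · exact card_intWindow_le _ hw1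
        · refine (card_nearSet_le Φ L hΛ _ q₀).trans ?_
          gcongr
          exact card_intWindow_le _ hw3
  refine hcard.trans ?_
  have e : (3 * (C3 * Λ)) ^ d * (3 * (C3 * Λ)) ^ k * ((3 * (C3 * Λ ^ 3)) ^ d * (3 * Λ) ^ d) =
      (3 * C3) ^ d * (3 * C3) ^ k * ((3 * C3) ^ d * 3 ^ d) * Λ ^ (5 * d + k) := by
    simp only [mul_pow, pow_add, ← pow_mul]
    rw [show 5 * d = d + 3 * d + d by ring]
    simp only [pow_add]
    ring
  rw [e]
  gcongr
  exact le_max_right _ _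

/-- The number of tubes through a fixed cube completing a resonant quadruple. -/
lemma card_completion_le {Φ : (Fin d → ℝ) → Fin k → ℝ} {L Λ : ℝ} (hL : 0 < L) (hΛ : 1 ≤ Λ)
    (q₀ : (Fin d → ℤ) × (Fin k → ℤ)) (m₁ m₁' m₂' : Fin d → ℤ)
    (𝒮 : Finset ((Fin d → ℤ) × (Fin d → ℤ)))
    (h𝒮 : ∀ T ∈ 𝒮, Inc Φ L Λ q₀ T ∧ Res Φ L m₁ T.1 m₁' m₂') :
    (𝒮.card : ℝ) ≤ 108 ^ d * Λ ^ d := by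
  rcases 𝒮.eq_empty_or_nonempty with rfl | ⟨y, hy⟩
  · simp only [Finset.card_empty, Nat.cast_zero]; positivity
  have key : 𝒮 ⊆ nearSet Φ L Λ (intWindow (rv y.1) 12) q₀ := by
    intro x hx
    rw [mem_nearSet (by linarith), mem_intWindow (by norm_num), norm_rv_sub_rv hL]
    refine ⟨?_, (h𝒮 x hx).1⟩
    have h1 := (h𝒮 x hx).2.completion
    have h2 := (h𝒮 y hy).2.completion
    have h3 : ‖capPt L x.1 - capPt L y.1‖ ≤ 3 / L + 3 / L := by
      rw [show capPt L x.1 - capPt L y.1 =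
        (capPt L m₁' + capPt L m₂' - capPt L m₁ - capPt L y.1) -
        (capPt L m₁' + capPt L m₂' - capPt L m₁ - capPt L x.1) by abel]
      exact (norm_sub_le _ _).trans (add_le_add h2 h1)
    calc 2 * L * ‖capPt L x.1 - capPt L y.1‖ ≤ 2 * L * (3 / L + 3 / L) := by gcongr
      _ = 12 := by field_simp; norm_num
  calc (𝒮.card : ℝ) ≤ _ := Nat.cast_le.2 (Finset.card_le_card key)
    _ ≤ (intWindow (rv y.1) 12).card * (3 * Λ) ^ d := card_nearSet_le Φ L hΛ _ q₀
    _ ≤ (3 * 12) ^ d * (3 * Λ) ^ d := by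
        gcongr; exact card_intWindow_le _ (by norm_num)
    _ = _ := by rw [mul_pow 3 Λ, ← mul_assoc, ← mul_pow]; norm_num

end Kakeya

section Redistribution
open Classical in
/-- The share of the weighted mass of cubes on the tube `t` lying in the block `B`. -/
def share {Q T β : Type*} (𝒬 : Finset Q) (N : Q → Finset T) (w : Q → ℝ) (blk : Q → β) (B : β)
    (t : T) : ℝ :=
  (∑ q ∈ 𝒬, if t ∈ N q ∧ blk q = B then w q else 0) / ∑ q ∈ 𝒬, if t ∈ N q then w q else 0

variable {Q T β : Type*} {𝒬 : Finset Q} {N : Q → Finset T} {w : Q → ℝ} {blk : Q → β}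

lemma share_nonneg (hw : ∀ q, 0 ≤ w q) (B : β) (t : T) : 0 ≤ share 𝒬 N w blk B t := by
  refine div_nonneg ?_ ?_ <;> refine Finset.sum_nonneg fun q _ => ?_ <;> split_ifs <;>
    simp [hw]

lemma sum_share_le_one (hw : ∀ q, 0 ≤ w q) (t : T) (Bs : Finset β) :
    ∑ B ∈ Bs, share 𝒬 N w blk B t ≤ 1 := by
  classical
  simp only [share]
  rw [← Finset.sum_div]
  refine div_le_one_of_le₀ ?_ (Finset.sum_nonneg fun q _ => by split_ifs <;> simp [hw])
  rw [Finset.sum_comm]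
  refine Finset.sum_le_sum fun q _ => ?_
  by_cases ht : t ∈ N q
  · simp only [ht, true_and, if_true, Finset.sum_ite_eq]
    split_ifs <;> simp [hw]
  · simp [ht]

lemma share_le_one (hw : ∀ q, 0 ≤ w q) (B : β) (t : T) : share 𝒬 N w blk B t ≤ 1 := by
  simpa using sum_share_le_one (𝒬 := 𝒬) (N := N) (blk := blk) hw t {B}

open Classical in
lemma one_sub_share_mul_le (hw : ∀ q, 0 ≤ w q) (B : β) (t : T) :
    (1 - share 𝒬 N w blk B t) * (∑ q ∈ 𝒬, if t ∈ N q then w q else 0) ≤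
      ∑ q ∈ 𝒬, if t ∈ N q ∧ blk q ≠ B then w q else 0 := by
  set m := ∑ q ∈ 𝒬, if t ∈ N q then w q else 0
  rcases eq_or_ne m 0 with hm | hm
  · rw [hm, mul_zero]
    exact Finset.sum_nonneg fun q _ => by split_ifs <;> simp [hw]
  · have h1 : share 𝒬 N w blk B t * m = ∑ q ∈ 𝒬, if t ∈ N q ∧ blk q = B then w q else 0 :=
      div_mul_cancel₀ _ hm
    rw [sub_mul, h1, one_mul, ← Finset.sum_sub_distrib]
    refine Finset.sum_le_sum fun q _ => ?_
    by_cases h2 : t ∈ N q <;> by_cases h3 : blk q = B <;> simp [h2, h3]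

lemma sum_sum_resonant_le {ι : Type*} (J : Finset ι) (R : ι → ι → Prop) [DecidableRel R]
    (hR : ∀ i j, R i j → R j i) (x y : ι → ι → ℝ)
    (hxy : ∀ i ∈ J, ∀ j ∈ J, x i j ≤ (y i j + y j i) / 2) :
    ∑ i ∈ J, ∑ j ∈ J, (if R i j then x i j else 0) ≤
      ∑ i ∈ J, ∑ j ∈ J, if R i j then y i j else 0 := by
  have h1 : ∑ i ∈ J, ∑ j ∈ J, (if R i j then x i j else 0) ≤
      ∑ i ∈ J, ∑ j ∈ J, ((if R i j then y i j else 0) / 2 + (if R j i then y j i else 0) / 2) := by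
    refine Finset.sum_le_sum fun i hi => Finset.sum_le_sum fun j hj => ?_
    by_cases h : R i j
    · simp only [h, hR i j h, if_true]; linarith [hxy i hi j hj]
    · have h' : ¬R j i := fun h' => h (hR j i h')
      simp [h, h']
  refine h1.trans_eq ?_
  simp only [Finset.sum_add_distrib, ← Finset.sum_div]
  rw [Finset.sum_comm (f := fun i j => if R j i then y j i else 0)]
  ring

open Classical in
/-- The energy estimate for the off-diagonal part of the redistribution. -/
lemma sum_offdiagonal_le {T₂ : Type*} (𝒢 : Finset Q) (h𝒢 : 𝒢 ⊆ 𝒬) (N₂ : Q → Finset T₂)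
    (𝒯 : Finset T) (𝒯₂ : Finset T₂) (hN : ∀ q ∈ 𝒬, N q ⊆ 𝒯) (hN₂ : ∀ q ∈ 𝒬, N₂ q ⊆ 𝒯₂)
    (a : T → ℝ) (b : T₂ → ℝ) (ha : ∀ t, 0 ≤ a t) (hb : ∀ t, 0 ≤ b t)
    (hw : w = fun q => ∑ t ∈ N₂ q, b t ^ 2)
    (R : T × T₂ → T × T₂ → Prop) [DecidableRel R] (hR : ∀ i j, R i j → R j i) {X : ℝ}
    (hX0 : 0 ≤ X)
    (hX : ∀ q₀ ∈ 𝒢, ∀ t₁ ∈ N q₀, ∀ t₂' ∈ N₂ q₀, ∀ t ∈ 𝒯₂,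
      ∑ t₁' ∈ N q₀, ∑ t₂ ∈ N₂ q₀, ∑ q ∈ 𝒬, (if R (t₁, t₂) (t₁', t₂') ∧ t₁' ∈ N q ∧
        blk q ≠ blk q₀ ∧ t ∈ N₂ q then (1 : ℝ) else 0) ≤ X) :
    ∑ q₀ ∈ 𝒢, ∑ i ∈ N q₀ ×ˢ N₂ q₀, ∑ j ∈ N q₀ ×ˢ N₂ q₀,
      (if R i j then (a i.1 * (1 - share 𝒬 N w blk (blk q₀) i.1) * b i.2) *
        (a j.1 * (1 - share 𝒬 N w blk (blk q₀) j.1) * b j.2) else 0) ≤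
      X * (∑ t ∈ 𝒯, a t ^ 2) * ∑ t ∈ 𝒯₂, b t ^ 2 := by
  have hw0 : ∀ q, 0 ≤ w q := fun q => by rw [hw]; exact Finset.sum_nonneg fun _ _ => sq_nonneg _
  set m : T → ℝ := fun t => ∑ q ∈ 𝒬, if t ∈ N q then w q else 0 with hm
  have hm0 : ∀ t, 0 ≤ m t := fun t => Finset.sum_nonneg fun q _ => by split_ifs <;> simp [hw0]
  have hmz : ∀ q ∈ 𝒬, ∀ t ∈ N q, m t = 0 → ∀ t₂ ∈ N₂ q, b t₂ = 0 := by
    intro q hq t ht h0 t₂ ht₂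
    have h1 := (Finset.sum_eq_zero_iff_of_nonneg fun q _ => by
      split_ifs <;> simp [hw0]).1 h0 q hq
    rw [if_pos ht, hw] at h1
    have h2 := (Finset.sum_eq_zero_iff_of_nonneg fun t _ => sq_nonneg _).1 h1 t₂ ht₂
    simpa using h2
  set E := ∑ t ∈ 𝒯₂, b t ^ 2 with hE
  have hE0 : 0 ≤ E := Finset.sum_nonneg fun _ _ => sq_nonneg _
  have step : ∀ q₀ ∈ 𝒢, ∑ i ∈ N q₀ ×ˢ N₂ q₀, ∑ j ∈ N q₀ ×ˢ N₂ q₀,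
      (if R i j then (a i.1 * (1 - share 𝒬 N w blk (blk q₀) i.1) * b i.2) *
        (a j.1 * (1 - share 𝒬 N w blk (blk q₀) j.1) * b j.2) else 0) ≤
      ∑ t₁ ∈ N q₀, a t₁ ^ 2 / m t₁ * w q₀ * (X * E) := by
    intro q₀ hq₀
    set c : T → ℝ := fun t => 1 - share 𝒬 N w blk (blk q₀) t with hc
    have hc0 : ∀ t, 0 ≤ c t := fun t => sub_nonneg.2 (share_le_one hw0 _ _)
    have hc1 : ∀ t, c t ≤ 1 := fun t => sub_le_self _ (share_nonneg hw0 _ _)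
    refine (sum_sum_resonant_le _ R hR _ (fun i j => a i.1 ^ 2 / m i.1 * b j.2 ^ 2 *
      (c j.1 * m j.1)) fun i hi j hj => ?_).trans ?_
    · rw [Finset.mem_product] at hi hj
      rcases eq_or_ne (m i.1) 0 with h0 | h0
      · rw [hmz q₀ (h𝒢 hq₀) _ hi.1 h0 _ hi.2]
        have := hm0 i.1; have := hm0 j.1; have := hc0 i.1; have := hc0 j.1
        simp only [mul_zero, zero_mul]; positivity
      rcases eq_or_ne (m j.1) 0 with h0' | h0'
      · rw [hmz q₀ (h𝒢 hq₀) _ hj.1 h0' _ hj.2]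
        have := hm0 i.1; have := hm0 j.1; have := hc0 i.1; have := hc0 j.1
        simp only [mul_zero]; positivity
      have p1 : 0 < m i.1 := lt_of_le_of_ne (hm0 _) h0.symm
      have p2 : 0 < m j.1 := lt_of_le_of_ne (hm0 _) h0'.symm
      have q1 := hc0 i.1
      have q2 := hc0 j.1
      have q3 := hc1 i.1
      have q4 := hc1 j.1
      have r1 := ha i.1; have r2 := ha j.1; have r3 := hb i.2; have r4 := hb j.2
      change a i.1 * c i.1 * b i.2 * (a j.1 * c j.1 * b j.2) ≤ _
      have e1 : a i.1 * c i.1 * b i.2 * (a j.1 * c j.1 * b j.2) ≤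
          c i.1 * c j.1 * ((a i.1 ^ 2 / m i.1 * b j.2 ^ 2 * m j.1 +
            a j.1 ^ 2 / m j.1 * b i.2 ^ 2 * m i.1) / 2) := by
        rw [show a i.1 * c i.1 * b i.2 * (a j.1 * c j.1 * b j.2) =
          c i.1 * c j.1 * (a i.1 * b j.2 * (a j.1 * b i.2)) by ring]
        refine mul_le_mul_of_nonneg_left ?_ (mul_nonneg q1 q2)
        rw [show a i.1 ^ 2 / m i.1 * b j.2 ^ 2 * m j.1 + a j.1 ^ 2 / m j.1 * b i.2 ^ 2 * m i.1 =
          ((a i.1 * b j.2 * m j.1) ^ 2 + (a j.1 * b i.2 * m i.1) ^ 2) / (m i.1 * m j.1) by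
            field_simp, div_div, le_div_iff₀ (by positivity)]
        nlinarith [sq_nonneg (a i.1 * b j.2 * m j.1 - a j.1 * b i.2 * m i.1)]
      refine e1.trans ?_
      have f1 : 0 ≤ a i.1 ^ 2 / m i.1 * b j.2 ^ 2 * m j.1 := by positivity
      have f2 : 0 ≤ a j.1 ^ 2 / m j.1 * b i.2 ^ 2 * m i.1 := by positivity
      have g1 : c i.1 * c j.1 ≤ c j.1 := mul_le_of_le_one_left q2 q3
      have g2 : c i.1 * c j.1 ≤ c i.1 := mul_le_of_le_one_right q1 q4
      nlinarith [mul_le_mul_of_nonneg_right g1 f1, mul_le_mul_of_nonneg_right g2 f2]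
    · have inner : ∀ t₁ ∈ N q₀, ∀ t₂' ∈ N₂ q₀, ∑ t₁' ∈ N q₀, ∑ t₂ ∈ N₂ q₀,
          (if R (t₁, t₂) (t₁', t₂') then c t₁' * m t₁' else 0) ≤ X * E := by
        intro t₁ ht₁ t₂' ht₂'
        calc _ ≤ ∑ t₁' ∈ N q₀, ∑ t₂ ∈ N₂ q₀, ∑ q ∈ 𝒬, ∑ t ∈ 𝒯₂, b t ^ 2 *
              (if R (t₁, t₂) (t₁', t₂') ∧ t₁' ∈ N q ∧ blk q ≠ blk q₀ ∧ t ∈ N₂ q then (1 : ℝ)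
                else 0) := by
              refine Finset.sum_le_sum fun t₁' _ => Finset.sum_le_sum fun t₂ _ => ?_
              by_cases h : R (t₁, t₂) (t₁', t₂')
              · rw [if_pos h]
                refine (one_sub_share_mul_le hw0 _ _).trans (Finset.sum_le_sum fun q hq => ?_)
                by_cases h' : t₁' ∈ N q ∧ blk q ≠ blk q₀
                · rw [if_pos h', hw]
                  simp only [h, h', true_and, mul_ite, mul_one, mul_zero, ne_eq,
                    not_false_eq_true]
                  rw [← Finset.sum_filter]
                  refine Finset.sum_le_sum_of_subset_of_nonneg (fun t ht => ?_)
                    fun _ _ _ => sq_nonneg _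
                  exact Finset.mem_filter.2 ⟨hN₂ q hq ht, ht⟩
                · rw [if_neg h']
                  exact Finset.sum_nonneg fun t _ => by positivity
              · rw [if_neg h]
                exact Finset.sum_nonneg fun q _ => Finset.sum_nonneg fun t _ => by positivity
          _ = ∑ t ∈ 𝒯₂, b t ^ 2 * ∑ t₁' ∈ N q₀, ∑ t₂ ∈ N₂ q₀, ∑ q ∈ 𝒬,
              (if R (t₁, t₂) (t₁', t₂') ∧ t₁' ∈ N q ∧ blk q ≠ blk q₀ ∧ t ∈ N₂ q then (1 : ℝ)
                else 0) := by
              simp only [Finset.mul_sum]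
              symm
              rw [Finset.sum_comm]
              refine Finset.sum_congr rfl fun t₁' _ => ?_
              rw [Finset.sum_comm]
              exact Finset.sum_congr rfl fun t₂ _ => Finset.sum_comm
          _ ≤ ∑ t ∈ 𝒯₂, b t ^ 2 * X := Finset.sum_le_sum fun t ht =>
              mul_le_mul_of_nonneg_left (hX q₀ hq₀ t₁ ht₁ t₂' ht₂' t ht) (sq_nonneg _)
          _ = X * E := by rw [← Finset.sum_mul, mul_comm]
      have e : ∑ i ∈ N q₀ ×ˢ N₂ q₀, ∑ j ∈ N q₀ ×ˢ N₂ q₀,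
          (if R i j then a i.1 ^ 2 / m i.1 * b j.2 ^ 2 * (c j.1 * m j.1) else 0) =
          ∑ t₁ ∈ N q₀, ∑ t₂' ∈ N₂ q₀, a t₁ ^ 2 / m t₁ * b t₂' ^ 2 *
            ∑ t₁' ∈ N q₀, ∑ t₂ ∈ N₂ q₀,
              (if R (t₁, t₂) (t₁', t₂') then c t₁' * m t₁' else 0) := by
        rw [Finset.sum_product]
        simp only [Finset.sum_product, Finset.mul_sum, mul_ite, mul_zero]
        refine Finset.sum_congr rfl fun t₁ _ => ?_
        calc _ = ∑ t₂ ∈ N₂ q₀, ∑ t₂' ∈ N₂ q₀, ∑ t₁' ∈ N q₀,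
              (if R (t₁, t₂) (t₁', t₂') then a t₁ ^ 2 / m t₁ * b t₂' ^ 2 * (c t₁' * m t₁')
                else 0) := Finset.sum_congr rfl fun t₂ _ => Finset.sum_comm
          _ = _ := by
            rw [Finset.sum_comm]
            exact Finset.sum_congr rfl fun t₂ _ => Finset.sum_comm
      rw [e]
      refine Finset.sum_le_sum fun t₁ ht₁ => ?_
      calc _ ≤ ∑ t₂' ∈ N₂ q₀, a t₁ ^ 2 / m t₁ * b t₂' ^ 2 * (X * E) :=
            Finset.sum_le_sum fun t₂' ht₂' => mul_le_mul_of_nonneg_left (inner t₁ ht₁ t₂' ht₂')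
              (by have := hm0 t₁; positivity)
        _ = _ := by rw [← Finset.sum_mul, ← Finset.mul_sum, hw]
  refine (Finset.sum_le_sum step).trans ?_
  calc _ ≤ ∑ q₀ ∈ 𝒬, ∑ t ∈ 𝒯, a t ^ 2 / m t * (X * E) * (if t ∈ N q₀ then w q₀ else 0) := by
        refine (Finset.sum_le_sum_of_subset_of_nonneg h𝒢 fun q _ _ => Finset.sum_nonneg
          fun t _ => by have := hm0 t; have := hw0 q; positivity).trans
          (Finset.sum_le_sum fun q hq => ?_)
        simp only [mul_ite, mul_zero]
        rw [← Finset.sum_filter, Finset.filter_mem_eq_inter,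
          Finset.inter_eq_right.2 (hN q hq)]
        exact Finset.sum_le_sum fun t _ => le_of_eq (by ring)
    _ = ∑ t ∈ 𝒯, a t ^ 2 / m t * m t * (X * E) := by
        rw [Finset.sum_comm]
        refine Finset.sum_congr rfl fun t _ => ?_
        rw [← Finset.mul_sum]; ring
    _ ≤ ∑ t ∈ 𝒯, a t ^ 2 * (X * E) := by
        refine Finset.sum_le_sum fun t _ => mul_le_mul_of_nonneg_right ?_ (mul_nonneg hX0 hE0)
        rcases eq_or_ne (m t) 0 with h0 | h0
        · rw [h0, mul_zero]; positivity
        · rw [div_mul_cancel₀ _ h0]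
    _ = X * (∑ t ∈ 𝒯, a t ^ 2) * E := by rw [← Finset.sum_mul]; ring

end Redistribution

section PacketSums
variable {d k : ℕ}

/-- The superposition of the wave packets in `S` with coefficients `c`. -/
def packSum (Φ : (Fin d → ℝ) → Fin k → ℝ) (L : ℝ) (S : Finset ((Fin d → ℤ) × (Fin d → ℤ)))
    (c : (Fin d → ℤ) × (Fin d → ℤ) → ℂ) (w : (Fin d → ℝ) × (Fin k → ℝ)) : ℂ :=
  ∑ T ∈ S, c T * exOp Φ (psi L T) w

lemma exOp_eq_osc (Φ : (Fin d → ℝ) → Fin k → ℝ) (f : (Fin d → ℝ) → ℂ) :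
    exOp Φ f = osc volume (fun ξ => (ξ, Φ ξ)) f := rfl

lemma continuous_exOp {Φ : (Fin d → ℝ) → Fin k → ℝ} (hΦ : Continuous Φ) {f : (Fin d → ℝ) → ℂ}
    (hf : Integrable f) : Continuous (exOp Φ f) := by
  rw [exOp_eq_osc]
  exact continuous_osc (by fun_prop) hf

lemma norm_exOp_le (Φ : (Fin d → ℝ) → Fin k → ℝ) (f : (Fin d → ℝ) → ℂ)
    (w : (Fin d → ℝ) × (Fin k → ℝ)) : ‖exOp Φ f w‖ ≤ ∫ ξ, ‖f ξ‖ := by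
  rw [exOp_eq_osc]
  exact norm_osc_le _ _ _

lemma continuous_packSum {Φ : (Fin d → ℝ) → Fin k → ℝ} (hΦ : Continuous Φ) {L : ℝ} (hL : 0 < L)
    (S : Finset ((Fin d → ℤ) × (Fin d → ℤ))) (c : (Fin d → ℤ) × (Fin d → ℤ) → ℂ) :
    Continuous (packSum Φ L S c) :=
  continuous_finsetSum _ fun T _ =>
    continuous_const.mul (continuous_exOp hΦ (integrable_psi hL T))

lemma exOp_synth {Φ : (Fin d → ℝ) → Fin k → ℝ} (hΦ : Continuous Φ) {L : ℝ} (hL : 0 < L)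
    (S : Finset ((Fin d → ℤ) × (Fin d → ℤ))) (c : (Fin d → ℤ) × (Fin d → ℤ) → ℂ)
    (w : (Fin d → ℝ) × (Fin k → ℝ)) : exOp Φ (synth L S c) w = packSum Φ L S c w := by
  unfold exOp synth packSum
  simp only [Finset.mul_sum]
  rw [integral_finsetSum]
  · refine Finset.sum_congr rfl fun T _ => ?_
    rw [exOp, ← integral_const_mul]
    congr 1; ext ξ; ring
  · intro T _
    exact integrable_eC_mul (P := fun ξ => (ξ, Φ ξ)) (by fun_prop)
      ((integrable_psi hL T).const_mul (c T)) w

open Classical in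
lemma exists_lintegral_packSum_mul_le (d k : ℕ) : ∃ C : ℝ, 0 < C ∧
    ∀ (Φ : (Fin d → ℝ) → Fin k → ℝ) (_ : Continuous Φ) (L : ℝ) (_ : 0 < L)
      (w₀ : (Fin d → ℝ) × (Fin k → ℝ)) (S₁ S₂ : Finset ((Fin d → ℤ) × (Fin d → ℤ)))
      (x y : (Fin d → ℤ) × (Fin d → ℤ) → ℂ),
      ∫⁻ w in Metric.closedBall w₀ L, ‖packSum Φ L S₁ x w * packSum Φ L S₂ y w‖ₑ ^ 2 ≤
        ENNReal.ofReal (C * L ^ (d + k) * (L⁻¹ ^ d) ^ 4 * ∑ i ∈ S₁ ×ˢ S₂, ∑ j ∈ S₁ ×ˢ S₂,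
          if Res Φ L i.1.1 i.2.1 j.1.1 j.2.1 then
            (‖x i.1‖ * ‖y i.2‖) * (‖x j.1‖ * ‖y j.2‖) else 0) := by
  obtain ⟨C, hC, h⟩ := exists_lintegral_sum_osc_le d k
  refine ⟨C, hC, fun Φ hΦ L hL w₀ S₁ S₂ x y => ?_⟩
  set P : (Fin d → ℝ) × (Fin d → ℝ) → (Fin d → ℝ) × (Fin k → ℝ) :=
    fun z => (z.1 + z.2, Φ z.1 + Φ z.2)
  have hP : Measurable P := by
    have : Continuous P := by fun_prop
    exact this.measurable
  set H : ((Fin d → ℤ) × (Fin d → ℤ)) × ((Fin d → ℤ) × (Fin d → ℤ)) →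
      (Fin d → ℝ) × (Fin d → ℝ) → ℂ := fun i z => x i.1 * psi L i.1 z.1 * (y i.2 * psi L i.2 z.2)
  have hxi : ∀ (c : ℂ) T, Integrable fun ξ => c * psi L T ξ := fun c T =>
    (integrable_psi (d := d) hL T).const_mul c
  have hn : ∀ (c : ℂ) T, ∫ ξ, ‖c * psi (d := d) L T ξ‖ ≤ ‖c‖ * L⁻¹ ^ d := by
    intro c T
    simp only [norm_mul]
    rw [integral_const_mul]
    exact mul_le_mul_of_nonneg_left (integral_norm_psi_le hL T) (norm_nonneg _)
  have h1 := h (volume.prod volume) (S₁ ×ˢ S₂) P hP H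
    (fun i _ => (hxi (x i.1) i.1).mul_prod (hxi (y i.2) i.2))
    (fun i => (‖x i.1‖ * L⁻¹ ^ d) * (‖y i.2‖ * L⁻¹ ^ d)) (fun i _ => by
      simp only [H, norm_mul (_ * _) (_ * _)]
      rw [integral_prod_mul (fun ξ => ‖x i.1 * psi L i.1 ξ‖) (fun ξ => ‖y i.2 * psi L i.2 ξ‖)]
      exact mul_le_mul (hn _ _) (hn _ _) (integral_nonneg fun _ => norm_nonneg _)
        (by positivity)) L hL w₀
    (fun i j => Res Φ L i.1.1 i.2.1 j.1.1 j.2.1) (fun i j hij z z' hz hz' => by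
      by_contra! hlt
      refine hij ⟨z.1, z.2, z'.1, z'.2, ?_, ?_, ?_, ?_, ?_, ?_⟩
      · exact norm_sub_capPt_le_of_psi hL fun h0 => hz (by simp [H, h0])
      · exact norm_sub_capPt_le_of_psi hL fun h0 => hz (by simp [H, h0])
      · exact norm_sub_capPt_le_of_psi hL fun h0 => hz' (by simp [H, h0])
      · exact norm_sub_capPt_le_of_psi hL fun h0 => hz' (by simp [H, h0])
      · exact ((norm_fst_le (P z - P z')).trans_lt hlt).le
      · exact ((norm_snd_le (P z - P z')).trans_lt hlt).le)
  have h2 : ∀ w, ∑ i ∈ S₁ ×ˢ S₂, osc (volume.prod volume) P (H i) w =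
      packSum Φ L S₁ x w * packSum Φ L S₂ y w := by
    intro w
    rw [packSum, packSum, Finset.sum_mul_sum, Finset.sum_product]
    refine Finset.sum_congr rfl fun T _ => Finset.sum_congr rfl fun T' _ => ?_
    have e : ∀ z : (Fin d → ℝ) × (Fin d → ℝ), eC (dotW w (P z)) * H (T, T') z =
        (x T * (eC (phase Φ w z.1) * psi L T z.1)) *
            (y T' * (eC (phase Φ w z.2) * psi L T' z.2)) := by
      intro z
      have : dotW w (P z) = phase Φ w z.1 + phase Φ w z.2 := by
        rw [phase_eq_dotW, phase_eq_dotW, ← dotW_add_right]; rfl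
      rw [this, eC_add]; ring
    unfold osc
    simp_rw [e]
    rw [integral_prod_mul (fun ξ => x T * (eC (phase Φ w ξ) * psi L T ξ))
      (fun ξ => y T' * (eC (phase Φ w ξ) * psi L T' ξ)), integral_const_mul, integral_const_mul]
    rfl
  simp_rw [h2] at h1
  refine h1.trans_eq ?_
  congr 1
  rw [mul_assoc (C * L ^ (d + k))]
  congr 1
  rw [Finset.mul_sum]
  refine Finset.sum_congr rfl fun i _ => ?_
  rw [Finset.mul_sum]
  refine Finset.sum_congr rfl fun j _ => ?_
  split_ifs
  · ring
  · simp

lemma exists_lintegral_packSum_sq_le (d k : ℕ) : ∃ C : ℝ, 0 < C ∧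
    ∀ (Φ : (Fin d → ℝ) → Fin k → ℝ) (_ : Continuous Φ) (L Λ : ℝ) (_ : 0 < L) (_ : 1 ≤ Λ)
      (w₀ : (Fin d → ℝ) × (Fin k → ℝ)) (M : Finset (Fin d → ℤ)) (q : (Fin d → ℤ) × (Fin k → ℤ))
      (x : (Fin d → ℤ) × (Fin d → ℤ) → ℂ),
      ∫⁻ w in Metric.closedBall w₀ L, ‖packSum Φ L (nearSet Φ L Λ M q) x w‖ₑ ^ 2 ≤
        ENNReal.ofReal (C * L ^ (d + k) * (L⁻¹ ^ d) ^ 2 * Λ ^ d *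
          ∑ T ∈ nearSet Φ L Λ M q, ‖x T‖ ^ 2) := by
  classical
  obtain ⟨C, hC, h⟩ := exists_lintegral_sum_osc_le d k
  refine ⟨C * 36 ^ d, by positivity, fun Φ hΦ L Λ hL hΛ w₀ M q x => ?_⟩
  set N := nearSet Φ L Λ M q
  set R : (Fin d → ℤ) × (Fin d → ℤ) → (Fin d → ℤ) × (Fin d → ℤ) → Prop :=
    fun i j => ‖capPt L i.1 - capPt L j.1‖ ≤ 2 / L with hR
  have h1 := h volume N (fun ξ : Fin d → ℝ => (ξ, Φ ξ)) (by fun_prop) (fun T ξ => x T * psi L T ξ)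
    (fun T _ => (integrable_psi hL T).const_mul _) (fun T => ‖x T‖ * L⁻¹ ^ d) (fun T _ => by
      simp only [norm_mul]
      rw [integral_const_mul]
      exact mul_le_mul_of_nonneg_left (integral_norm_psi_le hL T) (norm_nonneg _)) L hL w₀ R
    (fun i j hij ξ ξ' hξ hξ' => by
      by_contra! hlt
      refine hij ?_
      have e1 := norm_sub_capPt_le_of_psi hL (T := i) (ξ := ξ) fun h0 => hξ (by simp [h0])
      have e2 := norm_sub_capPt_le_of_psi hL (T := j) (ξ := ξ') fun h0 => hξ' (by simp [h0])
      have e3 : ‖ξ - ξ'‖ ≤ 1 / L :=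
        ((norm_fst_le ((ξ, Φ ξ) - (ξ', Φ ξ'))).trans_lt hlt).le
      have e4 : capPt L i.1 - capPt L j.1 =
        (ξ - ξ') - (ξ - capPt L i.1) + (ξ' - capPt L j.1) := by abel
      rw [hR]; simp only
      rw [e4]
      refine ((norm_add_le _ _).trans (add_le_add ((norm_sub_le _ _).trans
        (add_le_add e3 e1)) e2)).trans_eq ?_
      rw [← div_div]; ring)
  have h2 : ∀ w, ∑ T ∈ N, osc volume (fun ξ : Fin d → ℝ => (ξ, Φ ξ)) (fun ξ => x T * psi L T ξ) w =
      packSum Φ L N x w := by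
    intro w
    refine Finset.sum_congr rfl fun T _ => ?_
    rw [exOp, ← integral_const_mul]
    unfold osc
    congr 1; ext ξ
    rw [phase_eq_dotW]; ring
  simp_rw [h2] at h1
  refine h1.trans (ENNReal.ofReal_le_ofReal ?_)
  have h3 : ∑ i ∈ N, ∑ j ∈ N, (if R i j then (‖x i‖ * L⁻¹ ^ d) * (‖x j‖ * L⁻¹ ^ d) else 0) ≤
      ∑ i ∈ N, ∑ j ∈ N, if R i j then (‖x i‖ * L⁻¹ ^ d) ^ 2 else 0 :=
    sum_sum_resonant_le N R (fun i j hij => by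
      simp only [hR] at hij ⊢; rwa [norm_sub_rev]) _ _ fun i _ j _ => by
        nlinarith [sq_nonneg (‖x i‖ * L⁻¹ ^ d - ‖x j‖ * L⁻¹ ^ d)]
  have h4 : ∀ i ∈ N, ∑ j ∈ N, (if R i j then (‖x i‖ * L⁻¹ ^ d) ^ 2 else 0) ≤
      (36 * Λ) ^ d * (‖x i‖ * L⁻¹ ^ d) ^ 2 := by
    intro i _
    rw [← Finset.sum_filter, Finset.sum_const, nsmul_eq_mul]
    refine mul_le_mul_of_nonneg_right ?_ (sq_nonneg _)
    have hsub : N.filter (R i) ⊆ nearSet Φ L Λ (intWindow (rv i.1) 4) q := by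
      intro j hj
      rw [Finset.mem_filter, mem_nearSet (by linarith)] at hj
      rw [mem_nearSet (by linarith), mem_intWindow (by norm_num), norm_sub_rev, norm_rv_sub_rv hL]
      refine ⟨?_, hj.1.2⟩
      calc 2 * L * ‖capPt L i.1 - capPt L j.1‖ ≤ 2 * L * (2 / L) := by gcongr; exact hj.2
        _ = 4 := by field_simp; norm_num
    calc ((N.filter (R i)).card : ℝ) ≤ _ := Nat.cast_le.2 (Finset.card_le_card hsub)
      _ ≤ (intWindow (rv i.1) 4).card * (3 * Λ) ^ d := card_nearSet_le Φ L hΛ _ q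
      _ ≤ (3 * 4) ^ d * (3 * Λ) ^ d := by
          gcongr; exact card_intWindow_le _ (by norm_num)
      _ = (36 * Λ) ^ d := by rw [← mul_pow]; ring_nf
  calc C * L ^ (d + k) * ∑ i ∈ N, ∑ j ∈ N,
        (if R i j then (‖x i‖ * L⁻¹ ^ d) * (‖x j‖ * L⁻¹ ^ d) else 0)
      ≤ C * L ^ (d + k) * ∑ i ∈ N, (36 * Λ) ^ d * (‖x i‖ * L⁻¹ ^ d) ^ 2 := by
        exact mul_le_mul_of_nonneg_left (h3.trans (Finset.sum_le_sum h4)) (by positivity)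
    _ = _ := by
        rw [← Finset.mul_sum]
        simp only [mul_pow]
        rw [← Finset.sum_mul]; ring

end PacketSums

section Tails

variable {d k : ℕ}

/-- The `L²` norm as a real number. -/
def l2 (f : (Fin d → ℝ) → ℂ) : ℝ := √(∫ ξ, ‖f ξ‖ ^ 2)

lemma l2_nonneg (f : (Fin d → ℝ) → ℂ) : 0 ≤ l2 f := Real.sqrt_nonneg _

lemma l2_sq (f : (Fin d → ℝ) → ℂ) : l2 f ^ 2 = ∫ ξ, ‖f ξ‖ ^ 2 :=
  Real.sq_sqrt (integral_nonneg fun _ => sq_nonneg _)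

lemma exists_le_posVec {Φ : (Fin d → ℝ) → Fin k → ℝ} {L Λ B : ℝ} (hL : 0 < L)
    (hB : 0 ≤ B) (hΛ : 2 * (1 + B) ≤ Λ) {T : (Fin d → ℤ) × (Fin d → ℤ)}
    (hg : ∀ s, ‖grT Φ s (capPt L T.1)‖ ≤ B * ‖s‖) {q : (Fin d → ℤ) × (Fin k → ℤ)}
    (hT : ¬ Inc Φ L Λ q T) {w : (Fin d → ℝ) × (Fin k → ℝ)}
    (hw : w ∈ Metric.closedBall (L • rv q.1, L • rv q.2) L) :
    ∃ i, Λ / 2 ≤ |posVec Φ L T w i| := by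
  by_contra! hlt
  refine hT ?_
  have h1 : ‖posVec Φ L T w‖ ≤ Λ / 2 :=
    (pi_norm_le_iff_of_nonneg (by linarith)).2 fun i => (hlt i).le
  rw [mem_closedBall_iff_norm, Prod.norm_def, max_le_iff] at hw
  have h2 : rv q.1 + rv T.2 + grT Φ (rv q.2) (capPt L T.1) = posVec Φ L T w -
      L⁻¹ • (w.1 - L • rv q.1) - grT Φ (L⁻¹ • (w.2 - L • rv q.2)) (capPt L T.1) := by
    ext i
    simp only [posVec, grT, Pi.add_apply, Pi.sub_apply, Pi.smul_apply, smul_eq_mul, rv]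
    have : ∑ j, L⁻¹ * (w.2 j - L * (q.2 j : ℝ)) * gradPhi d (fun x => Φ x j) (capPt L T.1) i =
        L⁻¹ * ∑ j, w.2 j * gradPhi d (fun x => Φ x j) (capPt L T.1) i -
        ∑ j, (q.2 j : ℝ) * gradPhi d (fun x => Φ x j) (capPt L T.1) i := by
      rw [Finset.mul_sum, ← Finset.sum_sub_distrib]
      refine Finset.sum_congr rfl fun j _ => ?_
      field_simp
    rw [this]
    field_simp
    ring
  have h3 : ‖L⁻¹ • (w.1 - L • rv q.1)‖ ≤ 1 := by
    rw [norm_smul, Real.norm_of_nonneg (by positivity), inv_mul_le_iff₀ hL, mul_one]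
    exact hw.1
  have h4 : ‖L⁻¹ • (w.2 - L • rv q.2)‖ ≤ 1 := by
    rw [norm_smul, Real.norm_of_nonneg (by positivity), inv_mul_le_iff₀ hL, mul_one]
    exact hw.2
  unfold Inc
  rw [h2]
  have h5 := (hg _).trans (mul_le_mul_of_nonneg_left h4 hB)
  have := norm_sub_le (posVec Φ L T w - L⁻¹ • (w.1 - L • rv q.1))
    (grT Φ (L⁻¹ • (w.2 - L • rv q.2)) (capPt L T.1))
  have := norm_sub_le (posVec Φ L T w) (L⁻¹ • (w.1 - L • rv q.1))
  linarith

lemma exists_norm_packSum_far_le {Φ : (Fin d → ℝ) → Fin k → ℝ} (hΦ : ContDiff ℝ (⊤ : ℕ∞) Φ)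
    (ν : Fin d → ℝ) : ∃ r Λ₀ : ℝ, 0 < r ∧ r ≤ 1 ∧ 1 ≤ Λ₀ ∧ ∀ N : ℕ, ∃ C : ℝ, 0 < C ∧
    ∀ L Λ : ℝ, 1 ≤ L → Λ₀ ≤ Λ → ∀ ρ : ℝ, 0 ≤ ρ → ρ + 1 / (2 * L) ≤ r →
    ∀ f : (Fin d → ℝ) → ℂ, MemLp f 2 →
    ∀ q : (Fin d → ℤ) × (Fin k → ℤ), ‖rv q.2‖ ≤ L →
    ∀ w ∈ Metric.closedBall (L • rv q.1, L • rv q.2) L,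
    ∀ (S : Finset ((Fin d → ℤ) × (Fin d → ℤ))) (c : (Fin d → ℤ) × (Fin d → ℤ) → ℂ),
    (∀ T ∈ S, T.1 ∈ freqSet L ν ρ ∧ ¬ Inc Φ L Λ q T) → (∀ T, ‖c T‖ ≤ ‖coef L f T‖) →
    Λ ^ N * ‖packSum Φ L S c w‖ ≤ C * L ^ d * l2 f := by
  classical
  obtain ⟨r, B, hr, hB, hrB⟩ := exists_ball_bounds hΦ ν
  refine ⟨min r 1, 2 * (1 + B), by positivity, min_le_right _ _, by linarith, fun N => ?_⟩
  obtain ⟨C, hC, h⟩ := exists_sum_norm_sq_exOp_psi_le hΦ (‖ν‖ + r) 2 N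
  set D := 4 ^ N * 7 ^ d * C with hD
  have hD0 : 0 < D := by positivity
  refine ⟨D + 1, by positivity, fun L Λ hL hΛ ρ hρ hρr f hf q hq w hw S c hS hc => ?_⟩
  have hL0 : 0 < L := by linarith
  have hΛ0 : 0 < Λ := by linarith
  have hw2 : ‖w.2‖ ≤ 2 * L ^ 2 := by
    rw [mem_closedBall_iff_norm, Prod.norm_def, max_le_iff] at hw
    have e1 : ‖w.2‖ ≤ ‖w.2 - L • rv q.2‖ + ‖L • rv q.2‖ := by
      simpa using norm_add_le (w.2 - L • rv q.2) (L • rv q.2)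
    rw [norm_smul, Real.norm_of_nonneg hL0.le] at e1
    have e2 : ‖w.2 - L • rv q.2‖ ≤ L := hw.2
    nlinarith
  have hcap : ∀ m ∈ freqSet L ν ρ, ‖capPt L m - ν‖ ≤ r := fun m hm =>
    ((mem_freqSet hL0 hρ).1 hm).trans (hρr.trans (min_le_left _ _))
  have h1 : ∀ m ∈ freqSet L ν ρ,
      (Λ / 2) ^ (2 * N) * ∑ T ∈ S with T.1 = m, ‖exOp Φ (psi L T) w‖ ^ 2 ≤ C := by
    intro m hm
    have e : ∑ T ∈ S with T.1 = m, ‖exOp Φ (psi L T) w‖ ^ 2 =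
        ∑ ℓ ∈ (S.filter fun T => T.1 = m).image Prod.snd, ‖exOp Φ (psi L (m, ℓ)) w‖ ^ 2 := by
      rw [Finset.sum_image]
      · refine Finset.sum_congr rfl fun T hT => ?_
        rw [Finset.mem_filter] at hT
        rw [← hT.2]
      · intro T hT T' hT' hTT
        simp only [Finset.coe_filter, Set.mem_ofPred_eq] at hT hT'
        exact Prod.ext (hT.2.trans hT'.2.symm) hTT
    rw [e]
    refine h L hL m ?_ w hw2 (Λ / 2) (by positivity) _ fun ℓ hℓ => ?_
    · have := norm_add_le (capPt L m - ν) ν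
      rw [sub_add_cancel] at this
      linarith [hcap m hm]
    · obtain ⟨T, hT, rfl⟩ := Finset.mem_image.1 hℓ
      rw [Finset.mem_filter] at hT
      obtain ⟨hT, rfl⟩ := hT
      exact exists_le_posVec hL0 (by linarith) hΛ (fun s => (hrB _ (hcap _ (hS T hT).1)).1 s)
        (hS T hT).2 hw
  have h2 : (Λ / 2) ^ (2 * N) * ∑ T ∈ S, ‖exOp Φ (psi L T) w‖ ^ 2 ≤ (7 * L) ^ d * C := by
    rw [← Finset.sum_fiberwise_of_maps_to (fun T hT => (hS T hT).1), Finset.mul_sum]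
    refine (Finset.sum_le_sum h1).trans ?_
    rw [Finset.sum_const, nsmul_eq_mul]
    refine mul_le_mul_of_nonneg_right (card_freqSet_le hL ν ?_) hC.le
    have : 0 ≤ 1 / (2 * L) := by positivity
    linarith [min_le_right r 1]
  have h3 : ‖packSum Φ L S c w‖ ^ 2 ≤ (L ^ d * l2 f ^ 2) * ∑ T ∈ S, ‖exOp Φ (psi L T) w‖ ^ 2 := by
    calc ‖packSum Φ L S c w‖ ^ 2 ≤ (∑ T ∈ S, ‖c T‖ * ‖exOp Φ (psi L T) w‖) ^ 2 := by
          gcongr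
          refine (norm_sum_le _ _).trans_eq (by simp)
      _ ≤ _ := Finset.sum_mul_sq_le_sq_mul_sq _ _ _
      _ ≤ _ := by
          gcongr
          rw [l2_sq]
          refine (Finset.sum_le_sum fun T _ => ?_).trans (sum_norm_sq_coef_le hL0 hf S)
          gcongr
          exact hc T
  refine le_of_sq_le_sq ?_ (by have := l2_nonneg f; positivity)
  calc (Λ ^ N * ‖packSum Φ L S c w‖) ^ 2 =
      4 ^ N * ((Λ / 2) ^ (2 * N) * ‖packSum Φ L S c w‖ ^ 2) := by
        rw [div_pow, pow_mul 2]; norm_num; field_simp; ring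
    _ ≤ 4 ^ N * ((Λ / 2) ^ (2 * N) *
        ((L ^ d * l2 f ^ 2) * ∑ T ∈ S, ‖exOp Φ (psi L T) w‖ ^ 2)) := by gcongr
    _ = 4 ^ N * (L ^ d * l2 f ^ 2) *
        ((Λ / 2) ^ (2 * N) * ∑ T ∈ S, ‖exOp Φ (psi L T) w‖ ^ 2) := by ring
    _ ≤ 4 ^ N * (L ^ d * l2 f ^ 2) * ((7 * L) ^ d * C) := by gcongr
    _ = D * (L ^ d * l2 f) ^ 2 := by rw [hD, mul_pow 7]; ring
    _ ≤ (D + 1) ^ 2 * (L ^ d * l2 f) ^ 2 := by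
        gcongr; nlinarith
    _ = _ := by ring

lemma norm_exOp_sub_packSum_near_le {Φ : (Fin d → ℝ) → Fin k → ℝ} (hΦ : Continuous Φ)
    {L Λ ρ D : ℝ} {ν : Fin d → ℝ} (hL : 0 < L) (hΛ : 0 ≤ Λ) (hρ : 0 ≤ ρ)
    {f : (Fin d → ℝ) → ℂ} (hf : MemLp f 2) (hfs : ∀ ξ, f ξ ≠ 0 → ‖ξ - ν‖ ≤ ρ)
    {q : (Fin d → ℤ) × (Fin k → ℤ)} {w : (Fin d → ℝ) × (Fin k → ℝ)}
    (h : ∀ S : Finset ((Fin d → ℤ) × (Fin d → ℤ)),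
      (∀ T ∈ S, T.1 ∈ freqSet L ν ρ ∧ ¬ Inc Φ L Λ q T) → ‖packSum Φ L S (coef L f) w‖ ≤ D) :
    ‖exOp Φ f w - packSum Φ L (nearSet Φ L Λ (freqSet L ν ρ) q) (coef L f) w‖ ≤ D := by
  classical
  set N := nearSet Φ L Λ (freqSet L ν ρ) q with hN
  have ht := ((hasSum_exOp hL hf hρ hfs hΦ w).sub_const
    (packSum Φ L N (coef L f) w)).norm
  refine le_of_tendsto ht ?_
  filter_upwards [Filter.eventually_ge_atTop (N.image Prod.snd)] with F hF
  have e : ∑ ℓ ∈ F, ∑ m ∈ freqSet L ν ρ, coef L f (m, ℓ) * exOp Φ (psi L (m, ℓ)) w -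
      packSum Φ L N (coef L f) w = packSum Φ L ((freqSet L ν ρ ×ˢ F) \ N) (coef L f) w := by
    rw [sub_eq_iff_eq_add, Finset.sum_comm, ← Finset.sum_product']
    refine (Finset.sum_sdiff ?_).symm
    intro T hT
    rw [Finset.mem_product]
    exact ⟨((mem_nearSet hΛ).1 hT).1, hF (Finset.mem_image_of_mem _ hT)⟩
  rw [e]
  refine h _ fun T hT => ?_
  rw [Finset.mem_sdiff, Finset.mem_product, mem_nearSet hΛ] at hT
  exact ⟨hT.1.1, fun hi => hT.2 ⟨hT.1.1, hi⟩⟩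

end Tails

section Cells

variable {d k : ℕ}

/-- The index of the cell of side `L` containing `w`. -/
def cellOf (L : ℝ) (w : (Fin d → ℝ) × (Fin k → ℝ)) : (Fin d → ℤ) × (Fin k → ℤ) :=
  (fun i => ⌊w.1 i / L⌋, fun j => ⌊w.2 j / L⌋)

lemma measurable_cellOf (L : ℝ) :
    Measurable (cellOf L : (Fin d → ℝ) × (Fin k → ℝ) → (Fin d → ℤ) × (Fin k → ℤ)) := by
  unfold cellOf
  refine Measurable.prodMk ?_ ?_ <;>
  exact measurable_pi_lambda _ fun i => Int.measurable_floor.comp (by fun_prop)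

lemma mem_closedBall_cellOf {L : ℝ} (hL : 0 < L) (w : (Fin d → ℝ) × (Fin k → ℝ)) :
    w ∈ Metric.closedBall (L • rv (cellOf L w).1, L • rv (cellOf L w).2) L := by
  have h : ∀ x : ℝ, ‖x - L * (⌊x / L⌋ : ℝ)‖ ≤ L := by
    intro x
    have h1 := Int.floor_le (x / L)
    have h2 := Int.lt_floor_add_one (x / L)
    rw [le_div_iff₀ hL] at h1
    rw [div_lt_iff₀ hL] at h2
    rw [Real.norm_eq_abs, abs_le]
    constructor <;> nlinarith
  rw [mem_closedBall_iff_norm, Prod.norm_def, max_le_iff]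
  exact ⟨(pi_norm_le_iff_of_nonneg hL.le).2 fun i => h _,
    (pi_norm_le_iff_of_nonneg hL.le).2 fun i => h _⟩

lemma cellOf_mem_intWindow {L : ℝ} (hL : 2 ≤ L) {w : (Fin d → ℝ) × (Fin k → ℝ)}
    (hw : w ∈ Metric.closedBall 0 (L ^ 2 / 2)) :
    cellOf L w ∈ intWindow (0 : Fin d → ℝ) L ×ˢ intWindow (0 : Fin k → ℝ) L := by
  have h : ∀ x : ℝ, ‖x‖ ≤ L ^ 2 / 2 → ‖(⌊x / L⌋ : ℝ)‖ ≤ L := by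
    intro x hx
    have h1 := Int.floor_le (x / L)
    have h2 := Int.lt_floor_add_one (x / L)
    have h3 : |x / L| ≤ L / 2 := by
      rw [abs_div, abs_of_pos (by linarith : 0 < L), div_le_iff₀ (by linarith)]
      rw [Real.norm_eq_abs] at hx; linarith
    rw [abs_le] at h3
    rw [Real.norm_eq_abs, abs_le]
    constructor <;> linarith
  rw [mem_closedBall_zero_iff, Prod.norm_def, max_le_iff] at hw
  rw [Finset.mem_product, mem_intWindow (by linarith), mem_intWindow (by linarith),
      sub_zero, sub_zero]
  exact ⟨(pi_norm_le_iff_of_nonneg (by linarith)).2 fun i => h _ ((norm_le_pi_norm _ _).trans hw.1),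
    (pi_norm_le_iff_of_nonneg (by linarith)).2 fun i => h _ ((norm_le_pi_norm _ _).trans hw.2)⟩

lemma lintegral_cells (L : ℝ) (𝒢 : Finset ((Fin d → ℤ) × (Fin k → ℤ)))
    (F : (Fin d → ℤ) × (Fin k → ℤ) → (Fin d → ℝ) × (Fin k → ℝ) → ℝ≥0∞) :
    ∫⁻ w in cellOf L ⁻¹' 𝒢, F (cellOf L w) w = ∑ q ∈ 𝒢, ∫⁻ w in cellOf L ⁻¹' {q}, F q w := by
  have e : (cellOf L ⁻¹' (𝒢 : Set _) : Set ((Fin d → ℝ) × (Fin k → ℝ))) =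
      ⋃ q ∈ 𝒢, cellOf L ⁻¹' {q} := by
    ext w; simp
  rw [e, lintegral_biUnion_finset]
  · refine Finset.sum_congr rfl fun q _ => ?_
    refine setLIntegral_congr_fun (measurable_cellOf L (measurableSet_singleton q)) fun w hw => ?_
    have hw' : cellOf L w = q := hw
    simp only [hw']
  · intro q _ q' _ hqq
    exact Disjoint.preimage _ (Set.disjoint_singleton.2 hqq)
  · exact fun q _ => measurable_cellOf L (measurableSet_singleton q)

lemma measurable_glue (L : ℝ) {E : Type*} [MeasurableSpace E]
    {h : (Fin d → ℤ) × (Fin k → ℤ) → (Fin d → ℝ) × (Fin k → ℝ) → E}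
    (hh : ∀ q, Measurable (h q)) : Measurable fun w => h (cellOf L w) w :=
  (measurable_from_prod_countable_right (f := fun z : ((Fin d → ℤ) × (Fin k → ℤ)) × _ => h z.1 z.2)
    hh).comp ((measurable_cellOf L).prodMk measurable_id)

end Cells

section Blocks

variable {d k : ℕ}

/-- The block of side `N`, translated by `-s`, containing the cell `q`. -/
def blockOf (N s : ℕ) (q : (Fin d → ℤ) × (Fin k → ℤ)) : (Fin d → ℤ) × (Fin k → ℤ) :=
  (fun i => (q.1 i + s) / N, fun j => (q.2 j + s) / N)

/-- The integer `x` is at distance at least `c` from the boundary of its block. -/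
def Deep (N c s : ℕ) (x : ℤ) : Prop := (c : ℤ) ≤ (x + s) % N ∧ (x + s) % N < N - c

/-- The cell `q` is at distance at least `c` from the boundary of its block. -/
def DeepCell (N c s : ℕ) (q : (Fin d → ℤ) × (Fin k → ℤ)) : Prop :=
  (∀ i, Deep N c s (q.1 i)) ∧ ∀ j, Deep N c s (q.2 j)

lemma Deep.le_abs_sub {N c s : ℕ} (hN : 0 < N) {x y : ℤ} (hx : Deep N c s x)
    (hxy : (y + s) / N ≠ (x + s) / N) : (c : ℤ) ≤ |y - x| := by
  obtain ⟨h1, h2⟩ := hx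
  have hN' : (0 : ℤ) < N := by exact_mod_cast hN
  have e1 := Int.mul_ediv_add_emod (x + s) N
  have e2 := Int.mul_ediv_add_emod (y + s) N
  have e3 := Int.emod_nonneg (y + s) hN'.ne'
  have e4 := Int.emod_lt_of_pos (y + s) hN'
  rcases lt_or_gt_of_ne hxy with h | h
  · have : (N : ℤ) * ((y + s) / N + 1) ≤ N * ((x + s) / N) :=
      mul_le_mul_of_nonneg_left (by omega) hN'.le
    rw [mul_add] at this
    exact le_trans (by linarith) (neg_le_abs _)
  · have : (N : ℤ) * ((x + s) / N + 1) ≤ N * ((y + s) / N) :=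
      mul_le_mul_of_nonneg_left (by omega) hN'.le
    rw [mul_add] at this
    exact le_trans (by linarith) (le_abs_self _)

lemma DeepCell.le_norm_sub {N c s : ℕ} (hN : 0 < N) {q q' : (Fin d → ℤ) × (Fin k → ℤ)}
    (hq : DeepCell N c s q) (hqq : blockOf N s q' ≠ blockOf N s q) : (c : ℝ) ≤ ‖q' - q‖ := by
  have key : ∀ x : ℤ, (c : ℤ) ≤ |x| → (c : ℝ) ≤ ‖x‖ := by
    intro x hx
    rw [Int.norm_eq_abs]
    exact_mod_cast hx
  by_contra! hlt
  rw [Prod.norm_def, max_lt_iff] at hlt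
  refine hqq (Prod.ext (funext fun i => ?_) (funext fun j => ?_))
  · by_contra hne
    have h1 := key _ ((hq.1 i).le_abs_sub hN hne)
    have h2 := norm_le_pi_norm (q' - q).1 i
    exact absurd (h1.trans h2) (not_le.2 hlt.1)
  · by_contra hne
    have h1 := key _ ((hq.2 j).le_abs_sub hN hne)
    have h2 := norm_le_pi_norm (q' - q).2 j
    exact absurd (h1.trans h2) (not_le.2 hlt.2)

open Classical in
lemma card_not_deep_le {N c : ℕ} (hN : 0 < N) (hc : c ≤ N) (x : ℤ) :
    ((Finset.range N).filter fun s => ¬ Deep N c s x).card ≤ 2 * c := by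
  have hN' : (0 : ℤ) < N := by exact_mod_cast hN
  calc _ ≤ (Finset.range c ∪ Finset.Ico (N - c) N).card := by
        refine Finset.card_le_card_of_injOn (fun s => ((x + s) % N).toNat) ?_ ?_
        · intro s hs
          simp only [Finset.coe_filter, Set.mem_ofPred_eq, Deep, not_and_or, not_le, not_lt] at hs
          have e3 := Int.emod_nonneg (x + s) hN'.ne'
          have e4 := Int.emod_lt_of_pos (x + s) hN'
          simp only [Finset.coe_union, Finset.coe_range, Finset.coe_Ico, Set.mem_union, Set.mem_Iio,
            Set.mem_Ico]
          omega
        · intro s hs s' hs' hss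
          simp only [Finset.coe_filter, Set.mem_ofPred_eq, Finset.mem_range] at hs hs'
          have e1 := Int.emod_nonneg (x + s) hN'.ne'
          have e2 := Int.emod_nonneg (x + s') hN'.ne'
          have e3 : (x + s) % N = (x + s') % N := by
            simp only at hss; omega
          have e4 : ((s : ℤ)) % N = (s' : ℤ) % N := by
            have := Int.ModEq.add_left_cancel' x (show x + s ≡ x + s' [ZMOD N] from e3)
            exact this
          rw [Int.emod_eq_of_lt (by omega) (by omega),
              Int.emod_eq_of_lt (by omega) (by omega)] at e4
          exact_mod_cast e4
    _ ≤ c + c := by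
        refine (Finset.card_union_le _ _).trans ?_
        rw [Finset.card_range, Nat.card_Ico]; omega
    _ = 2 * c := by ring

open Classical in
lemma card_not_deepCell_le {N c : ℕ} (hN : 0 < N) (hc : c ≤ N)
    (q : (Fin d → ℤ) × (Fin k → ℤ)) :
    ((Finset.range N).filter fun s => ¬ DeepCell N c s q).card ≤ 2 * (d + k) * c := by
  have h : ((Finset.range N).filter fun s => ¬ DeepCell N c s q) ⊆
      (Finset.univ.biUnion fun i => (Finset.range N).filter fun s => ¬ Deep N c s (q.1 i)) ∪
      Finset.univ.biUnion fun j => (Finset.range N).filter fun s => ¬ Deep N c s (q.2 j) := by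
    intro s hs
    simp only [Finset.mem_filter, DeepCell, not_and_or, not_forall] at hs
    simp only [Finset.mem_union, Finset.mem_biUnion, Finset.mem_univ, true_and, Finset.mem_filter]
    rcases hs with ⟨h1, ⟨i, hi⟩ | ⟨j, hj⟩⟩
    · exact Or.inl ⟨i, h1, hi⟩
    · exact Or.inr ⟨j, h1, hj⟩
  refine (Finset.card_le_card h).trans ((Finset.card_union_le _ _).trans ?_)
  refine (add_le_add (Finset.card_biUnion_le_card_mul _ _ _ fun i _ => card_not_deep_le hN hc _)
    (Finset.card_biUnion_le_card_mul _ _ _ fun i _ => card_not_deep_le hN hc _)).trans_eq ?_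
  simp only [Finset.card_univ, Fintype.card_fin]; ring

open Classical in
/-- Averaging over translations of the block decomposition: some translation has little mass near
the boundaries of the blocks. -/
lemma exists_shift {N c : ℕ} (hN : 0 < N) (hc : c ≤ N)
    (𝒬 : Finset ((Fin d → ℤ) × (Fin k → ℤ))) (I : (Fin d → ℤ) × (Fin k → ℤ) → ℝ)
    (hI : ∀ q, 0 ≤ I q) :
    ∃ s : ℕ, N * ∑ q ∈ 𝒬 with ¬ DeepCell N c s q, I q ≤ 2 * (d + k) * c * ∑ q ∈ 𝒬, I q := by
  have h : ∑ s ∈ Finset.range N, N * ∑ q ∈ 𝒬 with ¬ DeepCell N c s q, I q ≤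
      ∑ s ∈ Finset.range N, 2 * (d + k) * c * ∑ q ∈ 𝒬, I q := by
    rw [Finset.sum_const, Finset.card_range, nsmul_eq_mul, ← Finset.mul_sum]
    refine mul_le_mul_of_nonneg_left ?_ (Nat.cast_nonneg _)
    simp only [Finset.sum_filter]
    rw [Finset.sum_comm, Finset.mul_sum]
    refine Finset.sum_le_sum fun q _ => ?_
    rw [← Finset.sum_filter, Finset.sum_const, nsmul_eq_mul]
    refine mul_le_mul_of_nonneg_right ?_ (hI q)
    exact_mod_cast card_not_deepCell_le hN hc q
  obtain ⟨s, -, hs⟩ := Finset.exists_le_of_sum_le (Finset.nonempty_range_iff.2 hN.ne') h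
  exact ⟨s, hs⟩

/-- Each block is contained in a ball. -/
lemma exists_closedBall_block {L : ℝ} (hL : 0 < L) {N : ℕ} (hN : 0 < N) (s : ℕ)
    (β : (Fin d → ℤ) × (Fin k → ℤ)) : ∃ w₀ : (Fin d → ℝ) × (Fin k → ℝ),
    ∀ w, blockOf N s (cellOf L w) = β → w ∈ Metric.closedBall w₀ (N * L / 2) := by
  refine ⟨(fun i => L * (N * β.1 i - s + N / 2), fun j => L * (N * β.2 j - s + N / 2)),
    fun w hw => ?_⟩
  have hN' : (0 : ℤ) < N := by exact_mod_cast hN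
  have key : ∀ (x : ℝ) (b : ℤ), (⌊x / L⌋ + s) / N = b →
      ‖x - L * (N * b - s + N / 2)‖ ≤ N * L / 2 := by
    intro x b hb
    have e1 := Int.mul_ediv_add_emod (⌊x / L⌋ + s) N
    have e3 := Int.emod_nonneg (⌊x / L⌋ + s) hN'.ne'
    have e4 := Int.emod_lt_of_pos (⌊x / L⌋ + s) hN'
    rw [hb] at e1
    have h1 : (N * b - s : ℤ) ≤ x / L :=
      (Int.cast_le.2 (by linarith : (N * b - s : ℤ) ≤ ⌊x / L⌋)).trans (Int.floor_le _)
    have h2 : x / L < (N * b - s + N : ℤ) :=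
      (Int.lt_floor_add_one _).trans_le (by
        exact_mod_cast (by omega : ⌊x / L⌋ + 1 ≤ N * b - s + N))
    push_cast at h1 h2
    rw [le_div_iff₀ hL] at h1
    rw [div_lt_iff₀ hL] at h2
    rw [Real.norm_eq_abs, abs_le]
    constructor <;> nlinarith
  have hNL : 0 ≤ N * L / 2 := by positivity
  rw [mem_closedBall_iff_norm, Prod.norm_def, max_le_iff]
  refine ⟨(pi_norm_le_iff_of_nonneg hNL).2 fun i => key _ _ (congrFun (congrArg Prod.fst hw) i),
    (pi_norm_le_iff_of_nonneg hNL).2 fun i => key _ _ (congrFun (congrArg Prod.snd hw) i)⟩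

end Blocks

section OffDiagonal

variable {d k : ℕ}

/-- All tubes with frequency in `M` passing near some cube of `𝒬`. -/
def tubeSet (Φ : (Fin d → ℝ) → Fin k → ℝ) (L Λ : ℝ) (M : Finset (Fin d → ℤ))
    (𝒬 : Finset ((Fin d → ℤ) × (Fin k → ℤ))) : Finset ((Fin d → ℤ) × (Fin d → ℤ)) :=
  open Classical in 𝒬.biUnion (nearSet Φ L Λ M)

lemma nearSet_subset_tubeSet {Φ : (Fin d → ℝ) → Fin k → ℝ} {L Λ : ℝ} {M : Finset (Fin d → ℤ)}
    {𝒬 : Finset ((Fin d → ℤ) × (Fin k → ℤ))} {q : (Fin d → ℤ) × (Fin k → ℤ)} (hq : q ∈ 𝒬) :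
    nearSet Φ L Λ M q ⊆ tubeSet Φ L Λ M 𝒬 := by
  classical
  exact Finset.subset_biUnion_of_mem (nearSet Φ L Λ M) hq

lemma fst_mem_of_mem_tubeSet {Φ : (Fin d → ℝ) → Fin k → ℝ} {L Λ : ℝ} (hΛ : 0 ≤ Λ)
    {M : Finset (Fin d → ℤ)} {𝒬 : Finset ((Fin d → ℤ) × (Fin k → ℤ))}
    {T : (Fin d → ℤ) × (Fin d → ℤ)} (hT : T ∈ tubeSet Φ L Λ M 𝒬) : T.1 ∈ M := by
  classical
  obtain ⟨q, -, hq⟩ := Finset.mem_biUnion.1 hT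
  exact ((mem_nearSet hΛ).1 hq).1

open Classical in
lemma exists_sum_resonant_le {Φ : (Fin d → ℝ) → Fin k → ℝ} (hΦ : ContDiff ℝ (⊤ : ℕ∞) Φ)
    {ν₁ ν₂ : Fin d → ℝ} (hc : LocalCond Φ ν₁ ν₂) : ∃ r C : ℝ, 0 < r ∧ 1 ≤ C ∧
    ∀ L Λ : ℝ, 1 ≤ Λ → C * Λ ^ 3 ≤ L → ∀ (𝒬 : Finset ((Fin d → ℤ) × (Fin k → ℤ)))
    (p : (Fin d → ℤ) × (Fin k → ℤ) → Prop) (q₀ : (Fin d → ℤ) × (Fin k → ℤ)),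
    (∀ q ∈ 𝒬, p q → L / Λ ^ 2 ≤ ‖q - q₀‖) → (∀ q ∈ 𝒬, ‖q - q₀‖ ≤ 4 * L) →
    ∀ M₁ M₂ : Finset (Fin d → ℤ), (∀ m ∈ M₁, ‖capPt L m - ν₁‖ ≤ r) →
    (∀ m ∈ M₂, ‖capPt L m - ν₂‖ ≤ r) → ∀ t₁ t₂' t : (Fin d → ℤ) × (Fin d → ℤ),
    t₁.1 ∈ M₁ → t₂'.1 ∈ M₂ → t.1 ∈ M₂ →
    ∑ t₁' ∈ nearSet Φ L Λ M₁ q₀, ∑ t₂ ∈ nearSet Φ L Λ M₂ q₀, ∑ q ∈ 𝒬,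
      (if Res Φ L t₁.1 t₂.1 t₁'.1 t₂'.1 ∧ t₁' ∈ nearSet Φ L Λ M₁ q ∧ p q ∧
        t ∈ nearSet Φ L Λ M₂ q then (1 : ℝ) else 0) ≤ C * Λ ^ (6 * d + k) := by
  obtain ⟨r, C, hr, hC, h⟩ := exists_card_incidence_le hΦ hc
  refine ⟨r, C * 108 ^ d, hr, one_le_mul_of_one_le_of_one_le hC (one_le_pow₀ (by norm_num)),
    fun L Λ hΛ hL 𝒬 p q₀ hsep h4 M₁ M₂ hM₁ hM₂ t₁ t₂' t ht₁ ht₂' ht => ?_⟩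
  have hΛ0 : 0 ≤ Λ := by linarith
  have hL' : C * Λ ^ 3 ≤ L := by
    refine le_trans ?_ hL
    gcongr
    exact le_mul_of_one_le_right (by linarith) (one_le_pow₀ (by norm_num))
  have hL0 : 0 < L := lt_of_lt_of_le (by positivity) hL'
  set N₁ := nearSet Φ L Λ M₁ with hN₁
  set N₂ := nearSet Φ L Λ M₂ with hN₂
  set 𝒮 := (𝒬 ×ˢ N₁ q₀).filter fun x => x.2 ∈ N₁ x.1 ∧ p x.1 ∧ t ∈ N₂ x.1 ∧
    ∃ t₂ ∈ N₂ q₀, Res Φ L t₁.1 t₂.1 x.2.1 t₂'.1 with h𝒮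
  have h1 : (𝒮.card : ℝ) ≤ C * Λ ^ (5 * d + k) := by
    refine h L Λ hΛ hL' 𝒮 q₀ t₁.1 t₂'.1 t (hM₁ _ ht₁) (hM₂ _ ht₂') (hM₂ _ ht) fun x hx => ?_
    rw [h𝒮, Finset.mem_filter, Finset.mem_product, hN₁, hN₂, mem_nearSet hΛ0, mem_nearSet hΛ0,
      mem_nearSet hΛ0] at hx
    obtain ⟨⟨hx1, hx2⟩, hx3, hx4, hx5, t₂, ht₂, hx6⟩ := hx
    exact ⟨hx5.2, hx3.2, hx2.2, hsep _ hx1 hx4, h4 _ hx1, hM₁ _ hx2.1, t₂.1,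
      hM₂ _ ((mem_nearSet hΛ0).1 ht₂).1, hx6⟩
  have h2 : ∀ x ∈ 𝒮, ∑ t₂ ∈ N₂ q₀, (if Res Φ L t₁.1 t₂.1 x.2.1 t₂'.1 then (1 : ℝ) else 0) ≤
      108 ^ d * Λ ^ d := by
    intro x _
    rw [Finset.sum_boole]
    refine card_completion_le (Φ := Φ) hL0 hΛ q₀ t₁.1 x.2.1 t₂'.1 _ fun T hT => ?_
    rw [Finset.mem_filter, hN₂, mem_nearSet hΛ0] at hT
    exact ⟨hT.1.2, hT.2⟩
  calc _ = ∑ x ∈ 𝒬 ×ˢ N₁ q₀, ∑ t₂ ∈ N₂ q₀,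
        (if Res Φ L t₁.1 t₂.1 x.2.1 t₂'.1 ∧ x.2 ∈ N₁ x.1 ∧ p x.1 ∧
          t ∈ N₂ x.1 then (1 : ℝ) else 0) := by
        rw [Finset.sum_product_right]
        exact Finset.sum_congr rfl fun _ _ => Finset.sum_comm
    _ ≤ ∑ x ∈ 𝒬 ×ˢ N₁ q₀, if x ∈ 𝒮 then (108 : ℝ) ^ d * Λ ^ d else 0 := by
        refine Finset.sum_le_sum fun x hx => ?_
        split_ifs with hxS
        · refine le_trans (Finset.sum_le_sum fun t₂ _ => ?_) (h2 x hxS)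
          split_ifs with h3 h4 h4
          · exact le_rfl
          · exact absurd h3.1 h4
          · exact zero_le_one
          · exact le_rfl
        · refine (Finset.sum_eq_zero fun t₂ ht₂ => if_neg fun h3 => hxS ?_).le
          exact Finset.mem_filter.2 ⟨hx, h3.2.1, h3.2.2.1, h3.2.2.2, t₂, ht₂, h3.1⟩
    _ = 𝒮.card * (108 ^ d * Λ ^ d) := by
        rw [Finset.sum_ite_mem, Finset.inter_eq_right.2 (Finset.filter_subset _ _),
          Finset.sum_const, nsmul_eq_mul]
    _ ≤ C * Λ ^ (5 * d + k) * (108 ^ d * Λ ^ d) := by gcongr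
    _ = _ := by ring

set_option maxHeartbeats 1000000 in
lemma exists_sum_lintegral_offdiag_le {Φ : (Fin d → ℝ) → Fin k → ℝ}
    (hΦ : ContDiff ℝ (⊤ : ℕ∞) Φ) {ν₁ ν₂ : Fin d → ℝ} (hc : LocalCond Φ ν₁ ν₂) :
    ∃ r C : ℝ, 0 < r ∧ 1 ≤ C ∧ ∀ L Λ : ℝ, 1 ≤ Λ → C * Λ ^ 3 ≤ L →
    ∀ (𝒬 𝒢 : Finset ((Fin d → ℤ) × (Fin k → ℤ)))
      (blk : (Fin d → ℤ) × (Fin k → ℤ) → (Fin d → ℤ) × (Fin k → ℤ)), 𝒢 ⊆ 𝒬 →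
    (∀ q₀ ∈ 𝒢, ∀ q ∈ 𝒬, blk q ≠ blk q₀ → L / Λ ^ 2 ≤ ‖q - q₀‖) →
    (∀ q₀ ∈ 𝒢, ∀ q ∈ 𝒬, ‖q - q₀‖ ≤ 4 * L) →
    ∀ M₁ M₂ : Finset (Fin d → ℤ), (∀ m ∈ M₁, ‖capPt L m - ν₁‖ ≤ r) →
    (∀ m ∈ M₂, ‖capPt L m - ν₂‖ ≤ r) → ∀ a b : (Fin d → ℤ) × (Fin d → ℤ) → ℝ,
    (∀ T, 0 ≤ a T) → (∀ T, 0 ≤ b T) →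
    ∀ x y : (Fin d → ℤ) × (Fin k → ℤ) → (Fin d → ℤ) × (Fin d → ℤ) → ℂ,
    (∀ q T, ‖x q T‖ ≤ a T * (1 - share 𝒬 (nearSet Φ L Λ M₁)
      (fun q => ∑ t ∈ nearSet Φ L Λ M₂ q, b t ^ 2) blk (blk q) T)) → (∀ q T, ‖y q T‖ ≤ b T) →
    ∑ q ∈ 𝒢, ∫⁻ w in Metric.closedBall (L • rv q.1, L • rv q.2) L,
      ‖packSum Φ L (nearSet Φ L Λ M₁ q) (x q) w * packSum Φ L (nearSet Φ L Λ M₂ q) (y q) w‖ₑ ^ 2 ≤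
    ENNReal.ofReal (C * L ^ (d + k) * (L⁻¹ ^ d) ^ 4 * Λ ^ (6 * d + k) *
      (∑ T ∈ tubeSet Φ L Λ M₁ 𝒬, a T ^ 2) * ∑ T ∈ tubeSet Φ L Λ M₂ 𝒬, b T ^ 2) := by
  classical
  obtain ⟨r, C, hr, hC, h⟩ := exists_sum_resonant_le hΦ hc
  obtain ⟨C', hC', h'⟩ := exists_lintegral_packSum_mul_le d k
  refine ⟨r, C * (C' + 1), hr, one_le_mul_of_one_le_of_one_le hC (by linarith),
    fun L Λ hΛ hL 𝒬 𝒢 blk h𝒢 hsep h4 M₁ M₂ hM₁ hM₂ a b ha hb x y hx hy => ?_⟩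
  have hΛ0 : 0 ≤ Λ := by linarith
  have hL' : C * Λ ^ 3 ≤ L := by
    refine le_trans ?_ hL
    gcongr
    exact le_mul_of_one_le_right (by linarith) (by linarith)
  have hL0 : 0 < L := lt_of_lt_of_le (by positivity) hL'
  set N₁ := nearSet Φ L Λ M₁ with hN₁
  set N₂ := nearSet Φ L Λ M₂ with hN₂
  set w : (Fin d → ℤ) × (Fin k → ℤ) → ℝ := fun q => ∑ t ∈ N₂ q, b t ^ 2 with hw
  have hw0 : ∀ q, 0 ≤ w q := fun q => Finset.sum_nonneg fun _ _ => sq_nonneg _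
  have hsh : ∀ B T, 0 ≤ 1 - share 𝒬 N₁ w blk B T := fun B T =>
    sub_nonneg.2 (share_le_one hw0 B T)
  have hcore := sum_offdiagonal_le (w := w) 𝒢 h𝒢 N₂ (tubeSet Φ L Λ M₁ 𝒬) (tubeSet Φ L Λ M₂ 𝒬)
    (blk := blk) (N := N₁) (fun q hq => nearSet_subset_tubeSet hq)
    (fun q hq => nearSet_subset_tubeSet hq) a b
    ha hb hw (fun i j => Res Φ L i.1.1 i.2.1 j.1.1 j.2.1) (fun i j hij => hij.symm)
    (X := C * Λ ^ (6 * d + k)) (by positivity) fun q₀ hq₀ t₁ ht₁ t₂' ht₂' t ht => by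
      refine le_of_eq_of_le ?_ (h L Λ hΛ hL' 𝒬 (fun q => blk q ≠ blk q₀) q₀ (hsep q₀ hq₀)
        (h4 q₀ hq₀) M₁ M₂ hM₁ hM₂ t₁ t₂' t ((mem_nearSet hΛ0).1 ht₁).1
        ((mem_nearSet hΛ0).1 ht₂').1 (fst_mem_of_mem_tubeSet hΛ0 ht))
      exact Finset.sum_congr rfl fun _ _ => Finset.sum_congr rfl fun _ _ =>
        Finset.sum_congr rfl fun _ _ => by congr
  have hK : 0 ≤ C' * L ^ (d + k) * (L⁻¹ ^ d) ^ 4 := by positivity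
  calc _ ≤ ∑ q ∈ 𝒢, ENNReal.ofReal (C' * L ^ (d + k) * (L⁻¹ ^ d) ^ 4 *
        ∑ i ∈ N₁ q ×ˢ N₂ q, ∑ j ∈ N₁ q ×ˢ N₂ q,
          if Res Φ L i.1.1 i.2.1 j.1.1 j.2.1 then
            (a i.1 * (1 - share 𝒬 N₁ w blk (blk q) i.1) * b i.2) *
            (a j.1 * (1 - share 𝒬 N₁ w blk (blk q) j.1) * b j.2) else 0) := by
        refine Finset.sum_le_sum fun q _ =>
            (h' Φ hΦ.continuous L hL0 _ (N₁ q) (N₂ q) (x q) (y q)).trans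
          (ENNReal.ofReal_le_ofReal (mul_le_mul_of_nonneg_left
            (Finset.sum_le_sum fun i _ => Finset.sum_le_sum fun j _ => ?_) hK))
        have e := fun i : ((Fin d → ℤ) × (Fin d → ℤ)) × ((Fin d → ℤ) × (Fin d → ℤ)) =>
          mul_le_mul (hx q i.1) (hy q i.2) (norm_nonneg _) (mul_nonneg (ha i.1) (hsh (blk q) i.1))
        split_ifs
        · exact mul_le_mul (e i) (e j) (by positivity)
            (mul_nonneg (mul_nonneg (ha i.1) (hsh (blk q) i.1)) (hb _))
        · exact le_rfl
    _ = ENNReal.ofReal (C' * L ^ (d + k) * (L⁻¹ ^ d) ^ 4 * ∑ q ∈ 𝒢,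
        ∑ i ∈ N₁ q ×ˢ N₂ q, ∑ j ∈ N₁ q ×ˢ N₂ q,
          if Res Φ L i.1.1 i.2.1 j.1.1 j.2.1 then
            (a i.1 * (1 - share 𝒬 N₁ w blk (blk q) i.1) * b i.2) *
            (a j.1 * (1 - share 𝒬 N₁ w blk (blk q) j.1) * b j.2) else 0) := by
        rw [Finset.mul_sum, ENNReal.ofReal_sum_of_nonneg]
        intro q _
        refine mul_nonneg hK (Finset.sum_nonneg fun i _ => Finset.sum_nonneg fun j _ => ?_)
        have e := fun i : ((Fin d → ℤ) × (Fin d → ℤ)) × ((Fin d → ℤ) × (Fin d → ℤ)) =>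
          mul_nonneg (mul_nonneg (ha i.1) (hsh (blk q) i.1)) (hb i.2)
        split_ifs
        · exact mul_nonneg (e i) (e j)
        · exact le_rfl
    _ ≤ ENNReal.ofReal (C' * L ^ (d + k) * (L⁻¹ ^ d) ^ 4 *
        (C * Λ ^ (6 * d + k) * (∑ T ∈ tubeSet Φ L Λ M₁ 𝒬, a T ^ 2) *
          ∑ T ∈ tubeSet Φ L Λ M₂ 𝒬, b T ^ 2)) :=
        ENNReal.ofReal_le_ofReal (mul_le_mul_of_nonneg_left hcore hK)
    _ ≤ _ := by
        refine ENNReal.ofReal_le_ofReal ?_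
        have e1 : 0 ≤ ∑ T ∈ tubeSet Φ L Λ M₁ 𝒬, a T ^ 2 := Finset.sum_nonneg fun _ _ => sq_nonneg _
        have e2 : 0 ≤ ∑ T ∈ tubeSet Φ L Λ M₂ 𝒬, b T ^ 2 := Finset.sum_nonneg fun _ _ => sq_nonneg _
        have : C' * (C * (L ^ (d + k) * (L⁻¹ ^ d) ^ 4 * Λ ^ (6 * d + k) *
          (∑ T ∈ tubeSet Φ L Λ M₁ 𝒬, a T ^ 2) * ∑ T ∈ tubeSet Φ L Λ M₂ 𝒬, b T ^ 2)) ≤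
          (C' + 1) * (C * (L ^ (d + k) * (L⁻¹ ^ d) ^ 4 * Λ ^ (6 * d + k) *
          (∑ T ∈ tubeSet Φ L Λ M₁ 𝒬, a T ^ 2) * ∑ T ∈ tubeSet Φ L Λ M₂ 𝒬, b T ^ 2)) := by
          gcongr; linarith
        linarith

lemma exists_sum_lintegral_packSum_sq_le (d k : ℕ) : ∃ C : ℝ, 1 ≤ C ∧
    ∀ (Φ : (Fin d → ℝ) → Fin k → ℝ) (_ : Continuous Φ) (L Λ : ℝ) (_ : 1 ≤ L) (_ : 1 ≤ Λ)
      (𝒬 : Finset ((Fin d → ℤ) × (Fin k → ℤ))) (_ : ∀ q ∈ 𝒬, ‖rv q.2‖ ≤ L)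
      (M : Finset (Fin d → ℤ)) (a : (Fin d → ℤ) × (Fin d → ℤ) → ℝ)
      (x : (Fin d → ℤ) × (Fin k → ℤ) → (Fin d → ℤ) × (Fin d → ℤ) → ℂ) (_ : ∀ q T, ‖x q T‖ ≤ a T),
      ∑ q ∈ 𝒬, ∫⁻ w in Metric.closedBall (L • rv q.1, L • rv q.2) L,
        ‖packSum Φ L (nearSet Φ L Λ M q) (x q) w‖ₑ ^ 2 ≤
      ENNReal.ofReal (C * L ^ (d + k) * (L⁻¹ ^ d) ^ 2 * L ^ k * Λ ^ (2 * d) *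
        ∑ T ∈ tubeSet Φ L Λ M 𝒬, a T ^ 2) := by
  classical
  obtain ⟨C, hC, h⟩ := exists_lintegral_packSum_sq_le d k
  refine ⟨(C + 1) * 3 ^ k * 3 ^ d, one_le_mul_of_one_le_of_one_le (one_le_mul_of_one_le_of_one_le
    (by linarith) (one_le_pow₀ (by norm_num))) (one_le_pow₀ (by norm_num)),
    fun Φ hΦ L Λ hL hΛ 𝒬 h𝒬 M a x hx => ?_⟩
  have hΛ0 : 0 ≤ Λ := by linarith
  have hL0 : 0 < L := by linarith
  set N := nearSet Φ L Λ M with hN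
  have hcard : ∀ T, ((𝒬.filter fun q => T ∈ N q).card : ℝ) ≤ (3 * L) ^ k * (3 * Λ) ^ d := by
    intro T
    have hsub : (𝒬.filter fun q => T ∈ N q) ⊆ (intWindow (0 : Fin k → ℝ) L).biUnion fun b =>
        (intWindow (-(rv T.2 + grT Φ (rv b) (capPt L T.1))) Λ).image fun c => (c, b) := by
      intro q hq
      rw [Finset.mem_filter, hN, mem_nearSet hΛ0] at hq
      refine Finset.mem_biUnion.2 ⟨q.2, (mem_intWindow hL0.le).2 (by simpa using h𝒬 q hq.1),
        Finset.mem_image.2 ⟨q.1, (mem_intWindow hΛ0).2 ?_, rfl⟩⟩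
      rw [sub_neg_eq_add, ← add_assoc]
      exact hq.2.2
    calc ((𝒬.filter fun q => T ∈ N q).card : ℝ) ≤ ((∑ b ∈ intWindow (0 : Fin k → ℝ) L,
          (intWindow (-(rv T.2 + grT Φ (rv b) (capPt L T.1))) Λ).card : ℕ) : ℝ) := by
          refine Nat.cast_le.2 ((Finset.card_le_card hsub).trans
            (Finset.card_biUnion_le.trans (Finset.sum_le_sum fun b _ => Finset.card_image_le)))
      _ ≤ ∑ b ∈ intWindow (0 : Fin k → ℝ) L, (3 * Λ) ^ d := by
          push_cast
          exact Finset.sum_le_sum fun b _ => card_intWindow_le _ hΛ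
      _ ≤ _ := by
          rw [Finset.sum_const, nsmul_eq_mul]
          gcongr
          exact card_intWindow_le _ hL
  have hK : 0 ≤ C * L ^ (d + k) * (L⁻¹ ^ d) ^ 2 * Λ ^ d := by positivity
  have hsum : ∑ q ∈ 𝒬, ∑ T ∈ N q, a T ^ 2 ≤
      (3 * L) ^ k * (3 * Λ) ^ d * ∑ T ∈ tubeSet Φ L Λ M 𝒬, a T ^ 2 := by
    calc ∑ q ∈ 𝒬, ∑ T ∈ N q, a T ^ 2 =
          ∑ q ∈ 𝒬, ∑ T ∈ tubeSet Φ L Λ M 𝒬, if T ∈ N q then a T ^ 2 else 0 := by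
          refine Finset.sum_congr rfl fun q hq => ?_
          rw [Finset.sum_ite_mem, Finset.inter_eq_right.2 (nearSet_subset_tubeSet hq)]
      _ = ∑ T ∈ tubeSet Φ L Λ M 𝒬, ((𝒬.filter fun q => T ∈ N q).card : ℝ) * a T ^ 2 := by
          rw [Finset.sum_comm]
          refine Finset.sum_congr rfl fun T _ => ?_
          rw [← Finset.sum_filter, Finset.sum_const, nsmul_eq_mul]
      _ ≤ _ := by
          rw [Finset.mul_sum]
          exact Finset.sum_le_sum fun T _ => mul_le_mul_of_nonneg_right (hcard T) (sq_nonneg _)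
  calc _ ≤ ∑ q ∈ 𝒬, ENNReal.ofReal (C * L ^ (d + k) * (L⁻¹ ^ d) ^ 2 * Λ ^ d *
        ∑ T ∈ N q, a T ^ 2) := by
        refine Finset.sum_le_sum fun q _ => (h Φ hΦ L Λ hL0 hΛ _ M q (x q)).trans
          (ENNReal.ofReal_le_ofReal (mul_le_mul_of_nonneg_left
            (Finset.sum_le_sum fun T _ => ?_) hK))
        have := hx q T
        gcongr
    _ = ENNReal.ofReal (C * L ^ (d + k) * (L⁻¹ ^ d) ^ 2 * Λ ^ d *
        ∑ q ∈ 𝒬, ∑ T ∈ N q, a T ^ 2) := by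
        rw [Finset.mul_sum, ENNReal.ofReal_sum_of_nonneg]
        intro q _
        exact mul_nonneg hK (Finset.sum_nonneg fun _ _ => sq_nonneg _)
    _ ≤ _ := by
        refine ENNReal.ofReal_le_ofReal ((mul_le_mul_of_nonneg_left hsum hK).trans ?_)
        have e1 : 0 ≤ ∑ T ∈ tubeSet Φ L Λ M 𝒬, a T ^ 2 := Finset.sum_nonneg fun _ _ => sq_nonneg _
        calc _ = C * (3 ^ k * 3 ^ d * (L ^ (d + k) * (L⁻¹ ^ d) ^ 2 * L ^ k * Λ ^ (2 * d) *
              ∑ T ∈ tubeSet Φ L Λ M 𝒬, a T ^ 2)) := by ring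
          _ ≤ (C + 1) * (3 ^ k * 3 ^ d * (L ^ (d + k) * (L⁻¹ ^ d) ^ 2 * L ^ k * Λ ^ (2 * d) *
              ∑ T ∈ tubeSet Φ L Λ M 𝒬, a T ^ 2)) := by gcongr; linarith
          _ = _ := by ring

end OffDiagonal

section Interpolation

lemma lintegral_rpow_le_interp {α : Type*} [MeasurableSpace α] {μ : Measure α} {Z : α → ℝ≥0∞}
    (hZ : AEMeasurable Z μ) {s : ℝ} (h1 : 1 ≤ s) (h2 : s ≤ 2) :
    ∫⁻ w, Z w ^ s ∂μ ≤ (∫⁻ w, Z w ∂μ) ^ (2 - s) * (∫⁻ w, Z w ^ 2 ∂μ) ^ (s - 1) := by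
  have h := ENNReal.lintegral_mul_norm_pow_le hZ (hZ.pow_const 2)
    (sub_nonneg.2 h2) (sub_nonneg.2 h1) (by ring)
  refine le_trans (lintegral_mono fun w => le_of_eq ?_) h
  rw [← ENNReal.rpow_natCast, ← ENNReal.rpow_mul, ← ENNReal.rpow_add_of_nonneg _ _ (by linarith)
    (by push_cast; linarith)]
  congr 1; push_cast; ring

lemma lintegral_mul_le_sqrt {α : Type*} [MeasurableSpace α] {μ : Measure α} {F G : α → ℝ≥0∞}
    (hF : AEMeasurable F μ) (hG : AEMeasurable G μ) :
    ∫⁻ w, F w * G w ∂μ ≤ (∫⁻ w, F w ^ 2 ∂μ) ^ (1 / 2 : ℝ) * (∫⁻ w, G w ^ 2 ∂μ) ^ (1 / 2 : ℝ) := by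
  have h := ENNReal.lintegral_mul_le_Lp_mul_Lq μ Real.HolderConjugate.two_two hF hG
  simpa only [Pi.mul_apply, ENNReal.rpow_two] using h

lemma interp_rpow_le {C Λ m s e₁ e₂ : ℝ} (hC : 1 ≤ C) (hΛ : 1 ≤ Λ) (hm : 0 ≤ m) (h1 : 1 ≤ s)
    (h2 : s ≤ 2) (he : e₁ * (2 - s) + e₂ * (s - 1) ≤ -s) :
    (C * Λ ^ e₁ * m) ^ (2 - s) * (C * Λ ^ e₂ * m ^ 2) ^ (s - 1) ≤ (C * Λ⁻¹ * m) ^ s := by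
  have hΛ0 : 0 < Λ := by linarith
  have hC0 : 0 < C := by linarith
  have em : m ^ (2 - s) * (m ^ 2) ^ (s - 1) = m ^ s := by
    rw [← Real.rpow_natCast m 2, ← Real.rpow_mul hm, ← Real.rpow_add_of_nonneg hm (by linarith)
      (by push_cast; linarith)]
    congr 1; push_cast; ring
  have eC : C ^ (2 - s) * C ^ (s - 1) ≤ C ^ s := by
    rw [← Real.rpow_add hC0]
    exact Real.rpow_le_rpow_of_exponent_le hC (by linarith)
  have eΛ : (Λ ^ e₁) ^ (2 - s) * (Λ ^ e₂) ^ (s - 1) ≤ Λ⁻¹ ^ s := by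
    rw [← Real.rpow_mul hΛ0.le, ← Real.rpow_mul hΛ0.le, ← Real.rpow_add hΛ0,
      Real.inv_rpow hΛ0.le, ← Real.rpow_neg hΛ0.le]
    exact Real.rpow_le_rpow_of_exponent_le hΛ he
  have p1 : 0 ≤ Λ ^ e₁ := Real.rpow_nonneg hΛ0.le _
  have p2 : 0 ≤ Λ ^ e₂ := Real.rpow_nonneg hΛ0.le _
  have pm2 : 0 ≤ m ^ 2 := sq_nonneg m
  rw [Real.mul_rpow (by positivity) hm, Real.mul_rpow (by positivity) (by positivity),
    Real.mul_rpow (by positivity) pm2, Real.mul_rpow (by positivity) (by positivity),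
    Real.mul_rpow (by positivity) hm, Real.mul_rpow (by positivity) (by positivity)]
  calc _ = (C ^ (2 - s) * C ^ (s - 1)) * ((Λ ^ e₁) ^ (2 - s) * (Λ ^ e₂) ^ (s - 1)) *
        (m ^ (2 - s) * (m ^ 2) ^ (s - 1)) := by ring
    _ ≤ C ^ s * Λ⁻¹ ^ s * m ^ s := by rw [em]; gcongr

lemma eLpNorm_ofReal_le {α : Type*} [MeasurableSpace α] {μ : Measure α} {Z : α → ℂ} {s c : ℝ}
    (hs : 0 < s) (hc : 0 ≤ c) (h : ∫⁻ w, ‖Z w‖ₑ ^ s ∂μ ≤ ENNReal.ofReal (c ^ s)) :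
    eLpNorm Z (ENNReal.ofReal s) μ ≤ ENNReal.ofReal c := by
  rw [eLpNorm_eq_lintegral_rpow_enorm_toReal (by simpa using hs) ENNReal.ofReal_ne_top,
    ENNReal.toReal_ofReal hs.le]
  refine (ENNReal.rpow_le_rpow h (by positivity)).trans_eq ?_
  rw [ENNReal.ofReal_rpow_of_nonneg (by positivity) (by positivity), ← Real.rpow_mul hc,
    mul_one_div_cancel hs.ne', Real.rpow_one]

variable {d k : ℕ}

lemma sum_cells_le {L : ℝ} (hL : 0 < L) (𝒢 : Finset ((Fin d → ℤ) × (Fin k → ℤ)))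
    (F : (Fin d → ℤ) × (Fin k → ℤ) → (Fin d → ℝ) × (Fin k → ℝ) → ℝ≥0∞) :
    ∫⁻ w in cellOf L ⁻¹' 𝒢, F (cellOf L w) w ≤
      ∑ q ∈ 𝒢, ∫⁻ w in Metric.closedBall (L • rv q.1, L • rv q.2) L, F q w := by
  rw [lintegral_cells]
  refine Finset.sum_le_sum fun q _ => lintegral_mono_set ?_
  rintro w rfl
  exact mem_closedBall_cellOf hL w

/-- The contribution of the tubes carrying little mass in a given block gains a power of the
scale. -/
lemma exists_eLpNorm_offdiag_le {Φ : (Fin d → ℝ) → Fin k → ℝ}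
    (hΦ : ContDiff ℝ (⊤ : ℕ∞) Φ) {ν₁ ν₂ : Fin d → ℝ} (hc : LocalCond Φ ν₁ ν₂) :
    ∃ r C : ℝ, 0 < r ∧ 1 ≤ C ∧ ∀ s : ℝ, 1 ≤ s → s ≤ 2 → ∀ K : ℕ, 4 ≤ K →
    6 * d + k + 2 ≤ K * (s * (d + k) - (d + 3 * k)) → ∀ L Λ : ℝ, C ≤ Λ → L = Λ ^ K →
    ∀ (𝒬 𝒢 : Finset ((Fin d → ℤ) × (Fin k → ℤ)))
      (blk : (Fin d → ℤ) × (Fin k → ℤ) → (Fin d → ℤ) × (Fin k → ℤ)), 𝒢 ⊆ 𝒬 →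
    (∀ q₀ ∈ 𝒢, ∀ q ∈ 𝒬, blk q ≠ blk q₀ → L / Λ ^ 2 ≤ ‖q - q₀‖) →
    (∀ q ∈ 𝒬, ‖rv q.1‖ ≤ L ∧ ‖rv q.2‖ ≤ L) →
    ∀ M₁ M₂ : Finset (Fin d → ℤ), (∀ m ∈ M₁, ‖capPt L m - ν₁‖ ≤ r) →
    (∀ m ∈ M₂, ‖capPt L m - ν₂‖ ≤ r) → ∀ a b : (Fin d → ℤ) × (Fin d → ℤ) → ℝ,
    (∀ T, 0 ≤ a T) → (∀ T, 0 ≤ b T) → ∀ A B : ℝ, 0 ≤ A → 0 ≤ B →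
    ∑ T ∈ tubeSet Φ L Λ M₁ 𝒬, a T ^ 2 ≤ L ^ d * A ^ 2 →
    ∑ T ∈ tubeSet Φ L Λ M₂ 𝒬, b T ^ 2 ≤ L ^ d * B ^ 2 →
    ∀ x y : (Fin d → ℤ) × (Fin k → ℤ) → (Fin d → ℤ) × (Fin d → ℤ) → ℂ,
    (∀ q T, ‖x q T‖ ≤ a T * (1 - share 𝒬 (nearSet Φ L Λ M₁)
      (fun q => ∑ t ∈ nearSet Φ L Λ M₂ q, b t ^ 2) blk (blk q) T)) → (∀ q T, ‖y q T‖ ≤ b T) →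
    eLpNorm (fun w => packSum Φ L (nearSet Φ L Λ M₁ (cellOf L w)) (x (cellOf L w)) w *
      packSum Φ L (nearSet Φ L Λ M₂ (cellOf L w)) (y (cellOf L w)) w) (ENNReal.ofReal s)
      (volume.restrict (cellOf L ⁻¹' 𝒢)) ≤ ENNReal.ofReal (C * Λ⁻¹ * (A * B)) := by
  classical
  obtain ⟨r, C₂, hr, hC₂, hsq⟩ := exists_sum_lintegral_offdiag_le hΦ hc
  obtain ⟨C₁, hC₁, hone⟩ := exists_sum_lintegral_packSum_sq_le d k
  have hC₁C : C₁ ≤ C₁ * C₂ := le_mul_of_one_le_right (by linarith) hC₂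
  have hC₂C : C₂ ≤ C₁ * C₂ := le_mul_of_one_le_left (by linarith) hC₁
  set C := C₁ * C₂
  refine ⟨r, C, hr, hC₁.trans hC₁C, fun s h1 h2 K hK hγ L Λ hΛC hLK 𝒬 𝒢 blk h𝒢 hsep h𝒬 M₁ M₂ hM₁ hM₂
    a b ha hb A B hA hB hsa hsb x y hx hy => ?_⟩
  have hΛ : 1 ≤ Λ := (hC₁.trans hC₁C).trans hΛC
  have hΛ0 : 0 < Λ := by linarith
  have hL : 1 ≤ L := hLK ▸ one_le_pow₀ hΛ
  have hL0 : 0 < L := by linarith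
  have hCL : C₂ * Λ ^ 3 ≤ L := by
    calc C₂ * Λ ^ 3 ≤ Λ * Λ ^ 3 := by gcongr; exact hC₂C.trans hΛC
      _ = Λ ^ 4 := by ring
      _ ≤ Λ ^ K := pow_le_pow_right₀ hΛ hK
      _ = L := hLK.symm
  have h4 : ∀ q₀ ∈ 𝒢, ∀ q ∈ 𝒬, ‖q - q₀‖ ≤ 4 * L := by
    intro q₀ hq₀ q hq
    have e1 := h𝒬 q₀ (h𝒢 hq₀)
    have e2 := h𝒬 q hq
    rw [norm_sub_eq_rv, max_le_iff]
    constructor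
    · linarith [norm_sub_le (rv q.1) (rv q₀.1)]
    · linarith [norm_sub_le (rv q.2) (rv q₀.2)]
  have hshare : ∀ q T, ‖x q T‖ ≤ a T := fun q T => (hx q T).trans (mul_le_of_le_one_right (ha T)
    (sub_le_self _ (share_nonneg (fun q => Finset.sum_nonneg fun _ _ => sq_nonneg _) _ _)))
  set μ := (volume : Measure ((Fin d → ℝ) × (Fin k → ℝ))).restrict (cellOf L ⁻¹' 𝒢)
  set F := fun w => packSum Φ L (nearSet Φ L Λ M₁ (cellOf L w)) (x (cellOf L w)) w
  set G := fun w => packSum Φ L (nearSet Φ L Λ M₂ (cellOf L w)) (y (cellOf L w)) w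
  have hF : Measurable F := measurable_glue L fun q =>
    (continuous_packSum hΦ.continuous hL0 (nearSet Φ L Λ M₁ q) (x q)).measurable
  have hG : Measurable G := measurable_glue L fun q =>
    (continuous_packSum hΦ.continuous hL0 (nearSet Φ L Λ M₂ q) (y q)).measurable
  have hFG : Measurable fun w => ‖F w * G w‖ₑ := (hF.mul hG).enorm
  set Y := C₁ * L ^ (d + k) * (L⁻¹ ^ d) ^ 2 * L ^ k * Λ ^ (2 * d) * L ^ d with hY
  have hY0 : 0 ≤ Y := by positivity
  have hX : ∀ (M : Finset (Fin d → ℤ)) (c : (Fin d → ℤ) × (Fin d → ℤ) → ℝ) (D : ℝ),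
      ∑ T ∈ tubeSet Φ L Λ M 𝒬, c T ^ 2 ≤ L ^ d * D ^ 2 →
      ∀ z : (Fin d → ℤ) × (Fin k → ℤ) → (Fin d → ℤ) × (Fin d → ℤ) → ℂ, (∀ q T, ‖z q T‖ ≤ c T) →
      ∫⁻ w, ‖packSum Φ L (nearSet Φ L Λ M (cellOf L w)) (z (cellOf L w)) w‖ₑ ^ 2 ∂μ ≤
        ENNReal.ofReal (Y * D ^ 2) := by
    intro M c D hD z hz
    refine (sum_cells_le hL0 𝒢 fun q w => ‖packSum Φ L (nearSet Φ L Λ M q) (z q) w‖ₑ ^ 2).trans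
      ((Finset.sum_le_sum_of_subset h𝒢).trans ((hone Φ hΦ.continuous L Λ hL hΛ 𝒬
        (fun q hq => (h𝒬 q hq).2) M c z hz).trans (ENNReal.ofReal_le_ofReal ?_)))
    rw [hY, mul_assoc (_ * _) (L ^ d)]
    gcongr
  have hI1 : ∫⁻ w, ‖F w * G w‖ₑ ∂μ ≤ ENNReal.ofReal (Y * (A * B)) := by
    simp_rw [enorm_mul]
    refine (lintegral_mul_le_sqrt hF.enorm.aemeasurable hG.enorm.aemeasurable).trans ?_
    refine (mul_le_mul' (ENNReal.rpow_le_rpow (hX M₁ a A hsa x hshare) (by norm_num))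
      (ENNReal.rpow_le_rpow (hX M₂ b B hsb y hy) (by norm_num))).trans_eq ?_
    rw [ENNReal.ofReal_rpow_of_nonneg (by positivity) (by norm_num),
      ENNReal.ofReal_rpow_of_nonneg (by positivity) (by norm_num),
      ← ENNReal.ofReal_mul (by positivity), ← Real.mul_rpow (by positivity) (by positivity),
      ← Real.sqrt_eq_rpow]
    congr 1
    rw [show Y * A ^ 2 * (Y * B ^ 2) = (Y * (A * B)) ^ 2 by ring, Real.sqrt_sq (by positivity)]
  have hI2 : ∫⁻ w, ‖F w * G w‖ₑ ^ 2 ∂μ ≤ ENNReal.ofReal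
      (C₂ * L ^ (d + k) * (L⁻¹ ^ d) ^ 4 * Λ ^ (6 * d + k) * L ^ d * L ^ d * (A * B) ^ 2) := by
    refine (sum_cells_le hL0 𝒢 fun q w => ‖packSum Φ L (nearSet Φ L Λ M₁ q) (x q) w *
      packSum Φ L (nearSet Φ L Λ M₂ q) (y q) w‖ₑ ^ 2).trans
      ((hsq L Λ hΛ hCL 𝒬 𝒢 blk h𝒢 hsep h4 M₁ M₂ hM₁ hM₂ a b ha hb x y hx hy).trans
      (ENNReal.ofReal_le_ofReal ?_))
    calc _ ≤ C₂ * L ^ (d + k) * (L⁻¹ ^ d) ^ 4 * Λ ^ (6 * d + k) * (L ^ d * A ^ 2) *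
          (L ^ d * B ^ 2) :=
          mul_le_mul (mul_le_mul_of_nonneg_left hsa (by positivity)) hsb
            (Finset.sum_nonneg fun _ _ => sq_nonneg _) (by positivity)
      _ = _ := by ring
  have hm : 0 ≤ A * B := mul_nonneg hA hB
  have hinv : L⁻¹ ^ d * L ^ d = 1 := by
    rw [← mul_pow, inv_mul_cancel₀ hL0.ne', one_pow]
  have hY' : Y ≤ C * Λ ^ (K * (2 * k) + 2 * d : ℝ) := by
    have : Y = C₁ * Λ ^ (K * (2 * k) + 2 * d : ℝ) := by
      rw [hY, Real.rpow_add hΛ0, Real.rpow_mul hΛ0.le, Real.rpow_natCast, ← hLK]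
      norm_cast
      calc _ = C₁ * (L ^ (2 * k) * Λ ^ (2 * d)) * (L⁻¹ ^ d * L ^ d) ^ 2 := by ring
        _ = _ := by rw [hinv, one_pow, mul_one]
    rw [this]; gcongr
  have hW' : C₂ * L ^ (d + k) * (L⁻¹ ^ d) ^ 4 * Λ ^ (6 * d + k) * L ^ d * L ^ d ≤
      C * Λ ^ (K * (k - d) + (6 * d + k) : ℝ) := by
    have : C₂ * L ^ (d + k) * (L⁻¹ ^ d) ^ 4 * Λ ^ (6 * d + k) * L ^ d * L ^ d =
        C₂ * Λ ^ (K * (k - d) + (6 * d + k) : ℝ) := by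
      rw [Real.rpow_add hΛ0, Real.rpow_mul hΛ0.le, Real.rpow_natCast, ← hLK, Real.rpow_sub hL0]
      norm_cast
      calc _ = C₂ * (L ^ k * L⁻¹ ^ d * Λ ^ (6 * d + k)) * (L⁻¹ ^ d * L ^ d) ^ 3 := by ring
        _ = _ := by rw [hinv, one_pow, mul_one, inv_pow, div_eq_mul_inv]
    rw [this]; gcongr
  refine eLpNorm_ofReal_le (by linarith) (by positivity) ?_
  refine (lintegral_rpow_le_interp hFG.aemeasurable h1 h2).trans ?_
  refine (mul_le_mul' (ENNReal.rpow_le_rpow (hI1.trans (ENNReal.ofReal_le_ofReal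
    (mul_le_mul_of_nonneg_right hY' hm))) (sub_nonneg.2 h2))
    (ENNReal.rpow_le_rpow (hI2.trans (ENNReal.ofReal_le_ofReal
    (mul_le_mul_of_nonneg_right hW' (sq_nonneg _)))) (sub_nonneg.2 h1))).trans ?_
  rw [ENNReal.ofReal_rpow_of_nonneg (by positivity) (by linarith),
    ENNReal.ofReal_rpow_of_nonneg (by positivity) (by linarith),
    ← ENNReal.ofReal_mul (by positivity)]
  refine ENNReal.ofReal_le_ofReal (interp_rpow_le (hC₁.trans hC₁C) hΛ hm h1 h2 ?_)
  have hd : (0 : ℝ) ≤ d := Nat.cast_nonneg d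
  have hk : (0 : ℝ) ≤ k := Nat.cast_nonneg k
  have e : (K * (2 * k) + 2 * d : ℝ) * (2 - s) + (K * (k - d) + (6 * d + k)) * (s - 1) =
    -(K * (s * (d + k) - (d + 3 * k))) + (2 * d * (2 - s) + (6 * d + k) * (s - 1)) := by ring
  rw [e]
  nlinarith

end Interpolation

section Blocks

lemma sum_rpow_le_rpow_sum {ι : Type*} {s : ℝ} (hs : 1 ≤ s) (S : Finset ι) {x : ι → ℝ}
    (hx : ∀ i, 0 ≤ x i) : ∑ i ∈ S, x i ^ s ≤ (∑ i ∈ S, x i) ^ s := by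
  classical
  induction S using Finset.induction_on with
  | empty => simp [Real.zero_rpow (by linarith : s ≠ 0)]
  | insert i S hi ih =>
    rw [Finset.sum_insert hi, Finset.sum_insert hi]
    exact (add_le_add le_rfl ih).trans
      (Real.add_rpow_le_rpow_add (hx i) (Finset.sum_nonneg fun j _ => hx j) hs)

lemma lintegral_rpow_le_of_eLpNorm_le {α : Type*} [MeasurableSpace α] {μ : Measure α} {Z : α → ℂ}
    {s c : ℝ} (hs : 0 < s) (hc : 0 ≤ c)
    (h : eLpNorm Z (ENNReal.ofReal s) μ ≤ ENNReal.ofReal c) :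
    ∫⁻ w, ‖Z w‖ₑ ^ s ∂μ ≤ ENNReal.ofReal (c ^ s) := by
  rw [eLpNorm_eq_lintegral_rpow_enorm_toReal (by simpa using hs) ENNReal.ofReal_ne_top,
    ENNReal.toReal_ofReal hs.le, one_div, ENNReal.rpow_inv_le_iff hs] at h
  rwa [← ENNReal.ofReal_rpow_of_nonneg hc hs.le]

variable {d k : ℕ}

lemma norm_exOp_le_l2 (Φ : (Fin d → ℝ) → Fin k → ℝ) {f : (Fin d → ℝ) → ℂ} (hf : MemLp f 2)
    {ν : Fin d → ℝ} {ρ : ℝ} (hρ : 0 ≤ ρ) (hρ1 : ρ ≤ 1) (hfs : ∀ ξ, f ξ ≠ 0 → ‖ξ - ν‖ ≤ ρ)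
    (w : (Fin d → ℝ) × (Fin k → ℝ)) : ‖exOp Φ f w‖ ≤ 2 ^ d * l2 f := by
  refine (norm_exOp_le Φ f w).trans
    (abs_le_of_sq_le_sq' ?_ (mul_nonneg (pow_nonneg zero_le_two d) (l2_nonneg f))).2
  refine (integral_norm_sq_le_of_ball_support hf hρ hfs).trans ?_
  rw [← l2_sq, mul_pow (2 ^ d : ℝ)]
  refine mul_le_mul_of_nonneg_right ?_ (sq_nonneg (l2 f))
  calc (2 * ρ) ^ d ≤ 2 ^ d := pow_le_pow_left₀ (by positivity) (by linarith) d
    _ ≤ (2 ^ d) ^ 2 := by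
      have : (1 : ℝ) ≤ 2 ^ d := one_le_pow₀ (by norm_num)
      nlinarith

/-- The bilinear estimate with constant `A` on all balls of diameter `R`, for functions supported
in balls of radius `ρ` around `ν₁` and `ν₂`. -/
def LocEst (Φ : (Fin d → ℝ) → Fin k → ℝ) (ν₁ ν₂ : Fin d → ℝ) (s R ρ A : ℝ) : Prop :=
  ∀ f g : (Fin d → ℝ) → ℂ, MemLp f 2 → MemLp g 2 → (∀ ξ, f ξ ≠ 0 → ‖ξ - ν₁‖ ≤ ρ) →
    (∀ ξ, g ξ ≠ 0 → ‖ξ - ν₂‖ ≤ ρ) → ∀ w₀ : (Fin d → ℝ) × (Fin k → ℝ),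
    eLpNorm (fun w => exOp Φ f w * exOp Φ g w) (ENNReal.ofReal s)
      (volume.restrict (Metric.closedBall w₀ (R / 2))) ≤ ENNReal.ofReal (A * (l2 f * l2 g))

/-- The part of the wave packet decomposition of `f` with coefficients weighted by `a`. -/
def weighted (L : ℝ) (S : Finset ((Fin d → ℤ) × (Fin d → ℤ)))
    (a : (Fin d → ℤ) × (Fin d → ℤ) → ℝ) (f : (Fin d → ℝ) → ℂ) : (Fin d → ℝ) → ℂ :=
  synth L S fun T => a T * coef L f T

lemma memLp_weighted {L : ℝ} (hL : 0 < L) (S : Finset ((Fin d → ℤ) × (Fin d → ℤ)))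
    (a : (Fin d → ℤ) × (Fin d → ℤ) → ℝ) (f : (Fin d → ℝ) → ℂ) : MemLp (weighted L S a f) 2 :=
  memLp_synth hL _ _ _

lemma norm_sub_le_of_weighted {L ρ : ℝ} (hL : 0 < L) (hρ : 0 ≤ ρ) {ν : Fin d → ℝ}
    {S : Finset ((Fin d → ℤ) × (Fin d → ℤ))} (hS : ∀ T ∈ S, T.1 ∈ freqSet L ν ρ)
    {a : (Fin d → ℤ) × (Fin d → ℤ) → ℝ} {f : (Fin d → ℝ) → ℂ} {ξ : Fin d → ℝ}
    (h : weighted L S a f ξ ≠ 0) : ‖ξ - ν‖ ≤ ρ + 1 / L := by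
  obtain ⟨T, hT, hne⟩ := Finset.exists_ne_zero_of_sum_ne_zero h
  have e1 := norm_sub_capPt_le_of_psi hL (right_ne_zero_of_mul hne)
  have e2 := (mem_freqSet hL hρ).1 (hS T hT)
  have e3 : 1 / L = 1 / (2 * L) + 1 / (2 * L) := by field_simp; norm_num
  linarith [norm_sub_le_norm_sub_add_norm_sub ξ (capPt L T.1) ν]

lemma sum_l2_weighted_sq_le {β : Type*} {L : ℝ} (hL : 0 < L) {f : (Fin d → ℝ) → ℂ}
    (hf : MemLp f 2) (S : Finset ((Fin d → ℤ) × (Fin d → ℤ))) (ℬ : Finset β)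
    {a : β → (Fin d → ℤ) × (Fin d → ℤ) → ℝ} (h0 : ∀ B T, 0 ≤ a B T)
    (h1 : ∀ T, ∑ B ∈ ℬ, a B T ≤ 1) : ∑ B ∈ ℬ, l2 (weighted L S (a B) f) ^ 2 ≤ l2 f ^ 2 := by
  have hLd : 0 < L ^ d := by positivity
  refine le_of_mul_le_mul_left ?_ hLd
  rw [Finset.mul_sum]
  calc ∑ B ∈ ℬ, L ^ d * l2 (weighted L S (a B) f) ^ 2
      ≤ ∑ B ∈ ℬ, ∑ T ∈ S, a B T ^ 2 * ‖coef L f T‖ ^ 2 := by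
        refine Finset.sum_le_sum fun B _ => ?_
        rw [l2_sq]
        refine (integral_norm_sq_synth_le hL S _).trans_eq (Finset.sum_congr rfl fun T _ => ?_)
        rw [norm_mul, mul_pow, Complex.norm_real, Real.norm_eq_abs, sq_abs]
    _ = ∑ T ∈ S, (∑ B ∈ ℬ, a B T ^ 2) * ‖coef L f T‖ ^ 2 := by
        rw [Finset.sum_comm]
        exact Finset.sum_congr rfl fun T _ => (Finset.sum_mul ..).symm
    _ ≤ ∑ T ∈ S, ‖coef L f T‖ ^ 2 := by
        refine Finset.sum_le_sum fun T _ => mul_le_of_le_one_left (sq_nonneg _) ?_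
        refine (Finset.sum_le_sum fun B hB => ?_).trans (h1 T)
        rw [sq]
        exact mul_le_of_le_one_left (h0 B T)
          ((Finset.single_le_sum (fun B _ => h0 B T) hB).trans (h1 T))
    _ ≤ L ^ d * l2 f ^ 2 := by
        rw [l2_sq]; exact sum_norm_sq_coef_le hL hf S

lemma LocEst.eLpNorm_blocks_le {Φ : (Fin d → ℝ) → Fin k → ℝ} {ν₁ ν₂ : Fin d → ℝ}
    {s L ρ ρ' A : ℝ} {N : ℕ} (h : LocEst Φ ν₁ ν₂ s (N * L) ρ' A) (hA : 0 ≤ A) (hs : 1 ≤ s)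
    (hL : 0 < L) (hN : 0 < N) (hρ : 0 ≤ ρ) (hρ' : ρ + 1 / L ≤ ρ') {f g : (Fin d → ℝ) → ℂ}
    (hf : MemLp f 2) (hg : MemLp g 2) {S₁ S₂ : Finset ((Fin d → ℤ) × (Fin d → ℤ))}
    (hS₁ : ∀ T ∈ S₁, T.1 ∈ freqSet L ν₁ ρ) (hS₂ : ∀ T ∈ S₂, T.1 ∈ freqSet L ν₂ ρ)
    {a b : (Fin d → ℤ) × (Fin k → ℤ) → (Fin d → ℤ) × (Fin d → ℤ) → ℝ}
    (ha0 : ∀ B T, 0 ≤ a B T) (ha1 : ∀ T ℬ, ∑ B ∈ ℬ, a B T ≤ 1)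
    (hb0 : ∀ B T, 0 ≤ b B T) (hb1 : ∀ T ℬ, ∑ B ∈ ℬ, b B T ≤ 1) (σ : ℕ)
    (𝒢 : Finset ((Fin d → ℤ) × (Fin k → ℤ))) :
    eLpNorm (fun w => exOp Φ (weighted L S₁ (a (blockOf N σ (cellOf L w))) f) w *
      exOp Φ (weighted L S₂ (b (blockOf N σ (cellOf L w))) g) w) (ENNReal.ofReal s)
      (volume.restrict (cellOf L ⁻¹' 𝒢)) ≤ ENNReal.ofReal (A * (l2 f * l2 g)) := by
  classical
  have hfg : 0 ≤ l2 f * l2 g := mul_nonneg (l2_nonneg f) (l2_nonneg g)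
  refine eLpNorm_ofReal_le (by linarith) (mul_nonneg hA hfg) ?_
  set H := fun (B : (Fin d → ℤ) × (Fin k → ℤ)) (w : (Fin d → ℝ) × (Fin k → ℝ)) =>
    ‖exOp Φ (weighted L S₁ (a B) f) w * exOp Φ (weighted L S₂ (b B) g) w‖ₑ ^ s with hH
  set u := fun B => l2 (weighted L S₁ (a B) f)
  set v := fun B => l2 (weighted L S₂ (b B) g)
  set ℬ := 𝒢.image (blockOf N σ)
  have hu : ∀ B, 0 ≤ u B := fun B => l2_nonneg _
  have hv : ∀ B, 0 ≤ v B := fun B => l2_nonneg _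
  have hB : ∀ B, ∑ q ∈ 𝒢 with blockOf N σ q = B, ∫⁻ w in cellOf L ⁻¹' {q}, H (blockOf N σ q) w ≤
      ENNReal.ofReal ((A * (u B * v B)) ^ s) := by
    intro B
    have e : ∑ q ∈ 𝒢 with blockOf N σ q = B, ∫⁻ w in cellOf L ⁻¹' {q}, H (blockOf N σ q) w =
        ∑ q ∈ 𝒢 with blockOf N σ q = B, ∫⁻ w in cellOf L ⁻¹' {q}, H B w :=
      Finset.sum_congr rfl fun q hq => by rw [(Finset.mem_filter.1 hq).2]
    obtain ⟨w₀, hw₀⟩ := exists_closedBall_block hL hN σ B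
    rw [e, ← lintegral_cells L _ fun _ => H B]
    refine (lintegral_mono_set (t := Metric.closedBall w₀ (N * L / 2))
        fun w hw => hw₀ w ?_).trans ?_
    · exact (Finset.mem_filter.1 (Finset.mem_coe.1 hw)).2
    · exact lintegral_rpow_le_of_eLpNorm_le (by linarith)
        (mul_nonneg hA (mul_nonneg (hu B) (hv B)))
        (h _ _ (memLp_weighted hL _ _ _) (memLp_weighted hL _ _ _)
          (fun ξ hξ => (norm_sub_le_of_weighted hL hρ hS₁ hξ).trans hρ')
          (fun ξ hξ => (norm_sub_le_of_weighted hL hρ hS₂ hξ).trans hρ') w₀)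
  rw [lintegral_cells L 𝒢 fun q => H (blockOf N σ q),
    ← Finset.sum_fiberwise_of_maps_to fun q hq => Finset.mem_image_of_mem (blockOf N σ) hq]
  refine (Finset.sum_le_sum fun B _ => hB B).trans ?_
  have hp : ∀ B, 0 ≤ A * (u B * v B) := fun B => mul_nonneg hA (mul_nonneg (hu B) (hv B))
  rw [← ENNReal.ofReal_sum_of_nonneg fun B _ => Real.rpow_nonneg (hp B) s]
  refine ENNReal.ofReal_le_ofReal ((sum_rpow_le_rpow_sum hs _ hp).trans
    (Real.rpow_le_rpow (Finset.sum_nonneg fun B _ => hp B) ?_ (by linarith)))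
  rw [← Finset.mul_sum]
  refine mul_le_mul_of_nonneg_left ?_ hA
  refine (abs_le_of_sq_le_sq' ?_ hfg).2
  calc _ ≤ (∑ B ∈ ℬ, u B ^ 2) * ∑ B ∈ ℬ, v B ^ 2 := Finset.sum_mul_sq_le_sq_mul_sq _ _ _
    _ ≤ l2 f ^ 2 * l2 g ^ 2 := mul_le_mul
        (sum_l2_weighted_sq_le hL hf S₁ ℬ ha0 fun T => ha1 T ℬ)
        (sum_l2_weighted_sq_le hL hg S₂ ℬ hb0 fun T => hb1 T ℬ)
        (Finset.sum_nonneg fun _ _ => sq_nonneg _) (sq_nonneg _)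
    _ = _ := by ring

end Blocks

section GoodCells

variable {d k : ℕ}

/-- Some translate of the block decomposition loses only a small fraction of the mass near the
boundaries of the blocks. -/
lemma exists_shift_eLpNorm_le {L s : ℝ} (hL : 2 ≤ L) (hs : 1 ≤ s) {N c : ℕ} (hN : 0 < N)
    (hcN : c ≤ N) (hc : 4 * ((d + k) * c) ≤ N) {Z : (Fin d → ℝ) × (Fin k → ℝ) → ℂ}
    (hZ : ∀ q : (Fin d → ℤ) × (Fin k → ℤ), ∫⁻ w in cellOf L ⁻¹' {q}, ‖Z w‖ₑ ^ s ≠ ∞) :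
    ∃ σ : ℕ, ∃ 𝒢 ⊆ intWindow (0 : Fin d → ℝ) L ×ˢ intWindow (0 : Fin k → ℝ) L,
      (∀ q ∈ 𝒢, DeepCell N c σ q) ∧
      eLpNorm Z (ENNReal.ofReal s) (volume.restrict (Metric.closedBall 0 (L ^ 2 / 2))) ≤
        ENNReal.ofReal (1 + 4 * ((d + k) * c / N)) *
          eLpNorm Z (ENNReal.ofReal s) (volume.restrict (cellOf L ⁻¹' 𝒢)) := by
  classical
  set 𝒬 := intWindow (0 : Fin d → ℝ) L ×ˢ intWindow (0 : Fin k → ℝ) L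
  set I := fun q : (Fin d → ℤ) × (Fin k → ℤ) => (∫⁻ w in cellOf L ⁻¹' {q}, ‖Z w‖ₑ ^ s).toReal
  have hI : ∀ q, 0 ≤ I q := fun q => ENNReal.toReal_nonneg
  have hN' : (0 : ℝ) < N := by exact_mod_cast hN
  have hsum : ∀ 𝒢 : Finset ((Fin d → ℤ) × (Fin k → ℤ)),
      ∫⁻ w in cellOf L ⁻¹' 𝒢, ‖Z w‖ₑ ^ s = ENNReal.ofReal (∑ q ∈ 𝒢, I q) := by
    intro 𝒢
    rw [lintegral_cells L 𝒢 fun _ w => ‖Z w‖ₑ ^ s, ENNReal.ofReal_sum_of_nonneg fun q _ => hI q]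
    exact Finset.sum_congr rfl fun q _ => (ENNReal.ofReal_toReal (hZ q)).symm
  obtain ⟨σ, hσ⟩ := exists_shift hN hcN 𝒬 I hI
  refine ⟨σ, 𝒬.filter (DeepCell N c σ), Finset.filter_subset _ _,
    fun q hq => (Finset.mem_filter.1 hq).2, ?_⟩
  set x : ℝ := (d + k) * c / N with hx
  have hx0 : 0 ≤ x := by positivity
  have hx1 : 4 * x ≤ 1 := by
    rw [hx, ← mul_div_assoc, div_le_one hN']
    exact_mod_cast hc
  have hmass : ∑ q ∈ 𝒬, I q ≤ (1 + 4 * x) * ∑ q ∈ 𝒬 with DeepCell N c σ q, I q := by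
    have e := Finset.sum_filter_add_sum_filter_not 𝒬 (DeepCell N c σ) I
    set T := ∑ q ∈ 𝒬, I q
    have hT : 0 ≤ T := Finset.sum_nonneg fun q _ => hI q
    have hb : ∑ q ∈ 𝒬 with ¬ DeepCell N c σ q, I q ≤ 2 * x * T := by
      refine le_of_mul_le_mul_left (hσ.trans_eq ?_) hN'
      rw [hx]; field_simp
    nlinarith [mul_nonneg (mul_nonneg hx0 hT) (sub_nonneg.2 hx1)]
  rw [eLpNorm_eq_lintegral_rpow_enorm_toReal (by simpa using by linarith) ENNReal.ofReal_ne_top,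
    eLpNorm_eq_lintegral_rpow_enorm_toReal (by simpa using by linarith) ENNReal.ofReal_ne_top,
    ENNReal.toReal_ofReal (by linarith)]
  have h1 : ∫⁻ w in Metric.closedBall 0 (L ^ 2 / 2), ‖Z w‖ₑ ^ s ≤
      ENNReal.ofReal (1 + 4 * x) *
          ∫⁻ w in cellOf L ⁻¹' (𝒬.filter (DeepCell N c σ)), ‖Z w‖ₑ ^ s := by
    rw [hsum, ← ENNReal.ofReal_mul (by positivity)]
    have h𝒬 : (Metric.closedBall 0 (L ^ 2 / 2) : Set ((Fin d → ℝ) × (Fin k → ℝ))) ⊆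
        cellOf L ⁻¹' 𝒬 := fun w hw => Finset.mem_coe.2 (cellOf_mem_intWindow hL hw)
    refine (lintegral_mono_set h𝒬).trans ?_
    rw [hsum]
    exact ENNReal.ofReal_le_ofReal hmass
  refine (ENNReal.rpow_le_rpow h1 (by positivity)).trans ?_
  rw [ENNReal.mul_rpow_of_nonneg _ _ (by positivity)]
  refine mul_le_mul_left ?_ _
  conv_rhs => rw [← ENNReal.rpow_one (ENNReal.ofReal (1 + 4 * x))]
  refine ENNReal.rpow_le_rpow_of_exponent_le ?_ ?_
  · rw [ENNReal.one_le_ofReal]; linarith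
  · rw [div_le_one (by linarith)]; exact hs

end GoodCells

section Improvement

variable {d k : ℕ}

lemma packSum_sub_near {Φ : (Fin d → ℝ) → Fin k → ℝ} {L Λ : ℝ} (hΛ : 0 ≤ Λ)
    {M : Finset (Fin d → ℤ)} {q : (Fin d → ℤ) × (Fin k → ℤ)}
    {S : Finset ((Fin d → ℤ) × (Fin d → ℤ))} (hS : nearSet Φ L Λ M q ⊆ S)
    (hM : ∀ T ∈ S, T.1 ∈ M) (c : (Fin d → ℤ) × (Fin d → ℤ) → ℂ)
    (w : (Fin d → ℝ) × (Fin k → ℝ)) : ∃ S' : Finset ((Fin d → ℤ) × (Fin d → ℤ)),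
      (∀ T ∈ S', T.1 ∈ M ∧ ¬ Inc Φ L Λ q T) ∧
      packSum Φ L S c w - packSum Φ L (nearSet Φ L Λ M q) c w = packSum Φ L S' c w := by
  classical
  refine ⟨S \ nearSet Φ L Λ M q, fun T hT => ?_, ?_⟩
  · rw [Finset.mem_sdiff, mem_nearSet hΛ, not_and] at hT
    exact ⟨hM T hT.1, hT.2 (hM T hT.1)⟩
  · rw [sub_eq_iff_eq_add]
    exact (Finset.sum_sdiff hS).symm

/-- Up to a rapidly decaying error, only the wave packets whose tube meets a cell contribute on
that cell. -/
lemma exists_norm_sub_near_le {Φ : (Fin d → ℝ) → Fin k → ℝ} (hΦ : ContDiff ℝ (⊤ : ℕ∞) Φ)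
    (ν : Fin d → ℝ) : ∃ r Λ₀ : ℝ, 0 < r ∧ r ≤ 1 ∧ 1 ≤ Λ₀ ∧ ∀ K : ℕ, ∃ C : ℝ, 0 < C ∧
    ∀ L Λ : ℝ, Λ₀ ≤ Λ → L = Λ ^ K → ∀ ρ : ℝ, 0 ≤ ρ → ρ + 1 / (2 * L) ≤ r →
    ∀ f : (Fin d → ℝ) → ℂ, MemLp f 2 → (∀ ξ, f ξ ≠ 0 → ‖ξ - ν‖ ≤ ρ) →
    ∀ q : (Fin d → ℤ) × (Fin k → ℤ), ‖rv q.2‖ ≤ L →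
    ∀ w ∈ Metric.closedBall (L • rv q.1, L • rv q.2) L,
    ‖exOp Φ f w - packSum Φ L (nearSet Φ L Λ (freqSet L ν ρ) q) (coef L f) w‖ ≤
      C * Λ⁻¹ * L⁻¹ ^ (2 * (d + k)) * l2 f ∧
    ∀ S : Finset ((Fin d → ℤ) × (Fin d → ℤ)), nearSet Φ L Λ (freqSet L ν ρ) q ⊆ S →
      (∀ T ∈ S, T.1 ∈ freqSet L ν ρ) → ∀ c : (Fin d → ℤ) × (Fin d → ℤ) → ℂ,
      (∀ T, ‖c T‖ ≤ ‖coef L f T‖) →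
      ‖packSum Φ L S c w - packSum Φ L (nearSet Φ L Λ (freqSet L ν ρ) q) c w‖ ≤
        C * Λ⁻¹ * L⁻¹ ^ (2 * (d + k)) * l2 f := by
  obtain ⟨r, Λ₀, hr, hr1, hΛ₀, h⟩ := exists_norm_packSum_far_le hΦ ν
  refine ⟨r, Λ₀, hr, hr1, hΛ₀, fun K => ?_⟩
  obtain ⟨C, hC, h⟩ := h (K * (2 * (d + k) + d) + 1)
  refine ⟨C, hC, fun L Λ hΛ hLK ρ hρ hρr f hf hfs q hq w hw => ?_⟩
  have hΛ1 : 1 ≤ Λ := hΛ₀.trans hΛ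
  have hΛ0 : 0 < Λ := by linarith
  have hL : 1 ≤ L := hLK ▸ one_le_pow₀ hΛ1
  have hL0 : 0 < L := by linarith
  have key : ∀ (S : Finset ((Fin d → ℤ) × (Fin d → ℤ))) (c : (Fin d → ℤ) × (Fin d → ℤ) → ℂ),
      (∀ T ∈ S, T.1 ∈ freqSet L ν ρ ∧ ¬ Inc Φ L Λ q T) → (∀ T, ‖c T‖ ≤ ‖coef L f T‖) →
      ‖packSum Φ L S c w‖ ≤ C * Λ⁻¹ * L⁻¹ ^ (2 * (d + k)) * l2 f := by
    intro S c hS hcf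
    have e := h L Λ hL hΛ ρ hρ hρr f hf q hq w hw S c hS hcf
    rw [pow_add, pow_mul, ← hLK, pow_one, pow_add L] at e
    have hP : 0 < L ^ (2 * (d + k)) * L ^ d * Λ := by positivity
    refine le_of_mul_le_mul_left (e.trans_eq ?_) hP
    rw [inv_pow]; field_simp
  refine ⟨norm_exOp_sub_packSum_near_le hΦ.continuous hL0 hΛ0.le hρ hf hfs
    fun S hS => key S _ hS fun _ => le_rfl, fun S hS hM c hcf => ?_⟩
  obtain ⟨S', hS', e⟩ := packSum_sub_near hΛ0.le hS hM c w
  rw [e]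
  exact key S' c hS' hcf

lemma norm_mul_sub_mul_le {a a' b b' : ℂ} {τ c A B : ℝ} (hτ : 0 ≤ τ) (hA : 0 ≤ A)
    (hc : 0 ≤ c) (ha : ‖a‖ ≤ c * A) (hb : ‖b‖ ≤ c * B) (haa : ‖a - a'‖ ≤ τ * A)
    (hbb : ‖b - b'‖ ≤ τ * B) : ‖a * b - a' * b'‖ ≤ τ * (2 * c + τ) * (A * B) := by
  have e : a * b - a' * b' = a * (b - b') + (a - a') * (b - (b - b')) := by ring
  have hb' : ‖b - (b - b')‖ ≤ c * B + τ * B := (norm_sub_le _ _).trans (add_le_add hb hbb)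
  rw [e]
  refine (norm_add_le _ _).trans ?_
  rw [norm_mul, norm_mul]
  calc _ ≤ c * A * (τ * B) + τ * A * (c * B + τ * B) := by gcongr
    _ = _ := by ring

lemma LocEst.of_center_zero {Φ : (Fin d → ℝ) → Fin k → ℝ} {ν₁ ν₂ : Fin d → ℝ} {s R ρ A : ℝ}
    (hΦ : Continuous Φ)
    (h : ∀ f g : (Fin d → ℝ) → ℂ, MemLp f 2 → MemLp g 2 → (∀ ξ, f ξ ≠ 0 → ‖ξ - ν₁‖ ≤ ρ) →
      (∀ ξ, g ξ ≠ 0 → ‖ξ - ν₂‖ ≤ ρ) →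
      eLpNorm (fun w => exOp Φ f w * exOp Φ g w) (ENNReal.ofReal s)
        (volume.restrict (Metric.closedBall 0 (R / 2))) ≤ ENNReal.ofReal (A * (l2 f * l2 g))) :
    LocEst Φ ν₁ ν₂ s R ρ A := by
  intro f g hf hg hfs hgs w₀
  have hc : Continuous fun ξ => eC (phase Φ w₀ ξ) :=
    continuous_eC.comp (continuous_dotW.comp (continuous_const.prodMk (continuous_id.prodMk hΦ)))
  have hm : ∀ {f : (Fin d → ℝ) → ℂ}, MemLp f 2 → MemLp (fun ξ => eC (phase Φ w₀ ξ) * f ξ) 2 :=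
    fun {f} hf => hf.of_le (hc.aestronglyMeasurable.mul hf.1)
      (Filter.Eventually.of_forall fun ξ => by rw [norm_mul, norm_eC, one_mul])
  have hl : ∀ f : (Fin d → ℝ) → ℂ, l2 (fun ξ => eC (phase Φ w₀ ξ) * f ξ) = l2 f := by
    intro f; simp only [l2, norm_mul, norm_eC, one_mul]
  have he : ∀ (f : (Fin d → ℝ) → ℂ) w, exOp Φ (fun ξ => eC (phase Φ w₀ ξ) * f ξ) w =
      exOp Φ f (w + w₀) := by
    intro f w
    simp only [exOp]
    congr 1; funext ξ
    rw [phase_eq_dotW, phase_eq_dotW, phase_eq_dotW, dotW_add_left, eC_add, mul_assoc]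
  have := h _ _ (hm hf) (hm hg) (fun ξ hξ => hfs ξ (right_ne_zero_of_mul hξ))
    fun ξ hξ => hgs ξ (right_ne_zero_of_mul hξ)
  simp only [he, hl] at this
  refine le_of_eq_of_le ?_ this
  have hmp : MeasurePreserving (fun w : (Fin d → ℝ) × (Fin k → ℝ) => w + w₀)
      (volume.restrict (Metric.closedBall 0 (R / 2)))
      (volume.restrict (Metric.closedBall w₀ (R / 2))) := by
    have e := (measurePreserving_add_right (volume : Measure ((Fin d → ℝ) × (Fin k → ℝ)))
      w₀).restrict_preimage (s := Metric.closedBall w₀ (R / 2)) measurableSet_closedBall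
    have e' : (fun w => w + w₀) ⁻¹' Metric.closedBall w₀ (R / 2) = Metric.closedBall 0 (R / 2) := by
      ext w; simp [dist_eq_norm]
    rwa [e'] at e
  exact (eLpNorm_comp_measurePreserving ((continuous_exOp hΦ
    (integrable_of_ball_support hf hfs)).mul (continuous_exOp hΦ
    (integrable_of_ball_support hg hgs))).aestronglyMeasurable hmp).symm

end Improvement

section GoodEstimate

variable {d k : ℕ}

lemma volume_cells_le {L : ℝ} (hL : 1 ≤ L) {𝒢 : Finset ((Fin d → ℤ) × (Fin k → ℤ))}
    (h𝒢 : 𝒢 ⊆ intWindow (0 : Fin d → ℝ) L ×ˢ intWindow (0 : Fin k → ℝ) L) :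
    volume (cellOf L ⁻¹' 𝒢 : Set ((Fin d → ℝ) × (Fin k → ℝ))) ≤
      ENNReal.ofReal (6 ^ (d + k) * L ^ (2 * (d + k))) := by
  have hL0 : 0 < L := by linarith
  have hv : ∀ q : (Fin d → ℤ) × (Fin k → ℤ),
      volume (Metric.closedBall (L • rv q.1, L • rv q.2) L : Set ((Fin d → ℝ) × (Fin k → ℝ))) =
        ENNReal.ofReal ((2 * L) ^ (d + k)) := by
    intro q
    rw [← closedBall_prod_same, Measure.volume_eq_prod, Measure.prod_prod,
      Real.volume_pi_closedBall _ hL0.le, Real.volume_pi_closedBall _ hL0.le,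
      ← ENNReal.ofReal_mul (by positivity), ← pow_add, Fintype.card_fin, Fintype.card_fin]
  have hcard : (𝒢.card : ℝ) ≤ (3 * L) ^ (d + k) := by
    calc (𝒢.card : ℝ) ≤
        ((intWindow (0 : Fin d → ℝ) L ×ˢ intWindow (0 : Fin k → ℝ) L).card : ℝ) := by
          exact_mod_cast Finset.card_le_card h𝒢
      _ ≤ (3 * L) ^ d * (3 * L) ^ k := by
          rw [Finset.card_product]; push_cast
          exact mul_le_mul (card_intWindow_le _ hL) (card_intWindow_le _ hL) (Nat.cast_nonneg _)
            (by positivity)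
      _ = _ := (pow_add _ _ _).symm
  calc volume (cellOf L ⁻¹' 𝒢 : Set ((Fin d → ℝ) × (Fin k → ℝ)))
      = ∫⁻ w in (cellOf L ⁻¹' 𝒢 : Set ((Fin d → ℝ) × (Fin k → ℝ))), 1 := by simp
    _ ≤ ∑ q ∈ 𝒢, ENNReal.ofReal ((2 * L) ^ (d + k)) := by
        refine (sum_cells_le hL0 𝒢 fun _ _ => 1).trans_eq (Finset.sum_congr rfl fun q _ => ?_)
        rw [← hv q]; simp
    _ = ENNReal.ofReal (𝒢.card * (2 * L) ^ (d + k)) := by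
        rw [Finset.sum_const, nsmul_eq_mul, ENNReal.ofReal_mul (Nat.cast_nonneg _),
          ENNReal.ofReal_natCast]
    _ ≤ _ := by
        refine ENNReal.ofReal_le_ofReal ?_
        calc _ ≤ (3 * L) ^ (d + k) * (2 * L) ^ (d + k) := by gcongr
          _ = _ := by rw [← mul_pow, two_mul (d + k), pow_add L, ← mul_pow, ← mul_pow]; ring

lemma eLpNorm_cells_le {L s e : ℝ} (hL : 1 ≤ L) (hs : 1 ≤ s)
    {𝒢 : Finset ((Fin d → ℤ) × (Fin k → ℤ))}
    (h𝒢 : 𝒢 ⊆ intWindow (0 : Fin d → ℝ) L ×ˢ intWindow (0 : Fin k → ℝ) L)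
    {Z : (Fin d → ℝ) × (Fin k → ℝ) → ℂ} (hZ : ∀ w, cellOf L w ∈ 𝒢 → ‖Z w‖ ≤ e) :
    eLpNorm Z (ENNReal.ofReal s) (volume.restrict (cellOf L ⁻¹' 𝒢)) ≤
      ENNReal.ofReal (6 ^ (d + k) * L ^ (2 * (d + k)) * e) := by
  have hae : ∀ᵐ w ∂(volume.restrict (cellOf L ⁻¹' (𝒢 : Set ((Fin d → ℤ) × (Fin k → ℤ))))),
      ‖Z w‖ ≤ e :=
    (ae_restrict_iff' (measurable_cellOf L (Set.Finite.measurableSet 𝒢.finite_toSet))).2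
      (Filter.Eventually.of_forall fun w hw => hZ w hw)
  have h1 : (1 : ℝ) ≤ 6 ^ (d + k) * L ^ (2 * (d + k)) :=
    one_le_mul_of_one_le_of_one_le (one_le_pow₀ (by norm_num)) (one_le_pow₀ hL)
  refine (eLpNorm_le_of_ae_bound hae).trans ?_
  rw [Measure.restrict_apply_univ, ENNReal.toReal_ofReal (by linarith),
    ENNReal.ofReal_mul (by linarith)]
  refine mul_le_mul_left ?_ _
  refine (ENNReal.rpow_le_rpow (volume_cells_le hL h𝒢) (by positivity)).trans ?_
  conv_rhs => rw [← ENNReal.rpow_one (ENNReal.ofReal _)]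
  exact ENNReal.rpow_le_rpow_of_exponent_le (ENNReal.one_le_ofReal.2 h1) (inv_le_one_of_one_le₀ hs)

lemma packSum_add (Φ : (Fin d → ℝ) → Fin k → ℝ) (L : ℝ) (S : Finset ((Fin d → ℤ) × (Fin d → ℤ)))
    (a : (Fin d → ℤ) × (Fin d → ℤ) → ℝ) (c : (Fin d → ℤ) × (Fin d → ℤ) → ℂ)
    (w : (Fin d → ℝ) × (Fin k → ℝ)) : packSum Φ L S c w =
      packSum Φ L S (fun T => ((1 - a T : ℝ) : ℂ) * c T) w +
      packSum Φ L S (fun T => (a T : ℂ) * c T) w := by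
  simp only [packSum]
  rw [← Finset.sum_add_distrib]
  refine Finset.sum_congr rfl fun T _ => ?_
  push_cast; ring

lemma norm_exOp_weighted_le (Φ : (Fin d → ℝ) → Fin k → ℝ) {L ρ : ℝ} (hL : 0 < L) (hρ : 0 ≤ ρ)
    (hρ1 : ρ + 1 / L ≤ 1) {ν : Fin d → ℝ} {f : (Fin d → ℝ) → ℂ} (hf : MemLp f 2)
    {S : Finset ((Fin d → ℤ) × (Fin d → ℤ))} (hS : ∀ T ∈ S, T.1 ∈ freqSet L ν ρ)
    {a : (Fin d → ℤ) × (Fin d → ℤ) → ℝ} (h0 : ∀ T, 0 ≤ a T) (h1 : ∀ T, a T ≤ 1)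
    (w : (Fin d → ℝ) × (Fin k → ℝ)) : ‖exOp Φ (weighted L S a f) w‖ ≤ 2 ^ d * l2 f := by
  refine (norm_exOp_le_l2 Φ (memLp_weighted hL S a f) (by positivity) hρ1
    (fun ξ hξ => norm_sub_le_of_weighted hL hρ hS hξ) w).trans ?_
  refine mul_le_mul_of_nonneg_left ?_ (by positivity)
  refine (abs_le_of_sq_le_sq' ?_ (l2_nonneg f)).2
  simpa using sum_l2_weighted_sq_le hL hf S {()} (a := fun _ => a) (fun _ => h0) (by simpa using h1)

/-- The bilinear estimate on the cells far from the boundaries of the blocks, in terms of the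
bilinear estimate at the scale of the blocks. -/
lemma exists_eLpNorm_good_le {Φ : (Fin d → ℝ) → Fin k → ℝ} (hΦ : ContDiff ℝ (⊤ : ℕ∞) Φ)
    {ν₁ ν₂ : Fin d → ℝ} (h12 : LocalCond Φ ν₁ ν₂) (h21 : LocalCond Φ ν₂ ν₁) {s : ℝ} (hs1 : 1 ≤ s)
    (hs2 : s ≤ 2) (hs : (d : ℝ) + 3 * k < s * (d + k)) :
    ∃ K : ℕ, 4 ≤ K ∧ ∃ r C : ℝ, 0 < r ∧ r ≤ 1 ∧ 1 ≤ C ∧ ∀ Λ : ℕ, C ≤ Λ → ∀ L : ℝ, L = Λ ^ K →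
    ∀ σ : ℕ, ∀ 𝒢 ⊆ intWindow (0 : Fin d → ℝ) L ×ˢ intWindow (0 : Fin k → ℝ) L,
    (∀ q ∈ 𝒢, DeepCell (Λ ^ (K - 1)) (Λ ^ (K - 2)) σ q) →
    ∀ ρ ρ' A : ℝ, 0 ≤ ρ → ρ + 1 / L ≤ ρ' → ρ' ≤ r → 0 ≤ A →
    LocEst Φ ν₁ ν₂ s ((Λ ^ (K - 1) : ℕ) * L) ρ' A →
    ∀ f g : (Fin d → ℝ) → ℂ, MemLp f 2 → MemLp g 2 → (∀ ξ, f ξ ≠ 0 → ‖ξ - ν₁‖ ≤ ρ) →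
    (∀ ξ, g ξ ≠ 0 → ‖ξ - ν₂‖ ≤ ρ) →
    eLpNorm (fun w => exOp Φ f w * exOp Φ g w) (ENNReal.ofReal s)
      (volume.restrict (cellOf L ⁻¹' 𝒢)) ≤
        ENNReal.ofReal ((A + C * (Λ : ℝ)⁻¹) * (l2 f * l2 g)) := by
  obtain ⟨r₁, C₁, hr₁, hC₁, off₁⟩ := exists_eLpNorm_offdiag_le hΦ h12
  obtain ⟨r₂, C₂, hr₂, hC₂, off₂⟩ := exists_eLpNorm_offdiag_le hΦ h21
  obtain ⟨t₁, Λ₁, ht₁, ht₁1, hΛ₁, tail₁⟩ := exists_norm_sub_near_le hΦ ν₁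
  obtain ⟨t₂, Λ₂, ht₂, ht₂1, hΛ₂, tail₂⟩ := exists_norm_sub_near_le hΦ ν₂
  obtain ⟨K₀, hK₀⟩ := exists_nat_ge ((6 * d + k + 2 : ℝ) / (s * (d + k) - (d + 3 * k)))
  set K := K₀ + 4 with hK
  have hK4 : 4 ≤ K := by omega
  have hγ : (6 * d + k + 2 : ℝ) ≤ K * (s * (d + k) - (d + 3 * k)) := by
    have h0 : 0 < s * (d + k) - (d + 3 * k) := by linarith
    rw [div_le_iff₀ h0] at hK₀
    rw [hK]; push_cast; nlinarith
  obtain ⟨D₁, hD₁, tail₁⟩ := tail₁ K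
  obtain ⟨D₂, hD₂, tail₂⟩ := tail₂ K
  set D := max D₁ D₂
  have hD0 : 0 < D := lt_max_of_lt_left hD₁
  set E : ℝ := 2 * (D * (2 * 2 ^ d + D)) * 6 ^ (d + k) with hE
  have hE0 : 0 < E := by positivity
  refine ⟨K, hK4, min (min r₁ r₂) (min t₁ t₂), C₁ + C₂ + Λ₁ + Λ₂ + E, by positivity,
    (min_le_right _ _).trans ((min_le_left _ _).trans ht₁1), by linarith,
    fun Λ hΛC L hLK σ 𝒢 h𝒢 hdeep ρ ρ' A hρ hρ' hρr hA hloc f g hf hg hfs hgs => ?_⟩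
  have hΛ : (1 : ℝ) ≤ Λ := by linarith
  have hΛ0 : (0 : ℝ) < Λ := by linarith
  have hΛN : 0 < Λ := by exact_mod_cast hΛ0
  have hL : 1 ≤ L := hLK ▸ one_le_pow₀ hΛ
  have hL0 : 0 < L := by linarith
  have hhalf : 1 / (2 * L) ≤ 1 / L := one_div_le_one_div_of_le hL0 (by linarith)
  have hρr' := le_min_iff.1 hρr
  have hρr₁ := le_min_iff.1 hρr'.1
  have hρr₂ := le_min_iff.1 hρr'.2
  set 𝒬 := intWindow (0 : Fin d → ℝ) L ×ˢ intWindow (0 : Fin k → ℝ) L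
  have h𝒬 : ∀ q ∈ 𝒬, ‖rv q.1‖ ≤ L ∧ ‖rv q.2‖ ≤ L := by
    intro q hq
    rw [Finset.mem_product, mem_intWindow hL0.le, mem_intWindow hL0.le, sub_zero, sub_zero] at hq
    exact hq
  have hsep : ∀ q₀ ∈ 𝒢, ∀ q ∈ 𝒬, blockOf (Λ ^ (K - 1)) σ q ≠ blockOf (Λ ^ (K - 1)) σ q₀ →
      L / Λ ^ 2 ≤ ‖q - q₀‖ := by
    intro q₀ hq₀ q _ hne
    refine le_of_eq_of_le ?_ ((hdeep q₀ hq₀).le_norm_sub (by positivity) hne)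
    rw [hLK, div_eq_iff (by positivity), Nat.cast_pow, ← pow_add]
    congr 1
  set M₁ := freqSet L ν₁ ρ with hM₁
  set M₂ := freqSet L ν₂ ρ with hM₂
  have hM₁r : ∀ m ∈ M₁, ‖capPt L m - ν₁‖ ≤ ρ' := fun m hm => by
    linarith [(mem_freqSet hL0 hρ).1 hm]
  have hM₂r : ∀ m ∈ M₂, ‖capPt L m - ν₂‖ ≤ ρ' := fun m hm => by
    linarith [(mem_freqSet hL0 hρ).1 hm]
  set N₁ := nearSet Φ L Λ M₁ with hN₁
  set N₂ := nearSet Φ L Λ M₂ with hN₂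
  set T₁ := tubeSet Φ L Λ M₁ 𝒬
  set T₂ := tubeSet Φ L Λ M₂ 𝒬
  have hT₁ : ∀ T ∈ T₁, T.1 ∈ M₁ := fun T => fst_mem_of_mem_tubeSet hΛ0.le
  have hT₂ : ∀ T ∈ T₂, T.1 ∈ M₂ := fun T => fst_mem_of_mem_tubeSet hΛ0.le
  set blk := blockOf (Λ ^ (K - 1)) σ
  set u := fun T => ‖coef L f T‖
  set v := fun T => ‖coef L g T‖
  have hu : ∀ q, 0 ≤ ∑ t ∈ N₁ q, u t ^ 2 := fun q => Finset.sum_nonneg fun _ _ => sq_nonneg _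
  have hv : ∀ q, 0 ≤ ∑ t ∈ N₂ q, v t ^ 2 := fun q => Finset.sum_nonneg fun _ _ => sq_nonneg _
  set a := share 𝒬 N₁ (fun q => ∑ t ∈ N₂ q, v t ^ 2) blk
  set b := share 𝒬 N₂ (fun q => ∑ t ∈ N₁ q, u t ^ 2) blk
  have ha0 : ∀ B T, 0 ≤ a B T := fun B T => share_nonneg hv B T
  have ha1 : ∀ B T, a B T ≤ 1 := fun B T => share_le_one hv B T
  have hb0 : ∀ B T, 0 ≤ b B T := fun B T => share_nonneg hu B T
  have hb1 : ∀ B T, b B T ≤ 1 := fun B T => share_le_one hu B T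
  have hl : 0 ≤ l2 f * l2 g := mul_nonneg (l2_nonneg f) (l2_nonneg g)
  have hsu : ∑ T ∈ T₁, u T ^ 2 ≤ L ^ d * l2 f ^ 2 := by
    rw [l2_sq]; exact sum_norm_sq_coef_le hL0 hf T₁
  have hsv : ∑ T ∈ T₂, v T ^ 2 ≤ L ^ d * l2 g ^ 2 := by
    rw [l2_sq]; exact sum_norm_sq_coef_le hL0 hg T₂
  have hn : ∀ {x : ℝ} {z : ℂ}, 0 ≤ x → x ≤ 1 → ‖(x : ℂ) * z‖ ≤ ‖z‖ := fun {x z} h0 h1 => by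
    rw [norm_mul, Complex.norm_real, Real.norm_of_nonneg h0]
    exact mul_le_of_le_one_left (norm_nonneg _) h1
  have hn' : ∀ {x : ℝ} {z : ℂ}, x ≤ 1 → ‖((1 - x : ℝ) : ℂ) * z‖ ≤ ‖z‖ * (1 - x) :=
    fun {x z} h1 => by
    rw [norm_mul, Complex.norm_real, Real.norm_of_nonneg (by linarith), mul_comm]
  set Z₁ := fun w => packSum Φ L (N₁ (cellOf L w))
      (fun T => ((1 - a (blk (cellOf L w)) T : ℝ) : ℂ) * coef L f T) w *
    packSum Φ L (N₂ (cellOf L w)) (coef L g) w with hZ₁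
  set Z₂ := fun w => packSum Φ L (N₂ (cellOf L w))
      (fun T => ((1 - b (blk (cellOf L w)) T : ℝ) : ℂ) * coef L g T) w *
    packSum Φ L (N₁ (cellOf L w)) (fun T => (a (blk (cellOf L w)) T : ℂ) * coef L f T) w with hZ₂
  set Z₃ := fun w => exOp Φ (weighted L T₁ (a (blk (cellOf L w))) f) w *
    exOp Φ (weighted L T₂ (b (blk (cellOf L w))) g) w with hZ₃
  set Z := fun w => exOp Φ f w * exOp Φ g w with hZ
  set μ := (volume : Measure ((Fin d → ℝ) × (Fin k → ℝ))).restrict (cellOf L ⁻¹' 𝒢)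
  have e₁ : eLpNorm Z₁ (ENNReal.ofReal s) μ ≤ ENNReal.ofReal (C₁ * (Λ : ℝ)⁻¹ * (l2 f * l2 g)) :=
    off₁ s hs1 hs2 K hK4 hγ L Λ (by linarith) hLK 𝒬 𝒢 blk h𝒢 hsep h𝒬 M₁ M₂
      (fun m hm => (hM₁r m hm).trans hρr₁.1) (fun m hm => (hM₂r m hm).trans hρr₁.1) u v
      (fun T => norm_nonneg _) (fun T => norm_nonneg _) _ _ (l2_nonneg f) (l2_nonneg g) hsu hsv
      (fun q T => ((1 - a (blk q) T : ℝ) : ℂ) * coef L f T) (fun q => coef L g)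
      (fun q T => hn' (ha1 _ _)) (fun q T => le_rfl)
  have e₂ : eLpNorm Z₂ (ENNReal.ofReal s) μ ≤ ENNReal.ofReal (C₂ * (Λ : ℝ)⁻¹ * (l2 g * l2 f)) :=
    off₂ s hs1 hs2 K hK4 hγ L Λ (by linarith) hLK 𝒬 𝒢 blk h𝒢 hsep h𝒬 M₂ M₁
      (fun m hm => (hM₂r m hm).trans hρr₁.2) (fun m hm => (hM₁r m hm).trans hρr₁.2) v u
      (fun T => norm_nonneg _) (fun T => norm_nonneg _) _ _ (l2_nonneg g) (l2_nonneg f) hsv hsu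
      (fun q T => ((1 - b (blk q) T : ℝ) : ℂ) * coef L g T)
      (fun q T => (a (blk q) T : ℂ) * coef L f T)
      (fun q T => hn' (hb1 _ _)) (fun q T => hn (ha0 _ _) (ha1 _ _))
  have e₃ : eLpNorm Z₃ (ENNReal.ofReal s) μ ≤ ENNReal.ofReal (A * (l2 f * l2 g)) :=
    hloc.eLpNorm_blocks_le hA hs1 hL0 (by positivity) hρ hρ' hf hg hT₁ hT₂ ha0
      (fun T ℬ => sum_share_le_one hv T ℬ) hb0 (fun T ℬ => sum_share_le_one hu T ℬ) σ 𝒢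
  set τ := D * (Λ : ℝ)⁻¹ * L⁻¹ ^ (2 * (d + k)) with hτ
  have hτ0 : 0 ≤ τ := by positivity
  have hτD : τ ≤ D := by
    rw [hτ, mul_assoc]
    exact mul_le_of_le_one_right hD0.le (mul_le_one₀ (inv_le_one_of_one_le₀ hΛ) (by positivity)
      (pow_le_one₀ (by positivity) (inv_le_one_of_one_le₀ hL)))
  have e₄ : eLpNorm (fun w => Z w - (Z₁ w + (Z₂ w + Z₃ w))) (ENNReal.ofReal s) μ ≤
      ENNReal.ofReal (E * (Λ : ℝ)⁻¹ * (l2 f * l2 g)) := by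
    have hpt : ∀ w, cellOf L w ∈ 𝒢 → ‖Z w - (Z₁ w + (Z₂ w + Z₃ w))‖ ≤
        2 * (τ * (2 * 2 ^ d + D)) * (l2 f * l2 g) := by
      intro w hw
      have hq := h𝒢 hw
      obtain ⟨p₁, p₁'⟩ := tail₁ L Λ (by linarith) hLK ρ hρ (by linarith) f hf hfs _ (h𝒬 _ hq).2 w
        (mem_closedBall_cellOf hL0 w)
      obtain ⟨p₂, p₂'⟩ := tail₂ L Λ (by linarith) hLK ρ hρ (by linarith) g hg hgs _ (h𝒬 _ hq).2 w
        (mem_closedBall_cellOf hL0 w)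
      have hD₁ : D₁ * (Λ : ℝ)⁻¹ * L⁻¹ ^ (2 * (d + k)) * l2 f ≤ τ * l2 f :=
        mul_le_mul_of_nonneg_right (by rw [hτ]; gcongr; exact le_max_left _ _) (l2_nonneg f)
      have hD₂ : D₂ * (Λ : ℝ)⁻¹ * L⁻¹ ^ (2 * (d + k)) * l2 g ≤ τ * l2 g :=
        mul_le_mul_of_nonneg_right (by rw [hτ]; gcongr; exact le_max_right _ _) (l2_nonneg g)
      have hρ1 : ρ + 1 / L ≤ 1 := by linarith
      have hρ1' : ρ ≤ 1 := by linarith [one_div_pos.2 hL0]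
      have n₁ := norm_mul_sub_mul_le hτ0 (l2_nonneg f) (by positivity : (0 : ℝ) ≤ 2 ^ d)
        (norm_exOp_le_l2 Φ hf hρ hρ1' hfs w) (norm_exOp_le_l2 Φ hg hρ hρ1' hgs w)
        (p₁.trans hD₁) (p₂.trans hD₂)
      have q₁ := (p₁' T₁ (nearSet_subset_tubeSet hq) hT₁ _
        fun T => hn (ha0 (blk (cellOf L w)) T) (ha1 _ T)).trans hD₁
      have q₂ := (p₂' T₂ (nearSet_subset_tubeSet hq) hT₂ _
        fun T => hn (hb0 (blk (cellOf L w)) T) (hb1 _ T)).trans hD₂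
      rw [← exOp_synth hΦ.continuous hL0] at q₁ q₂
      have n₂ := norm_mul_sub_mul_le hτ0 (l2_nonneg f) (by positivity : (0 : ℝ) ≤ 2 ^ d)
        (norm_exOp_weighted_le Φ hL0 hρ hρ1 hf hT₁ (ha0 (blk (cellOf L w))) (ha1 _) w)
        (norm_exOp_weighted_le Φ hL0 hρ hρ1 hg hT₂ (hb0 (blk (cellOf L w))) (hb1 _) w) q₁ q₂
      rw [packSum_add Φ L _ (a (blk (cellOf L w))) (coef L f)] at n₁
      have hZe : Z w - (Z₁ w + (Z₂ w + Z₃ w)) = (exOp Φ f w * exOp Φ g w -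
          (packSum Φ L (N₁ (cellOf L w)) (fun T => ((1 - a (blk (cellOf L w)) T : ℝ) : ℂ) *
            coef L f T) w + packSum Φ L (N₁ (cellOf L w)) (fun T => (a (blk (cellOf L w)) T : ℂ) *
            coef L f T) w) * packSum Φ L (N₂ (cellOf L w)) (coef L g) w) -
          (exOp Φ (weighted L T₁ (a (blk (cellOf L w))) f) w *
            exOp Φ (weighted L T₂ (b (blk (cellOf L w))) g) w -
          packSum Φ L (N₁ (cellOf L w)) (fun T => (a (blk (cellOf L w)) T : ℂ) * coef L f T) w *
            packSum Φ L (N₂ (cellOf L w))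
                (fun T => (b (blk (cellOf L w)) T : ℂ) * coef L g T) w) := by
        simp only [hZ, hZ₁, hZ₂, hZ₃]
        rw [packSum_add Φ L (N₂ (cellOf L w)) (b (blk (cellOf L w))) (coef L g)]
        ring
      rw [hZe]
      refine (norm_sub_le _ _).trans ((add_le_add n₁ n₂).trans ?_)
      calc _ = 2 * (τ * (2 * 2 ^ d + τ)) * (l2 f * l2 g) := by ring
        _ ≤ _ := by gcongr
    refine (eLpNorm_cells_le hL hs1 h𝒢 hpt).trans_eq ?_
    congr 1
    rw [hE, hτ, inv_pow]; field_simp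
  have hp : 1 ≤ ENNReal.ofReal s := ENNReal.one_le_ofReal.2 hs1
  have hc := hΦ.continuous
  have m₁ : Measurable Z₁ := (measurable_glue L fun q => (continuous_packSum hc hL0 (N₁ q)
    fun T => ((1 - a (blk q) T : ℝ) : ℂ) * coef L f T).measurable).mul
    (measurable_glue L fun q => (continuous_packSum hc hL0 (N₂ q) (coef L g)).measurable)
  have m₂ : Measurable Z₂ := (measurable_glue L fun q => (continuous_packSum hc hL0 (N₂ q)
    fun T => ((1 - b (blk q) T : ℝ) : ℂ) * coef L g T).measurable).mul
    (measurable_glue L fun q => (continuous_packSum hc hL0 (N₁ q)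
      fun T => (a (blk q) T : ℂ) * coef L f T).measurable)
  have hw : ∀ S (c : (Fin d → ℤ) × (Fin d → ℤ) → ℝ) f, Continuous (exOp Φ (weighted L S c f)) :=
    fun S c f => continuous_exOp hc (memLp_one_iff_integrable.1 (memLp_synth hL0 _ _ _))
  have m₃ : Measurable Z₃ :=
    (measurable_glue L fun q => (hw T₁ (a (blk q)) f).measurable).mul
      (measurable_glue L fun q => (hw T₂ (b (blk q)) g).measurable)
  have m : Measurable Z := (continuous_exOp hc (integrable_of_ball_support hf hfs)).measurable.mul
    (continuous_exOp hc (integrable_of_ball_support hg hgs)).measurable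
  have hZe : Z = (fun w => Z w - (Z₁ w + (Z₂ w + Z₃ w))) + (Z₁ + (Z₂ + Z₃)) := by
    funext w; simp
  rw [hZe]
  refine (eLpNorm_add_le (m.sub (m₁.add (m₂.add m₃))).aestronglyMeasurable
    (m₁.add (m₂.add m₃)).aestronglyMeasurable hp).trans ?_
  refine (add_le_add e₄ ((eLpNorm_add_le m₁.aestronglyMeasurable
    (m₂.add m₃).aestronglyMeasurable hp).trans (add_le_add e₁ ((eLpNorm_add_le
    m₂.aestronglyMeasurable m₃.aestronglyMeasurable hp).trans (add_le_add e₂ e₃))))).trans ?_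
  have hl' : 0 ≤ l2 g * l2 f := mul_nonneg (l2_nonneg g) (l2_nonneg f)
  rw [← ENNReal.ofReal_add (by positivity) (by positivity),
    ← ENNReal.ofReal_add (by positivity) (by positivity),
    ← ENNReal.ofReal_add (by positivity) (by positivity)]
  refine ENNReal.ofReal_le_ofReal ?_
  have : 0 ≤ (Λ₁ + Λ₂) * (Λ : ℝ)⁻¹ * (l2 f * l2 g) := by
    have : 0 ≤ Λ₁ + Λ₂ := by linarith
    positivity
  linarith

end GoodEstimate

section Induction

variable {d k : ℕ} {Φ : (Fin d → ℝ) → Fin k → ℝ} {ν₁ ν₂ : Fin d → ℝ} {s : ℝ}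

lemma LocEst.mono {R R' ρ ρ' A A' : ℝ} (h : LocEst Φ ν₁ ν₂ s R' ρ' A') (hR : R ≤ R')
    (hρ : ρ ≤ ρ') (hA : A' ≤ A) : LocEst Φ ν₁ ν₂ s R ρ A := by
  intro f g hf hg hfs hgs w₀
  refine (eLpNorm_mono_measure _ (Measure.restrict_mono
    (Metric.closedBall_subset_closedBall (by linarith)) le_rfl)).trans
    ((h f g hf hg (fun ξ hξ => (hfs ξ hξ).trans hρ) (fun ξ hξ => (hgs ξ hξ).trans hρ) w₀).trans
    (ENNReal.ofReal_le_ofReal (mul_le_mul_of_nonneg_right hA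
      (mul_nonneg (l2_nonneg f) (l2_nonneg g)))))

lemma norm_exOp_mul_exOp_le {f g : (Fin d → ℝ) → ℂ} (hf : MemLp f 2) (hg : MemLp g 2)
    {ρ : ℝ} (hρ : 0 ≤ ρ) (hρ1 : ρ ≤ 1) (hfs : ∀ ξ, f ξ ≠ 0 → ‖ξ - ν₁‖ ≤ ρ)
    (hgs : ∀ ξ, g ξ ≠ 0 → ‖ξ - ν₂‖ ≤ ρ) (w : (Fin d → ℝ) × (Fin k → ℝ)) :
    ‖exOp Φ f w * exOp Φ g w‖ ≤ 4 ^ d * (l2 f * l2 g) := by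
  rw [norm_mul]
  refine (mul_le_mul (norm_exOp_le_l2 Φ hf hρ hρ1 hfs w) (norm_exOp_le_l2 Φ hg hρ hρ1 hgs w)
    (norm_nonneg _) (mul_nonneg (by positivity) (l2_nonneg f))).trans_eq ?_
  rw [show (4 : ℝ) = 2 * 2 by norm_num, mul_pow]; ring

lemma exists_locEst (hΦ : Continuous Φ) (R : ℝ) {ρ : ℝ} (hρ : 0 ≤ ρ) (hρ1 : ρ ≤ 1) :
    ∃ A, 1 ≤ A ∧ LocEst Φ ν₁ ν₂ s R ρ A := by
  set V := volume (Metric.closedBall (0 : (Fin d → ℝ) × (Fin k → ℝ)) (R / 2)) ^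
    ((ENNReal.ofReal s).toReal⁻¹)
  have hV : V ≠ ∞ := ENNReal.rpow_ne_top_of_nonneg (by positivity)
    (measure_closedBall_lt_top).ne
  refine ⟨max 1 (V.toReal * 4 ^ d), le_max_left _ _,
    LocEst.of_center_zero hΦ fun f g hf hg hfs hgs => ?_⟩
  have hl : 0 ≤ l2 f * l2 g := mul_nonneg (l2_nonneg f) (l2_nonneg g)
  refine (eLpNorm_le_of_ae_bound (Filter.Eventually.of_forall
    (norm_exOp_mul_exOp_le hf hg hρ hρ1 hfs hgs))).trans ?_
  rw [Measure.restrict_apply_univ]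
  change V * _ ≤ _
  rw [show V = ENNReal.ofReal V.toReal from (ENNReal.ofReal_toReal hV).symm,
    ENNReal.toReal_ofReal ENNReal.toReal_nonneg, ← ENNReal.ofReal_mul ENNReal.toReal_nonneg,
    ← mul_assoc]
  exact ENNReal.ofReal_le_ofReal (mul_le_mul_of_nonneg_right (le_max_right _ _) hl)

/-- The bilinear estimate passes from scale `Λ ^ (2 * K - 1)` to scale `Λ ^ (2 * K)` with a small
loss in the constant. -/
lemma exists_locEst_improvement (hΦ : ContDiff ℝ (⊤ : ℕ∞) Φ) (h12 : LocalCond Φ ν₁ ν₂)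
    (h21 : LocalCond Φ ν₂ ν₁) (hs1 : 1 ≤ s) (hs2 : s ≤ 2)
    (hs : (d : ℝ) + 3 * k < s * (d + k)) :
    ∃ K : ℕ, 4 ≤ K ∧ ∃ r C : ℝ, 0 < r ∧ r ≤ 1 ∧ 1 ≤ C ∧ ∀ Λ : ℕ, C ≤ Λ → ∀ ρ ρ' A : ℝ,
    0 ≤ ρ → ρ + 1 / (Λ : ℝ) ^ K ≤ ρ' → ρ' ≤ r → 1 ≤ A →
    LocEst Φ ν₁ ν₂ s ((Λ : ℝ) ^ (2 * K - 1)) ρ' A →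
    LocEst Φ ν₁ ν₂ s ((Λ : ℝ) ^ (2 * K)) ρ (A * (1 + C * (Λ : ℝ)⁻¹)) := by
  obtain ⟨K, hK, r, C₀, hr, hr1, hC₀, h⟩ := exists_eLpNorm_good_le hΦ h12 h21 hs1 hs2 hs
  refine ⟨K, hK, r, 4 * (d + k) + C₀ + 4 * (d + k) * C₀ + 2, hr, hr1, by nlinarith,
    fun Λ hΛC ρ ρ' A hρ hρ' hρr hA hloc =>
    LocEst.of_center_zero hΦ.continuous fun f g hf hg hfs hgs => ?_⟩
  have hn : (0 : ℝ) ≤ d + k := by positivity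
  have hnC : 0 ≤ (d + k : ℝ) * C₀ := by positivity
  have hΛ2 : (2 : ℝ) ≤ Λ := by linarith
  have hΛ0 : (0 : ℝ) < Λ := by linarith
  have hΛN : 0 < Λ := by exact_mod_cast hΛ0
  set L : ℝ := (Λ : ℝ) ^ K with hL
  have hL2 : 2 ≤ L := hΛ2.trans (le_self_pow₀ (by linarith) (by omega))
  have hKK : Λ ^ (K - 1) = Λ * Λ ^ (K - 2) := by
    rw [← pow_succ']; congr 1; omega
  have hpos : 0 < Λ ^ (K - 2) := by positivity
  have hcN : Λ ^ (K - 2) ≤ Λ ^ (K - 1) := by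
    rw [hKK]; exact Nat.le_mul_of_pos_left _ hΛN
  have h4 : 4 * ((d + k) * Λ ^ (K - 2)) ≤ Λ ^ (K - 1) := by
    rw [hKK, ← mul_assoc]
    refine Nat.mul_le_mul_right _ ?_
    have : (4 * (d + k) : ℝ) ≤ Λ := by linarith
    exact_mod_cast this
  set Z := fun w => exOp Φ f w * exOp Φ g w
  have hρ1 : ρ ≤ 1 := by
    have : 0 ≤ 1 / L := by positivity
    linarith
  have hfin : ∀ q : (Fin d → ℤ) × (Fin k → ℤ), ∫⁻ w in cellOf L ⁻¹' {q}, ‖Z w‖ₑ ^ s ≠ ∞ := by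
    intro q
    refine ne_top_of_le_ne_top (b := ∫⁻ _ in Metric.closedBall
      (L • rv q.1, L • rv q.2) L, ENNReal.ofReal (4 ^ d * (l2 f * l2 g)) ^ s) ?_ ?_
    · rw [setLIntegral_const]
      exact ENNReal.mul_ne_top (ENNReal.rpow_ne_top_of_nonneg (by linarith) ENNReal.ofReal_ne_top)
        measure_closedBall_lt_top.ne
    · refine lintegral_mono' (Measure.restrict_mono ?_ le_rfl) fun w =>
        ENNReal.rpow_le_rpow ?_ (by linarith)
      · rintro w rfl
        exact mem_closedBall_cellOf (by linarith) w
      · rw [← ofReal_norm]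
        exact ENNReal.ofReal_le_ofReal (norm_exOp_mul_exOp_le hf hg hρ hρ1 hfs hgs w)
  obtain ⟨σ, 𝒢, h𝒢, hdeep, hle⟩ := exists_shift_eLpNorm_le hL2 hs1 (N := Λ ^ (K - 1))
    (by positivity) hcN h4 hfin
  have hsc : ((Λ ^ (K - 1) : ℕ) : ℝ) * L = (Λ : ℝ) ^ (2 * K - 1) := by
    rw [Nat.cast_pow, hL, ← pow_add]; congr 1; omega
  have hgood := h Λ (by linarith) L rfl σ 𝒢 h𝒢 hdeep ρ ρ' A hρ hρ' hρr (by linarith)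
    (hsc ▸ hloc) f g hf hg hfs hgs
  have hl : 0 ≤ l2 f * l2 g := mul_nonneg (l2_nonneg f) (l2_nonneg g)
  rw [show (Λ : ℝ) ^ (2 * K) = L ^ 2 by rw [hL, ← pow_mul, mul_comm]]
  refine hle.trans ((mul_le_mul_right hgood _).trans ?_)
  rw [← ENNReal.ofReal_mul (by positivity), ← mul_assoc]
  refine ENNReal.ofReal_le_ofReal (mul_le_mul_of_nonneg_right ?_ hl)
  have e : (d + k : ℝ) * (Λ ^ (K - 2) : ℕ) / (Λ ^ (K - 1) : ℕ) = (d + k) * (Λ : ℝ)⁻¹ := by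
    have : ((Λ ^ (K - 2) : ℕ) : ℝ) ≠ 0 := by positivity
    rw [hKK, Nat.cast_mul]; field_simp
  rw [e]
  have hi : 0 ≤ (Λ : ℝ)⁻¹ := by positivity
  have hi1 : (Λ : ℝ)⁻¹ ≤ 1 := inv_le_one_of_one_le₀ (by linarith)
  have hii : (Λ : ℝ)⁻¹ * (Λ : ℝ)⁻¹ ≤ (Λ : ℝ)⁻¹ := mul_le_of_le_one_left hi hi1
  calc _ ≤ (1 + 4 * ((d + k) * (Λ : ℝ)⁻¹)) * (A * (1 + C₀ * (Λ : ℝ)⁻¹)) := by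
        refine mul_le_mul_of_nonneg_left ?_ (by positivity)
        nlinarith [mul_nonneg (by linarith : 0 ≤ C₀) hi]
    _ = A * (1 + (4 * (d + k) + C₀) * (Λ : ℝ)⁻¹ +
        4 * ((d + k) * C₀) * ((Λ : ℝ)⁻¹ * (Λ : ℝ)⁻¹)) := by ring
    _ ≤ A * (1 + (4 * (d + k) + C₀) * (Λ : ℝ)⁻¹ + 4 * ((d + k) * C₀) * (Λ : ℝ)⁻¹) := by gcongr
    _ ≤ _ := by
        refine mul_le_mul_of_nonneg_left ?_ (by linarith)
        linarith

lemma exists_forall_locEst (hΦ : ContDiff ℝ (⊤ : ℕ∞) Φ) (h12 : LocalCond Φ ν₁ ν₂)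
    (h21 : LocalCond Φ ν₂ ν₁) (hs1 : 1 ≤ s) (hs2 : s ≤ 2)
    (hs : (d : ℝ) + 3 * k < s * (d + k)) :
    ∃ r A : ℝ, 0 < r ∧ 0 ≤ A ∧ ∀ R, LocEst Φ ν₁ ν₂ s R r A := by
  obtain ⟨K, hK, r, C, hr, hr1, hC, hstep⟩ := exists_locEst_improvement hΦ h12 h21 hs1 hs2 hs
  obtain ⟨j₀, hj₀⟩ : ∃ j₀ : ℕ, 2 * K ≤ j₀ ∧ 2 * C ≤ 2 ^ j₀ ∧ 2 / r ≤ 2 ^ j₀ := by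
    have ht := tendsto_pow_atTop_atTop_of_one_lt (one_lt_two : (1 : ℝ) < 2)
    exact ((Filter.eventually_ge_atTop _).and ((ht.eventually_ge_atTop _).and
      (ht.eventually_ge_atTop _))).exists
  obtain ⟨hj1, hj2, hj3⟩ := hj₀
  set ρ := fun j : ℕ => r / 2 * (1 + (1 / 2) ^ j) with hρ
  obtain ⟨A, hA, hbase⟩ := exists_locEst (ν₁ := ν₁) (ν₂ := ν₂) (s := s) hΦ.continuous
    (((2 ^ j₀ : ℕ) : ℝ) ^ (2 * K)) hr.le hr1
  have hall : ∀ j : ℕ, LocEst Φ ν₁ ν₂ s (((2 ^ (j + j₀) : ℕ) : ℝ) ^ (2 * K)) (ρ j)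
      (A * (2 - (1 / 2) ^ j)) := by
    intro j
    induction j with
    | zero =>
      convert hbase using 1
      · rw [zero_add]
      · simp only [hρ]; ring
      · ring
    | succ j ih =>
      set x : ℝ := (1 / 2) ^ j with hx
      have hx0 : 0 < x := by positivity
      have hx1 : x ≤ 1 := pow_le_one₀ (by norm_num) (by norm_num)
      have hxs : (1 / 2 : ℝ) ^ (j + 1) = x / 2 := by rw [pow_succ, hx]; ring
      have hinv : (((2 ^ (j + 1 + j₀) : ℕ) : ℝ))⁻¹ = x / 2 * (2 ^ j₀)⁻¹ := by
        rw [← hxs]; push_cast; rw [pow_add, mul_inv, one_div, inv_pow]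
      have hbig : (1 : ℝ) ≤ 2 ^ (j + 1) := one_le_pow₀ (by norm_num)
      have hΛ : C ≤ ((2 ^ (j + 1 + j₀) : ℕ) : ℝ) := by
        push_cast; rw [pow_add]; nlinarith
      have hΛ1 : (1 : ℝ) ≤ ((2 ^ (j + 1 + j₀) : ℕ) : ℝ) := hC.trans hΛ
      have h := hstep (2 ^ (j + 1 + j₀)) hΛ (ρ (j + 1)) (ρ j) (A * (2 - x)) (by positivity) ?_ ?_
        (by nlinarith) (ih.mono ?_ le_rfl le_rfl)
      · refine h.mono le_rfl le_rfl ?_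
        rw [hinv, hxs, mul_assoc]
        refine mul_le_mul_of_nonneg_left ?_ (by linarith)
        have hC2 : C * (2 ^ j₀)⁻¹ ≤ 1 / 2 := by
          rw [← div_eq_mul_inv, div_le_iff₀ (by positivity)]; linarith
        have : C * (x / 2 * (2 ^ j₀)⁻¹) ≤ x / 4 := by nlinarith
        nlinarith
      · have h1 : 1 / ((2 ^ (j + 1 + j₀) : ℕ) : ℝ) ^ K ≤ x / 2 * (2 ^ j₀)⁻¹ := by
          rw [← hinv, one_div]
          exact inv_anti₀ (by positivity) (le_self_pow₀ hΛ1 (by omega))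
        have h2 : ((2 : ℝ) ^ j₀)⁻¹ ≤ r / 2 := by
          rw [← inv_div]; exact inv_anti₀ (by positivity) hj3
        have h3 : x / 2 * (2 ^ j₀)⁻¹ ≤ x / 2 * (r / 2) := by gcongr
        simp only [hρ, hxs, ← hx]
        nlinarith
      · simp only [hρ, ← hx]; nlinarith
      · push_cast
        rw [← pow_mul, ← pow_mul]
        refine pow_le_pow_right₀ (by norm_num) ?_
        obtain ⟨m, hm⟩ : ∃ m, 2 * K = m + 1 := ⟨2 * K - 1, by omega⟩
        rw [hm, Nat.add_sub_cancel]
        nlinarith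
  refine ⟨r / 2, 2 * A, by positivity, by linarith, fun R => ?_⟩
  have ht := tendsto_pow_atTop_atTop_of_one_lt (one_lt_two : (1 : ℝ) < 2)
  obtain ⟨j, hj⟩ := (ht.eventually_ge_atTop (max R 1)).exists
  have hj1' := max_le_iff.1 hj
  refine (hall j).mono ?_ ?_ ?_
  · refine hj1'.1.trans ?_
    push_cast
    rw [← pow_mul]
    refine pow_le_pow_right₀ (by norm_num) ?_
    nlinarith
  · simp only [hρ]
    have : (0 : ℝ) ≤ (1 / 2) ^ j := by positivity
    nlinarith
  · have : (0 : ℝ) ≤ (1 / 2) ^ j := by positivity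
    nlinarith

lemma eLpNorm_le_of_forall_closedBall {W : Type*} [PseudoMetricSpace W] [MeasurableSpace W]
    {μ : Measure W} {Z : W → ℂ} (hs : 0 < s) {c : ℝ} (hc : 0 ≤ c) (w₀ : W)
    (h : ∀ n : ℕ, eLpNorm Z (ENNReal.ofReal s) (μ.restrict (Metric.closedBall w₀ n)) ≤
      ENNReal.ofReal c) : eLpNorm Z (ENNReal.ofReal s) μ ≤ ENNReal.ofReal c := by
  refine eLpNorm_ofReal_le hs hc ?_
  have hu : (⋃ n : ℕ, Metric.closedBall w₀ (n : ℝ)) = Set.univ := Metric.iUnion_closedBall_nat w₀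
  rw [← setLIntegral_univ, ← hu, setLIntegral_iUnion_of_directed]
  · exact iSup_le fun n => lintegral_rpow_le_of_eLpNorm_le hs hc (h n)
  · exact Monotone.directed_le fun m n hmn =>
      Metric.closedBall_subset_closedBall (Nat.cast_le.2 hmn)

end Induction

section EqualDimensions

variable {d : ℕ} {Φ : (Fin d → ℝ) → Fin d → ℝ} {ν₁ ν₂ : Fin d → ℝ}

/-- The parametrization of the sum of two pieces of the surface. -/
def pairMap (Φ : (Fin d → ℝ) → Fin d → ℝ) (y : (Fin d → ℝ) × (Fin d → ℝ)) :
    (Fin d → ℝ) × (Fin d → ℝ) := (y.1 + y.2, Φ y.1 + Φ y.2)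

lemma exists_pairMap_lower_bound (hΦ : ContDiff ℝ (⊤ : ℕ∞) Φ)
    (hD : (Dmat d d Φ ν₁ ν₂).det ≠ 0) :
    ∃ r c : ℝ, 0 < r ∧ 0 < c ∧ ∀ y y' : (Fin d → ℝ) × (Fin d → ℝ), ‖y - (ν₁, ν₂)‖ ≤ r →
    ‖y' - (ν₁, ν₂)‖ ≤ r → ‖y - y'‖ ≤ c * ‖pairMap Φ y - pairMap Φ y'‖ := by
  set A := (ContinuousLinearMap.fst ℝ (Fin d → ℝ) (Fin d → ℝ) + .snd ℝ _ _).prod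
    ((fderiv ℝ Φ ν₁).comp (.fst ℝ _ _) + (fderiv ℝ Φ ν₂).comp (.snd ℝ _ _)) with hA
  have hinj : A.toLinearMap.ker = ⊥ := by
    refine LinearMap.ker_eq_bot'.2 ?_
    rintro ⟨u, v⟩ h
    have h1 : u + v = 0 := congrArg Prod.fst h
    have h2 : fderiv ℝ Φ ν₁ u + fderiv ℝ Φ ν₂ v = 0 := congrArg Prod.snd h
    obtain rfl : u = -v := eq_neg_of_add_eq_zero_left h1
    have h3 : Dmat d d Φ ν₁ ν₂ *ᵥ v = 0 := by
      rw [← fderiv_sub_fderiv_apply hΦ, ← h2, map_neg]; abel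
    have hv := Matrix.eq_zero_of_mulVec_eq_zero hD h3
    simp [hv]
  obtain ⟨K, hK, hAK⟩ := A.toLinearMap.exists_antilipschitzWith hinj
  have hK' : (0 : ℝ) < K := hK
  have hder : HasFDerivAt (pairMap Φ) A (ν₁, ν₂) := by
    have h1 := (hΦ.differentiable (by simp) ν₁).hasFDerivAt.comp (ν₁, ν₂)
      (hasFDerivAt_fst (𝕜 := ℝ) (p := (ν₁, ν₂)))
    have h2 := (hΦ.differentiable (by simp) ν₂).hasFDerivAt.comp (ν₁, ν₂)
      (hasFDerivAt_snd (𝕜 := ℝ) (p := (ν₁, ν₂)))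
    exact (hasFDerivAt_fst.add hasFDerivAt_snd).prodMk (h1.add h2)
  have hP : ContDiff ℝ (⊤ : ℕ∞) (pairMap Φ) :=
    (contDiff_fst.add contDiff_snd).prodMk
      ((hΦ.comp contDiff_fst).add (hΦ.comp contDiff_snd))
  obtain ⟨r, hr, h⟩ := exists_strict_bound hP (ν₁, ν₂) (ε := 1 / (2 * K)) (by positivity)
  refine ⟨r, 2 * K, hr, by positivity, fun y y' hy hy' => ?_⟩
  have h1 := h y y' hy hy'
  rw [hder.fderiv] at h1
  have h2 : ‖y - y'‖ ≤ K * ‖A (y - y')‖ := by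
    simpa using hAK.le_mul_dist (y - y') 0
  have h3 : ‖A (y - y')‖ ≤ ‖pairMap Φ y - pairMap Φ y'‖ + 1 / (2 * K) * ‖y - y'‖ := by
    have := norm_sub_le (pairMap Φ y - pairMap Φ y')
      (pairMap Φ y - pairMap Φ y' - A (y - y'))
    have e : pairMap Φ y - pairMap Φ y' - (pairMap Φ y - pairMap Φ y' - A (y - y')) =
        A (y - y') := by abel
    rw [e] at this
    linarith
  have h4 : K * ‖A (y - y')‖ ≤ K * ‖pairMap Φ y - pairMap Φ y'‖ + 1 / 2 * ‖y - y'‖ := by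
    refine (mul_le_mul_of_nonneg_left h3 hK'.le).trans_eq ?_
    field_simp
  linarith

lemma volume_closedBall_prod (y : (Fin d → ℝ) × (Fin d → ℝ)) {ρ : ℝ} (hρ : 0 ≤ ρ) :
    volume (Metric.closedBall y ρ) = ENNReal.ofReal ((2 * ρ) ^ (d + d)) := by
  rw [← closedBall_prod_same y.1 y.2 ρ, Measure.volume_eq_prod, Measure.prod_prod,
    Real.volume_pi_closedBall _ hρ, Real.volume_pi_closedBall _ hρ, Fintype.card_fin,
    ← ENNReal.ofReal_mul (by positivity), pow_add]

lemma osc_pairMap (f g : (Fin d → ℝ) → ℂ) (w : (Fin d → ℝ) × (Fin d → ℝ)) :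
    osc volume (pairMap Φ) (fun y => f y.1 * g y.2) w = exOp Φ f w * exOp Φ g w := by
  unfold osc exOp
  rw [← integral_prod_mul (fun ξ => eC (phase Φ w ξ) * f ξ) (fun ξ => eC (phase Φ w ξ) * g ξ)]
  refine integral_congr_ae (Filter.Eventually.of_forall fun y => ?_)
  simp only [phase_eq_dotW]
  rw [show pairMap Φ y = (y.1, Φ y.1) + (y.2, Φ y.2) from rfl, dotW_add_right, eC_add]
  ring

lemma exists_eLpNorm_two_le (hΦ : ContDiff ℝ (⊤ : ℕ∞) Φ) (hD : (Dmat d d Φ ν₁ ν₂).det ≠ 0) :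
    ∃ r A : ℝ, 0 < r ∧ 0 ≤ A ∧ ∀ R, LocEst Φ ν₁ ν₂ 2 R r A := by
  obtain ⟨r, c, hr, hc, h⟩ := exists_pairMap_lower_bound hΦ hD
  obtain ⟨C, hC, hosc⟩ := exists_lintegral_osc_le d d
  have hpow : ∀ x : ℝ≥0∞, x ^ (2 : ℝ) = x ^ 2 := fun x => by
    rw [← ENNReal.rpow_natCast]; norm_num
  have key : ∀ R, 0 < R → LocEst Φ ν₁ ν₂ 2 R r (√(C * 2 * (2 * c) ^ (d + d))) := by
    intro R hR f g hf hg hfs hgs w₀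
    set L := R / 2 with hL
    have hL0 : 0 < L := by positivity
    set A := √(C * 2 * (2 * c) ^ (d + d)) with hA
    have hA2 : A ^ 2 = C * 2 * (2 * c) ^ (d + d) := Real.sq_sqrt (by positivity)
    refine eLpNorm_ofReal_le two_pos
      (mul_nonneg (Real.sqrt_nonneg _) (mul_nonneg (l2_nonneg f) (l2_nonneg g))) ?_
    have hPm : Measurable (pairMap Φ) :=
      ((continuous_fst.add continuous_snd).prodMk ((hΦ.continuous.comp continuous_fst).add
        (hΦ.continuous.comp continuous_snd))).measurable
    have hint : Integrable (fun y : (Fin d → ℝ) × (Fin d → ℝ) => f y.1 * g y.2) :=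
      (integrable_of_ball_support hf hfs).mul_prod (integrable_of_ball_support hg hgs)
    have h1 := hosc volume (pairMap Φ) hPm (fun y => f y.1 * g y.2) hint
      (Metric.closedBall (ν₁, ν₂) r) measurableSet_closedBall ?_ L hL0 w₀
      (ENNReal.ofReal ((2 * (c * (1 / L))) ^ (d + d))) ?_
    · simp only [osc_pairMap] at h1
      simp only [hpow]
      refine h1.trans (le_of_eq ?_)
      have e1 : ∫⁻ y : (Fin d → ℝ) × (Fin d → ℝ), ‖f y.1 * g y.2‖ₑ ^ 2 =
          ENNReal.ofReal ((l2 f * l2 g) ^ 2) := by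
        have e2 : ∀ f : (Fin d → ℝ) → ℂ, MemLp f 2 →
            ∫⁻ ξ, ‖f ξ‖ₑ ^ 2 = ENNReal.ofReal (l2 f ^ 2) := by
          intro f hf
          rw [l2_sq, ofReal_integral_eq_lintegral_ofReal
            ((memLp_two_iff_integrable_sq_norm hf.1).1 hf)
            (Filter.Eventually.of_forall fun ξ => by positivity)]
          refine lintegral_congr fun ξ => ?_
          rw [ENNReal.ofReal_pow (norm_nonneg _), ofReal_norm]
        simp only [enorm_mul, mul_pow]
        rw [Measure.volume_eq_prod, lintegral_prod_mul (hf.1.enorm.pow_const 2)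
          (hg.1.enorm.pow_const 2), e2 f hf, e2 g hg, ← ENNReal.ofReal_mul (by positivity)]
      rw [e1, ← ENNReal.ofReal_mul (by positivity),
        show (2 : ℝ≥0∞) = ENNReal.ofReal 2 by simp, ← ENNReal.ofReal_mul (by positivity),
        ← ENNReal.ofReal_mul (by positivity)]
      congr 1
      rw [show ((2 : ℝ)) = ((2 : ℕ) : ℝ) by norm_num, Real.rpow_natCast, mul_pow A, hA2]
      have : (2 * (c * (1 / L))) ^ (d + d) = (2 * c) ^ (d + d) / L ^ (d + d) := by
        rw [← div_pow]; congr 1; ring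
      push_cast
      rw [this]
      field_simp
    · intro y hy
      rw [Metric.mem_closedBall, dist_eq_norm, Prod.norm_def, max_le_iff, not_and_or] at hy
      by_contra! hne
      exact hy.elim (fun h => h (hfs _ (left_ne_zero_of_mul hne)))
        fun h => h (hgs _ (right_ne_zero_of_mul hne))
    · intro y hy
      rw [← volume_closedBall_prod y (by positivity)]
      refine measure_mono fun y' hy' => ?_
      rw [Metric.mem_closedBall, dist_comm, dist_eq_norm]
      exact (h y y' (mem_closedBall_iff_norm.1 hy) (mem_closedBall_iff_norm.1 hy'.1)).trans
        (mul_le_mul_of_nonneg_left hy'.2.le hc.le)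
  exact ⟨r, _, hr, Real.sqrt_nonneg _, fun R =>
    (key (max R 1) (by positivity)).mono (le_max_left _ _) le_rfl le_rfl⟩

end EqualDimensions

section LocalEstimate

variable {d k : ℕ} {Φ : (Fin d → ℝ) → Fin k → ℝ} {ν₁ ν₂ : Fin d → ℝ} {s : ℝ}

lemma LocalCond.le (hk : 1 ≤ k) (h : LocalCond Φ ν₁ ν₂) : k ≤ d := by
  obtain ⟨-, h2⟩ := h (Pi.single ⟨0, hk⟩ 1) (by simp [Pi.single_apply])
  have h3 := Matrix.rank_of_isUnit _ ((Matrix.isUnit_iff_isUnit_det _).2 (isUnit_iff_ne_zero.2 h2))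
  rw [Fintype.card_fin, Matrix.mul_assoc] at h3
  exact h3.symm.le.trans ((Matrix.rank_mul_le_left _ _).trans (Matrix.rank_le_width _))

/-- The bilinear estimate for functions supported near a pair of points satisfying the curvature
and transversality conditions. -/
lemma exists_eLpNorm_exOp_mul_le (hΦ : ContDiff ℝ (⊤ : ℕ∞) Φ) (hk : 1 ≤ k)
    (h12 : LocalCond Φ ν₁ ν₂) (h21 : LocalCond Φ ν₂ ν₁) (hs1 : 1 ≤ s) (hs2 : s ≤ 2)
    (hs : (d : ℝ) + 3 * k < s * (d + k) ∨ d = k ∧ s = 2) :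
    ∃ r A : ℝ, 0 < r ∧ 0 ≤ A ∧ ∀ f g : (Fin d → ℝ) → ℂ, MemLp f 2 → MemLp g 2 →
    (∀ ξ, f ξ ≠ 0 → ‖ξ - ν₁‖ ≤ r) → (∀ ξ, g ξ ≠ 0 → ‖ξ - ν₂‖ ≤ r) →
    eLpNorm (fun w => exOp Φ f w * exOp Φ g w) (ENNReal.ofReal s) ≤
      ENNReal.ofReal (A * (l2 f * l2 g)) := by
  obtain ⟨r, A, hr, hA, h⟩ : ∃ r A : ℝ, 0 < r ∧ 0 ≤ A ∧ ∀ R, LocEst Φ ν₁ ν₂ s R r A := by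
    rcases hs with hs | ⟨rfl, rfl⟩
    · exact exists_forall_locEst hΦ h12 h21 hs1 hs2 hs
    · refine exists_eLpNorm_two_le hΦ fun hD => ?_
      obtain ⟨-, h2⟩ := h12 (Pi.single ⟨0, hk⟩ 1) (by simp [Pi.single_apply])
      simp [Matrix.det_mul, hD] at h2
  refine ⟨r, A, hr, hA, fun f g hf hg hfs hgs => ?_⟩
  refine eLpNorm_le_of_forall_closedBall (by linarith)
    (mul_nonneg hA (mul_nonneg (l2_nonneg f) (l2_nonneg g))) 0 fun n => ?_
  have := h (2 * n) f g hf hg hfs hgs 0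
  rwa [mul_div_cancel_left₀ _ two_ne_zero] at this

end LocalEstimate

section Bands

/-- The index of the dyadic shell containing `z`; the disc of radius one has index zero. -/
def shell (z : ℂ) : ℕ := Nat.clog 2 ⌈‖z‖⌉₊

/-- The function which is the identity on the `j`-th dyadic shell and zero elsewhere. -/
def shellPart (j : ℕ) (z : ℂ) : ℂ := if shell z = j then z else 0

lemma measurable_shellPart (j : ℕ) : Measurable (shellPart j) := by
  have h : Measurable shell := (Measurable.of_discrete (f := Nat.clog 2)).comp
    (Nat.measurable_ceil.comp measurable_norm)
  exact Measurable.ite (h (measurableSet_singleton j)) measurable_id measurable_const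

lemma norm_shellPart_le (j : ℕ) (z : ℂ) : ‖shellPart j z‖ ≤ 2 ^ j := by
  unfold shellPart
  split_ifs with h
  · refine (Nat.le_ceil _).trans ?_
    rw [← h]
    exact_mod_cast Nat.le_pow_clog one_lt_two ⌈‖z‖⌉₊
  · simp

lemma lt_norm_of_shell {j : ℕ} {z : ℂ} (h : shell z = j + 1) : (2 : ℝ) ^ j < ‖z‖ := by
  have h1 : 2 ^ j < ⌈‖z‖⌉₊ := (Nat.lt_clog_iff_pow_lt one_lt_two).1 (by
    change j < shell z; omega)
  exact_mod_cast Nat.lt_ceil.1 h1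

lemma sum_shellPart (n : ℕ) (z : ℂ) :
    ∑ j ∈ Finset.range n, shellPart j z = if shell z < n then z else 0 := by
  simp [shellPart]

lemma norm_shellPart_pow_le {p : ℝ} (hp : 0 ≤ p) (j m : ℕ) (z : ℂ) (hm : m ≠ 0) :
    ‖shellPart j z‖ ^ m ≤
      (2 ^ j) ^ m * (2 ^ p * (2 : ℝ) ^ (-(j * p)) * (‖z‖ ^ p + if z = 0 then 0 else 1)) := by
  have hnn : 0 ≤ ‖z‖ ^ p + if z = 0 then (0 : ℝ) else 1 := by positivity
  by_cases h0 : shellPart j z = 0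
  · rw [h0, norm_zero, zero_pow hm]; positivity
  have hj : shell z = j := by
    by_contra hj; exact h0 (if_neg hj)
  have hz : z ≠ 0 := by
    rintro rfl; exact h0 (by simp [shellPart])
  refine (pow_le_pow_left₀ (norm_nonneg _) (norm_shellPart_le j z) m).trans
    (le_mul_of_one_le_right (by positivity) ?_)
  rw [if_neg hz, ← Real.rpow_add two_pos]
  rcases j with _ | j
  · have h2 : 1 ≤ (2 : ℝ) ^ p := Real.one_le_rpow one_le_two hp
    have h3 : 0 ≤ ‖z‖ ^ p := by positivity
    simp only [Nat.cast_zero, zero_mul, neg_zero, add_zero]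
    nlinarith
  · have h1 := Real.rpow_le_rpow (by positivity) (lt_norm_of_shell hj).le hp
    rw [← Real.rpow_natCast, ← Real.rpow_mul two_pos.le] at h1
    calc (1 : ℝ) = 2 ^ (p + -(((j + 1 : ℕ) : ℝ) * p)) * 2 ^ ((j : ℝ) * p) := by
          rw [← Real.rpow_add two_pos]; push_cast
          rw [show p + -(((j : ℝ) + 1) * p) + j * p = 0 by ring, Real.rpow_zero]
      _ ≤ _ := by gcongr; linarith

variable {d k : ℕ}

lemma integral_shellPart_le {f : (Fin d → ℝ) → ℂ} {ν : Fin d → ℝ} {r p : ℝ} (hp : 1 ≤ p)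
    (hr : 0 ≤ r) (hr1 : r ≤ 1) (hf : AEStronglyMeasurable f) (hfs : ∀ ξ, f ξ ≠ 0 → ‖ξ - ν‖ ≤ r)
    (hfp : eLpNorm f (ENNReal.ofReal p) ≤ 1) (j m : ℕ) (hm : m ≠ 0) :
    Integrable (fun ξ => ‖shellPart j (f ξ)‖ ^ m) ∧ ∫ ξ, ‖shellPart j (f ξ)‖ ^ m ≤
      (2 ^ j) ^ m * (2 ^ p * (1 + 2 ^ d) * (2 : ℝ) ^ (-(j * p))) := by
  have hp0 : 0 < p := by linarith
  set B := Metric.closedBall ν r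
  set G : (Fin d → ℝ) → ℝ := fun ξ => ‖f ξ‖ ^ p + B.indicator 1 ξ
  have hB : volume B = ENNReal.ofReal ((2 * r) ^ d) := by
    rw [Real.volume_pi_closedBall _ hr, Fintype.card_fin]
  have hLp : MemLp f (ENNReal.ofReal p) := ⟨hf, hfp.trans_lt one_lt_top⟩
  have hi1 : Integrable fun ξ => ‖f ξ‖ ^ p := by
    have := hLp.integrable_norm_rpow (by simpa using hp0) ofReal_ne_top
    rwa [ENNReal.toReal_ofReal hp0.le] at this
  have hi2 : Integrable (B.indicator (1 : (Fin d → ℝ) → ℝ)) :=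
    (integrable_indicator_iff measurableSet_closedBall).2
      (integrableOn_const (measure_closedBall_lt_top.ne))
  have hG : Integrable G := hi1.add hi2
  have hGle : ∫ ξ, G ξ ≤ 1 + 2 ^ d := by
    rw [integral_add hi1 hi2]
    refine add_le_add ?_ ?_
    · rw [integral_eq_lintegral_of_nonneg_ae (Filter.Eventually.of_forall fun ξ => by positivity)
        hi1.1]
      refine ENNReal.toReal_le_of_le_ofReal zero_le_one ?_
      have h1 := lintegral_rpow_le_of_eLpNorm_le hp0 zero_le_one (by simpa using hfp)
      rw [Real.one_rpow] at h1
      refine (lintegral_congr fun ξ => ?_).trans_le h1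
      rw [← ENNReal.ofReal_rpow_of_nonneg (norm_nonneg _) hp0.le, ofReal_norm]
    · rw [integral_indicator_one measurableSet_closedBall, Measure.real, hB,
        ENNReal.toReal_ofReal (by positivity)]
      exact pow_le_pow_left₀ (by positivity) (by linarith) d
  set c := (2 ^ j) ^ m * (2 ^ p * (2 : ℝ) ^ (-(j * p)))
  have hc : 0 ≤ c := by positivity
  have hpt : ∀ ξ, ‖shellPart j (f ξ)‖ ^ m ≤ c * G ξ := by
    intro ξ
    refine (norm_shellPart_pow_le hp0.le j m (f ξ) hm).trans ?_
    rw [← mul_assoc]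
    refine mul_le_mul_of_nonneg_left (add_le_add le_rfl ?_) hc
    split_ifs with h0
    · exact Set.indicator_nonneg (fun _ _ => zero_le_one) _
    · rw [Set.indicator_of_mem (mem_closedBall_iff_norm.2 (hfs ξ h0))]; rfl
  refine ⟨(hG.const_mul c).mono' ?_ (Filter.Eventually.of_forall fun ξ => ?_), ?_⟩
  · exact (((measurable_shellPart j).comp_aemeasurable hf.aemeasurable).norm.pow_const
      m).aestronglyMeasurable
  · rw [norm_pow, norm_norm]; exact hpt ξ
  · calc _ ≤ ∫ ξ, c * G ξ := integral_mono_of_nonneg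
          (Filter.Eventually.of_forall fun ξ => by positivity) (hG.const_mul c)
          (Filter.Eventually.of_forall hpt)
      _ = c * ∫ ξ, G ξ := integral_const_mul _ _
      _ ≤ c * (1 + 2 ^ d) := mul_le_mul_of_nonneg_left hGle hc
      _ = _ := by ring

lemma eLpNorm_le_interp_top {α : Type*} [MeasurableSpace α] {μ : Measure α} {Z : α → ℂ}
    {s q a b : ℝ} (hs : 0 < s) (hsq : s ≤ q) (ha : 0 ≤ a) (hb : 0 ≤ b)
    (h1 : eLpNorm Z (ENNReal.ofReal s) μ ≤ ENNReal.ofReal a) (h2 : ∀ x, ‖Z x‖ ≤ b) :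
    eLpNorm Z (ENNReal.ofReal q) μ ≤ ENNReal.ofReal (a ^ (s / q) * b ^ (1 - s / q)) := by
  have hq : 0 < q := hs.trans_le hsq
  refine eLpNorm_ofReal_le hq (by positivity) ?_
  calc ∫⁻ x, ‖Z x‖ₑ ^ q ∂μ ≤ ∫⁻ x, ENNReal.ofReal (b ^ (q - s)) * ‖Z x‖ₑ ^ s ∂μ := by
        refine lintegral_mono fun x => ?_
        rw [← ENNReal.ofReal_rpow_of_nonneg hb (by linarith)]
        calc ‖Z x‖ₑ ^ q = ‖Z x‖ₑ ^ (q - s) * ‖Z x‖ₑ ^ s := by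
              rw [← ENNReal.rpow_add_of_nonneg _ _ (by linarith) hs.le, sub_add_cancel]
          _ ≤ _ := by
              refine mul_le_mul_left (ENNReal.rpow_le_rpow ?_ (by linarith)) _
              rw [← ofReal_norm]; exact ENNReal.ofReal_le_ofReal (h2 x)
    _ = ENNReal.ofReal (b ^ (q - s)) * ∫⁻ x, ‖Z x‖ₑ ^ s ∂μ := lintegral_const_mul' _ _ ofReal_ne_top
    _ ≤ ENNReal.ofReal (b ^ (q - s)) * ENNReal.ofReal (a ^ s) :=
        mul_le_mul_right (lintegral_rpow_le_of_eLpNorm_le hs ha h1) _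
    _ = _ := by
        rw [← ENNReal.ofReal_mul (by positivity), Real.mul_rpow (by positivity) (by positivity),
          ← Real.rpow_mul ha, ← Real.rpow_mul hb, sub_mul, div_mul_cancel₀ _ hq.ne', one_mul,
          mul_comm]

lemma mul_sqrt_rpow_mul_rpow {M m θ : ℝ} (hM : 0 < M) (hm : 0 < m) :
    (M * √m) ^ θ * (M * m) ^ (1 - θ) = M * m ^ (1 - θ / 2) := by
  rw [Real.sqrt_eq_rpow, Real.mul_rpow hM.le (by positivity), Real.mul_rpow hM.le hm.le,
    ← Real.rpow_mul hm.le, mul_mul_mul_comm, ← Real.rpow_add hM, ← Real.rpow_add hm,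
    add_sub_cancel, Real.rpow_one]
  congr 2; ring

/-- The bilinear estimate for single dyadic pieces. -/
lemma eLpNorm_shellPart_le {Φ : (Fin d → ℝ) → Fin k → ℝ} {ν₁ ν₂ : Fin d → ℝ} {r A s q p : ℝ}
    (hp : 1 ≤ p) (hr : 0 ≤ r) (hr1 : r ≤ 1) (hA : 0 ≤ A) (hs : 0 < s) (hsq : s ≤ q)
    (h : ∀ f g : (Fin d → ℝ) → ℂ, MemLp f 2 → MemLp g 2 →
      (∀ ξ, f ξ ≠ 0 → ‖ξ - ν₁‖ ≤ r) → (∀ ξ, g ξ ≠ 0 → ‖ξ - ν₂‖ ≤ r) →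
      eLpNorm (fun w => exOp Φ f w * exOp Φ g w) (ENNReal.ofReal s) ≤
        ENNReal.ofReal (A * (l2 f * l2 g)))
    {f g : (Fin d → ℝ) → ℂ} (hf : AEStronglyMeasurable f) (hg : AEStronglyMeasurable g)
    (hfs : ∀ ξ, f ξ ≠ 0 → ‖ξ - ν₁‖ ≤ r) (hgs : ∀ ξ, g ξ ≠ 0 → ‖ξ - ν₂‖ ≤ r)
    (hfp : eLpNorm f (ENNReal.ofReal p) ≤ 1) (hgp : eLpNorm g (ENNReal.ofReal p) ≤ 1) (i j : ℕ) :
    eLpNorm (fun w => exOp Φ (fun ξ => shellPart i (f ξ)) w *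
      exOp Φ (fun ξ => shellPart j (g ξ)) w) (ENNReal.ofReal q) ≤
      ENNReal.ofReal (A ^ (s / q) * (((2 ^ p * (1 + 2 ^ d)) ^ (1 - s / q / 2)) ^ 2 *
        (((2 : ℝ) ^ (1 - p * (1 - s / q / 2))) ^ i *
          ((2 : ℝ) ^ (1 - p * (1 - s / q / 2))) ^ j))) := by
  set D : ℝ := 2 ^ p * (1 + 2 ^ d) with hD
  have hD0 : 0 < D := by positivity
  set m : ℕ → ℝ := fun j => D * 2 ^ (-(j * p)) with hm
  have hm0 : ∀ j, 0 < m j := fun j => by positivity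
  set θ := s / q
  have h0 : ∀ j, shellPart j 0 = 0 := fun j => by simp [shellPart]
  have hsupp : ∀ {f : (Fin d → ℝ) → ℂ} {ν} (j : ℕ), (∀ ξ, f ξ ≠ 0 → ‖ξ - ν‖ ≤ r) →
      ∀ ξ, shellPart j (f ξ) ≠ 0 → ‖ξ - ν‖ ≤ r := fun j hfs ξ hξ =>
    hfs ξ fun h => hξ (by rw [h, h0])
  have hpiece : ∀ {f : (Fin d → ℝ) → ℂ} {ν : Fin d → ℝ}, AEStronglyMeasurable f →
      (∀ ξ, f ξ ≠ 0 → ‖ξ - ν‖ ≤ r) → eLpNorm f (ENNReal.ofReal p) ≤ 1 → ∀ j : ℕ,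
      MemLp (fun ξ => shellPart j (f ξ)) 2 ∧ l2 (fun ξ => shellPart j (f ξ)) ≤ 2 ^ j * √(m j) ∧
      ∀ w, ‖exOp Φ (fun ξ => shellPart j (f ξ)) w‖ ≤ 2 ^ j * m j := by
    intro f ν hf hfs hfp j
    have hmeas : AEStronglyMeasurable fun ξ => shellPart j (f ξ) :=
      ((measurable_shellPart j).comp_aemeasurable hf.aemeasurable).aestronglyMeasurable
    obtain ⟨h2, h2'⟩ := integral_shellPart_le hp hr hr1 hf hfs hfp j 2 two_ne_zero
    obtain ⟨-, h1'⟩ := integral_shellPart_le hp hr hr1 hf hfs hfp j 1 one_ne_zero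
    simp only [pow_one] at h1'
    refine ⟨(memLp_two_iff_integrable_sq_norm hmeas).2 h2, ?_, fun w =>
      (norm_exOp_le Φ _ w).trans h1'⟩
    refine Real.sqrt_le_iff.2 ⟨by positivity, h2'.trans_eq ?_⟩
    rw [mul_pow, Real.sq_sqrt (hm0 j).le]
  obtain ⟨hf2, hfl, hfb⟩ := hpiece hf hfs hfp i
  obtain ⟨hg2, hgl, hgb⟩ := hpiece hg hgs hgp j
  have hmain := eLpNorm_le_interp_top hs hsq
    (a := A * (2 ^ i * √(m i) * (2 ^ j * √(m j)))) (b := 2 ^ i * m i * (2 ^ j * m j))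
    (by positivity) (mul_nonneg (by have := hm0 i; positivity) (by have := hm0 j; positivity))
    ((h _ _ hf2 hg2 (hsupp i hfs) (hsupp j hgs)).trans (ENNReal.ofReal_le_ofReal
      (mul_le_mul_of_nonneg_left (mul_le_mul hfl hgl (l2_nonneg _) (by positivity)) hA)))
    (fun w => by
      rw [norm_mul]
      exact mul_le_mul (hfb w) (hgb w) (norm_nonneg _) (by have := hm0 i; positivity))
  refine hmain.trans_eq (congrArg _ ?_)
  have hx : ∀ j : ℕ, (2 : ℝ) ^ j * m j ^ (1 - θ / 2) =
      D ^ (1 - θ / 2) * ((2 : ℝ) ^ (1 - p * (1 - θ / 2))) ^ j := by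
    intro j
    rw [hm, Real.mul_rpow hD0.le (by positivity), ← Real.rpow_mul two_pos.le,
      ← Real.rpow_natCast (2 ^ (1 - p * (1 - θ / 2))), ← Real.rpow_mul two_pos.le, mul_left_comm,
      ← Real.rpow_natCast, ← Real.rpow_add two_pos]
    congr 2; ring
  have hi := hm0 i
  have hj := hm0 j
  rw [Real.mul_rpow hA (by positivity), Real.mul_rpow (by positivity) (by positivity),
    Real.mul_rpow (x := 2 ^ i * m i) (by positivity) (by positivity), mul_assoc, mul_mul_mul_comm,
    mul_sqrt_rpow_mul_rpow (by positivity) hi, mul_sqrt_rpow_mul_rpow (by positivity) hj,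
    hx, hx]
  ring

end Bands

section ExtensionAlgebra

variable {d k : ℕ} {Φ : (Fin d → ℝ) → Fin k → ℝ}

lemma integrable_eC_phase_mul (hΦ : Continuous Φ) {f : (Fin d → ℝ) → ℂ} (hf : Integrable f)
    (w : (Fin d → ℝ) × (Fin k → ℝ)) : Integrable fun ξ => eC (phase Φ w ξ) * f ξ :=
  integrable_eC_mul (P := fun ξ => (ξ, Φ ξ)) (by fun_prop) hf w

lemma exOp_add (hΦ : Continuous Φ) {f g : (Fin d → ℝ) → ℂ} (hf : Integrable f)
    (hg : Integrable g) (w : (Fin d → ℝ) × (Fin k → ℝ)) :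
    exOp Φ (f + g) w = exOp Φ f w + exOp Φ g w := by
  unfold exOp
  rw [← integral_add (integrable_eC_phase_mul hΦ hf w) (integrable_eC_phase_mul hΦ hg w)]
  simp only [Pi.add_apply, mul_add]

lemma exOp_sum (hΦ : Continuous Φ) {ι : Type*} (s : Finset ι) {f : ι → (Fin d → ℝ) → ℂ}
    (hf : ∀ i ∈ s, Integrable (f i)) (w : (Fin d → ℝ) × (Fin k → ℝ)) :
    exOp Φ (fun ξ => ∑ i ∈ s, f i ξ) w = ∑ i ∈ s, exOp Φ (f i) w := by
  unfold exOp
  rw [← integral_finsetSum s fun i hi => integrable_eC_phase_mul hΦ (hf i hi) w]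
  simp only [Finset.mul_sum]

lemma exOp_const_mul (c : ℂ) (f : (Fin d → ℝ) → ℂ) (w : (Fin d → ℝ) × (Fin k → ℝ)) :
    exOp Φ (fun ξ => c * f ξ) w = c * exOp Φ f w := by
  unfold exOp
  rw [← integral_const_mul]
  simp only [mul_left_comm]

lemma exOp_eq_zero {f : (Fin d → ℝ) → ℂ} (hf : f =ᵐ[volume] 0) (w : (Fin d → ℝ) × (Fin k → ℝ)) :
    exOp Φ f w = 0 :=
  integral_eq_zero_of_ae (hf.mono fun ξ hξ => by simp [hξ])

lemma exOp_of_not_integrable (hΦ : Continuous Φ) {f : (Fin d → ℝ) → ℂ} (hf : ¬Integrable f)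
    (w : (Fin d → ℝ) × (Fin k → ℝ)) : exOp Φ f w = 0 := by
  refine integral_undef fun h => hf ?_
  have h1 := integrable_eC_mul (P := fun ξ => (ξ, Φ ξ)) (by fun_prop) h (-w)
  refine h1.congr (Filter.Eventually.of_forall fun ξ => ?_)
  have h2 : dotW (-w) (ξ, Φ ξ) = -dotW w (ξ, Φ ξ) := by
    simpa using dotW_smul_left (-1) w (ξ, Φ ξ)
  simp only [phase_eq_dotW]
  rw [h2, ← mul_assoc, ← eC_add, neg_add_cancel, eC_zero, one_mul]

lemma tendsto_exOp (hΦ : Continuous Φ) {f : (Fin d → ℝ) → ℂ} (hf : Integrable f)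
    {F : ℕ → (Fin d → ℝ) → ℂ} (hF : ∀ n, AEStronglyMeasurable (F n))
    (hle : ∀ n ξ, ‖F n ξ‖ ≤ ‖f ξ‖)
    (hlim : ∀ ξ, Filter.Tendsto (fun n => F n ξ) Filter.atTop (nhds (f ξ)))
    (w : (Fin d → ℝ) × (Fin k → ℝ)) :
    Filter.Tendsto (fun n => exOp Φ (F n) w) Filter.atTop (nhds (exOp Φ f w)) := by
  refine tendsto_integral_of_dominated_convergence (fun ξ => ‖f ξ‖) (fun n => ?_) hf.norm
    (fun n => Filter.Eventually.of_forall fun ξ => ?_)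
    (Filter.Eventually.of_forall fun ξ => (hlim ξ).const_mul _)
  · exact (integrable_eC_phase_mul hΦ (hf.norm.mono' (hF n)
      (Filter.Eventually.of_forall (hle n))) w).1
  · rw [norm_mul, norm_eC, one_mul]; exact hle n ξ

end ExtensionAlgebra

section Summation

variable {d k : ℕ} {Φ : (Fin d → ℝ) → Fin k → ℝ} {ν₁ ν₂ : Fin d → ℝ} {r A s q p : ℝ}

lemma exists_eLpNorm_le_of_eLpNorm_le_one (hΦ : Continuous Φ) (hp : 1 ≤ p) (hr : 0 ≤ r)
    (hr1 : r ≤ 1) (hA : 0 ≤ A) (hs : 1 ≤ s) (hsq : s ≤ q) (hpq : 1 / p + s / (2 * q) < 1)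
    (h : ∀ f g : (Fin d → ℝ) → ℂ, MemLp f 2 → MemLp g 2 →
      (∀ ξ, f ξ ≠ 0 → ‖ξ - ν₁‖ ≤ r) → (∀ ξ, g ξ ≠ 0 → ‖ξ - ν₂‖ ≤ r) →
      eLpNorm (fun w => exOp Φ f w * exOp Φ g w) (ENNReal.ofReal s) ≤
        ENNReal.ofReal (A * (l2 f * l2 g))) :
    ∃ C : ℝ, 0 < C ∧ ∀ f g : (Fin d → ℝ) → ℂ, Integrable f → Integrable g →
      (∀ ξ, f ξ ≠ 0 → ‖ξ - ν₁‖ ≤ r) → (∀ ξ, g ξ ≠ 0 → ‖ξ - ν₂‖ ≤ r) →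
      eLpNorm f (ENNReal.ofReal p) ≤ 1 → eLpNorm g (ENNReal.ofReal p) ≤ 1 →
      eLpNorm (fun w => exOp Φ f w * exOp Φ g w) (ENNReal.ofReal q) ≤ ENNReal.ofReal C := by
  set K : ℝ := A ^ (s / q) * ((2 ^ p * (1 + 2 ^ d)) ^ (1 - s / q / 2)) ^ 2 with hK
  set x : ℝ := (2 : ℝ) ^ (1 - p * (1 - s / q / 2)) with hx
  have hK0 : 0 ≤ K := by positivity
  have hx0 : 0 < x := by positivity
  have hx1 : x < 1 := by
    refine Real.rpow_lt_one_of_one_lt_of_neg one_lt_two ?_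
    have h1 : 1 / p < 1 - s / q / 2 := by
      rw [div_div, mul_comm q]; linarith
    rw [div_lt_iff₀ (by linarith)] at h1
    linarith
  refine ⟨K * ((1 - x)⁻¹ * (1 - x)⁻¹) + 1, by have := sub_pos.2 hx1; positivity,
    fun f g hf hg hfs hgs hfp hgp => ?_⟩
  set F := fun n ξ => ∑ j ∈ Finset.range n, shellPart j (f ξ)
  set G := fun n ξ => ∑ j ∈ Finset.range n, shellPart j (g ξ)
  have hmeas : ∀ {f : (Fin d → ℝ) → ℂ}, Integrable f → ∀ j,
      AEStronglyMeasurable fun ξ => shellPart j (f ξ) := fun hf j =>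
    ((measurable_shellPart j).comp_aemeasurable hf.1.aemeasurable).aestronglyMeasurable
  have hint : ∀ {f : (Fin d → ℝ) → ℂ}, Integrable f → ∀ j,
      Integrable fun ξ => shellPart j (f ξ) := by
    refine fun hf j => hf.mono (hmeas hf j) (Filter.Eventually.of_forall fun ξ => ?_)
    unfold shellPart
    split_ifs <;> simp
  have hconv : ∀ {f : (Fin d → ℝ) → ℂ}, Integrable f → ∀ w, Filter.Tendsto
      (fun n => exOp Φ (fun ξ => ∑ j ∈ Finset.range n, shellPart j (f ξ)) w) Filter.atTop
      (nhds (exOp Φ f w)) := by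
    refine fun {f} hf w => tendsto_exOp hΦ hf (fun n =>
      (integrable_finsetSum _ fun j _ => hint hf j).1) (fun n ξ => ?_) (fun ξ => ?_) w
    · rw [sum_shellPart]; split_ifs <;> simp
    · refine tendsto_const_nhds.congr' ?_
      filter_upwards [Filter.eventually_gt_atTop (shell (f ξ))] with n hn
      rw [sum_shellPart, if_pos hn]
  have hgeom : ∀ n : ℕ, ∑ j ∈ Finset.range n, x ^ j ≤ (1 - x)⁻¹ := fun n => by
    rw [← tsum_geometric_of_lt_one hx0.le hx1]
    exact (summable_geometric_of_lt_one hx0.le hx1).sum_le_tsum _ fun j _ => by positivity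
  have hbound : ∀ n, eLpNorm (fun w => exOp Φ (F n) w * exOp Φ (G n) w) (ENNReal.ofReal q) ≤
      ENNReal.ofReal (K * ((1 - x)⁻¹ * (1 - x)⁻¹) + 1) := by
    intro n
    have e : (fun w => exOp Φ (F n) w * exOp Φ (G n) w) =
        ∑ ij ∈ Finset.range n ×ˢ Finset.range n, fun w =>
          exOp Φ (fun ξ => shellPart ij.1 (f ξ)) w * exOp Φ (fun ξ => shellPart ij.2 (g ξ)) w := by
      ext w
      rw [exOp_sum hΦ _ fun j _ => hint hf j, exOp_sum hΦ _ fun j _ => hint hg j,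
        Finset.sum_mul_sum, Finset.sum_apply, Finset.sum_product]
    rw [e]
    refine (eLpNorm_sum_le (fun ij _ => ((continuous_exOp hΦ (hint hf ij.1)).mul
      (continuous_exOp hΦ (hint hg ij.2))).aestronglyMeasurable)
      (ENNReal.one_le_ofReal.2 (hs.trans hsq))).trans ((Finset.sum_le_sum fun ij _ =>
        eLpNorm_shellPart_le hp hr hr1 hA (by linarith) hsq h hf.1 hg.1 hfs hgs hfp hgp
          ij.1 ij.2).trans ?_)
    rw [← ENNReal.ofReal_sum_of_nonneg fun ij _ => by positivity]
    refine ENNReal.ofReal_le_ofReal ?_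
    simp only [← mul_assoc (A ^ (s / q)), ← hK, ← hx]
    rw [← Finset.mul_sum, Finset.sum_product, ← Finset.sum_mul_sum]
    refine (mul_le_mul_of_nonneg_left (mul_le_mul (hgeom n) (hgeom n)
      (Finset.sum_nonneg fun j _ => by positivity) ((Finset.sum_nonneg fun j _ => by
        positivity).trans (hgeom n))) hK0).trans (by linarith)
  refine (Lp.eLpNorm_lim_le_liminf_eLpNorm (f := fun n w => exOp Φ (F n) w * exOp Φ (G n) w)
    (fun n => ?_) _ (Filter.Eventually.of_forall fun w => (hconv hf w).mul (hconv hg w))).trans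
    (Filter.liminf_le_of_le (h := fun b hb => ?_))
  · exact ((continuous_exOp hΦ (integrable_finsetSum _ fun j _ => hint hf j)).mul
      (continuous_exOp hΦ (integrable_finsetSum _ fun j _ => hint hg j))).aestronglyMeasurable
  · obtain ⟨n, hn⟩ := hb.exists
    exact hn.trans (hbound n)

/-- The bilinear estimate for functions supported in (measurable neighbourhoods of) `T` and
`U`. -/
def BilinearBound (Φ : (Fin d → ℝ) → Fin k → ℝ) (q p : ℝ) (T U : Set (Fin d → ℝ)) : Prop :=
  ∃ T' U' : Set (Fin d → ℝ), MeasurableSet T' ∧ MeasurableSet U' ∧ T ⊆ T' ∧ U ⊆ U' ∧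
    ∃ C : ℝ, 0 < C ∧ ∀ f g : (Fin d → ℝ) → ℂ, Integrable f → Integrable g →
      (∀ ξ, f ξ ≠ 0 → ξ ∈ T') → (∀ ξ, g ξ ≠ 0 → ξ ∈ U') →
      eLpNorm (fun w => exOp Φ f w * exOp Φ g w) (ENNReal.ofReal q) ≤
        ENNReal.ofReal C * eLpNorm f (ENNReal.ofReal p) * eLpNorm g (ENNReal.ofReal p)

variable {T T₁ T₂ U V : Set (Fin d → ℝ)}

lemma BilinearBound.mono (h : BilinearBound Φ q p T U) (hT : T₁ ⊆ T) (hU : V ⊆ U) :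
    BilinearBound Φ q p T₁ V := by
  obtain ⟨T', U', hT', hU', hTT, hUU, h⟩ := h
  exact ⟨T', U', hT', hU', hT.trans hTT, hU.trans hUU, h⟩

lemma BilinearBound.symm (h : BilinearBound Φ q p T U) : BilinearBound Φ q p U T := by
  obtain ⟨T', U', hT', hU', hTT, hUU, C, hC, h⟩ := h
  refine ⟨U', T', hU', hT', hUU, hTT, C, hC, fun f g hf hg hfs hgs => ?_⟩
  have := h g f hg hf hgs hfs
  simpa only [mul_comm (exOp Φ g _), mul_right_comm _ (eLpNorm g _ _)] using this

lemma BilinearBound.empty_left : BilinearBound Φ q p ∅ U := by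
  refine ⟨∅, Set.univ, .empty, .univ, subset_rfl, Set.subset_univ U, 1, one_pos,
    fun f g hf hg hfs hgs => ?_⟩
  have hf0 : f = 0 := by
    ext ξ; by_contra h; exact hfs ξ h
  simp [exOp_eq_zero (Φ := Φ) (Filter.EventuallyEq.of_eq hf0)]

lemma BilinearBound.union_left (hΦ : Continuous Φ) (hq : 1 ≤ q) (h₁ : BilinearBound Φ q p T₁ U)
    (h₂ : BilinearBound Φ q p T₂ U) : BilinearBound Φ q p (T₁ ∪ T₂) U := by
  obtain ⟨T₁', U₁', hT₁', hU₁', hTT₁, hUU₁, C₁, hC₁, h₁⟩ := h₁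
  obtain ⟨T₂', U₂', hT₂', hU₂', hTT₂, hUU₂, C₂, hC₂, h₂⟩ := h₂
  refine ⟨T₁' ∪ T₂', U₁' ∩ U₂', hT₁'.union hT₂', hU₁'.inter hU₂', Set.union_subset_union hTT₁ hTT₂,
    Set.subset_inter hUU₁ hUU₂, C₁ + C₂, by positivity, fun f g hf hg hfs hgs => ?_⟩
  set f₁ := T₁'.indicator f
  set f₂ := T₁'ᶜ.indicator f
  have hf₁ : Integrable f₁ := hf.indicator hT₁'
  have hf₂ : Integrable f₂ := hf.indicator hT₁'.compl
  have e : (fun w => exOp Φ f w * exOp Φ g w) =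
      (fun w => exOp Φ f₁ w * exOp Φ g w) + fun w => exOp Φ f₂ w * exOp Φ g w := by
    ext w
    rw [Pi.add_apply, ← add_mul, ← exOp_add hΦ hf₁ hf₂, Set.indicator_self_add_compl]
  have hgc := continuous_exOp hΦ hg
  rw [e]
  refine (eLpNorm_add_le ((continuous_exOp hΦ hf₁).mul hgc).aestronglyMeasurable
    ((continuous_exOp hΦ hf₂).mul hgc).aestronglyMeasurable
    (ENNReal.one_le_ofReal.2 hq)).trans ?_
  rw [ENNReal.ofReal_add hC₁.le hC₂.le, add_mul, add_mul]
  refine add_le_add ((h₁ f₁ g hf₁ hg ?_ fun ξ hξ => (hgs ξ hξ).1).trans ?_)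
    ((h₂ f₂ g hf₂ hg ?_ fun ξ hξ => (hgs ξ hξ).2).trans ?_)
  · exact fun ξ hξ => Set.mem_of_indicator_ne_zero hξ
  · gcongr; exact eLpNorm_indicator_le f
  · intro ξ hξ
    have h3 := Set.mem_of_indicator_ne_zero hξ
    have h4 : f₂ ξ = f ξ := Set.indicator_of_mem h3 f
    rw [h4] at hξ
    exact (hfs ξ hξ).resolve_left h3
  · gcongr; exact eLpNorm_indicator_le f

lemma BilinearBound.of_isCompact (hΦ : Continuous Φ) (hq : 1 ≤ q) (hT : IsCompact T)
    (hU : IsCompact U) (h : ∀ x ∈ T, ∀ y ∈ U, ∃ X ∈ nhds x, ∃ Y ∈ nhds y,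
    BilinearBound Φ q p X Y) : BilinearBound Φ q p T U := by
  have h1 : ∀ y ∈ U, ∃ Y ∈ nhds y, BilinearBound Φ q p T Y := by
    intro y hy
    refine hT.induction_on (p := fun X => ∃ Y ∈ nhds y, BilinearBound Φ q p X Y)
      ⟨Set.univ, Filter.univ_mem, .empty_left⟩ ?_ ?_ ?_
    · rintro X X' hX ⟨Y, hY, hb⟩
      exact ⟨Y, hY, hb.mono hX subset_rfl⟩
    · rintro X X' ⟨Y, hY, hb⟩ ⟨Y', hY', hb'⟩
      exact ⟨Y ∩ Y', Filter.inter_mem hY hY', (hb.mono subset_rfl Set.inter_subset_left).union_left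
        hΦ hq (hb'.mono subset_rfl Set.inter_subset_right)⟩
    · intro x hx
      obtain ⟨X, hX, hb⟩ := h x hx y hy
      exact ⟨X, mem_nhdsWithin_of_mem_nhds hX, hb⟩
  refine hU.induction_on (p := fun Y => BilinearBound Φ q p T Y) BilinearBound.empty_left.symm
    (fun Y Y' hY hb => hb.mono subset_rfl hY)
    (fun Y Y' hb hb' => (hb.symm.union_left hΦ hq hb'.symm).symm) fun y hy => ?_
  obtain ⟨Y, hY, hb⟩ := h1 y hy
  exact ⟨Y, mem_nhdsWithin_of_mem_nhds hY, hb⟩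

lemma exists_bilinearBound_closedBall (hΦ : ContDiff ℝ (⊤ : ℕ∞) Φ) (hk : 1 ≤ k)
    (h12 : LocalCond Φ ν₁ ν₂) (h21 : LocalCond Φ ν₂ ν₁) (hs1 : 1 ≤ s) (hs2 : s ≤ 2)
    (hs : (d : ℝ) + 3 * k < s * (d + k) ∨ d = k ∧ s = 2) (hp : 1 ≤ p) (hsq : s ≤ q)
    (hpq : 1 / p + s / (2 * q) < 1) :
    ∃ X ∈ nhds ν₁, ∃ Y ∈ nhds ν₂, BilinearBound Φ q p X Y := by
  obtain ⟨r₀, A, hr₀, hA, h⟩ := exists_eLpNorm_exOp_mul_le hΦ hk h12 h21 hs1 hs2 hs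
  set r := min r₀ 1
  have hr : 0 < r := lt_min hr₀ one_pos
  obtain ⟨C, hC, hb⟩ := exists_eLpNorm_le_of_eLpNorm_le_one hΦ.continuous hp hr.le
    (min_le_right _ _) hA hs1 hsq hpq fun f g hf hg hfs hgs => h f g hf hg
      (fun ξ hξ => (hfs ξ hξ).trans (min_le_left _ _))
      fun ξ hξ => (hgs ξ hξ).trans (min_le_left _ _)
  refine ⟨_, Metric.closedBall_mem_nhds ν₁ hr, _, Metric.closedBall_mem_nhds ν₂ hr, _, _,
    measurableSet_closedBall, measurableSet_closedBall, subset_rfl, subset_rfl, C, hC,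
    fun f g hf hg hfs hgs => ?_⟩
  have hp0 : ENNReal.ofReal p ≠ 0 := by simp; linarith
  set a := eLpNorm f (ENNReal.ofReal p) with ha
  set b := eLpNorm g (ENNReal.ofReal p) with hbb
  by_cases ha0 : a = 0
  · simp [exOp_eq_zero (Φ := Φ) ((eLpNorm_eq_zero_iff hf.1 hp0).1 ha0)]
  by_cases hb0 : b = 0
  · simp [exOp_eq_zero (Φ := Φ) ((eLpNorm_eq_zero_iff hg.1 hp0).1 hb0)]
  have hC0 : ENNReal.ofReal C ≠ 0 := by simpa using hC
  by_cases hat : a = ∞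
  · rw [hat, ENNReal.mul_top hC0, ENNReal.top_mul hb0]; exact le_top
  by_cases hbt : b = ∞
  · rw [hbt, ENNReal.mul_top (mul_ne_zero hC0 ha0)]; exact le_top
  have hnorm : ∀ {f : (Fin d → ℝ) → ℂ}, eLpNorm f (ENNReal.ofReal p) ≠ 0 →
      eLpNorm f (ENNReal.ofReal p) ≠ ∞ → eLpNorm (fun ξ =>
        ((eLpNorm f (ENNReal.ofReal p)).toReal⁻¹ : ℂ) * f ξ) (ENNReal.ofReal p) ≤ 1 := by
    intro f h0 ht
    have := eLpNorm_const_smul ((eLpNorm f (ENNReal.ofReal p)).toReal⁻¹ : ℂ) f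
      (ENNReal.ofReal p) volume
    refine this.trans_le ?_
    rw [← Complex.ofReal_inv, ← ofReal_norm, Complex.norm_real, Real.norm_of_nonneg (by positivity),
      ENNReal.ofReal_inv_of_pos (ENNReal.toReal_pos h0 ht), ENNReal.ofReal_toReal ht,
      ENNReal.inv_mul_cancel h0 ht]
  have hmain := hb (fun ξ => (a.toReal⁻¹ : ℂ) * f ξ) (fun ξ => (b.toReal⁻¹ : ℂ) * g ξ)
    (hf.const_mul _) (hg.const_mul _)
    (fun ξ hξ => mem_closedBall_iff_norm.1 (hfs ξ (right_ne_zero_of_mul hξ)))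
    (fun ξ hξ => mem_closedBall_iff_norm.1 (hgs ξ (right_ne_zero_of_mul hξ)))
    (hnorm ha0 hat) (hnorm hb0 hbt)
  have ha' : (a.toReal : ℂ) ≠ 0 := by exact_mod_cast (ENNReal.toReal_pos ha0 hat).ne'
  have hb' : (b.toReal : ℂ) ≠ 0 := by exact_mod_cast (ENNReal.toReal_pos hb0 hbt).ne'
  have e : (fun w => exOp Φ f w * exOp Φ g w) = ((a.toReal * b.toReal : ℝ) : ℂ) • fun w =>
      exOp Φ (fun ξ => (a.toReal⁻¹ : ℂ) * f ξ) w * exOp Φ (fun ξ => (b.toReal⁻¹ : ℂ) * g ξ) w := by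
    ext w
    rw [Pi.smul_apply, smul_eq_mul, exOp_const_mul, exOp_const_mul]
    push_cast
    field_simp
  rw [e, eLpNorm_const_smul, ← ofReal_norm, Complex.norm_real, Real.norm_of_nonneg (by positivity),
    ENNReal.ofReal_mul ENNReal.toReal_nonneg, ENNReal.ofReal_toReal hat, ENNReal.ofReal_toReal hbt,
    mul_assoc (ENNReal.ofReal C), mul_comm (ENNReal.ofReal C)]
  exact mul_le_mul_right hmain _

end Summation

section Main

variable {d k : ℕ} {Φ : (Fin d → ℝ) → Fin k → ℝ}

lemma localCond_symm_of_forall {ν₁ ν₂ : Fin d → ℝ}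
    (h₁ : ∀ t : Fin k → ℝ, ∑ i, t i ^ 2 = 1 → (tHess d k Φ t ν₂).det ≠ 0)
    (h₂ : ∀ t : Fin k → ℝ, ∑ i, t i ^ 2 = 1 →
      (Dmat d k Φ ν₁ ν₂ * (tHess d k Φ t ν₂)⁻¹ * (Dmat d k Φ ν₁ ν₂)ᵀ).det ≠ 0) :
    LocalCond Φ ν₂ ν₁ := by
  have e : Dmat d k Φ ν₂ ν₁ = -Dmat d k Φ ν₁ ν₂ := by
    ext i j; simp [Dmat]
  intro t ht
  refine ⟨h₁ t ht, ?_⟩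
  rw [e, Matrix.transpose_neg, Matrix.neg_mul, Matrix.neg_mul, Matrix.mul_neg, neg_neg]
  exact h₂ t ht

lemma IsClosedCube.isCompact {S : Set (Fin d → ℝ)} (hS : IsClosedCube d S) : IsCompact S := by
  obtain ⟨a, r, hr, rfl⟩ := hS
  have e : {x : Fin d → ℝ | ∀ i, |x i - a i| ≤ r} = Metric.closedBall a r := by
    ext x
    simp [dist_pi_le_iff hr, Real.dist_eq]
  exact e ▸ isCompact_closedBall a r

lemma IsClosedCube.nonempty {S : Set (Fin d → ℝ)} (hS : IsClosedCube d S) : S.Nonempty := by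
  obtain ⟨a, r, hr, rfl⟩ := hS
  exact ⟨a, fun i => by simpa using hr⟩

/-- The choice of the exponent at which the local estimate is applied. -/
lemma exists_local_exponent {q p : ℝ} (hk : 1 ≤ k) (hkd : k ≤ d)
    (hq : ((d : ℝ) + 3 * k) / (d + k) < q)
    (hpq : 1 / p + ((d : ℝ) + 3 * k) / (d + k) * (1 / (2 * q)) < 1) :
    ∃ s : ℝ, 1 ≤ s ∧ s ≤ 2 ∧ ((d : ℝ) + 3 * k < s * (d + k) ∨ d = k ∧ s = 2) ∧ s ≤ q ∧
      1 / p + s / (2 * q) < 1 := by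
  have hk' : (1 : ℝ) ≤ k := by exact_mod_cast hk
  have hkd' : (k : ℝ) ≤ d := by exact_mod_cast hkd
  have hn : (0 : ℝ) < d + k := by linarith
  set q₀ := ((d : ℝ) + 3 * k) / (d + k) with hq₀
  have h1 : 1 ≤ q₀ := by rw [hq₀, le_div_iff₀ hn]; linarith
  have hq0 : 0 < q := by linarith
  rw [mul_one_div] at hpq
  rcases hkd.eq_or_lt with rfl | hlt
  · have h2 : q₀ = 2 := by rw [hq₀, div_eq_iff hn.ne']; ring
    rw [h2] at hq hpq
    exact ⟨2, by norm_num, le_rfl, Or.inr ⟨rfl, rfl⟩, hq.le, hpq⟩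
  · have hlt' : (k : ℝ) < d := by exact_mod_cast hlt
    have h2 : q₀ < 2 := by rw [hq₀, div_lt_iff₀ hn]; linarith
    have h3 : q₀ < 2 * q * (1 - 1 / p) := by
      have : q₀ / (2 * q) < 1 - 1 / p := by linarith
      rwa [div_lt_iff₀' (by positivity)] at this
    obtain ⟨s, hs, hs'⟩ := exists_between (lt_min (lt_min h2 hq) h3)
    simp only [lt_min_iff] at hs'
    refine ⟨s, by linarith, hs'.1.1.le, Or.inl ?_, hs'.1.2.le, ?_⟩
    · rwa [hq₀, div_lt_iff₀ hn] at hs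
    · have : s / (2 * q) < 1 - 1 / p := by
        rw [div_lt_iff₀' (by positivity)]; exact hs'.2
      linarith

end Main

/-- **Theorem 1 (main bilinear restriction estimate).** Under the curvature
conditions (C1) and (C2), for `q > (d+3k)/(d+k)` and
`1/p + ((d+3k)/(d+k))·(1/(2q)) < 1`, the bilinear adjoint restriction estimate
`‖E₁f · E₂g‖_{L^q(ℝ^{d+k})} ≤ C ‖f‖_{L^p} ‖g‖_{L^p}` holds. -/
theorem bilinear_restriction_main
    (d k : ℕ) (hd : 1 ≤ d) (hk : 1 ≤ k)
    (Φ : (Fin d → ℝ) → Fin k → ℝ) (hΦ : ContDiff ℝ (⊤ : ℕ∞) Φ)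
    (S₁ S₂ : Set (Fin d → ℝ))
    (hS₁ : IsClosedCube d S₁) (hS₂ : IsClosedCube d S₂)
    (hS₁I : S₁ ⊆ Set.Icc (-1) 1) (hS₂I : S₂ ⊆ Set.Icc (-1) 1)
    (hC1 : ∀ ν ∈ S₁ ∪ S₂, ∀ t : Fin k → ℝ, (∑ i, t i ^ 2) = 1 →
      (tHess d k Φ t ν).det ≠ 0)
    (hC2 : ∀ ν₁ ∈ S₁, ∀ ν₂ ∈ S₂, ∀ t : Fin k → ℝ, (∑ i, t i ^ 2) = 1 →
      ∀ ν, (ν = ν₁ ∨ ν = ν₂) →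
      (Dmat d k Φ ν₁ ν₂ * (tHess d k Φ t ν)⁻¹ * (Dmat d k Φ ν₁ ν₂)ᵀ).det ≠ 0)
    (q p : ℝ) (hp : 1 ≤ p)
    (hq : ((d : ℝ) + 3 * k) / ((d : ℝ) + k) < q)
    (hpq : 1 / p + (((d : ℝ) + 3 * k) / ((d : ℝ) + k)) * (1 / (2 * q)) < 1) :
    ∃ C : ℝ, ∀ f g : (Fin d → ℝ) → ℂ,
      eLpNorm (fun w => extOp d k S₁ Φ f w * extOp d k S₂ Φ g w)
          (ENNReal.ofReal q) volume ≤
        ENNReal.ofReal C * eLpNorm f (ENNReal.ofReal p) volume *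
          eLpNorm g (ENNReal.ofReal p) volume := by
  have hΦc : Continuous Φ := hΦ.continuous
  obtain ⟨ν₁, hν₁⟩ := hS₁.nonempty
  obtain ⟨ν₂, hν₂⟩ := hS₂.nonempty
  have h12 : ∀ x ∈ S₁, ∀ y ∈ S₂, LocalCond Φ x y := fun x hx y hy t ht =>
    ⟨hC1 x (Or.inl hx) t ht, hC2 x hx y hy t ht x (Or.inl rfl)⟩
  have h21 : ∀ x ∈ S₁, ∀ y ∈ S₂, LocalCond Φ y x := fun x hx y hy =>
    localCond_symm_of_forall (hC1 y (Or.inr hy)) fun t ht => hC2 x hx y hy t ht y (Or.inr rfl)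
  have hkd : k ≤ d := (h12 ν₁ hν₁ ν₂ hν₂).le hk
  obtain ⟨s, hs1, hs2, hs, hsq, hpq'⟩ := exists_local_exponent hk hkd hq hpq
  obtain ⟨T, U, -, -, hST, hSU, C, -, h⟩ := BilinearBound.of_isCompact hΦc (hs1.trans hsq)
    hS₁.isCompact hS₂.isCompact fun x hx y hy => exists_bilinearBound_closedBall hΦ hk
      (h12 x hx y hy) (h21 x hx y hy) hs1 hs2 hs hp hsq hpq'
  refine ⟨C, fun f g => ?_⟩
  simp only [extOp_eq_exOp Φ hS₁.isCompact.measurableSet,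
    extOp_eq_exOp Φ hS₂.isCompact.measurableSet]
  by_cases hf : Integrable (S₁.indicator f)
  · by_cases hg : Integrable (S₂.indicator g)
    · refine (h _ _ hf hg (fun ξ hξ => hST (Set.mem_of_indicator_ne_zero hξ))
        fun ξ hξ => hSU (Set.mem_of_indicator_ne_zero hξ)).trans ?_
      gcongr ENNReal.ofReal C * ?_ * ?_
      · exact eLpNorm_indicator_le f
      · exact eLpNorm_indicator_le g
    · simp [exOp_of_not_integrable hΦc hg]
  · simp [exOp_of_not_integrable hΦc hf]

end
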